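/- Assume Hypotheses (H). Fix θ ∈ (0,1), f ∈ C^{2+θ}_b(ℝ^N) and g ∈ C^{0,θ}([0,T]×ℝ^N). Then the Cauchy problem D_t u = 𝒜u + g on [0,T]×ℝ^N, u(0,·)=f, admits a unique bounded classical solution u. Moreover u(t,·) ∈ C^{2+θ}_b(ℝ^N) for every t ∈ [0,T] and there exists a constant C > 0, independent of f and g, such that sup_{t∈[0,T]} ‖u(t,·)‖_{C^{2+θ}_b(ℝ^N)} ≤ C ( ‖f‖_{C^{2+θ}_b(ℝ^N)} + sup_{t∈[0,T]} ‖g(t,·)‖_{C^θ_b(ℝ^N)} ). -/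

import Mathlib

open Set Filter MeasureTheory Metric
open scoped Topology ENNReal RealInnerProductSpace Classical

noncomputable section

/-- `ℝ^N` with the Euclidean norm. -/
abbrev ES (N : ℕ) := EuclideanSpace ℝ (Fin N)

/-- First-order partial derivative `D_i f` in the `i`-th coordinate direction. -/
def pd1 {N : ℕ} (f : ES N → ℝ) (i : Fin N) : ES N → ℝ :=
  fun x => fderiv ℝ f x (EuclideanSpace.single i 1)

/-- Second-order partial derivative `D_{ij} f`. -/
def pd2 {N : ℕ} (f : ES N → ℝ) (i j : Fin N) : ES N → ℝ := pd1 (pd1 f j) i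

/-- Third-order partial derivative `D_{ijk} f`. -/
def pd3 {N : ℕ} (f : ES N → ℝ) (i j k : Fin N) : ES N → ℝ := pd1 (pd2 f j k) i

/-- The nonautonomous elliptic operator
`(𝒜 φ)(t,x) = ∑ᵢⱼ qᵢⱼ(t,x) Dᵢⱼφ(x) + ∑ⱼ bⱼ(t,x) Dⱼφ(x) + c(t,x) φ(x)`. -/
def Aop {N : ℕ} (q : ℝ → ES N → Fin N → Fin N → ℝ) (b : ℝ → ES N → Fin N → ℝ)
    (c : ℝ → ES N → ℝ) (φ : ES N → ℝ) (t : ℝ) (x : ES N) : ℝ :=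
  (∑ i, ∑ j, q t x i j * pd2 φ i j x) + (∑ j, b t x j * pd1 φ j x) + c t x * φ x

/-- Membership in the parabolic Hölder space `C^{δ/2,δ}([0,T] × B(0,R))`. -/
def ParabolicHolderOn {N : ℕ} (T δ R : ℝ) (h : ℝ → ES N → ℝ) : Prop :=
  ∃ C : ℝ, ∀ t ∈ Icc (0:ℝ) T, ∀ s ∈ Icc (0:ℝ) T,
    ∀ x ∈ closedBall (0 : ES N) R, ∀ y ∈ closedBall (0 : ES N) R,
      |h t x - h s y| ≤ C * (|t - s| + ‖x - y‖ ^ 2) ^ (δ / 2)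

/-- Hypotheses (H) of Lorenzi's paper (smooth unbounded coefficients). -/
structure Hyp (N : ℕ) (T : ℝ) (q : ℝ → ES N → Fin N → Fin N → ℝ)
    (b : ℝ → ES N → Fin N → ℝ) (c : ℝ → ES N → ℝ) where
  T_pos : 0 < T
  N_pos : 1 ≤ N
  /- (i) smoothness in space and parabolic Hölder regularity up to third-order
     spatial derivatives on `[0,T] × B(0,R)` for every `R`. -/
  δ : ℝ
  δ_mem : δ ∈ Ioo (0:ℝ) 1
  smooth_q : ∀ t ∈ Icc (0:ℝ) T, ∀ i j, ContDiff ℝ 3 fun x => q t x i j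
  smooth_b : ∀ t ∈ Icc (0:ℝ) T, ∀ j, ContDiff ℝ 3 fun x => b t x j
  smooth_c : ∀ t ∈ Icc (0:ℝ) T, ContDiff ℝ 3 fun x => c t x
  holder_q : ∀ R > 0, ∀ i j, ParabolicHolderOn T δ R fun t x => q t x i j
  holder_q1 : ∀ R > 0, ∀ i j k, ParabolicHolderOn T δ R fun t x => pd1 (fun y => q t y i j) k x
  holder_q2 : ∀ R > 0, ∀ i j k l, ParabolicHolderOn T δ R fun t x => pd2 (fun y => q t y i j) k l x
  holder_q3 : ∀ R > 0, ∀ i j k l m, ParabolicHolderOn T δ R fun t x => pd3 (fun y => q t y i j) k l m x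
  holder_b : ∀ R > 0, ∀ j, ParabolicHolderOn T δ R fun t x => b t x j
  holder_b1 : ∀ R > 0, ∀ j k, ParabolicHolderOn T δ R fun t x => pd1 (fun y => b t y j) k x
  holder_b2 : ∀ R > 0, ∀ j k l, ParabolicHolderOn T δ R fun t x => pd2 (fun y => b t y j) k l x
  holder_b3 : ∀ R > 0, ∀ j k l m, ParabolicHolderOn T δ R fun t x => pd3 (fun y => b t y j) k l m x
  holder_c : ∀ R > 0, ParabolicHolderOn T δ R c
  holder_c1 : ∀ R > 0, ∀ k, ParabolicHolderOn T δ R fun t x => pd1 (c t) k x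
  holder_c2 : ∀ R > 0, ∀ k l, ParabolicHolderOn T δ R fun t x => pd2 (c t) k l x
  holder_c3 : ∀ R > 0, ∀ k l m, ParabolicHolderOn T δ R fun t x => pd3 (c t) k l m x
  /- (ii) symmetry and (uniform) ellipticity. -/
  q_symm : ∀ t ∈ Icc (0:ℝ) T, ∀ x i j, q t x i j = q t x j i
  ν : ℝ → ES N → ℝ
  ν₀ : ℝ
  ν₀_pos : 0 < ν₀
  ν_lb : ∀ t ∈ Icc (0:ℝ) T, ∀ x, ν₀ ≤ ν t x
  ellip : ∀ t ∈ Icc (0:ℝ) T, ∀ x, ∀ ξ : ES N, ν t x * ‖ξ‖ ^ 2 ≤ ∑ i, ∑ j, q t x i j * ξ i * ξ j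
  /- (iii) growth conditions. -/
  C₁ : ℝ
  C₂ : ℝ
  C₃ : ℝ
  C₁_pos : 0 < C₁
  C₂_pos : 0 < C₂
  C₃_pos : 0 < C₃
  growth_Q : ∀ t ∈ Icc (0:ℝ) T, ∀ x,
    ‖(EuclideanSpace.equiv (Fin N) ℝ).symm fun i => ∑ j, q t x i j * x j‖
      ≤ C₁ * (1 + ‖x‖ ^ 2) * ν t x
  growth_tr : ∀ t ∈ Icc (0:ℝ) T, ∀ x, (∑ i, q t x i i) ≤ C₂ * (1 + ‖x‖ ^ 2) * ν t x
  growth_b : ∀ t ∈ Icc (0:ℝ) T, ∀ x, (∑ j, b t x j * x j) ≤ C₃ * (1 + ‖x‖ ^ 2) * ν t x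
  /- (iv) `c` is bounded from above. -/
  c₀ : ℝ
  c_ub : ∀ t ∈ Icc (0:ℝ) T, ∀ x, c t x ≤ c₀
  /- (v) bounds on the derivatives of the diffusion coefficients. -/
  K₁ : ℝ
  K₂ : ℝ
  K₃ : ℝ
  K₁_pos : 0 < K₁
  K₂_pos : 0 < K₂
  K₃_pos : 0 < K₃
  dq1_bound : ∀ t ∈ Icc (0:ℝ) T, ∀ x i j k, |pd1 (fun y => q t y i j) k x| ≤ K₁ * ν t x
  dq3_bound : ∀ t ∈ Icc (0:ℝ) T, ∀ x i j k l m, |pd3 (fun y => q t y i j) k l m x| ≤ K₃ * ν t x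
  dq2_quad : ∀ t ∈ Icc (0:ℝ) T, ∀ x, ∀ Ξ : Fin N → Fin N → ℝ, (∀ h k, Ξ h k = Ξ k h) →
    (∑ h, ∑ k, ∑ l, ∑ m, pd2 (fun y => q t y h k) l m x * Ξ h k * Ξ l m)
      ≤ K₂ * ν t x * ∑ h, ∑ k, Ξ h k ^ 2
  /- (vi) dissipativity and bounds on the derivatives of the drift and of `c`. -/
  d : ℝ → ES N → ℝ
  r : ℝ → ES N → ℝ
  ϱ : ℝ → ES N → ℝ
  ϱ₀ : ℝ
  ϱ₀_pos : 0 < ϱ₀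
  ϱ_lb : ∀ t ∈ Icc (0:ℝ) T, ∀ x, ϱ₀ ≤ ϱ t x
  L₁ : ℝ
  L₂ : ℝ
  L₃ : ℝ
  L₁_pos : 0 < L₁
  L₂_pos : 0 < L₂
  L₃_pos : 0 < L₃
  dissip : ∀ t ∈ Icc (0:ℝ) T, ∀ x, ∀ ξ : ES N,
    (∑ i, ∑ j, pd1 (fun y => b t y i) j x * ξ j * ξ i) ≤ d t x * ‖ξ‖ ^ 2
  db2_bound : ∀ t ∈ Icc (0:ℝ) T, ∀ x j k l, |pd2 (fun y => b t y j) k l x| ≤ r t x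
  db3_bound : ∀ t ∈ Icc (0:ℝ) T, ∀ x j k l m, |pd3 (fun y => b t y j) k l m x| ≤ r t x
  dc1_bound : ∀ t ∈ Icc (0:ℝ) T, ∀ x k, |pd1 (c t) k x| ≤ ϱ t x
  dc2_bound : ∀ t ∈ Icc (0:ℝ) T, ∀ x k l, |pd2 (c t) k l x| ≤ ϱ t x
  dc3_bound : ∀ t ∈ Icc (0:ℝ) T, ∀ x k l m, |pd3 (c t) k l m x| ≤ ϱ t x
  funz : ∀ t ∈ Icc (0:ℝ) T, ∀ x, d t x + L₁ * r t x + L₂ * ϱ t x ^ 2 ≤ L₃ * ν t x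
  /- (vii) existence of a Lyapunov function. -/
  liap : ∃ φ : ES N → ℝ, ∃ lam : ℝ, 0 < lam ∧ (∀ x, 0 < φ x) ∧ ContDiff ℝ 2 φ ∧
    Tendsto φ (cocompact (ES N)) atTop ∧
    ∃ M : ℝ, ∀ t ∈ Icc (0:ℝ) T, ∀ x, Aop q b c φ t x - lam * φ x ≤ M

/-- `u` is a bounded classical solution on `[s,τ] × ℝ^N` of the homogeneous Cauchy problem
`D_t u = 𝒜 u`, `u(s,·) = f`: it is bounded and continuous on `[s,τ] × ℝ^N`, continuously
differentiable once in time and twice in space on `(s,τ] × ℝ^N`, satisfies the equation there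
and attains the initial datum `f` at time `s`. -/
def IsBCSol {N : ℕ} (q : ℝ → ES N → Fin N → Fin N → ℝ) (b : ℝ → ES N → Fin N → ℝ)
    (c : ℝ → ES N → ℝ) (s τ : ℝ) (f : ES N → ℝ) (u : ℝ → ES N → ℝ) : Prop :=
  (∃ M, ∀ t ∈ Icc s τ, ∀ x, |u t x| ≤ M) ∧
  ContinuousOn (fun p : ℝ × ES N => u p.1 p.2) (Icc s τ ×ˢ univ) ∧
  (∀ t ∈ Ioc s τ, ContDiff ℝ 2 (u t)) ∧
  (∀ x, ∀ t ∈ Ioc s τ, DifferentiableAt ℝ (fun t' => u t' x) t) ∧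
  ContinuousOn (fun p : ℝ × ES N => deriv (fun t' => u t' p.2) p.1) (Ioc s τ ×ˢ univ) ∧
  (∀ i, ContinuousOn (fun p : ℝ × ES N => pd1 (u p.1) i p.2) (Ioc s τ ×ˢ univ)) ∧
  (∀ i j, ContinuousOn (fun p : ℝ × ES N => pd2 (u p.1) i j p.2) (Ioc s τ ×ˢ univ)) ∧
  (∀ t ∈ Ioc s τ, ∀ x, deriv (fun t' => u t' x) t = Aop q b c (u t) t x) ∧
  (∀ x, u s x = f x)

/-- `u` is a bounded classical solution on `[0,T] × ℝ^N` of the nonhomogeneous Cauchy problem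
`D_t u = 𝒜 u + g`, `u(0,·) = f`, continuously differentiable once in time and twice in space
on all of `[0,T] × ℝ^N`. -/
def IsBCSolInhom {N : ℕ} (q : ℝ → ES N → Fin N → Fin N → ℝ) (b : ℝ → ES N → Fin N → ℝ)
    (c : ℝ → ES N → ℝ) (T : ℝ) (f : ES N → ℝ) (g : ℝ → ES N → ℝ) (u : ℝ → ES N → ℝ) : Prop :=
  (∃ M, ∀ t ∈ Icc (0:ℝ) T, ∀ x, |u t x| ≤ M) ∧
  (∀ t ∈ Icc (0:ℝ) T, ContDiff ℝ 2 (u t)) ∧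
  (∀ x, ∀ t ∈ Icc (0:ℝ) T, DifferentiableWithinAt ℝ (fun t' => u t' x) (Icc (0:ℝ) T) t) ∧
  ContinuousOn (fun p : ℝ × ES N => derivWithin (fun t' => u t' p.2) (Icc (0:ℝ) T) p.1)
    (Icc (0:ℝ) T ×ˢ univ) ∧
  (∀ i, ContinuousOn (fun p : ℝ × ES N => pd1 (u p.1) i p.2) (Icc (0:ℝ) T ×ˢ univ)) ∧
  (∀ i j, ContinuousOn (fun p : ℝ × ES N => pd2 (u p.1) i j p.2) (Icc (0:ℝ) T ×ˢ univ)) ∧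
  (∀ t ∈ Icc (0:ℝ) T, ∀ x,
    derivWithin (fun t' => u t' x) (Icc (0:ℝ) T) t = Aop q b c (u t) t x + g t x) ∧
  (∀ x, u 0 x = f x)

/-- Extended-real sup norm of the `k`-th derivative. -/
def supNormE {N : ℕ} (k : ℕ) (f : ES N → ℝ) : ℝ≥0∞ :=
  ⨆ x : ES N, ENNReal.ofReal ‖iteratedFDeriv ℝ k f x‖

/-- Extended-real `γ`-Hölder seminorm of the `k`-th derivative. -/
def holderSemiE {N : ℕ} (k : ℕ) (γ : ℝ) (f : ES N → ℝ) : ℝ≥0∞ :=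
  ⨆ (x : ES N) (y : ES N) (_ : x ≠ y),
    ENNReal.ofReal (‖iteratedFDeriv ℝ k f x - iteratedFDeriv ℝ k f y‖ / ‖x - y‖ ^ γ)

/-- The `C^α_b(ℝ^N)` norm (valued in `[0,∞]`): sup norms of the derivatives up to order `⌊α⌋`
plus, when `α ∉ ℕ`, the `(α-⌊α⌋)`-Hölder seminorm of the `⌊α⌋`-th order derivatives. -/
def CbNorm {N : ℕ} (α : ℝ) (f : ES N → ℝ) : ℝ≥0∞ :=
  (∑ k ∈ Finset.range (⌊α⌋₊ + 1), supNormE k f) +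
    (if (⌊α⌋₊ : ℝ) = α then 0 else holderSemiE ⌊α⌋₊ (α - ⌊α⌋₊) f)

/-- Membership in `C^α_b(ℝ^N)`. -/
def MemCb {N : ℕ} (α : ℝ) (f : ES N → ℝ) : Prop :=
  ContDiff ℝ (⌊α⌋₊ : ℕ) f ∧ CbNorm α f ≠ ⊤

set_option linter.unusedSectionVars false

section Calculus

variable {E : Type*} [NormedAddCommGroup E] [NormedSpace ℝ E] {κ : Type*}

/-- Smooth real functions. -/
def Sm (Φ : E → ℝ) : Prop := ContDiff ℝ ((⊤ : ℕ∞) : WithTop ℕ∞) Φ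

/-- Directional derivative as a function. -/
def dd (v : E) (Φ : E → ℝ) : E → ℝ := fun y => fderiv ℝ Φ y v

/-- Iterated derivative along a word of directions. -/
def wd (e : κ → E) : List κ → (E → ℝ) → (E → ℝ)
  | [], Φ => Φ
  | i :: γ, Φ => dd (e i) (wd e γ Φ)

@[simp] lemma wd_nil (e : κ → E) (Φ : E → ℝ) : wd e [] Φ = Φ := rfl

@[simp] lemma wd_cons (e : κ → E) (i : κ) (γ : List κ) (Φ : E → ℝ) :
    wd e (i :: γ) Φ = dd (e i) (wd e γ Φ) := rfl

lemma wd_append (e : κ → E) (γ δ : List κ) (Φ : E → ℝ) :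
    wd e (γ ++ δ) Φ = wd e γ (wd e δ Φ) := by
  induction γ with
  | nil => rfl
  | cons i γ ih => simp [ih]

lemma two_le_smooth : (2 : WithTop ℕ∞) ≤ ((⊤ : ℕ∞) : WithTop ℕ∞) := by
  exact WithTop.coe_le_coe.2 (le_top : (2 : ℕ∞) ≤ ⊤)

lemma Sm.differentiable {Φ : E → ℝ} (h : Sm Φ) : Differentiable ℝ Φ :=
  ContDiff.differentiable h (by simp)

lemma Sm.differentiableAt {Φ : E → ℝ} (h : Sm Φ) {y : E} : DifferentiableAt ℝ Φ y :=
  h.differentiable y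

lemma Sm.continuous {Φ : E → ℝ} (h : Sm Φ) : Continuous Φ := ContDiff.continuous h

lemma Sm.dd {Φ : E → ℝ} (h : Sm Φ) (v : E) : Sm (dd v Φ) := by
  unfold Sm _root_.dd at *
  exact (h.fderiv_right (m := ((⊤ : ℕ∞) : WithTop ℕ∞)) (by simp)).clm_apply contDiff_const

lemma Sm.wd {Φ : E → ℝ} (h : Sm Φ) (e : κ → E) (γ : List κ) : Sm (wd e γ Φ) := by
  induction γ with
  | nil => exact h
  | cons i γ ih => exact ih.dd _

lemma sm_const (a : ℝ) : Sm (fun _ : E => a) := contDiff_const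

lemma Sm.add {f g : E → ℝ} (hf : Sm f) (hg : Sm g) : Sm (fun y => f y + g y) :=
  ContDiff.add hf hg

lemma Sm.sub {f g : E → ℝ} (hf : Sm f) (hg : Sm g) : Sm (fun y => f y - g y) :=
  ContDiff.sub hf hg

lemma Sm.mul {f g : E → ℝ} (hf : Sm f) (hg : Sm g) : Sm (fun y => f y * g y) :=
  ContDiff.mul hf hg

lemma Sm.sum {ι : Type*} {s : Finset ι} {f : ι → E → ℝ} (hf : ∀ i ∈ s, Sm (f i)) :
    Sm (fun y => ∑ i ∈ s, f i y) :=
  ContDiff.sum hf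

lemma dd_const (v : E) (a : ℝ) : dd v (fun _ => a) = fun _ => 0 := by
  funext y; simp [dd]

lemma dd_add {f g : E → ℝ} (hf : Sm f) (hg : Sm g) (v : E) :
    dd v (fun y => f y + g y) = fun y => dd v f y + dd v g y := by
  funext y
  simp only [dd]
  rw [fderiv_fun_add hf.differentiableAt hg.differentiableAt]; rfl

lemma dd_sub {f g : E → ℝ} (hf : Sm f) (hg : Sm g) (v : E) :
    dd v (fun y => f y - g y) = fun y => dd v f y - dd v g y := by
  funext y
  simp only [dd]
  rw [fderiv_fun_sub hf.differentiableAt hg.differentiableAt]; rfl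

lemma dd_mul {f g : E → ℝ} (hf : Sm f) (hg : Sm g) (v : E) :
    dd v (fun y => f y * g y) = fun y => dd v f y * g y + f y * dd v g y := by
  funext y
  simp only [dd]
  rw [fderiv_fun_mul hf.differentiableAt hg.differentiableAt]
  simp; ring

lemma dd_const_mul {f : E → ℝ} (hf : Sm f) (a : ℝ) (v : E) :
    dd v (fun y => a * f y) = fun y => a * dd v f y := by
  rw [dd_mul (sm_const a) hf, dd_const]; simp

lemma dd_sum {ι : Type*} {s : Finset ι} {f : ι → E → ℝ} (hf : ∀ i ∈ s, Sm (f i)) (v : E) :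
    dd v (fun y => ∑ i ∈ s, f i y) = fun y => ∑ i ∈ s, dd v (f i) y := by
  funext y
  simp only [dd]
  rw [fderiv_fun_sum fun i hi => (hf i hi).differentiableAt]
  simp

lemma dd_comm {f : E → ℝ} (hf : Sm f) (v w : E) : dd v (dd w f) = dd w (dd v f) := by
  funext y
  have hd : DifferentiableAt ℝ (fderiv ℝ f) y :=
    (ContDiff.differentiable (ContDiff.fderiv_right (m := 1) hf
      (by rw [one_add_one_eq_two]; exact two_le_smooth)) one_ne_zero) y
  have h1 : ∀ v w : E, dd v (dd w f) y = fderiv ℝ (fderiv ℝ f) y v w := by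
    intro v w
    unfold dd
    rw [fderiv_clm_apply hd (by simp)]
    simp
  rw [h1, h1]
  have hs : IsSymmSndFDerivAt ℝ f y :=
    (ContDiff.contDiffAt hf).isSymmSndFDerivAt (by simpa using two_le_smooth)
  exact hs v w

lemma wd_dd_comm {f : E → ℝ} (hf : Sm f) (e : κ → E) (γ : List κ) (v : E) :
    wd e γ (dd v f) = dd v (wd e γ f) := by
  induction γ with
  | nil => rfl
  | cons i γ ih => simp only [wd_cons, ih]; exact dd_comm (hf.wd e γ) _ _

lemma wd_add {f g : E → ℝ} (hf : Sm f) (hg : Sm g) (e : κ → E) (γ : List κ) :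
    wd e γ (fun y => f y + g y) = fun y => wd e γ f y + wd e γ g y := by
  induction γ with
  | nil => rfl
  | cons i γ ih => simp only [wd_cons, ih]; exact dd_add (hf.wd e γ) (hg.wd e γ) _

lemma wd_sub {f g : E → ℝ} (hf : Sm f) (hg : Sm g) (e : κ → E) (γ : List κ) :
    wd e γ (fun y => f y - g y) = fun y => wd e γ f y - wd e γ g y := by
  induction γ with
  | nil => rfl
  | cons i γ ih => simp only [wd_cons, ih]; exact dd_sub (hf.wd e γ) (hg.wd e γ) _

lemma wd_const_mul {f : E → ℝ} (hf : Sm f) (a : ℝ) (e : κ → E) (γ : List κ) :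
    wd e γ (fun y => a * f y) = fun y => a * wd e γ f y := by
  induction γ with
  | nil => rfl
  | cons i γ ih => simp only [wd_cons, ih]; exact dd_const_mul (hf.wd e γ) a _

lemma wd_sum {ι : Type*} {s : Finset ι} {f : ι → E → ℝ} (hf : ∀ i ∈ s, Sm (f i))
    (e : κ → E) (γ : List κ) :
    wd e γ (fun y => ∑ i ∈ s, f i y) = fun y => ∑ i ∈ s, wd e γ (f i) y := by
  induction γ with
  | nil => rfl
  | cons i γ ih =>
    simp only [wd_cons, ih]; exact dd_sum (fun j hj => (hf j hj).wd e γ) _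

lemma wd_zero (e : κ → E) (γ : List κ) : wd e γ (fun _ => (0 : ℝ)) = fun _ => 0 := by
  induction γ with
  | nil => rfl
  | cons i γ ih => simp only [wd_cons, ih]; exact dd_const _ _

/-- A family of smooth functions all of whose iterated derivatives are bounded uniformly in the
parameter. -/
structure UB (e : κ → E) {P : Type*} (a : P → E → ℝ) : Prop where
  sm : ∀ p, Sm (a p)
  bd : ∀ γ, ∃ C : ℝ, ∀ p y, |wd e γ (a p) y| ≤ C

/-- Smooth functions with all derivatives bounded. -/
def SB (e : κ → E) (f : E → ℝ) : Prop := UB e (fun _ : Unit => f)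

variable {e : κ → E} {P : Type*}

lemma SB.sm {f : E → ℝ} (h : SB e f) : Sm f := UB.sm h ()

lemma SB.bd {f : E → ℝ} (h : SB e f) (γ : List κ) : ∃ C : ℝ, ∀ y, |wd e γ f y| ≤ C := by
  obtain ⟨C, hC⟩ := UB.bd h γ
  exact ⟨C, fun y => hC () y⟩

lemma SB.mk {f : E → ℝ} (h : Sm f) (h2 : ∀ γ, ∃ C : ℝ, ∀ y, |wd e γ f y| ≤ C) : SB e f :=
  ⟨fun _ => h, fun γ => by obtain ⟨C, hC⟩ := h2 γ; exact ⟨C, fun _ => hC⟩⟩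

lemma UB.comap {Q : Type*} {a : P → E → ℝ} (h : UB e a) (φ : Q → P) :
    UB e (fun q => a (φ q)) :=
  ⟨fun q => h.sm _, fun γ => by obtain ⟨C, hC⟩ := h.bd γ; exact ⟨C, fun q => hC _⟩⟩

lemma SB.ub {f : E → ℝ} (h : SB e f) : UB e (fun _ : P => f) := UB.comap h (fun _ => ())

lemma UB.add {a b : P → E → ℝ} (ha : UB e a) (hb : UB e b) : UB e (fun p y => a p y + b p y) := by
  refine ⟨fun p => (ha.sm p).add (hb.sm p), fun γ => ?_⟩
  obtain ⟨C, hC⟩ := ha.bd γ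
  obtain ⟨D, hD⟩ := hb.bd γ
  refine ⟨C + D, fun p y => ?_⟩
  rw [wd_add (ha.sm p) (hb.sm p)]
  exact (abs_add_le _ _).trans (add_le_add (hC p y) (hD p y))

lemma UB.dd {a : P → E → ℝ} (ha : UB e a) (i : κ) : UB e (fun p => dd (e i) (a p)) := by
  refine ⟨fun p => (ha.sm p).dd _, fun γ => ?_⟩
  obtain ⟨C, hC⟩ := ha.bd (γ ++ [i])
  refine ⟨C, fun p y => ?_⟩
  have := hC p y
  rwa [wd_append] at this

lemma UB.wd {a : P → E → ℝ} (ha : UB e a) (γ : List κ) : UB e (fun p => wd e γ (a p)) := by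
  induction γ with
  | nil => exact ha
  | cons i γ ih => exact ih.dd i

lemma UB.mul {a b : P → E → ℝ} (ha : UB e a) (hb : UB e b) : UB e (fun p y => a p y * b p y) := by
  refine ⟨fun p => (ha.sm p).mul (hb.sm p), fun γ => ?_⟩
  induction γ using List.reverseRecOn generalizing a b with
  | nil =>
    obtain ⟨C, hC⟩ := ha.bd []
    obtain ⟨D, hD⟩ := hb.bd []
    refine ⟨C * D, fun p y => ?_⟩
    simp only [wd_nil, abs_mul] at *
    exact mul_le_mul (hC p y) (hD p y) (abs_nonneg _) ((abs_nonneg _).trans (hC p y))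
  | append_singleton γ i ih =>
    obtain ⟨C, hC⟩ := ih (ha.dd i) hb
    obtain ⟨D, hD⟩ := ih ha (hb.dd i)
    refine ⟨C + D, fun p y => ?_⟩
    rw [wd_append, wd_cons, wd_nil, dd_mul (ha.sm p) (hb.sm p),
      wd_add (((ha.sm p).dd _).mul (hb.sm p)) ((ha.sm p).mul ((hb.sm p).dd _))]
    exact (abs_add_le _ _).trans (add_le_add (hC p y) (hD p y))

lemma UB.of_const {a : P → ℝ} {C : ℝ} (h : ∀ p, |a p| ≤ C) : UB e (fun p (_ : E) => a p) := by
  refine ⟨fun p => sm_const _, fun γ => ?_⟩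
  induction γ using List.reverseRecOn with
  | nil => exact ⟨C, fun p _ => h p⟩
  | append_singleton γ i ih =>
    refine ⟨0, fun p y => ?_⟩
    rw [wd_append, wd_cons, wd_nil, dd_const, wd_zero]; simp

lemma ub_const (a : ℝ) : UB e (fun (_ : P) (_ : E) => a) := UB.of_const (C := |a|) fun _ => le_rfl

lemma UB.const_mul {a : P → E → ℝ} (ha : UB e a) (r : ℝ) : UB e (fun p y => r * a p y) :=
  (ub_const r).mul ha

lemma UB.neg {a : P → E → ℝ} (ha : UB e a) : UB e (fun p y => - a p y) := by
  simpa using ha.const_mul (-1)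

lemma UB.sub {a b : P → E → ℝ} (ha : UB e a) (hb : UB e b) :
    UB e (fun p y => a p y - b p y) := by
  simpa [sub_eq_add_neg] using ha.add hb.neg

lemma UB.sum {ι : Type*} {s : Finset ι} {a : ι → P → E → ℝ} (ha : ∀ i ∈ s, UB e (a i)) :
    UB e (fun p y => ∑ i ∈ s, a i p y) := by
  induction s using Finset.induction_on with
  | empty => simpa using ub_const (0 : ℝ)
  | insert i s hi ih =>
    simp only [Finset.sum_insert hi]
    exact (ha i (by simp)).add (ih fun j hj => ha j (by simp [hj]))

lemma SB.add {f g : E → ℝ} (hf : SB e f) (hg : SB e g) : SB e (fun y => f y + g y) := UB.add hf hg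
lemma SB.sub {f g : E → ℝ} (hf : SB e f) (hg : SB e g) : SB e (fun y => f y - g y) := UB.sub hf hg
lemma SB.mul {f g : E → ℝ} (hf : SB e f) (hg : SB e g) : SB e (fun y => f y * g y) := UB.mul hf hg
lemma SB.const_mul {f : E → ℝ} (hf : SB e f) (r : ℝ) : SB e (fun y => r * f y) :=
  UB.const_mul hf r
lemma sb_const (a : ℝ) : SB e (fun _ => a) := ub_const a
lemma SB.dd {f : E → ℝ} (hf : SB e f) (i : κ) : SB e (dd (e i) f) := UB.dd hf i
lemma SB.wd {f : E → ℝ} (hf : SB e f) (γ : List κ) : SB e (wd e γ f) := UB.wd hf γ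

end Calculus

section Taylor

variable {E : Type*} [NormedAddCommGroup E] [NormedSpace ℝ E] {κ : Type*}

lemma dd_vec_smul (v : E) (r : ℝ) (f : E → ℝ) : dd (r • v) f = fun y => r * dd v f y := by
  funext y; simp [dd]

lemma dd_vec_sum {ι : Type*} (s : Finset ι) (w : ι → E) (f : E → ℝ) :
    dd (∑ i ∈ s, w i) f = fun y => ∑ i ∈ s, dd (w i) f y := by
  funext y; simp [dd]

lemma dd_comb [Fintype κ] (e : κ → E) (a : κ → ℝ) (f : E → ℝ) :
    dd (∑ j, a j • e j) f = fun y => ∑ j, a j * dd (e j) f y := by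
  rw [dd_vec_sum]; simp only [dd_vec_smul]

lemma hasDerivAt_line {f : E → ℝ} {y v : E} {t : ℝ} (hf : DifferentiableAt ℝ f (y + t • v)) :
    HasDerivAt (fun t : ℝ => f (y + t • v)) (dd v f (y + t • v)) t := by
  have h1 : HasDerivAt (fun t : ℝ => y + t • v) v t := by
    simpa using ((hasDerivAt_id t).smul_const v).const_add y
  exact hf.hasFDerivAt.comp_hasDerivAt t h1

lemma taylor_one {f : E → ℝ} (hf : Differentiable ℝ f) {y v : E} {B : ℝ}
    (h : ∀ t ∈ Icc (0 : ℝ) 1, |dd v f (y + t • v)| ≤ B) : |f (y + v) - f y| ≤ B := by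
  have := norm_image_sub_le_of_norm_deriv_le_segment_01' (f := fun t : ℝ => f (y + t • v))
    (f' := fun t => dd v f (y + t • v)) (C := B)
    (fun t _ => (hasDerivAt_line (hf _)).hasDerivWithinAt)
    (fun t ht => h t (Ico_subset_Icc_self ht))
  simpa using this

lemma seg_mem {s t : ℝ} (hs : s ∈ Icc (0 : ℝ) 1) (ht : t ∈ Icc (0 : ℝ) 1) :
    s * t ∈ Icc (0 : ℝ) 1 := ⟨mul_nonneg hs.1 ht.1, mul_le_one₀ hs.2 ht.1 ht.2⟩

lemma taylor_two {f : E → ℝ} (hf : Differentiable ℝ f) {y v : E} {B : ℝ}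
    (hf' : Differentiable ℝ (dd v f))
    (h : ∀ t ∈ Icc (0 : ℝ) 1, |dd v (dd v f) (y + t • v)| ≤ B) :
    |f (y + v) - f y - dd v f y| ≤ B := by
  have hB : 0 ≤ B := (abs_nonneg _).trans (h 0 (by simp))
  have := norm_image_sub_le_of_norm_deriv_le_segment_01'
    (f := fun t : ℝ => f (y + t • v) - t * dd v f y)
    (f' := fun t => dd v f (y + t • v) - dd v f y) (C := B)
    (fun t _ => by
      have := ((hasDerivAt_line (v := v) (y := y) (t := t) (hf _)).fun_sub
        ((hasDerivAt_id' t).mul_const (dd v f y)))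
      convert this.hasDerivWithinAt using 1
      ring)
    (fun t ht => by
      have ht' := Ico_subset_Icc_self ht
      refine taylor_one hf' (y := y) (v := t • v) fun s hs => ?_
      rw [dd_vec_smul, smul_smul, abs_mul]
      calc |t| * _ ≤ 1 * B := mul_le_mul (by rw [abs_of_nonneg ht'.1]; exact ht'.2)
            (h _ (seg_mem hs ht')) (abs_nonneg _) zero_le_one
        _ = B := one_mul B)
  simp only [one_smul, one_mul, zero_smul, add_zero, zero_mul, sub_zero, Real.norm_eq_abs] at this
  convert this using 2; ring

lemma taylor_three {f : E → ℝ} (hf : Sm f) {y v : E} {B : ℝ}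
    (h : ∀ t ∈ Icc (0 : ℝ) 1, |dd v (dd v (dd v f)) (y + t • v)| ≤ B) :
    |f (y + v) - f y - dd v f y - 1 / 2 * dd v (dd v f) y| ≤ B := by
  have hB : 0 ≤ B := (abs_nonneg _).trans (h 0 (by simp))
  have := norm_image_sub_le_of_norm_deriv_le_segment_01'
    (f := fun t : ℝ => f (y + t • v) - t * dd v f y - t ^ 2 * (1 / 2 * dd v (dd v f) y))
    (f' := fun t => dd v f (y + t • v) - dd v f y - t * dd v (dd v f) y) (C := B)
    (fun t _ => by
      have := ((hasDerivAt_line (v := v) (y := y) (t := t) (hf.differentiable _)).fun_sub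
        ((hasDerivAt_id' t).mul_const (dd v f y))).fun_sub
        ((hasDerivAt_pow 2 t).mul_const (1 / 2 * dd v (dd v f) y))
      convert this.hasDerivWithinAt using 1
      push_cast; ring)
    (fun t ht => by
      have ht' := Ico_subset_Icc_self ht
      have := taylor_two (hf.dd v).differentiable (y := y) (v := t • v) (B := B)
        (by rw [dd_vec_smul]; exact (((hf.dd v).dd v).differentiable).const_mul t) fun s hs => ?_
      · rw [dd_vec_smul] at this; exact this
      · rw [dd_vec_smul, dd_vec_smul, dd_const_mul ((hf.dd v).dd v), smul_smul, abs_mul, abs_mul]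
        have h1 : |t| ≤ 1 := by rw [abs_of_nonneg ht'.1]; exact ht'.2
        calc |t| * (|t| * _) ≤ 1 * (1 * B) := mul_le_mul h1
              (mul_le_mul h1 (h _ (seg_mem hs ht')) (abs_nonneg _) zero_le_one)
              (by positivity) zero_le_one
          _ = B := by ring)
  simp only [one_smul, one_mul, zero_smul, add_zero, zero_mul, sub_zero, Real.norm_eq_abs,
    one_pow, ne_eq, OfNat.ofNat_ne_zero, not_false_eq_true, zero_pow] at this
  convert this using 2; ring

lemma abs_sum_mul_le {ι : Type*} {s : Finset ι} {a b : ι → ℝ} {B : ℝ} (h : ∀ i ∈ s, |b i| ≤ B) :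
    |∑ i ∈ s, a i * b i| ≤ (∑ i ∈ s, |a i|) * B := by
  refine (Finset.abs_sum_le_sum_abs _ _).trans ?_
  rw [Finset.sum_mul]
  exact Finset.sum_le_sum fun i hi => by
    rw [abs_mul]; exact mul_le_mul_of_nonneg_left (h i hi) (abs_nonneg _)

variable [Fintype κ] (e : κ → E)

lemma dd_comb_comb {f : E → ℝ} (hf : Sm f) (a : κ → ℝ) :
    dd (∑ j, a j • e j) (dd (∑ j, a j • e j) f) =
      fun y => ∑ i, a i * ∑ j, a j * wd e [i, j] f y := by
  rw [dd_comb, dd_comb]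
  funext y
  refine Finset.sum_congr rfl fun i _ => ?_
  rw [dd_sum fun j _ => (sm_const (a j)).mul (hf.dd (e j))]
  simp only [dd_const_mul (hf.dd _)]; rfl

lemma taylor_one_word {f : E → ℝ} (hf : Sm f) (y : E) (a : κ → ℝ) {B : ℝ}
    (h : ∀ j y, |wd e [j] f y| ≤ B) : |f (y + ∑ j, a j • e j) - f y| ≤ (∑ j, |a j|) * B := by
  refine taylor_one hf.differentiable fun t _ => ?_
  rw [dd_comb]
  exact abs_sum_mul_le fun j _ => h j _

lemma taylor_two_word {f : E → ℝ} (hf : Sm f) (y : E) (a : κ → ℝ) {B : ℝ}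
    (h : ∀ i j y, |wd e [i, j] f y| ≤ B) :
    |f (y + ∑ j, a j • e j) - f y - ∑ j, a j * wd e [j] f y| ≤ (∑ j, |a j|) ^ 2 * B := by
  have := taylor_two (y := y) (v := ∑ j, a j • e j) (B := (∑ j, |a j|) ^ 2 * B) hf.differentiable
    (hf.dd _).differentiable fun t _ => ?_
  · rwa [dd_comb] at this
  · rw [dd_comb_comb e hf, sq, mul_assoc]
    exact abs_sum_mul_le fun i _ => abs_sum_mul_le fun j _ => h i j _

lemma taylor_three_word {f : E → ℝ} (hf : Sm f) (y : E) (a : κ → ℝ) {B : ℝ}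
    (h : ∀ i j k y, |wd e [i, j, k] f y| ≤ B) :
    |f (y + ∑ j, a j • e j) - f y - ∑ j, a j * wd e [j] f y
      - 1 / 2 * ∑ i, a i * ∑ j, a j * wd e [i, j] f y| ≤ (∑ j, |a j|) ^ 3 * B := by
  have := taylor_three (y := y) (v := ∑ j, a j • e j) (B := (∑ j, |a j|) ^ 3 * B) hf
    fun t _ => ?_
  · rwa [dd_comb_comb e hf, dd_comb] at this
  · rw [dd_comb_comb e hf, dd_comb]
    have : (∑ j, |a j|) ^ 3 * B = (∑ j, |a j|) * ((∑ j, |a j|) * ((∑ j, |a j|) * B)) := by ring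
    rw [this]
    refine abs_sum_mul_le fun k _ => ?_
    have hs : ∀ i, Sm (fun y => ∑ j, a j * wd e [i, j] f y) := fun i =>
      Sm.sum fun j _ => (sm_const _).mul (hf.wd e [i, j])
    rw [dd_sum fun i _ => (sm_const (a i)).mul (hs i)]
    simp only [dd_const_mul (hs _)]
    refine abs_sum_mul_le fun i _ => ?_
    rw [dd_sum fun j _ => (sm_const (a j)).mul (hf.wd e [i, j])]
    simp only [dd_const_mul (hf.wd e _)]
    exact abs_sum_mul_le fun j _ => h k i j _

end Taylor

section ClosedFamily

variable {E : Type*} [NormedAddCommGroup E] [NormedSpace ℝ E] [FiniteDimensional ℝ E]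
  {κ : Type*} [Fintype κ]

/-- The linear functional with prescribed values on a basis. -/
def coordCLM (e : Module.Basis κ ℝ E) (a : κ → ℝ) : E →L[ℝ] ℝ :=
  ∑ j, a j • LinearMap.toContinuousLinearMap (e.coord j)

lemma coordCLM_basis (e : Module.Basis κ ℝ E) (a : κ → ℝ) (i : κ) :
    coordCLM e a (e i) = a i := by
  simp [coordCLM, Finsupp.single_apply]

lemma coordCLM_apply (e : Module.Basis κ ℝ E) (a : κ → ℝ) (v : E) :
    coordCLM e a v = ∑ j, a j * e.coord j v := by
  simp [coordCLM]

lemma coord_sum_le (e : Module.Basis κ ℝ E) : ∃ C : ℝ, 0 ≤ C ∧ ∀ v, ∑ j, |e.coord j v| ≤ C * ‖v‖ := by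
  refine ⟨∑ j, ‖LinearMap.toContinuousLinearMap (e.coord j)‖, by positivity, fun v => ?_⟩
  rw [Finset.sum_mul]
  exact Finset.sum_le_sum fun j _ =>
    (LinearMap.toContinuousLinearMap (e.coord j)).le_opNorm v

lemma closed_family (e : Module.Basis κ ℝ E) {V : List κ → E → ℝ}
    (hV : ∀ γ y, HasFDerivAt (V γ) (coordCLM e fun j => V (j :: γ) y) y) :
    (∀ γ, Sm (V γ)) ∧ ∀ γ, wd e γ (V []) = V γ := by
  have hs : ∀ n : ℕ, ∀ γ, ContDiff ℝ n (V γ) := by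
    intro n
    induction n with
    | zero => exact fun γ => contDiff_zero.2 (continuous_iff_continuousAt.2 fun y =>
        (hV γ y).continuousAt)
    | succ n ih =>
      intro γ
      have : ((n + 1 : ℕ) : WithTop ℕ∞) = n + 1 := by norm_cast
      rw [this, contDiff_succ_iff_hasFDerivAt]
      refine ⟨fun y => coordCLM e fun j => V (j :: γ) y, ?_, hV γ⟩
      unfold coordCLM
      exact ContDiff.sum fun j _ => (ih _).smul contDiff_const
  refine ⟨fun γ => contDiff_infty.2 fun n => hs n γ, fun γ => ?_⟩
  induction γ with
  | nil => rfl
  | cons i γ ih =>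
    rw [wd_cons, ih]
    funext y
    rw [dd, (hV γ y).fderiv, coordCLM_basis]

lemma hasFDerivAt_of_quadratic (e : Module.Basis κ ℝ E) {f : E → ℝ} {a : κ → ℝ} {y : E} {B : ℝ}
    (h : ∀ w : κ → ℝ, |f (y + ∑ j, w j • e j) - f y - ∑ j, w j * a j| ≤ (∑ j, |w j|) ^ 2 * B) :
    HasFDerivAt f (coordCLM e a) y := by
  obtain ⟨C, hC0, hC⟩ := coord_sum_le e
  have hB : 0 ≤ |B| := abs_nonneg B
  rw [hasFDerivAt_iff_isLittleO_nhds_zero]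
  have h1 : (fun v : E => f (y + v) - f y - coordCLM e a v) =O[𝓝 0] fun v => ‖v‖ ^ 2 := by
    refine Asymptotics.IsBigO.of_bound (C ^ 2 * |B|) (Eventually.of_forall fun v => ?_)
    have h2 := h fun j => e.coord j v
    have h3 : ∑ j, e.coord j v • e j = v := e.sum_repr v
    rw [h3] at h2
    rw [coordCLM_apply, Real.norm_eq_abs]
    have h4 : ∑ j, a j * e.coord j v = ∑ j, e.coord j v * a j :=
      Finset.sum_congr rfl fun j _ => mul_comm _ _
    rw [h4]
    refine h2.trans ?_
    have h5 : (∑ j, |e.coord j v|) ^ 2 ≤ (C * ‖v‖) ^ 2 :=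
      pow_le_pow_left₀ (by positivity) (hC v) 2
    calc _ ≤ (∑ j, |e.coord j v|) ^ 2 * |B| :=
          mul_le_mul_of_nonneg_left (le_abs_self B) (by positivity)
      _ ≤ (C * ‖v‖) ^ 2 * |B| := mul_le_mul_of_nonneg_right h5 hB
      _ = _ := by rw [norm_pow, norm_norm]; ring
  refine h1.trans_isLittleO ?_
  have := (Asymptotics.isLittleO_pow_id (𝕜 := ℝ) one_lt_two)
  have h6 := this.comp_tendsto (tendsto_norm_zero (E := E))
  exact h6.norm_right.congr_right (by simp) |>.of_norm_right

end ClosedFamily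

section Ultralimit

/-- Limit along a fixed nonprincipal ultrafilter. -/
def ulim (a : ℕ → ℝ) : ℝ := limUnder (hyperfilter ℕ : Filter ℕ) a

lemma tendsto_ulim {a : ℕ → ℝ} {C : ℝ} (h : ∀ n, |a n| ≤ C) :
    Tendsto a (hyperfilter ℕ) (𝓝 (ulim a)) := by
  have hc : IsCompact (Icc (-C) C) := isCompact_Icc
  obtain ⟨x, _, hx⟩ := hc.ultrafilter_le_nhds ((hyperfilter ℕ).map a)
    (by
      simp only [Ultrafilter.coe_map, le_principal_iff, mem_map]
      exact Eventually.of_forall fun n => abs_le.1 (h n))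
  exact tendsto_nhds_limUnder ⟨x, hx⟩

lemma tendsto_ulim_of_eventually {a : ℕ → ℝ} {C : ℝ} (h : ∀ᶠ n in atTop, |a n| ≤ C) :
    Tendsto a (hyperfilter ℕ) (𝓝 (ulim a)) := by
  have hc : IsCompact (Icc (-C) C) := isCompact_Icc
  obtain ⟨x, _, hx⟩ := hc.ultrafilter_le_nhds ((hyperfilter ℕ).map a)
    (by
      simp only [Ultrafilter.coe_map, le_principal_iff, mem_map]
      have : ∀ᶠ n in (hyperfilter ℕ : Filter ℕ), |a n| ≤ C := Nat.hyperfilter_le_atTop h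
      filter_upwards [this] with n hn using abs_le.1 hn)
  exact tendsto_nhds_limUnder ⟨x, hx⟩

end Ultralimit

section Scheme

variable {E : Type*} [NormedAddCommGroup E] [NormedSpace ℝ E]
  {κ : Type*} [Fintype κ] {ι : Type*} [Fintype ι]

/-- Smooth bounded coefficients of a diffusion operator in square-root form. -/
structure Dat (e : κ → E) (ι : Type*) where
  σ : ι → κ → E → ℝ
  β : κ → E → ℝ
  c : E → ℝ
  hσ : ∀ m j, SB e (σ m j)
  hβ : ∀ j, SB e (β j)
  hc : SB e c

variable {e : κ → E}

namespace Dat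

/-- The displacement coefficients. -/
def a (D : Dat e ι) (m : ι) (s : ℝ) (y : E) (j : κ) : ℝ := s * D.σ m j y + s ^ 2 * D.β j y

/-- The shifted point. -/
def X (D : Dat e ι) (m : ι) (s : ℝ) (y : E) : E := y + ∑ j, D.a m s y j • e j

/-- One step of the approximation scheme. -/
def S (D : Dat e ι) (s : ℝ) (Φ : E → ℝ) (y : E) : ℝ :=
  (2 * (Fintype.card ι : ℝ))⁻¹ *
    ∑ m, ((1 + s ^ 2 * D.c y) * Φ (D.X m s y) + (1 + s ^ 2 * D.c y) * Φ (D.X m (-s) y))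

/-- The generator. -/
def L (D : Dat e ι) (Φ : E → ℝ) (y : E) : ℝ :=
  (2 * (Fintype.card ι : ℝ))⁻¹ * (∑ m, ∑ i, D.σ m i y * ∑ j, D.σ m j y * wd e [i, j] Φ y)
    + (∑ j, D.β j y * wd e [j] Φ y) + D.c y * Φ y

lemma a_sb (D : Dat e ι) (m : ι) (s : ℝ) (j : κ) : SB e (fun y => D.a m s y j) :=
  ((D.hσ m j).const_mul s).add ((D.hβ j).const_mul (s ^ 2))

lemma comp_sm (D : Dat e ι) (m : ι) (s : ℝ) {ψ : E → ℝ} (hψ : Sm ψ) :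
    Sm (fun y => ψ (D.X m s y)) := by
  refine ContDiff.comp hψ ?_
  exact contDiff_id.add (ContDiff.sum fun j _ => ContDiff.smul (D.a_sb m s j).sm contDiff_const)

lemma dd_comp (D : Dat e ι) (m : ι) (s : ℝ) {ψ : E → ℝ} (hψ : Sm ψ) (i : κ) (y : E) :
    dd (e i) (fun y => ψ (D.X m s y)) y = dd (e i) ψ (D.X m s y) +
      ∑ j, (s * dd (e i) (D.σ m j) y + s ^ 2 * dd (e i) (D.β j) y) * dd (e j) ψ (D.X m s y) := by
  have hX : HasFDerivAt (D.X m s)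
      (ContinuousLinearMap.id ℝ E + ∑ j, (fderiv ℝ (fun y => D.a m s y j) y).smulRight (e j)) y := by
    refine (hasFDerivAt_id y).add ?_
    refine HasFDerivAt.fun_sum fun j _ => ?_
    exact ((D.a_sb m s j).sm.differentiableAt.hasFDerivAt).smul_const (e j)
  have h1 := (hψ.differentiableAt (y := D.X m s y)).hasFDerivAt.comp y hX
  have h2 := congrArg (fun f => f (e i)) h1.fderiv
  refine h2.trans ?_
  simp only [ContinuousLinearMap.comp_apply, add_apply,
    ContinuousLinearMap.id_apply, map_add, dd, sum_apply, map_sum,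
    ContinuousLinearMap.smulRight_apply, map_smul, smul_eq_mul]
  congr 1
  refine Finset.sum_congr rfl fun j _ => ?_
  congr 1
  have := congrFun (dd_add (((D.hσ m j).const_mul s).sm) (((D.hβ j).const_mul (s ^ 2)).sm) (e i)) y
  rw [dd_const_mul (D.hσ m j).sm, dd_const_mul (D.hβ j).sm] at this
  exact this

/-- Parameters of modulus at most one. -/
abbrev Pm := {s : ℝ // |s| ≤ 1}

/-- Negation on parameters. -/
def Pm.neg (s : Pm) : Pm := ⟨-s.1, by simpa using s.2⟩

/-- Remainder operators in the expansion of derivatives of shifted functions. -/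
inductive Rem (D : Dat e ι) (m : ι) : ℕ → ((E → ℝ) → Pm → E → ℝ) → Prop
  | single (n : ℕ) (δ : List κ) (h : δ.length ≤ n) (a1 : E → ℝ) (a2 : Pm → E → ℝ) (h1 : SB e a1)
      (h2 : UB e a2) :
      Rem D m n (fun ψ s y => (s.1 * a1 y + s.1 ^ 2 * a2 s y) * wd e δ ψ (D.X m s.1 y))
  | zero (n : ℕ) : Rem D m n (fun _ _ _ => 0)
  | add (n : ℕ) (R R' : (E → ℝ) → Pm → E → ℝ) (h : Rem D m n R) (h' : Rem D m n R') :
      Rem D m n (fun ψ s y => R ψ s y + R' ψ s y)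

lemma Rem.sum {D : Dat e ι} {m : ι} {n : ℕ} {ι' : Type*} (t : Finset ι')
    {R : ι' → (E → ℝ) → Pm → E → ℝ} (h : ∀ i ∈ t, Rem D m n (R i)) :
    Rem D m n (fun ψ s y => ∑ i ∈ t, R i ψ s y) := by
  induction t using Finset.induction_on with
  | empty => simpa using Rem.zero n
  | insert i t hi ih =>
    simp only [Finset.sum_insert hi]
    exact Rem.add _ _ _ (h i (by simp)) (ih fun j hj => h j (by simp [hj]))

lemma coef_sm {a1 : E → ℝ} {a2 : Pm → E → ℝ} (h1 : SB e a1) (h2 : UB e a2) (s : Pm) :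
    Sm (fun y => s.1 * a1 y + s.1 ^ 2 * a2 s y) :=
  ((sm_const s.1).mul h1.sm).add ((sm_const (s.1 ^ 2)).mul (h2.sm s))

lemma Rem.sm {D : Dat e ι} {m : ι} {n : ℕ} {R : (E → ℝ) → Pm → E → ℝ} (h : Rem D m n R)
    {ψ : E → ℝ} (hψ : Sm ψ) (s : Pm) : Sm (R ψ s) := by
  induction h with
  | single δ h a1 a2 h1 h2 => exact (coef_sm h1 h2 s).mul (D.comp_sm m s.1 (hψ.wd e δ))
  | zero => exact sm_const 0
  | add R R' h h' ih ih' => exact ih.add ih'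

lemma pm_ub : UB e (fun (s : Pm) (_ : E) => s.1) := UB.of_const (C := 1) fun s => s.2

lemma Rem.deriv {D : Dat e ι} {m : ι} {n : ℕ} {R : (E → ℝ) → Pm → E → ℝ} (h : Rem D m n R)
    (i : κ) : ∃ R', Rem D m (n + 1) R' ∧ ∀ ψ, Sm ψ → ∀ s, dd (e i) (R ψ s) = R' ψ s := by
  induction h with
  | single δ h a1 a2 h1 h2 =>
    refine ⟨fun ψ s y => (s.1 * dd (e i) a1 y + s.1 ^ 2 * dd (e i) (a2 s) y) *
        wd e δ ψ (D.X m s.1 y) + ((s.1 * a1 y + s.1 ^ 2 * a2 s y) *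
        wd e (i :: δ) ψ (D.X m s.1 y) + ∑ j, (s.1 * 0 + s.1 ^ 2 *
          ((a1 y + s.1 * a2 s y) * (dd (e i) (D.σ m j) y + s.1 * dd (e i) (D.β j) y))) *
          wd e (j :: δ) ψ (D.X m s.1 y)), ?_, ?_⟩
    · refine Rem.add _ _ _ ?_ (Rem.add _ _ _ ?_ (Rem.sum _ fun j _ => ?_))
      · exact Rem.single _ δ (h.trans (Nat.le_succ n)) _ _ (h1.dd i) (h2.dd i)
      · exact Rem.single _ (i :: δ) (by simpa using h) _ _ h1 h2
      · refine Rem.single _ (j :: δ) (by simpa using h) (fun _ => 0)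
          (fun s y => (a1 y + s.1 * a2 s y) * (dd (e i) (D.σ m j) y + s.1 * dd (e i) (D.β j) y))
          (sb_const 0) ?_
        exact (h1.ub.add (pm_ub.mul h2)).mul
          (((D.hσ m j).dd i).ub.add (pm_ub.mul ((D.hβ j).dd i).ub))
    · intro ψ hψ s
      rw [dd_mul (coef_sm h1 h2 s) (D.comp_sm m s.1 (hψ.wd e δ)),
        dd_add ((sm_const s.1).mul h1.sm) ((sm_const (s.1 ^ 2)).mul (h2.sm s)),
        dd_const_mul h1.sm, dd_const_mul (h2.sm s)]
      funext y
      rw [D.dd_comp m s.1 (hψ.wd e δ)]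
      congr 1
      rw [mul_add, Finset.mul_sum]
      congr 1
      refine Finset.sum_congr rfl fun j _ => ?_
      simp only [wd_cons]
      ring
  | zero => exact ⟨_, Rem.zero _, fun ψ _ s => dd_const _ _⟩
  | add R R' h h' ih ih' =>
    obtain ⟨Q, hQ, hQe⟩ := ih
    obtain ⟨Q', hQ', hQe'⟩ := ih'
    refine ⟨_, Rem.add _ _ _ hQ hQ', fun ψ hψ s => ?_⟩
    rw [dd_add (h.sm hψ s) (h'.sm hψ s), hQe ψ hψ, hQe' ψ hψ]

lemma expansion (D : Dat e ι) (m : ι) (γ : List κ) :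
    ∃ R, Rem D m γ.length R ∧ ∀ ψ, Sm ψ → ∀ s : Pm, ∀ y,
      wd e γ (fun y => (1 + s.1 ^ 2 * D.c y) * ψ (D.X m s.1 y)) y
        = wd e γ ψ (D.X m s.1 y) + R ψ s y := by
  induction γ with
  | nil =>
    refine ⟨_, Rem.single 0 [] (by simp) (fun _ => 0) (fun _ => D.c) (sb_const 0) D.hc.ub,
      fun ψ hψ s y => ?_⟩
    simp only [wd_nil]; ring
  | cons i γ ih =>
    obtain ⟨R, hR, hRe⟩ := ih
    obtain ⟨R', hR', hRe'⟩ := hR.deriv i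
    refine ⟨fun ψ s y => (∑ j, (s.1 * dd (e i) (D.σ m j) y + s.1 ^ 2 * dd (e i) (D.β j) y) *
        wd e (j :: γ) ψ (D.X m s.1 y)) + R' ψ s y,
      Rem.add _ _ _ (Rem.sum _ fun j _ => ?_) hR', fun ψ hψ s y => ?_⟩
    · exact Rem.single _ (j :: γ) le_rfl _ (fun _ => dd (e i) (D.β j)) ((D.hσ m j).dd i)
        ((D.hβ j).dd i).ub
    · rw [wd_cons, funext (hRe ψ hψ s), dd_add (D.comp_sm m s.1 (hψ.wd e γ)) (hR.sm hψ s),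
        hRe' ψ hψ s]
      simp only []
      rw [D.dd_comp m s.1 (hψ.wd e γ), add_assoc]
      rfl

lemma Rem.bound {D : Dat e ι} {m : ι} {n : ℕ} {R : (E → ℝ) → Pm → E → ℝ} (h : Rem D m n R) :
    ∃ C : ℝ, 0 ≤ C ∧ ∀ (ψ : E → ℝ) (s : Pm) (y : E) (d B : ℝ),
      (∀ δ : List κ, δ.length ≤ n →
        |wd e δ ψ (D.X m s.1 y) - wd e δ ψ (D.X m s.neg.1 y)| ≤ d) →
      (∀ δ : List κ, δ.length ≤ n →
        |wd e δ ψ (D.X m s.1 y)| ≤ B ∧ |wd e δ ψ (D.X m s.neg.1 y)| ≤ B) →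
      |R ψ s y + R ψ s.neg y| ≤ C * (|s.1| * d + s.1 ^ 2 * B) := by
  induction h with
  | single δ h a1 a2 h1 h2 =>
    obtain ⟨C1, hC1⟩ := h1.bd []
    obtain ⟨C2, hC2⟩ := h2.bd []
    refine ⟨|C1| + 2 * |C2|, by positivity, fun ψ s y d B hd hB => ?_⟩
    have e1 := hd δ h
    obtain ⟨e2, e3⟩ := hB δ h
    have hs : s.neg.1 = -s.1 := rfl
    set u := wd e δ ψ (D.X m s.1 y)
    set v := wd e δ ψ (D.X m s.neg.1 y)
    have c1 : |a1 y| ≤ |C1| := (hC1 y).trans (le_abs_self _)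
    have c2 : |a2 s y| ≤ |C2| := (hC2 s y).trans (le_abs_self _)
    have c3 : |a2 s.neg y| ≤ |C2| := (hC2 s.neg y).trans (le_abs_self _)
    have : (s.1 * a1 y + s.1 ^ 2 * a2 s y) * u + (s.neg.1 * a1 y + s.neg.1 ^ 2 * a2 s.neg y) * v
        = s.1 * (a1 y * (u - v)) + (s.1 ^ 2 * (a2 s y * u) + s.1 ^ 2 * (a2 s.neg y * v)) := by
      rw [hs]; ring
    rw [this]
    have hd0 : 0 ≤ d := (abs_nonneg _).trans e1
    have hB0 : 0 ≤ B := (abs_nonneg _).trans e2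
    have f1 : |s.1 * (a1 y * (u - v))| ≤ |s.1| * (|C1| * d) := by
      rw [abs_mul, abs_mul]
      exact mul_le_mul_of_nonneg_left (mul_le_mul c1 e1 (abs_nonneg _) (abs_nonneg _))
        (abs_nonneg _)
    have f2 : |s.1 ^ 2 * (a2 s y * u)| ≤ s.1 ^ 2 * (|C2| * B) := by
      rw [abs_mul, abs_mul, abs_of_nonneg (sq_nonneg s.1)]
      exact mul_le_mul_of_nonneg_left (mul_le_mul c2 e2 (abs_nonneg _) (abs_nonneg _))
        (sq_nonneg _)
    have f3 : |s.1 ^ 2 * (a2 s.neg y * v)| ≤ s.1 ^ 2 * (|C2| * B) := by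
      rw [abs_mul, abs_mul, abs_of_nonneg (sq_nonneg s.1)]
      exact mul_le_mul_of_nonneg_left (mul_le_mul c3 e3 (abs_nonneg _) (abs_nonneg _))
        (sq_nonneg _)
    refine (abs_add_le _ _).trans ((add_le_add f1 ((abs_add_le _ _).trans (add_le_add f2 f3))).trans ?_)
    have g1 : 0 ≤ |s.1| * d * |C2| := by positivity
    have g2 : 0 ≤ s.1 ^ 2 * B * |C1| := by positivity
    nlinarith
  | zero =>
    refine ⟨0, le_rfl, fun ψ s y d B hd hB => by simp⟩
  | add R R' h h' ih ih' =>
    obtain ⟨C, hC0, hC⟩ := ih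
    obtain ⟨C', hC0', hC'⟩ := ih'
    refine ⟨C + C', by positivity, fun ψ s y d B hd hB => ?_⟩
    have := (abs_add_le _ _).trans (add_le_add (hC ψ s y d B hd hB) (hC' ψ s y d B hd hB))
    rw [add_mul]
    refine le_trans (le_of_eq ?_) this
    congr 1; ring

end Dat

end Scheme

section Stability

/-- Words of bounded length. -/
abbrev Wd (κ : Type*) (K : ℕ) := {γ : List κ // γ.length ≤ K}

instance wdFintype (κ : Type*) [Fintype κ] (K : ℕ) : Fintype (Wd κ K) :=
  have : Finite (Wd κ K) := (List.finite_length_le κ K).to_subtype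
  Fintype.ofFinite _

lemma hilbert_step {J : Type*} [Fintype J] {C : ℝ} (hC : 0 ≤ C) {p q n : EuclideanSpace ℝ J}
    {B s : ℝ} (hs : 0 ≤ s) (hp : ‖p‖ ≤ B) (hq : ‖q‖ ≤ B)
    (h : ∀ i, |2 * n i - (p i + q i)| ≤ C * (s * ‖p - q‖ + s ^ 2 * B)) :
    ‖n‖ ≤ (1 + ((Fintype.card J * C) ^ 2 + Fintype.card J * C) * s ^ 2) * B := by
  have hB : 0 ≤ B := (norm_nonneg _).trans hp
  set k : ℝ := Fintype.card J * C
  have hk : 0 ≤ k := by positivity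
  have h1 : ‖(2 : ℝ) • n - (p + q)‖ ≤ k * (s * ‖p - q‖ + s ^ 2 * B) := by
    have h0 : ‖(2 : ℝ) • n - (p + q)‖ ≤ ∑ i, ‖((2 : ℝ) • n - (p + q)) i‖ := by
      rw [EuclideanSpace.norm_eq]
      refine Real.sqrt_le_iff.2 ⟨Finset.sum_nonneg fun i _ => norm_nonneg _, ?_⟩
      exact Finset.sum_sq_le_sq_sum_of_nonneg fun i _ => norm_nonneg _
    refine h0.trans ((Finset.sum_le_sum
      (g := fun _ => C * (s * ‖p - q‖ + s ^ 2 * B)) fun i _ => ?_).trans (le_of_eq ?_))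
    · exact h i
    · simp [k]; ring
  have h2 : ‖(2 : ℝ) • n‖ ≤ ‖p + q‖ + k * (s * ‖p - q‖ + s ^ 2 * B) := by
    have := norm_add_le ((2 : ℝ) • n - (p + q)) (p + q)
    rw [sub_add_cancel] at this
    linarith
  have h3 : ‖(2 : ℝ) • n‖ = 2 * ‖n‖ := by rw [norm_smul]; simp
  have h4 := parallelogram_law_with_norm ℝ p q
  set u := ‖p + q‖
  set d := ‖p - q‖
  have hu : 0 ≤ u := norm_nonneg _
  have hd : 0 ≤ d := norm_nonneg _
  have h5 : u * u + d * d ≤ (2 * B) ^ 2 := by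
    have a1 : ‖p‖ * ‖p‖ ≤ B * B := mul_le_mul hp hp (norm_nonneg _) hB
    have a2 : ‖q‖ * ‖q‖ ≤ B * B := mul_le_mul hq hq (norm_nonneg _) hB
    nlinarith
  have h6 : u + k * s * d ≤ (1 + (k * s) ^ 2) * (2 * B) := by
    have hks : 0 ≤ k * s := by positivity
    have hr : 0 ≤ (1 + (k * s) ^ 2) * (2 * B) := by positivity
    refine (le_abs_self _).trans (abs_le_of_sq_le_sq ?_ hr)
    calc (u + k * s * d) ^ 2 ≤ (1 + (k * s) ^ 2) * (u * u + d * d) := by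
          nlinarith [sq_nonneg (d - k * s * u)]
      _ ≤ (1 + (k * s) ^ 2) * (2 * B) ^ 2 := mul_le_mul_of_nonneg_left h5 (by positivity)
      _ ≤ ((1 + (k * s) ^ 2) * (2 * B)) ^ 2 := by
          rw [mul_pow _ (2 * B)]
          have h8 : (1 : ℝ) + (k * s) ^ 2 ≤ (1 + (k * s) ^ 2) ^ 2 := by
            nlinarith [sq_nonneg (k * s)]
          exact mul_le_mul_of_nonneg_right h8 (sq_nonneg _)
  have h7 : k * s ^ 2 * B ≥ 0 := by positivity
  nlinarith

variable {E : Type*} [NormedAddCommGroup E] [NormedSpace ℝ E]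
  {κ : Type*} [Fintype κ] {ι : Type*} [Fintype ι] {e : κ → E}

/-- The vector of all derivatives up to a given order. -/
def vK (e : κ → E) (K : ℕ) (Φ : E → ℝ) (y : E) : EuclideanSpace ℝ (Wd κ K) :=
  WithLp.toLp 2 fun γ => wd e γ.1 Φ y

lemma abs_le_vK (K : ℕ) (Φ : E → ℝ) (y : E) {γ : List κ} (h : γ.length ≤ K) :
    |wd e γ Φ y| ≤ ‖vK e K Φ y‖ :=
  PiLp.norm_apply_le (vK e K Φ y) (⟨γ, h⟩ : Wd κ K)

lemma vK_bound (K : ℕ) {Φ : E → ℝ} (h : SB e Φ) : ∃ B, 0 ≤ B ∧ ∀ y, ‖vK e K Φ y‖ ≤ B := by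
  choose C hC using fun γ : Wd κ K => h.bd γ.1
  refine ⟨Real.sqrt (∑ γ, (C γ) ^ 2), Real.sqrt_nonneg _, fun y => ?_⟩
  rw [EuclideanSpace.norm_eq]
  refine Real.sqrt_le_sqrt (Finset.sum_le_sum fun γ _ => ?_)
  exact pow_le_pow_left₀ (norm_nonneg _) (hC γ y) 2

namespace Dat

/-- The contribution of one direction to the scheme. -/
def Sm1 (D : Dat e ι) (m : ι) (s : ℝ) (Φ : E → ℝ) (y : E) : ℝ :=
  (1 + s ^ 2 * D.c y) * Φ (D.X m s y) + (1 + s ^ 2 * D.c y) * Φ (D.X m (-s) y)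

lemma half_sm (D : Dat e ι) (m : ι) (s t : ℝ) {Φ : E → ℝ} (hΦ : Sm Φ) :
    Sm (fun y => (1 + s ^ 2 * D.c y) * Φ (D.X m t y)) :=
  (((sm_const 1).add ((sm_const (s ^ 2)).mul D.hc.sm))).mul (D.comp_sm m t hΦ)

lemma sm1_sm (D : Dat e ι) (m : ι) (s : ℝ) {Φ : E → ℝ} (hΦ : Sm Φ) : Sm (D.Sm1 m s Φ) :=
  (D.half_sm m s s hΦ).add (D.half_sm m s (-s) hΦ)

lemma S_eq (D : Dat e ι) (s : ℝ) (Φ : E → ℝ) :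
    D.S s Φ = fun y => (2 * (Fintype.card ι : ℝ))⁻¹ * ∑ m, D.Sm1 m s Φ y := rfl

lemma S_sm (D : Dat e ι) (s : ℝ) {Φ : E → ℝ} (hΦ : Sm Φ) : Sm (D.S s Φ) := by
  rw [S_eq]
  exact (sm_const _).mul (Sm.sum fun m _ => D.sm1_sm m s hΦ)

lemma wd_S (D : Dat e ι) (s : ℝ) {Φ : E → ℝ} (hΦ : Sm Φ) (γ : List κ) :
    wd e γ (D.S s Φ) = fun y => (2 * (Fintype.card ι : ℝ))⁻¹ * ∑ m, wd e γ (D.Sm1 m s Φ) y := by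
  rw [S_eq, wd_const_mul (Sm.sum fun m _ => D.sm1_sm m s hΦ),
    wd_sum fun m _ => D.sm1_sm m s hΦ]

/-- Derivatives of one step, up to controlled remainders. -/
lemma wd_Sm1 (D : Dat e ι) (m : ι) (γ : List κ) :
    ∃ C : ℝ, 0 ≤ C ∧ ∀ (ψ : E → ℝ), Sm ψ → ∀ (s : ℝ), |s| ≤ 1 → ∀ (y : E) (d B : ℝ),
      (∀ δ : List κ, δ.length ≤ γ.length →
        |wd e δ ψ (D.X m s y) - wd e δ ψ (D.X m (-s) y)| ≤ d) →
      (∀ δ : List κ, δ.length ≤ γ.length →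
        |wd e δ ψ (D.X m s y)| ≤ B ∧ |wd e δ ψ (D.X m (-s) y)| ≤ B) →
      |wd e γ (D.Sm1 m s ψ) y - (wd e γ ψ (D.X m s y) + wd e γ ψ (D.X m (-s) y))|
        ≤ C * (|s| * d + s ^ 2 * B) := by
  obtain ⟨R, hR, hRe⟩ := D.expansion m γ
  obtain ⟨C, hC0, hC⟩ := hR.bound
  refine ⟨C, hC0, fun ψ hψ s hs y d B hd hB => ?_⟩
  have h1 := hRe ψ hψ ⟨s, hs⟩ y
  have h2 := hRe ψ hψ (Pm.neg ⟨s, hs⟩) y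
  have h3 := hC ψ ⟨s, hs⟩ y d B hd hB
  have h4 : wd e γ (D.Sm1 m s ψ) y = wd e γ (fun y => (1 + s ^ 2 * D.c y) * ψ (D.X m s y)) y +
      wd e γ (fun y => (1 + s ^ 2 * D.c y) * ψ (D.X m (-s) y)) y :=
    congrFun (wd_add (D.half_sm m s s hψ) (D.half_sm m s (-s) hψ) e γ) y
  have hn : (Pm.neg ⟨s, hs⟩).1 = -s := rfl
  rw [hn, neg_sq] at h2
  simp only at h1
  rw [h4, h1, h2]
  refine le_trans (le_of_eq ?_) h3
  congr 1; ring

lemma stable1 (D : Dat e ι) (m : ι) (K : ℕ) :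
    ∃ C : ℝ, 0 ≤ C ∧ ∀ (s : ℝ), |s| ≤ 1 → ∀ (Φ : E → ℝ), Sm Φ → ∀ B : ℝ,
      (∀ y, ‖vK e K Φ y‖ ≤ B) →
      ∀ y, ‖vK e K (fun y => 2⁻¹ * D.Sm1 m s Φ y) y‖ ≤ (1 + C * s ^ 2) * B := by
  choose C hC0 hC using fun γ : Wd κ K => D.wd_Sm1 m γ.1
  set C1 := ∑ γ, C γ
  have hC1 : 0 ≤ C1 := Finset.sum_nonneg fun γ _ => hC0 γ
  refine ⟨(Fintype.card (Wd κ K) * C1) ^ 2 + Fintype.card (Wd κ K) * C1, by positivity,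
    fun s hs Φ hΦ B hB y => ?_⟩
  rw [← sq_abs s]
  refine hilbert_step hC1 (p := vK e K Φ (D.X m s y)) (q := vK e K Φ (D.X m (-s) y))
    (abs_nonneg s) (hB _) (hB _) fun γ => ?_
  have hle : C γ ≤ C1 := Finset.single_le_sum (fun γ _ => hC0 γ) (Finset.mem_univ γ)
  have hB0 : 0 ≤ B := (norm_nonneg _).trans (hB y)
  have h1 := hC γ Φ hΦ s hs y ‖vK e K Φ (D.X m s y) - vK e K Φ (D.X m (-s) y)‖ B
    (fun δ hδ => PiLp.norm_apply_le (vK e K Φ (D.X m s y) - vK e K Φ (D.X m (-s) y))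
      (⟨δ, hδ.trans γ.2⟩ : Wd κ K))
    (fun δ hδ => ⟨(abs_le_vK K Φ _ (hδ.trans γ.2)).trans (hB _),
      (abs_le_vK K Φ _ (hδ.trans γ.2)).trans (hB _)⟩)
  have h2 : (2 : ℝ) * vK e K (fun y => 2⁻¹ * D.Sm1 m s Φ y) y γ = wd e γ.1 (D.Sm1 m s Φ) y := by
    simp only [vK]
    rw [wd_const_mul (D.sm1_sm m s hΦ)]
    ring
  rw [h2]
  refine h1.trans ?_
  rw [sq_abs]
  exact mul_le_mul_of_nonneg_right hle (by positivity)

/-- Stability of the scheme in all orders of differentiability. -/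
lemma stable [Nonempty ι] (D : Dat e ι) (K : ℕ) :
    ∃ C : ℝ, 0 ≤ C ∧ ∀ (s : ℝ), |s| ≤ 1 → ∀ (Φ : E → ℝ), Sm Φ → ∀ B : ℝ,
      (∀ y, ‖vK e K Φ y‖ ≤ B) → ∀ y, ‖vK e K (D.S s Φ) y‖ ≤ (1 + C * s ^ 2) * B := by
  choose C hC0 hC using fun m => D.stable1 m K
  refine ⟨∑ m, C m, Finset.sum_nonneg fun m _ => hC0 m, fun s hs Φ hΦ B hB y => ?_⟩
  have hB0 : 0 ≤ B := (norm_nonneg _).trans (hB y)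
  have hcard : (0 : ℝ) < Fintype.card ι := by exact_mod_cast Fintype.card_pos
  have h1 : vK e K (D.S s Φ) y = (Fintype.card ι : ℝ)⁻¹ •
      ∑ m, vK e K (fun y => 2⁻¹ * D.Sm1 m s Φ y) y := by
    ext γ
    simp only [vK, PiLp.smul_apply, WithLp.ofLp_sum, Finset.sum_apply, smul_eq_mul]
    rw [D.wd_S s hΦ]
    simp only [wd_const_mul (D.sm1_sm _ s hΦ)]
    rw [← Finset.mul_sum, mul_inv]; ring
  rw [h1, norm_smul, Real.norm_eq_abs, abs_of_pos (inv_pos.2 hcard), inv_mul_le_iff₀ hcard]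
  refine (norm_sum_le _ _).trans ((Finset.sum_le_sum
    (g := fun _ => (1 + (∑ m, C m) * s ^ 2) * B) fun m _ => ?_).trans (le_of_eq ?_))
  · refine (hC m s hs Φ hΦ B hB y).trans ?_
    have : C m ≤ ∑ m, C m := Finset.single_le_sum (fun m _ => hC0 m) (Finset.mem_univ m)
    gcongr
  · simp

lemma sup_bound [Nonempty ι] (D : Dat e ι) {c₀ : ℝ} (h0 : ∀ y, D.c y ≤ c₀) :
    ∃ s₀ > 0, ∀ s : ℝ, |s| ≤ s₀ → ∀ (Φ : E → ℝ) (B : ℝ), (∀ y, |Φ y| ≤ B) →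
      ∀ y, |D.S s Φ y| ≤ (1 + s ^ 2 * c₀) * B := by
  obtain ⟨C, hC⟩ := D.hc.bd []
  refine ⟨min 1 (|C| + 1)⁻¹, by positivity, fun s hs Φ B hB y => ?_⟩
  have hB0 : 0 ≤ B := (abs_nonneg _).trans (hB y)
  have hcard : (0 : ℝ) < Fintype.card ι := by exact_mod_cast Fintype.card_pos
  have hs1 : |s| ≤ 1 := hs.trans (min_le_left _ _)
  have hs2 : |s| * (|C| + 1) ≤ 1 := by
    have := hs.trans (min_le_right _ _)
    rwa [← one_div, le_div_iff₀ (by positivity)] at this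
  have hc : |D.c y| ≤ |C| + 1 := (hC y).trans ((le_abs_self C).trans (by linarith))
  have hp : 0 ≤ 1 + s ^ 2 * D.c y := by
    have h1 : s ^ 2 * |D.c y| ≤ 1 := by
      rw [← sq_abs, sq, mul_assoc]
      calc |s| * (|s| * |D.c y|) ≤ 1 * (|s| * (|C| + 1)) := by gcongr
        _ ≤ 1 := by linarith
    have := neg_abs_le (D.c y)
    nlinarith [sq_nonneg s]
  have hq : 1 + s ^ 2 * D.c y ≤ 1 + s ^ 2 * c₀ := by nlinarith [sq_nonneg s, h0 y]
  unfold S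
  rw [abs_mul, abs_of_pos (by positivity), inv_mul_le_iff₀ (by positivity)]
  refine (Finset.abs_sum_le_sum_abs _ _).trans ((Finset.sum_le_sum (g := fun _ =>
    2 * ((1 + s ^ 2 * c₀) * B)) fun m _ => ?_).trans (le_of_eq ?_))
  · refine (abs_add_le _ _).trans ?_
    rw [two_mul]
    simp only [abs_mul, abs_of_nonneg hp]
    exact add_le_add (mul_le_mul hq (hB _) (abs_nonneg _) (hp.trans hq))
      (mul_le_mul hq (hB _) (abs_nonneg _) (hp.trans hq))
  · simp; ring

lemma a_bound (D : Dat e ι) : ∃ C : ℝ, 0 ≤ C ∧ ∀ m s, |s| ≤ 1 → ∀ y,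
    ∑ j, |D.a m s y j| ≤ C * |s| := by
  choose Cσ hσ using fun m j => (D.hσ m j).bd []
  choose Cβ hβ using fun j => (D.hβ j).bd []
  refine ⟨∑ m, ∑ j, (|Cσ m j| + |Cβ j|), by positivity, fun m s hs y => ?_⟩
  have h1 : ∑ j, |D.a m s y j| ≤ (∑ j, (|Cσ m j| + |Cβ j|)) * |s| := by
    rw [Finset.sum_mul]
    refine Finset.sum_le_sum fun j _ => ?_
    unfold a
    refine (abs_add_le _ _).trans ?_
    rw [abs_mul, abs_mul, abs_pow]
    have e1 : |D.σ m j y| ≤ |Cσ m j| := (hσ m j y).trans (le_abs_self _)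
    have e2 : |D.β j y| ≤ |Cβ j| := (hβ j y).trans (le_abs_self _)
    have e3 : |s| ^ 2 ≤ |s| := by nlinarith [abs_nonneg s]
    calc |s| * |D.σ m j y| + |s| ^ 2 * |D.β j y| ≤ |s| * |Cσ m j| + |s| * |Cβ j| := by
          gcongr
      _ = _ := by ring
  refine h1.trans (mul_le_mul_of_nonneg_right ?_ (abs_nonneg s))
  exact Finset.single_le_sum (f := fun m => ∑ j, (|Cσ m j| + |Cβ j|))
    (fun m _ => by positivity) (Finset.mem_univ m)

end Dat

end Stability

section Consistency

variable {E : Type*} [NormedAddCommGroup E] [NormedSpace ℝ E]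
  {κ : Type*} [Fintype κ] {ι : Type*} [Fintype ι] {e : κ → E}

namespace Dat

lemma a_add (D : Dat e ι) (m : ι) (s : ℝ) (y : E) (j : κ) :
    D.a m s y j + D.a m (-s) y j = 2 * s ^ 2 * D.β j y := by
  unfold a; ring

lemma β_bound (D : Dat e ι) : ∃ C : ℝ, 0 ≤ C ∧ ∀ y, ∑ j, |D.β j y| ≤ C := by
  choose C hC using fun j => (D.hβ j).bd []
  refine ⟨∑ j, |C j|, by positivity, fun y => Finset.sum_le_sum fun j _ => ?_⟩
  exact (hC j y).trans (le_abs_self _)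

lemma step_lip1 (D : Dat e ι) (m : ι) (γ : List κ) :
    ∃ C : ℝ, 0 ≤ C ∧ ∀ s : ℝ, |s| ≤ 1 → ∀ Φ : E → ℝ, Sm Φ → ∀ B : ℝ,
      (∀ δ : List κ, δ.length ≤ γ.length + 2 → ∀ y, |wd e δ Φ y| ≤ B) →
      ∀ y, |wd e γ (D.Sm1 m s Φ) y - 2 * wd e γ Φ y| ≤ C * s ^ 2 * B := by
  obtain ⟨C, hC0, hC⟩ := D.wd_Sm1 m γ
  obtain ⟨A, hA0, hA⟩ := D.a_bound
  obtain ⟨b, hb0, hb⟩ := D.β_bound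
  refine ⟨C * (2 * A + 1) + 2 * A ^ 2 + 2 * b, by positivity, fun s hs Φ hΦ B hB y => ?_⟩
  have hs' : |(-s)| ≤ 1 := by rwa [abs_neg]
  have hB0 : 0 ≤ B := (abs_nonneg _).trans (hB [] (by simp) y)
  have h1 := hC Φ hΦ s hs y (2 * A * |s| * B) B (fun δ hδ => by
      have hd : ∀ j y, |wd e [j] (wd e δ Φ) y| ≤ B := fun j y => hB (j :: δ) (by simp; omega) y
      have e1 := taylor_one_word e (hΦ.wd e δ) y (D.a m s y) hd
      have e2 := taylor_one_word e (hΦ.wd e δ) y (D.a m (-s) y) hd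
      have e3 := mul_le_mul_of_nonneg_right (hA m s hs y) hB0
      have e4 := mul_le_mul_of_nonneg_right (hA m (-s) hs' y) hB0
      rw [abs_neg] at e4
      have e5 : wd e δ Φ (D.X m s y) - wd e δ Φ (D.X m (-s) y) =
        (wd e δ Φ (D.X m s y) - wd e δ Φ y) - (wd e δ Φ (D.X m (-s) y) - wd e δ Φ y) := by ring
      rw [e5]
      refine (abs_sub _ _).trans ((add_le_add (e1.trans e3) (e2.trans e4)).trans (le_of_eq ?_))
      ring)
    (fun δ hδ => ⟨hB δ (by omega) _, hB δ (by omega) _⟩)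
  have hd : ∀ i j y, |wd e [i, j] (wd e γ Φ) y| ≤ B := fun i j y =>
    hB (i :: j :: γ) (by simp) y
  have e1 := taylor_two_word e (hΦ.wd e γ) y (D.a m s y) hd
  have e2 := taylor_two_word e (hΦ.wd e γ) y (D.a m (-s) y) hd
  have q1 : (∑ j, |D.a m s y j|) ^ 2 * B ≤ A ^ 2 * s ^ 2 * B := by
    rw [← sq_abs s, ← mul_pow]
    exact mul_le_mul_of_nonneg_right (pow_le_pow_left₀ (by positivity) (hA m s hs y) 2) hB0
  have q2 : (∑ j, |D.a m (-s) y j|) ^ 2 * B ≤ A ^ 2 * s ^ 2 * B := by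
    rw [← sq_abs s, ← mul_pow, ← abs_neg s]
    exact mul_le_mul_of_nonneg_right (pow_le_pow_left₀ (by positivity) (hA m (-s) hs' y) 2) hB0
  have q3 : |(∑ j, D.a m s y j * wd e [j] (wd e γ Φ) y) +
      ∑ j, D.a m (-s) y j * wd e [j] (wd e γ Φ) y| ≤ 2 * s ^ 2 * (b * B) := by
    rw [← Finset.sum_add_distrib]
    have : ∀ j, D.a m s y j * wd e [j] (wd e γ Φ) y + D.a m (-s) y j * wd e [j] (wd e γ Φ) y
        = 2 * s ^ 2 * (D.β j y * wd e [j] (wd e γ Φ) y) := fun j => by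
      rw [← add_mul, D.a_add]; ring
    rw [Finset.sum_congr rfl fun j _ => this j, ← Finset.mul_sum, abs_mul,
      abs_of_nonneg (by positivity : (0 : ℝ) ≤ 2 * s ^ 2)]
    refine mul_le_mul_of_nonneg_left ?_ (by positivity)
    refine (abs_sum_mul_le (B := B) fun j _ => hB (j :: γ) (by simp) y).trans ?_
    exact mul_le_mul_of_nonneg_right (hb y) hB0
  have r1 := abs_le.1 (e1.trans q1)
  have r2 := abs_le.1 (e2.trans q2)
  have r3 := abs_le.1 q3
  have r4 := abs_le.1 h1
  have hX : ∀ s, D.X m s y = y + ∑ j, D.a m s y j • e j := fun _ => rfl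
  rw [← hX] at r1 r2
  have hsq : |s| * (2 * A * |s| * B) = 2 * A * s ^ 2 * B := by rw [← sq_abs s]; ring
  rw [hsq] at r4
  rw [abs_le]
  constructor <;> nlinarith

lemma avg_bound [Nonempty ι] {F : ι → ℝ} {x r : ℝ} (h : ∀ m, |F m - 2 * x| ≤ 2 * r) :
    |(2 * (Fintype.card ι : ℝ))⁻¹ * (∑ m, F m) - x| ≤ r := by
  have hcard : (0 : ℝ) < Fintype.card ι := by exact_mod_cast Fintype.card_pos
  have : (2 * (Fintype.card ι : ℝ))⁻¹ * (∑ m, F m) - x =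
      (2 * (Fintype.card ι : ℝ))⁻¹ * ∑ m, (F m - 2 * x) := by
    rw [Finset.sum_sub_distrib]; simp; field_simp
  rw [this, abs_mul, abs_of_pos (by positivity), inv_mul_le_iff₀ (by positivity)]
  refine (Finset.abs_sum_le_sum_abs _ _).trans ((Finset.sum_le_sum fun m _ => h m).trans ?_)
  simp; apply le_of_eq; ring

lemma step_lip [Nonempty ι] (D : Dat e ι) (γ : List κ) :
    ∃ C : ℝ, 0 ≤ C ∧ ∀ s : ℝ, |s| ≤ 1 → ∀ Φ : E → ℝ, Sm Φ → ∀ B : ℝ,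
      (∀ δ : List κ, δ.length ≤ γ.length + 2 → ∀ y, |wd e δ Φ y| ≤ B) →
      ∀ y, |wd e γ (D.S s Φ) y - wd e γ Φ y| ≤ C * s ^ 2 * B := by
  choose C hC0 hC using fun m => D.step_lip1 m γ
  refine ⟨∑ m, C m, Finset.sum_nonneg fun m _ => hC0 m, fun s hs Φ hΦ B hB y => ?_⟩
  have hB0 : 0 ≤ B := (abs_nonneg _).trans (hB [] (by simp) y)
  rw [D.wd_S s hΦ]
  refine avg_bound fun m => (hC m s hs Φ hΦ B hB y).trans ?_
  have : C m ≤ ∑ m, C m := Finset.single_le_sum (fun m _ => hC0 m) (Finset.mem_univ m)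
  have h2 : C m * s ^ 2 * B ≤ (∑ m, C m) * s ^ 2 * B := by gcongr
  have h3 : 0 ≤ (∑ m, C m) * s ^ 2 * B :=
    (mul_nonneg (mul_nonneg (hC0 m) (sq_nonneg s)) hB0).trans h2
  linarith

/-- The part of the generator contributed by one direction. -/
lemma L_eq_avg [Nonempty ι] (D : Dat e ι) (Φ : E → ℝ) (y : E) :
    D.L Φ y = (2 * (Fintype.card ι : ℝ))⁻¹ * ∑ m, ((∑ i, D.σ m i y * ∑ j, D.σ m j y *
      wd e [i, j] Φ y) + 2 * ((∑ j, D.β j y * wd e [j] Φ y) + D.c y * Φ y)) := by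
  have hcard : (0 : ℝ) < Fintype.card ι := by exact_mod_cast Fintype.card_pos
  rw [Finset.sum_add_distrib, mul_add]
  unfold L
  rw [add_assoc]
  congr 1
  simp; field_simp

lemma consistent1 (D : Dat e ι) (m : ι) :
    ∃ C : ℝ, 0 ≤ C ∧ ∀ s : ℝ, |s| ≤ 1 → ∀ Φ : E → ℝ, Sm Φ → ∀ B : ℝ,
      (∀ δ : List κ, δ.length ≤ 3 → ∀ y, |wd e δ Φ y| ≤ B) →
      ∀ y, |D.Sm1 m s Φ y - 2 * Φ y - s ^ 2 * ((∑ i, D.σ m i y * ∑ j, D.σ m j y *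
      wd e [i, j] Φ y) + 2 * ((∑ j, D.β j y * wd e [j] Φ y) + D.c y * Φ y))|
        ≤ C * |s| ^ 3 * B := by
  obtain ⟨A, hA0, hA⟩ := D.a_bound
  obtain ⟨b, hb0, hb⟩ := D.β_bound
  obtain ⟨c1, hc1⟩ := D.hc.bd []
  refine ⟨2 * A ^ 3 + b ^ 2 + |c1| * 2 * A, by positivity, fun s hs Φ hΦ B hB y => ?_⟩
  have hs' : |(-s)| ≤ 1 := by rwa [abs_neg]
  have hB0 : 0 ≤ B := (abs_nonneg _).trans (hB [] (by simp) y)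
  have t1 := taylor_three_word e hΦ y (D.a m s y) (B := B) fun i j k y => hB _ (by simp) y
  have t2 := taylor_three_word e hΦ y (D.a m (-s) y) (B := B) fun i j k y => hB _ (by simp) y
  have f1 := taylor_one_word e hΦ y (D.a m s y) (B := B) fun i y => hB _ (by simp) y
  have f2 := taylor_one_word e hΦ y (D.a m (-s) y) (B := B) fun i y => hB _ (by simp) y
  have hX : ∀ s, D.X m s y = y + ∑ j, D.a m s y j • e j := fun _ => rfl
  rw [← hX] at t1 t2 f1 f2
  have q1 : (∑ j, |D.a m s y j|) ^ 3 * B ≤ A ^ 3 * |s| ^ 3 * B := by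
    rw [← mul_pow]
    exact mul_le_mul_of_nonneg_right (pow_le_pow_left₀ (by positivity) (hA m s hs y) 3) hB0
  have q2 : (∑ j, |D.a m (-s) y j|) ^ 3 * B ≤ A ^ 3 * |s| ^ 3 * B := by
    rw [← mul_pow, ← abs_neg s]
    exact mul_le_mul_of_nonneg_right (pow_le_pow_left₀ (by positivity) (hA m (-s) hs' y) 3) hB0
  have g1 := f1.trans (mul_le_mul_of_nonneg_right (hA m s hs y) hB0)
  have g2 := f2.trans (mul_le_mul_of_nonneg_right (hA m (-s) hs' y) hB0)
  rw [abs_neg] at g2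
  have r1 := t1.trans q1
  have r2 := t2.trans q2
  set Fp := Φ (D.X m s y)
  set Fm := Φ (D.X m (-s) y)
  have i1 : (∑ j, D.a m s y j * wd e [j] Φ y) + ∑ j, D.a m (-s) y j * wd e [j] Φ y
      = s ^ 2 * (2 * ∑ j, D.β j y * wd e [j] Φ y) := by
    rw [← Finset.sum_add_distrib, Finset.mul_sum, Finset.mul_sum]
    exact Finset.sum_congr rfl fun j _ => by rw [← add_mul, D.a_add]; ring
  have i2 : (∑ i, D.a m s y i * ∑ j, D.a m s y j * wd e [i, j] Φ y) +
      ∑ i, D.a m (-s) y i * ∑ j, D.a m (-s) y j * wd e [i, j] Φ y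
      = 2 * s ^ 2 * (∑ i, D.σ m i y * ∑ j, D.σ m j y * wd e [i, j] Φ y) +
        2 * s ^ 4 * (∑ i, D.β i y * ∑ j, D.β j y * wd e [i, j] Φ y) := by
    simp only [Finset.mul_sum, ← Finset.sum_add_distrib]
    refine Finset.sum_congr rfl fun i _ => Finset.sum_congr rfl fun j _ => ?_
    unfold a; ring
  set T1p := ∑ j, D.a m s y j * wd e [j] Φ y
  set T1m := ∑ j, D.a m (-s) y j * wd e [j] Φ y
  set T2p := ∑ i, D.a m s y i * ∑ j, D.a m s y j * wd e [i, j] Φ y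
  set T2m := ∑ i, D.a m (-s) y i * ∑ j, D.a m (-s) y j * wd e [i, j] Φ y
  set Q := ∑ i, D.σ m i y * ∑ j, D.σ m j y * wd e [i, j] Φ y
  set R := ∑ i, D.β i y * ∑ j, D.β j y * wd e [i, j] Φ y
  set b1 := ∑ j, D.β j y * wd e [j] Φ y
  have hR : |R| ≤ b ^ 2 * B := by
    have := abs_sum_mul_le (s := Finset.univ) (a := fun i => D.β i y)
      (b := fun i => ∑ j, D.β j y * wd e [i, j] Φ y) (B := b * B) fun i _ =>
      (abs_sum_mul_le (B := B) fun j _ => hB [i, j] (by simp) y).trans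
        (mul_le_mul_of_nonneg_right (hb y) hB0)
    refine this.trans ?_
    rw [sq, mul_assoc]
    exact mul_le_mul_of_nonneg_right (hb y) (by positivity)
  have key : D.Sm1 m s Φ y - 2 * Φ y - s ^ 2 * (Q + 2 * (b1 + D.c y * Φ y))
      = (Fp - Φ y - T1p - 1 / 2 * T2p) + (Fm - Φ y - T1m - 1 / 2 * T2m) + s ^ 4 * R +
        s ^ 2 * D.c y * ((Fp - Φ y) + (Fm - Φ y)) := by
    have : D.Sm1 m s Φ y = (1 + s ^ 2 * D.c y) * Fp + (1 + s ^ 2 * D.c y) * Fm := rfl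
    rw [this]
    linear_combination i1 + (1 / 2) * i2
  rw [key]
  have hs4 : s ^ 4 ≤ |s| ^ 3 := by
    have : s ^ 4 = |s| ^ 3 * |s| := by
      rw [← pow_succ]; exact ((even_two.mul_left 2).pow_abs s).symm
    rw [this]; exact mul_le_of_le_one_right (by positivity) hs
  have h3 : |s ^ 4 * R| ≤ |s| ^ 3 * (b ^ 2 * B) := by
    rw [abs_mul, abs_of_nonneg (by positivity : (0 : ℝ) ≤ s ^ 4)]
    exact mul_le_mul hs4 hR (abs_nonneg _) (by positivity)
  have h4 : |s ^ 2 * D.c y * ((Fp - Φ y) + (Fm - Φ y))| ≤ |s| ^ 2 * |c1| * (2 * (A * |s| * B)) := by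
    rw [abs_mul, abs_mul, abs_pow]
    have hc : |D.c y| ≤ |c1| := (hc1 y).trans (le_abs_self _)
    have := (abs_add_le _ _).trans (add_le_add g1 g2)
    rw [two_mul]
    gcongr
  refine (abs_add_le _ _).trans ((add_le_add ((abs_add_le _ _).trans (add_le_add
    ((abs_add_le _ _).trans (add_le_add r1 r2)) h3)) h4).trans (le_of_eq ?_))
  ring

lemma consistent [Nonempty ι] (D : Dat e ι) :
    ∃ C : ℝ, 0 ≤ C ∧ ∀ s : ℝ, |s| ≤ 1 → ∀ Φ : E → ℝ, Sm Φ → ∀ B : ℝ,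
      (∀ δ : List κ, δ.length ≤ 3 → ∀ y, |wd e δ Φ y| ≤ B) →
      ∀ y, |D.S s Φ y - Φ y - s ^ 2 * D.L Φ y| ≤ C * |s| ^ 3 * B := by
  choose C hC0 hC using fun m => D.consistent1 m
  refine ⟨∑ m, C m, Finset.sum_nonneg fun m _ => hC0 m, fun s hs Φ hΦ B hB y => ?_⟩
  have hB0 : 0 ≤ B := (abs_nonneg _).trans (hB [] (by simp) y)
  rw [D.L_eq_avg, D.S_eq]
  have := avg_bound (F := fun m => D.Sm1 m s Φ y - s ^ 2 * ((∑ i, D.σ m i y * ∑ j, D.σ m j y *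
      wd e [i, j] Φ y) + 2 * ((∑ j, D.β j y * wd e [j] Φ y) + D.c y * Φ y))) (x := Φ y)
      (r := (∑ m, C m) * |s| ^ 3 * B) fun m => ?_
  · rw [Finset.sum_sub_distrib, ← Finset.mul_sum] at this
    refine le_trans (le_of_eq ?_) this
    congr 1; ring
  · have h1 := hC m s hs Φ hΦ B hB y
    have : C m ≤ ∑ m, C m := Finset.single_le_sum (fun m _ => hC0 m) (Finset.mem_univ m)
    have h2 : C m * |s| ^ 3 * B ≤ (∑ m, C m) * |s| ^ 3 * B := by gcongr
    have h3 : 0 ≤ (∑ m, C m) * |s| ^ 3 * B :=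
      (mul_nonneg (mul_nonneg (hC0 m) (by positivity)) hB0).trans h2
    rw [sub_right_comm]
    linarith

lemma L_sm (D : Dat e ι) {Φ : E → ℝ} (hΦ : Sm Φ) : Sm (D.L Φ) := by
  unfold L
  refine Sm.add (Sm.add ((sm_const _).mul (Sm.sum fun m _ => Sm.sum fun i _ =>
    (D.hσ m i).sm.mul (Sm.sum fun j _ => (D.hσ m j).sm.mul (hΦ.wd e [i, j])))) ?_) ?_
  · exact Sm.sum fun j _ => (D.hβ j).sm.mul (hΦ.wd e [j])
  · exact D.hc.sm.mul hΦ

lemma L_ub (D : Dat e ι) {P : Type*} {Φ : P → E → ℝ} (hΦ : UB e Φ) :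
    UB e (fun p => D.L (Φ p)) := by
  unfold L
  refine UB.add (UB.add (UB.const_mul (UB.sum fun m _ => UB.sum fun i _ =>
    (D.hσ m i).ub.mul (UB.sum fun j _ => (D.hσ m j).ub.mul (hΦ.wd [i, j]))) _) ?_) ?_
  · exact UB.sum fun j _ => (D.hβ j).ub.mul (hΦ.wd [j])
  · exact D.hc.ub.mul hΦ

lemma L_sub (D : Dat e ι) {Φ Ψ : E → ℝ} (hΦ : Sm Φ) (hΨ : Sm Ψ) (y : E) :
    D.L (fun y => Φ y - Ψ y) y = D.L Φ y - D.L Ψ y := by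
  unfold L
  simp only [wd_sub hΦ hΨ, mul_sub, Finset.sum_sub_distrib]
  ring

lemma L_bound (D : Dat e ι) : ∃ C : ℝ, 0 ≤ C ∧ ∀ (Φ : E → ℝ) (y : E) (B : ℝ),
    (∀ δ : List κ, δ.length ≤ 2 → |wd e δ Φ y| ≤ B) → |D.L Φ y| ≤ C * B := by
  choose Cσ hσ using fun m j => (D.hσ m j).bd []
  obtain ⟨b, hb0, hb⟩ := D.β_bound
  obtain ⟨c1, hc1⟩ := D.hc.bd []
  refine ⟨|(2 * (Fintype.card ι : ℝ))⁻¹| * (∑ m, (∑ i, |Cσ m i|) * ∑ j, |Cσ m j|) + b + |c1|,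
    by positivity, fun Φ y B hB => ?_⟩
  have hB0 : 0 ≤ B := (abs_nonneg _).trans (hB [] (by simp))
  unfold L
  have hs : ∀ m, ∑ i, |D.σ m i y| ≤ ∑ i, |Cσ m i| := fun m =>
    Finset.sum_le_sum fun i _ => (hσ m i y).trans (le_abs_self _)
  have h1 : |∑ m, ∑ i, D.σ m i y * ∑ j, D.σ m j y * wd e [i, j] Φ y| ≤
      (∑ m, (∑ i, |Cσ m i|) * ∑ j, |Cσ m j|) * B := by
    rw [Finset.sum_mul]
    refine (Finset.abs_sum_le_sum_abs _ _).trans (Finset.sum_le_sum fun m _ => ?_)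
    have := abs_sum_mul_le (s := Finset.univ) (a := fun i => D.σ m i y)
      (b := fun i => ∑ j, D.σ m j y * wd e [i, j] Φ y) (B := (∑ j, |Cσ m j|) * B) fun i _ =>
      (abs_sum_mul_le (B := B) fun j _ => hB [i, j] (by simp)).trans
        (mul_le_mul_of_nonneg_right (hs m) hB0)
    refine this.trans ?_
    rw [mul_assoc]
    exact mul_le_mul_of_nonneg_right (hs m) (by positivity)
  have h2 : |∑ j, D.β j y * wd e [j] Φ y| ≤ b * B :=
    (abs_sum_mul_le (B := B) fun j _ => hB [j] (by simp)).trans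
      (mul_le_mul_of_nonneg_right (hb y) hB0)
  have h3 : |D.c y * Φ y| ≤ |c1| * B := by
    rw [abs_mul]
    exact mul_le_mul ((hc1 y).trans (le_abs_self _)) (hB [] (by simp)) (abs_nonneg _)
      (abs_nonneg _)
  have h4 := mul_le_mul_of_nonneg_left h1 (abs_nonneg ((2 * (Fintype.card ι : ℝ))⁻¹))
  rw [← abs_mul] at h4
  refine (abs_add_le _ _).trans ((add_le_add ((abs_add_le _ _).trans (add_le_add
    h4 h2)) h3).trans (le_of_eq ?_))
  ring

end Dat

end Consistency

section Iterates

variable {E : Type*} [NormedAddCommGroup E] [NormedSpace ℝ E]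
  {κ : Type*} [Fintype κ] {ι : Type*} [Fintype ι] [Nonempty ι] {e : κ → E}

namespace Dat

/-- Iterates of the scheme. -/
def it (D : Dat e ι) (s : ℝ) (j : ℕ) (Φ : E → ℝ) : E → ℝ := (D.S s)^[j] Φ

lemma it_succ (D : Dat e ι) (s : ℝ) (j : ℕ) (Φ : E → ℝ) :
    D.it s (j + 1) Φ = D.S s (D.it s j Φ) := Function.iterate_succ_apply' _ _ _

lemma it_sm (D : Dat e ι) (s : ℝ) (j : ℕ) {Φ : E → ℝ} (h : Sm Φ) : Sm (D.it s j Φ) := by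
  induction j with
  | zero => exact h
  | succ j ih => rw [it_succ]; exact D.S_sm s ih

lemma it_sub (D : Dat e ι) (s : ℝ) (j : ℕ) (Φ Ψ : E → ℝ) :
    D.it s j (fun y => Φ y - Ψ y) = fun y => D.it s j Φ y - D.it s j Ψ y := by
  induction j with
  | zero => rfl
  | succ j ih =>
    simp only [it_succ, ih]
    funext y
    simp only [S]
    rw [← mul_sub, ← Finset.sum_sub_distrib]
    congr 1
    exact Finset.sum_congr rfl fun m _ => by ring

lemma it_words (D : Dat e ι) (T : ℝ) {Φ : E → ℝ} (h : SB e Φ) (K : ℕ) :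
    ∃ B : ℝ, 0 ≤ B ∧ ∀ s : ℝ, |s| ≤ 1 → ∀ j : ℕ, s ^ 2 * j ≤ T →
      ∀ δ : List κ, δ.length ≤ K → ∀ y, |wd e δ (D.it s j Φ) y| ≤ B := by
  obtain ⟨C, hC0, hC⟩ := D.stable K
  obtain ⟨B, hB0, hB⟩ := vK_bound K h
  refine ⟨Real.exp (C * T) * B, by positivity, fun s hs j hj δ hδ y => ?_⟩
  refine (abs_le_vK K _ y hδ).trans ?_
  have h1 : ∀ j : ℕ, ∀ y, ‖vK e K (D.it s j Φ) y‖ ≤ (1 + C * s ^ 2) ^ j * B := by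
    intro j
    induction j with
    | zero => intro y; simpa [it] using hB y
    | succ j ih =>
      rw [it_succ, pow_succ', mul_assoc]
      exact hC s hs _ (D.it_sm s j h.sm) _ ih
  refine (h1 j y).trans (mul_le_mul_of_nonneg_right ?_ hB0)
  calc (1 + C * s ^ 2) ^ j ≤ (Real.exp (C * s ^ 2)) ^ j :=
        pow_le_pow_left₀ (by positivity) (by rw [add_comm]; exact Real.add_one_le_exp _) j
    _ = Real.exp (j * (C * s ^ 2)) := (Real.exp_nat_mul _ j).symm
    _ ≤ _ := Real.exp_le_exp.2 (by nlinarith)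

lemma it_sup (D : Dat e ι) {c₀ : ℝ} (hc₀ : 0 ≤ c₀) (h0 : ∀ y, D.c y ≤ c₀) :
    ∃ s₀ > 0, ∀ s : ℝ, |s| ≤ s₀ → ∀ (Φ : E → ℝ) (B : ℝ), (∀ y, |Φ y| ≤ B) →
      ∀ j y, |D.it s j Φ y| ≤ Real.exp (c₀ * (s ^ 2 * j)) * B := by
  obtain ⟨s₀, hs₀, h⟩ := D.sup_bound h0
  refine ⟨s₀, hs₀, fun s hs Φ B hB j y => ?_⟩
  have hB0 : 0 ≤ B := (abs_nonneg _).trans (hB y)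
  have h1 : ∀ j : ℕ, ∀ y, |D.it s j Φ y| ≤ (1 + s ^ 2 * c₀) ^ j * B := by
    intro j
    induction j with
    | zero => intro y; simpa [it] using hB y
    | succ j ih =>
      rw [it_succ, pow_succ', mul_assoc]
      exact h s hs _ _ ih
  refine (h1 j y).trans (mul_le_mul_of_nonneg_right ?_ hB0)
  calc (1 + s ^ 2 * c₀) ^ j ≤ (Real.exp (s ^ 2 * c₀)) ^ j :=
        pow_le_pow_left₀ (by positivity) (by rw [add_comm]; exact Real.add_one_le_exp _) j
    _ = Real.exp (j * (s ^ 2 * c₀)) := (Real.exp_nat_mul _ j).symm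
    _ = _ := by congr 1; ring

lemma it_lip (D : Dat e ι) (T : ℝ) {Φ : E → ℝ} (h : SB e Φ) (γ : List κ) :
    ∃ C : ℝ, 0 ≤ C ∧ ∀ s : ℝ, |s| ≤ 1 → ∀ j k : ℕ, s ^ 2 * (j + k : ℕ) ≤ T →
      ∀ y, |wd e γ (D.it s (j + k) Φ) y - wd e γ (D.it s j Φ) y| ≤ C * (k * s ^ 2) := by
  obtain ⟨C, hC0, hC⟩ := D.step_lip γ
  obtain ⟨B, hB0, hB⟩ := D.it_words T h (γ.length + 2)
  refine ⟨C * B, by positivity, fun s hs j k => ?_⟩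
  induction k with
  | zero => intro _ y; simp
  | succ k ih =>
    intro hk y
    have hk' : s ^ 2 * ((j + k : ℕ) : ℝ) ≤ T := by
      refine le_trans (mul_le_mul_of_nonneg_left ?_ (sq_nonneg s)) hk
      exact_mod_cast (by omega : j + k ≤ j + (k + 1))
    have h1 := ih hk' y
    have h2 := hC s hs _ (D.it_sm s (j + k) h.sm) B (fun δ hδ y => hB s hs _ hk' δ hδ y) y
    rw [← it_succ] at h2
    have h3 := abs_sub_le (wd e γ (D.it s (j + (k + 1)) Φ) y) (wd e γ (D.it s (j + k) Φ) y)
      (wd e γ (D.it s j Φ) y)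
    refine h3.trans ((add_le_add h2 h1).trans (le_of_eq ?_))
    push_cast; ring

lemma it_eq (D : Dat e ι) (T : ℝ) {Φ : E → ℝ} (h : SB e Φ) :
    ∃ C : ℝ, 0 ≤ C ∧ ∀ s : ℝ, |s| ≤ 1 → ∀ j k : ℕ, s ^ 2 * (j + k : ℕ) ≤ T →
      ∀ y, |D.it s (j + k) Φ y - D.it s j Φ y - k * s ^ 2 * D.L (D.it s j Φ) y| ≤
        C * (k * |s| ^ 3 + (k * s ^ 2) ^ 2) := by
  obtain ⟨C1, hC10, hC1⟩ := D.consistent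
  obtain ⟨B, hB0, hB⟩ := D.it_words T h 3
  obtain ⟨C2, hC20, hC2⟩ := D.L_bound
  choose C3 hC30 hC3 using fun δ : Wd κ 2 => D.it_lip T h δ.1
  set C4 := ∑ δ, C3 δ
  have hC4 : 0 ≤ C4 := Finset.sum_nonneg fun _ _ => hC30 _
  refine ⟨C1 * B + C2 * C4, by positivity, fun s hs j k => ?_⟩
  induction k with
  | zero => intro _ y; simp
  | succ k ih =>
    intro hk y
    have hk' : s ^ 2 * ((j + k : ℕ) : ℝ) ≤ T := by
      refine le_trans (mul_le_mul_of_nonneg_left ?_ (sq_nonneg s)) hk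
      exact_mod_cast (by omega : j + k ≤ j + (k + 1))
    have h1 := ih hk' y
    have h2 := hC1 s hs _ (D.it_sm s (j + k) h.sm) B (fun δ hδ y => hB s hs _ hk' δ hδ y) y
    rw [← it_succ] at h2
    have hj := D.it_sm s j h.sm
    have hjk := D.it_sm s (j + k) h.sm
    have h3 := hC2 (fun y => D.it s (j + k) Φ y - D.it s j Φ y) y (C4 * (k * s ^ 2))
      (fun δ hδ => by
        rw [wd_sub hjk hj]
        refine (hC3 ⟨δ, hδ⟩ s hs j k hk' y).trans (mul_le_mul_of_nonneg_right ?_ (by positivity))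
        exact Finset.single_le_sum (f := C3) (fun i _ => hC30 i) (Finset.mem_univ _))
    rw [D.L_sub hjk hj] at h3
    have h4 : |s ^ 2 * (D.L (D.it s (j + k) Φ) y - D.L (D.it s j Φ) y)| ≤
        s ^ 2 * (C2 * (C4 * (k * s ^ 2))) := by
      rw [abs_mul, abs_of_nonneg (sq_nonneg s)]
      exact mul_le_mul_of_nonneg_left h3 (sq_nonneg s)
    have e1 : D.it s (j + (k + 1)) Φ y - D.it s j Φ y
        - ((k + 1 : ℕ) : ℝ) * s ^ 2 * D.L (D.it s j Φ) y =
        (D.it s (j + k + 1) Φ y - D.it s (j + k) Φ y - s ^ 2 * D.L (D.it s (j + k) Φ) y) +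
        (D.it s (j + k) Φ y - D.it s j Φ y - k * s ^ 2 * D.L (D.it s j Φ) y) +
        s ^ 2 * (D.L (D.it s (j + k) Φ) y - D.L (D.it s j Φ) y) := by
      rw [← add_assoc]; push_cast; ring
    rw [e1]
    refine (abs_add_three _ _ _).trans ((add_le_add (add_le_add h2 h1) h4).trans ?_)
    have h5 : 0 ≤ C1 * B * (s ^ 2) ^ 2 * (2 * k + 1) := by positivity
    have h6 : 0 ≤ C2 * C4 * |s| ^ 3 := by positivity
    have h7 : 0 ≤ C2 * C4 * (s ^ 2) ^ 2 * (k + 1) := by positivity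
    push_cast
    nlinarith [h5, h6, h7]

end Dat

end Iterates

section UltraWords

variable {E : Type*} [NormedAddCommGroup E] [NormedSpace ℝ E] [FiniteDimensional ℝ E]
  {κ : Type*} [Fintype κ] {e : Module.Basis κ ℝ E}

lemma abs_le_of_tendsto_hyper {a : ℕ → ℝ} {x B : ℝ} (h : Tendsto a (hyperfilter ℕ) (𝓝 x))
    (hB : ∀ n, |a n| ≤ B) : |x| ≤ B :=
  le_of_tendsto h.abs (Eventually.of_forall hB)

lemma ulim_words {f : ℕ → E → ℝ} (h : UB e f) :
    Sm (fun y => ulim fun n => f n y) ∧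
      ∀ γ, wd e γ (fun y => ulim fun n => f n y) = fun y => ulim fun n => wd e γ (f n) y := by
  have ht : ∀ γ y, Tendsto (fun n => wd e γ (f n) y) (hyperfilter ℕ)
      (𝓝 (ulim fun n => wd e γ (f n) y)) := fun γ y => by
    obtain ⟨C, hC⟩ := h.bd γ
    exact tendsto_ulim fun n => hC n y
  have := closed_family e (V := fun γ y => ulim fun n => wd e γ (f n) y) fun γ y => by
    choose C hC using fun i j : κ => h.bd (i :: j :: γ)
    refine hasFDerivAt_of_quadratic e (B := ∑ i, ∑ j, |C i j|) fun w => ?_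
    refine abs_le_of_tendsto_hyper (((ht γ _).sub (ht γ y)).sub
      (tendsto_finsetSum _ fun j _ => (ht (j :: γ) y).const_mul (w j))) fun n => ?_
    refine taylor_two_word e ((h.sm n).wd e γ) y w fun i j y => ?_
    rw [← wd_append]
    refine (hC i j n y).trans ((le_abs_self _).trans ?_)
    refine (Finset.single_le_sum (f := fun j => |C i j|) (fun _ _ => abs_nonneg _)
      (Finset.mem_univ j)).trans ?_
    exact Finset.single_le_sum (f := fun i => ∑ j, |C i j|)
      (fun _ _ => Finset.sum_nonneg fun _ _ => abs_nonneg _) (Finset.mem_univ i)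
  exact ⟨this.1 [], this.2⟩

lemma ulim_words_tendsto {f : ℕ → E → ℝ} (h : UB e f) (γ : List κ) (y : E) :
    Tendsto (fun n => wd e γ (f n) y) (hyperfilter ℕ)
      (𝓝 (wd e γ (fun y => ulim fun n => f n y) y)) := by
  rw [(ulim_words h).2 γ]
  obtain ⟨C, hC⟩ := h.bd γ
  exact tendsto_ulim fun n => hC n y

end UltraWords

lemma intervalIntegrable_sum {κ : Type*} {s : Finset κ} {f : κ → ℝ → ℝ} {a b : ℝ}
    (h : ∀ i ∈ s, IntervalIntegrable (f i) volume a b) :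
    IntervalIntegrable (fun σ => ∑ i ∈ s, f i σ) volume a b :=
  ⟨integrable_finsetSum s fun i hi => (h i hi).1, integrable_finsetSum s fun i hi => (h i hi).2⟩

section TimeFamilies

variable {E : Type*} [NormedAddCommGroup E] [NormedSpace ℝ E] [FiniteDimensional ℝ E]
  {κ : Type*} [Fintype κ] {e : Module.Basis κ ℝ E}

/-- Families of smooth functions, uniformly bounded and Lipschitz in time together with all
their derivatives. -/
structure TF (e : κ → E) (T : ℝ) (u : ℝ → E → ℝ) : Prop where
  ub : UB e (fun τ : Icc (0 : ℝ) T => u τ)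
  lip : ∀ γ, ∃ C : ℝ, 0 ≤ C ∧ ∀ τ ∈ Icc (0 : ℝ) T, ∀ τ' ∈ Icc (0 : ℝ) T, ∀ y,
    |wd e γ (u τ) y - wd e γ (u τ') y| ≤ C * |τ - τ'|

lemma TF.sm {T : ℝ} {u : ℝ → E → ℝ} (h : TF e T u) {τ : ℝ} (hτ : τ ∈ Icc (0 : ℝ) T) : Sm (u τ) :=
  h.ub.sm ⟨τ, hτ⟩

lemma TF.bd {T : ℝ} {u : ℝ → E → ℝ} (h : TF e T u) (γ : List κ) :
    ∃ C : ℝ, ∀ τ ∈ Icc (0 : ℝ) T, ∀ y, |wd e γ (u τ) y| ≤ C := by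
  obtain ⟨C, hC⟩ := h.ub.bd γ
  exact ⟨C, fun τ hτ y => hC ⟨τ, hτ⟩ y⟩

lemma TF.continuousOn {T : ℝ} {u : ℝ → E → ℝ} (h : TF e T u) (γ : List κ) (y : E) :
    ContinuousOn (fun τ => wd e γ (u τ) y) (Icc 0 T) := by
  obtain ⟨C, hC0, hC⟩ := h.lip γ
  refine (LipschitzOnWith.of_dist_le_mul (K := ⟨C, hC0⟩) fun τ hτ τ' hτ' => ?_).continuousOn
  rw [Real.dist_eq, Real.dist_eq]
  exact hC τ hτ τ' hτ' y

lemma TF.intervalIntegrable {T : ℝ} {u : ℝ → E → ℝ} (h : TF e T u) (γ : List κ) (y : E)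
    {a b : ℝ} (ha : a ∈ Icc 0 T) (hb : b ∈ Icc 0 T) :
    IntervalIntegrable (fun τ => wd e γ (u τ) y) volume a b :=
  ((h.continuousOn γ y).mono (uIcc_subset_Icc ha hb)).intervalIntegrable

lemma integral_words {T : ℝ} {u : ℝ → E → ℝ} (h : TF e T u) {a b : ℝ} (ha : a ∈ Icc 0 T)
    (hb : b ∈ Icc 0 T) :
    Sm (fun y => ∫ σ in a..b, u σ y) ∧
      ∀ γ, wd e γ (fun y => ∫ σ in a..b, u σ y) = fun y => ∫ σ in a..b, wd e γ (u σ) y := by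
  have hab : uIoc a b ⊆ Icc 0 T := uIoc_subset_uIcc.trans (uIcc_subset_Icc ha hb)
  have := closed_family e (V := fun γ y => ∫ σ in a..b, wd e γ (u σ) y) fun γ y => by
    choose C hC using fun i j : κ => h.bd (i :: j :: γ)
    refine hasFDerivAt_of_quadratic e (B := (∑ i, ∑ j, |C i j|) * |b - a|) fun w => ?_
    have h1 := h.intervalIntegrable γ (y + ∑ j, w j • e j) ha hb
    have h2 := h.intervalIntegrable γ y ha hb
    have h3 := fun j => (h.intervalIntegrable (j :: γ) y ha hb).const_mul (w j)
    have h4 : (∫ σ in a..b, wd e γ (u σ) (y + ∑ j, w j • e j)) - (∫ σ in a..b, wd e γ (u σ) y) -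
        ∑ j, w j * ∫ σ in a..b, wd e (j :: γ) (u σ) y =
        ∫ σ in a..b, (wd e γ (u σ) (y + ∑ j, w j • e j) - wd e γ (u σ) y -
          ∑ j, w j * wd e (j :: γ) (u σ) y) := by
      rw [intervalIntegral.integral_sub (h1.sub h2) (intervalIntegrable_sum fun j _ => h3 j),
        intervalIntegral.integral_sub h1 h2, intervalIntegral.integral_finsetSum fun j _ => h3 j]
      simp only [intervalIntegral.integral_const_mul]
    rw [h4, ← Real.norm_eq_abs, ← mul_assoc]
    refine intervalIntegral.norm_integral_le_of_norm_le_const fun σ hσ => ?_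
    rw [Real.norm_eq_abs]
    refine taylor_two_word e ((h.sm (hab hσ)).wd e γ) y w fun i j y => ?_
    rw [← wd_append]
    refine (hC i j σ (hab hσ) y).trans ((le_abs_self _).trans ?_)
    refine (Finset.single_le_sum (f := fun j => |C i j|) (fun _ _ => abs_nonneg _)
      (Finset.mem_univ j)).trans ?_
    exact Finset.single_le_sum (f := fun i => ∑ j, |C i j|)
      (fun _ _ => Finset.sum_nonneg fun _ _ => abs_nonneg _) (Finset.mem_univ i)
  exact ⟨this.1 [], this.2⟩

lemma TF.integral {T : ℝ} {u : ℝ → E → ℝ} (h : TF e T u) :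
    TF e T (fun r y => ∫ σ in (0 : ℝ)..r, u σ y) := by
  rcases lt_or_ge T 0 with hT | hT
  · have : Icc (0 : ℝ) T = ∅ := Icc_eq_empty (not_le.2 hT)
    refine ⟨⟨fun p => absurd p.2 (by simp [this]), fun γ => ⟨0, fun p => absurd p.2 (by simp [this])⟩⟩,
      fun γ => ⟨0, le_rfl, fun τ hτ => absurd hτ (by simp [this])⟩⟩
  have h0 : (0 : ℝ) ∈ Icc 0 T := ⟨le_rfl, hT⟩
  have hl : ∀ γ, ∃ C : ℝ, 0 ≤ C ∧ ∀ τ ∈ Icc (0 : ℝ) T, ∀ τ' ∈ Icc (0 : ℝ) T, ∀ y,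
      |wd e γ (fun y => ∫ σ in (0 : ℝ)..τ, u σ y) y - wd e γ (fun y => ∫ σ in (0 : ℝ)..τ', u σ y) y|
        ≤ C * |τ - τ'| := fun γ => by
    obtain ⟨C, hC⟩ := h.bd γ
    refine ⟨|C|, abs_nonneg _, fun τ hτ τ' hτ' y => ?_⟩
    rw [(integral_words h h0 hτ).2, (integral_words h h0 hτ').2,
      intervalIntegral.integral_interval_sub_left (h.intervalIntegrable γ y h0 hτ)
        (h.intervalIntegrable γ y h0 hτ')]
    rw [← Real.norm_eq_abs]
    refine intervalIntegral.norm_integral_le_of_norm_le_const fun σ hσ => ?_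
    rw [Real.norm_eq_abs]
    exact (hC σ (uIcc_subset_Icc hτ' hτ (uIoc_subset_uIcc hσ)) y).trans (le_abs_self _)
  refine ⟨⟨fun p => (integral_words h h0 p.2).1, fun γ => ?_⟩, hl⟩
  obtain ⟨C, hC0, hC⟩ := hl γ
  refine ⟨C * T, fun p y => ?_⟩
  have := hC p p.2 0 h0 y
  simp only [intervalIntegral.integral_same, wd_zero, sub_zero] at this
  refine this.trans (mul_le_mul_of_nonneg_left ?_ hC0)
  rw [abs_of_nonneg p.2.1]; exact p.2.2

variable {ι : Type*} [Fintype ι]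

lemma Dat.L_const_mul (D : Dat e ι) {Φ : E → ℝ} (hΦ : Sm Φ) (r : ℝ) (y : E) :
    D.L (fun y => r * Φ y) y = r * D.L Φ y := by
  unfold Dat.L
  simp only [wd_const_mul hΦ, mul_add, Finset.mul_sum]
  congr 1
  · congr 1
    · refine Finset.sum_congr rfl fun m _ => Finset.sum_congr rfl fun i _ =>
        Finset.sum_congr rfl fun j _ => by ring
    · exact Finset.sum_congr rfl fun j _ => by ring
  · ring

lemma TF.L {T : ℝ} {u : ℝ → E → ℝ} (h : TF e T u) (D : Dat e ι) : TF e T (fun τ => D.L (u τ)) := by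
  refine ⟨D.L_ub h.ub, fun γ => ?_⟩
  have h1 : UB e (fun (p : Icc (0 : ℝ) T × Icc (0 : ℝ) T) y =>
      (p.1.1 - p.2.1)⁻¹ * (u p.1 y - u p.2 y)) := by
    refine ⟨fun p => (sm_const _).mul ((h.sm p.1.2).sub (h.sm p.2.2)), fun γ => ?_⟩
    obtain ⟨C, hC0, hC⟩ := h.lip γ
    refine ⟨C, fun p y => ?_⟩
    rw [wd_const_mul ((h.sm p.1.2).sub (h.sm p.2.2)), wd_sub (h.sm p.1.2) (h.sm p.2.2), abs_mul,
      abs_inv, mul_comm, ← div_eq_mul_inv]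
    exact div_le_of_le_mul₀ (abs_nonneg _) hC0 (hC _ p.1.2 _ p.2.2 y)
  obtain ⟨C, hC⟩ := (D.L_ub h1).bd γ
  refine ⟨|C|, abs_nonneg _, fun τ hτ τ' hτ' y => ?_⟩
  rcases eq_or_ne τ τ' with rfl | hne
  · simp
  have h2 := hC (⟨τ, hτ⟩, ⟨τ', hτ'⟩) y
  have h3 : D.L (fun y => (τ - τ')⁻¹ * (u τ y - u τ' y)) =
      fun y => (τ - τ')⁻¹ * (D.L (u τ) y - D.L (u τ') y) := by
    funext y
    rw [D.L_const_mul ((h.sm hτ).sub (h.sm hτ')), D.L_sub (h.sm hτ) (h.sm hτ')]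
  simp only at h2
  rw [h3, wd_const_mul ((D.L_sm (h.sm hτ)).sub (D.L_sm (h.sm hτ'))),
    wd_sub (D.L_sm (h.sm hτ)) (D.L_sm (h.sm hτ')), abs_mul, abs_inv, inv_mul_le_iff₀
      (abs_pos.2 (sub_ne_zero.2 hne)), mul_comm] at h2
  exact h2.trans (mul_le_mul_of_nonneg_right (le_abs_self _) (abs_nonneg _))

lemma Dat.L_integral (D : Dat e ι) {T : ℝ} {u : ℝ → E → ℝ} (h : TF e T u) {r : ℝ}
    (hr : r ∈ Icc 0 T) (y : E) :
    D.L (fun y => ∫ σ in (0 : ℝ)..r, u σ y) y = ∫ σ in (0 : ℝ)..r, D.L (u σ) y := by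
  have h0 : (0 : ℝ) ∈ Icc 0 T := ⟨le_rfl, hr.1.trans hr.2⟩
  have hi := fun γ => h.intervalIntegrable γ y h0 hr
  have hi2 : ∀ m i, IntervalIntegrable (fun σ => ∑ j, D.σ m j y * wd e [i, j] (u σ) y)
      volume 0 r := fun m i => by
    exact intervalIntegrable_sum fun j _ => (hi [i, j]).const_mul (D.σ m j y)
  have hi3 : ∀ m, IntervalIntegrable (fun σ => ∑ i, D.σ m i y * ∑ j, D.σ m j y * wd e [i, j] (u σ) y)
      volume 0 r := fun m => by
    exact intervalIntegrable_sum fun i _ => (hi2 m i).const_mul (D.σ m i y)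
  have hi4 : IntervalIntegrable (fun σ => ∑ m, ∑ i, D.σ m i y * ∑ j, D.σ m j y *
      wd e [i, j] (u σ) y) volume 0 r := by
    exact intervalIntegrable_sum fun m _ => hi3 m
  have hi5 : IntervalIntegrable (fun σ => ∑ j, D.β j y * wd e [j] (u σ) y) volume 0 r := by
    exact intervalIntegrable_sum fun j _ => (hi [j]).const_mul (D.β j y)
  have hi0 : IntervalIntegrable (fun σ => u σ y) volume 0 r := hi []
  unfold Dat.L
  simp only [(integral_words h h0 hr).2]
  rw [intervalIntegral.integral_add ((hi4.const_mul _).add hi5) (hi0.const_mul _),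
    intervalIntegral.integral_add (hi4.const_mul _) hi5]
  simp only [intervalIntegral.integral_const_mul]
  rw [intervalIntegral.integral_finsetSum fun m _ => hi3 m,
    intervalIntegral.integral_finsetSum fun j _ => (hi [j]).const_mul _]
  simp only [intervalIntegral.integral_const_mul]
  congr 3
  refine Finset.sum_congr rfl fun m _ => ?_
  rw [intervalIntegral.integral_finsetSum fun i _ => (hi2 m i).const_mul _]
  refine Finset.sum_congr rfl fun i _ => ?_
  rw [intervalIntegral.integral_const_mul,
    intervalIntegral.integral_finsetSum fun j _ => (hi [i, j]).const_mul _]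
  simp only [intervalIntegral.integral_const_mul]

/-- `V` is the time derivative of `U`, in integrated form. -/
structure Evo (e : κ → E) (T : ℝ) (U V : ℝ → E → ℝ) : Prop where
  tU : TF e T U
  tV : TF e T V
  eq : ∀ y, ∀ τ ∈ Icc (0 : ℝ) T, ∀ τ' ∈ Icc (0 : ℝ) T, U τ' y - U τ y = ∫ σ in τ..τ', V σ y

lemma Evo.eq_words {T : ℝ} {U V : ℝ → E → ℝ} (h : Evo e T U V) (γ : List κ) {τ τ' : ℝ}
    (hτ : τ ∈ Icc (0 : ℝ) T) (hτ' : τ' ∈ Icc (0 : ℝ) T) (y : E) :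
    wd e γ (U τ') y - wd e γ (U τ) y = ∫ σ in τ..τ', wd e γ (V σ) y := by
  have h1 : (fun y => U τ' y - U τ y) = fun y => ∫ σ in τ..τ', V σ y :=
    funext fun y => h.eq y τ hτ τ' hτ'
  have h2 := congrArg (fun f => wd e γ f y) h1
  simp only [(integral_words h.tV hτ hτ').2, wd_sub (h.tU.sm hτ') (h.tU.sm hτ)] at h2
  exact h2

lemma Evo.quad {T : ℝ} {U V : ℝ → E → ℝ} (h : Evo e T U V) (γ : List κ) :
    ∃ C : ℝ, 0 ≤ C ∧ ∀ τ ∈ Icc (0 : ℝ) T, ∀ τ' ∈ Icc (0 : ℝ) T, ∀ y,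
      |wd e γ (U τ') y - wd e γ (U τ) y - (τ' - τ) * wd e γ (V τ) y| ≤ C * (τ' - τ) ^ 2 := by
  obtain ⟨C, hC0, hC⟩ := h.tV.lip γ
  refine ⟨C, hC0, fun τ hτ τ' hτ' y => ?_⟩
  have h1 : (τ' - τ) * wd e γ (V τ) y = ∫ σ in τ..τ', wd e γ (V τ) y := by
    rw [intervalIntegral.integral_const, smul_eq_mul]
  rw [h.eq_words γ hτ hτ', h1, ← intervalIntegral.integral_sub
    (h.tV.intervalIntegrable γ y hτ hτ') (by simp), ← Real.norm_eq_abs]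
  refine (intervalIntegral.norm_integral_le_of_norm_le_const (C := C * |τ' - τ|)
    fun σ hσ => ?_).trans (le_of_eq ?_)
  · rw [Real.norm_eq_abs]
    refine (hC σ (uIcc_subset_Icc hτ hτ' (uIoc_subset_uIcc hσ)) τ hτ y).trans
      (mul_le_mul_of_nonneg_left ?_ hC0)
    exact abs_sub_left_of_mem_uIcc (uIoc_subset_uIcc hσ)
  · rw [mul_assoc, ← sq, sq_abs]

end TimeFamilies

section Semigroup

/-- Step sizes. -/
def sN (n : ℕ) : ℝ := ((n : ℝ) + 1)⁻¹

/-- Number of steps. -/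
def jN (n : ℕ) (τ : ℝ) : ℕ := ⌊τ * ((n : ℝ) + 1) ^ 2⌋₊

lemma sN_pos (n : ℕ) : 0 < sN n := by unfold sN; positivity

lemma sN_le (n : ℕ) : |sN n| ≤ 1 := by
  rw [abs_of_pos (sN_pos n), sN]
  exact inv_le_one_of_one_le₀ (by linarith [(Nat.cast_nonneg n : (0 : ℝ) ≤ n)])

lemma sN_tendsto : Tendsto sN atTop (𝓝 0) := by
  have := tendsto_one_div_add_atTop_nhds_zero_nat (𝕜 := ℝ)
  simp only [one_div] at this
  exact this

lemma sN_jN_le (n : ℕ) {τ : ℝ} (h : 0 ≤ τ) : sN n ^ 2 * jN n τ ≤ τ := by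
  have h1 : (jN n τ : ℝ) ≤ τ * ((n : ℝ) + 1) ^ 2 := Nat.floor_le (by positivity)
  refine (mul_le_mul_of_nonneg_left h1 (sq_nonneg _)).trans (le_of_eq ?_)
  have : (n : ℝ) + 1 ≠ 0 := by positivity
  unfold sN; field_simp

lemma jN_mono (n : ℕ) {τ τ' : ℝ} (h : τ ≤ τ') : jN n τ ≤ jN n τ' :=
  Nat.floor_mono (mul_le_mul_of_nonneg_right h (by positivity))

lemma sN_jN_tendsto {τ : ℝ} (h : 0 ≤ τ) :
    Tendsto (fun n => sN n ^ 2 * jN n τ) atTop (𝓝 τ) := by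
  have h1 : Tendsto (fun n : ℕ => ((n : ℝ) + 1) ^ 2) atTop atTop :=
    (tendsto_pow_atTop two_ne_zero).comp
      (tendsto_atTop_add_const_right _ _ tendsto_natCast_atTop_atTop)
  refine ((tendsto_nat_floor_mul_div_atTop h).comp h1).congr fun n => ?_
  simp only [Function.comp, sN, jN]
  rw [div_eq_inv_mul, inv_pow]

variable {E : Type*} [NormedAddCommGroup E] [NormedSpace ℝ E] [FiniteDimensional ℝ E]
  {κ : Type*} [Fintype κ] {ι : Type*} [Fintype ι] [Nonempty ι] {e : Module.Basis κ ℝ E}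

namespace Dat

/-- The semigroup generated by `L`. -/
def P (D : Dat e ι) (Φ : E → ℝ) (τ : ℝ) (y : E) : ℝ := ulim fun n => D.it (sN n) (jN n τ) Φ y

lemma it_ub (D : Dat e ι) {Φ : E → ℝ} (h : SB e Φ) (T : ℝ) :
    UB e (fun p : ℕ × Icc (0 : ℝ) T => D.it (sN p.1) (jN p.1 p.2) Φ) := by
  refine ⟨fun p => D.it_sm _ _ h.sm, fun γ => ?_⟩
  obtain ⟨B, hB0, hB⟩ := D.it_words T h γ.length
  exact ⟨B, fun p y => hB _ (sN_le _) _ ((sN_jN_le _ p.2.2.1).trans p.2.2.2) γ le_rfl y⟩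

lemma P_tendsto (D : Dat e ι) {Φ : E → ℝ} (h : SB e Φ) {τ : ℝ} (hτ : 0 ≤ τ) (γ : List κ) (y : E) :
    Tendsto (fun n => wd e γ (D.it (sN n) (jN n τ) Φ) y) (hyperfilter ℕ)
      (𝓝 (wd e γ (D.P Φ τ) y)) :=
  ulim_words_tendsto ((D.it_ub h τ).comap fun n => (n, ⟨τ, hτ, le_rfl⟩)) γ y

lemma P_sm (D : Dat e ι) {Φ : E → ℝ} (h : SB e Φ) {τ : ℝ} (hτ : 0 ≤ τ) : Sm (D.P Φ τ) :=
  (ulim_words ((D.it_ub h τ).comap fun n => (n, ⟨τ, hτ, le_rfl⟩))).1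

lemma P_zero (D : Dat e ι) {Φ : E → ℝ} (h : SB e Φ) : D.P Φ 0 = Φ := by
  funext y
  have h1 := D.P_tendsto h le_rfl [] y
  refine tendsto_nhds_unique h1 ?_
  simp [jN, it]

lemma P_sub (D : Dat e ι) {Φ Ψ : E → ℝ} (h : SB e Φ) (h' : SB e Ψ) {τ : ℝ} (hτ : 0 ≤ τ) (y : E) :
    D.P (fun y => Φ y - Ψ y) τ y = D.P Φ τ y - D.P Ψ τ y := by
  refine tendsto_nhds_unique (D.P_tendsto (h.sub h') hτ [] y) ?_
  simp only [it_sub]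
  exact (D.P_tendsto h hτ [] y).sub (D.P_tendsto h' hτ [] y)

lemma P_sup (D : Dat e ι) {c₀ : ℝ} (hc₀ : 0 ≤ c₀) (h0 : ∀ y, D.c y ≤ c₀) {Φ : E → ℝ} (h : SB e Φ)
    {B : ℝ} (hB : ∀ y, |Φ y| ≤ B) {τ : ℝ} (hτ : 0 ≤ τ) (y : E) :
    |D.P Φ τ y| ≤ Real.exp (c₀ * τ) * B := by
  obtain ⟨s₀, hs₀, hs⟩ := D.it_sup hc₀ h0
  have hB0 : 0 ≤ B := (abs_nonneg _).trans (hB y)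
  refine le_of_tendsto (D.P_tendsto h hτ [] y).abs ?_
  have h1 : ∀ᶠ n in atTop, |sN n| ≤ s₀ := by
    have := sN_tendsto.abs
    rw [abs_zero] at this
    exact this.eventually_le_const hs₀
  have h2 : ∀ᶠ n in (hyperfilter ℕ : Filter ℕ), |sN n| ≤ s₀ := Nat.hyperfilter_le_atTop h1
  filter_upwards [h2] with n hn
  refine (hs _ hn Φ B hB _ y).trans (mul_le_mul_of_nonneg_right (Real.exp_le_exp.2 ?_) hB0)
  exact mul_le_mul_of_nonneg_left (sN_jN_le n hτ) hc₀

lemma P_tf (D : Dat e ι) {Φ : E → ℝ} (h : SB e Φ) (T : ℝ) : TF e T (D.P Φ) := by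
  refine ⟨⟨fun p => D.P_sm h p.2.1, fun γ => ?_⟩, fun γ => ?_⟩
  · obtain ⟨C, hC⟩ := (D.it_ub h T).bd γ
    exact ⟨C, fun p y => abs_le_of_tendsto_hyper (D.P_tendsto h p.2.1 γ y) fun n => hC (n, p) y⟩
  · obtain ⟨C, hC0, hC⟩ := D.it_lip T h γ
    have key : ∀ τ τ' : ℝ, 0 ≤ τ → τ ≤ τ' → τ' ≤ T → ∀ y,
        |wd e γ (D.P Φ τ') y - wd e γ (D.P Φ τ) y| ≤ C * (τ' - τ) := by
      intro τ τ' h0 h1 h2 y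
      have hl := ((D.P_tendsto h (h0.trans h1) γ y).sub (D.P_tendsto h h0 γ y)).abs
      have hr : Tendsto (fun n => C * (sN n ^ 2 * jN n τ' - sN n ^ 2 * jN n τ)) (hyperfilter ℕ)
          (𝓝 (C * (τ' - τ))) :=
        (((sN_jN_tendsto (h0.trans h1)).sub (sN_jN_tendsto h0)).const_mul C).mono_left
          Nat.hyperfilter_le_atTop
      refine le_of_tendsto_of_tendsto hl hr (Eventually.of_forall fun n => ?_)
      obtain ⟨k, hk⟩ := Nat.exists_eq_add_of_le (jN_mono n h1)
      have := hC (sN n) (sN_le n) (jN n τ) k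
        (by rw [← hk]; exact (sN_jN_le n (h0.trans h1)).trans h2) y
      rw [← hk] at this
      refine this.trans (le_of_eq ?_)
      simp only [hk]; push_cast; ring
    refine ⟨C, hC0, fun τ hτ τ' hτ' y => ?_⟩
    rcases le_total τ τ' with hle | hle
    · rw [abs_sub_comm, abs_sub_comm τ, abs_of_nonneg (sub_nonneg.2 hle)]
      exact key τ τ' hτ.1 hle hτ'.2 y
    · rw [abs_of_nonneg (sub_nonneg.2 hle)]
      exact key τ' τ hτ'.1 hle hτ.2 y

lemma P_step (D : Dat e ι) {Φ : E → ℝ} (h : SB e Φ) (T : ℝ) :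
    ∃ C : ℝ, 0 ≤ C ∧ ∀ τ τ' : ℝ, 0 ≤ τ → τ ≤ τ' → τ' ≤ T → ∀ y,
      |D.P Φ τ' y - D.P Φ τ y - (τ' - τ) * D.L (D.P Φ τ) y| ≤ C * (τ' - τ) ^ 2 := by
  obtain ⟨C, hC0, hC⟩ := D.it_eq T h
  refine ⟨C, hC0, fun τ τ' h0 h1 h2 y => ?_⟩
  have hL : Tendsto (fun n => D.L (D.it (sN n) (jN n τ) Φ) y) (hyperfilter ℕ)
      (𝓝 (D.L (D.P Φ τ) y)) := by
    unfold L
    exact (((tendsto_finsetSum _ fun m _ => tendsto_finsetSum _ fun i _ =>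
      (tendsto_finsetSum _ fun j _ => (D.P_tendsto h h0 [i, j] y).const_mul _).const_mul
      _).const_mul _).add (tendsto_finsetSum _ fun j _ =>
      (D.P_tendsto h h0 [j] y).const_mul _)).add ((D.P_tendsto h h0 [] y).const_mul _)
  have hd : Tendsto (fun n => sN n ^ 2 * jN n τ' - sN n ^ 2 * jN n τ) (hyperfilter ℕ)
      (𝓝 (τ' - τ)) :=
    ((sN_jN_tendsto (h0.trans h1)).sub (sN_jN_tendsto h0)).mono_left Nat.hyperfilter_le_atTop
  have hs : Tendsto sN (hyperfilter ℕ) (𝓝 0) := sN_tendsto.mono_left Nat.hyperfilter_le_atTop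
  have hl := (((D.P_tendsto h (h0.trans h1) [] y).sub (D.P_tendsto h h0 [] y)).sub
    (hd.mul hL)).abs
  have hr := (((hd.mul hs).add (hd.pow 2)).const_mul C)
  rw [mul_zero, zero_add] at hr
  refine le_of_tendsto_of_tendsto hl hr (Eventually.of_forall fun n => ?_)
  obtain ⟨k, hk⟩ := Nat.exists_eq_add_of_le (jN_mono n h1)
  have := hC (sN n) (sN_le n) (jN n τ) k
    (by rw [← hk]; exact (sN_jN_le n (h0.trans h1)).trans h2) y
  rw [← hk] at this
  have e1 : sN n ^ 2 * jN n τ' - sN n ^ 2 * jN n τ = k * sN n ^ 2 := by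
    rw [hk]; push_cast; ring
  simp only [e1, wd_nil]
  refine this.trans (le_of_eq ?_)
  rw [abs_of_pos (sN_pos n)]; ring

lemma P_evo (D : Dat e ι) {Φ : E → ℝ} (h : SB e Φ) (T : ℝ) :
    Evo e T (D.P Φ) (fun τ => D.L (D.P Φ τ)) := by
  have tU := D.P_tf h T
  have tV := tU.L D
  refine ⟨tU, tV, fun y => ?_⟩
  obtain ⟨C, hC0, hC⟩ := D.P_step h T
  obtain ⟨C', hC'0, hC'⟩ := tV.lip []
  have hq : ∀ τ ∈ Icc (0 : ℝ) T, ∀ τ' ∈ Icc (0 : ℝ) T,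
      |D.P Φ τ' y - D.P Φ τ y - (τ' - τ) * D.L (D.P Φ τ) y| ≤ (C + C') * (τ' - τ) ^ 2 := by
    intro τ hτ τ' hτ'
    rcases le_total τ τ' with hle | hle
    · refine (hC τ τ' hτ.1 hle hτ'.2 y).trans ?_
      nlinarith [sq_nonneg (τ' - τ)]
    · have h1 := hC τ' τ hτ'.1 hle hτ.2 y
      have h2 := hC' τ hτ τ' hτ' y
      simp only [wd_nil] at h2
      have e1 : D.P Φ τ' y - D.P Φ τ y - (τ' - τ) * D.L (D.P Φ τ) y =
        -(D.P Φ τ y - D.P Φ τ' y - (τ - τ') * D.L (D.P Φ τ') y) +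
          (τ - τ') * (D.L (D.P Φ τ) y - D.L (D.P Φ τ') y) := by ring
      rw [e1]
      refine (abs_add_le _ _).trans ?_
      rw [abs_neg, abs_mul]
      have h3 := mul_le_mul_of_nonneg_left h2 (abs_nonneg (τ - τ'))
      have h4 : |τ - τ'| * (C' * |τ - τ'|) = C' * (τ' - τ) ^ 2 := by
        rw [← sq_abs (τ' - τ), abs_sub_comm τ']; ring
      have h5 : (τ - τ') ^ 2 = (τ' - τ) ^ 2 := by ring
      rw [h5] at h1
      linarith
  have hd : ∀ τ ∈ Ioo (0 : ℝ) T, HasDerivAt (fun τ => D.P Φ τ y) (D.L (D.P Φ τ) y) τ := by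
    intro τ hτ
    rw [hasDerivAt_iff_isLittleO]
    have hn : ∀ᶠ τ' in 𝓝 τ, τ' ∈ Icc (0 : ℝ) T := Icc_mem_nhds hτ.1 hτ.2
    have h1 : (fun τ' => D.P Φ τ' y - D.P Φ τ y - (τ' - τ) • D.L (D.P Φ τ) y) =O[𝓝 τ]
        fun τ' => (τ' - τ) ^ 2 := by
      refine Asymptotics.IsBigO.of_bound (C + C') ?_
      filter_upwards [hn] with τ' hτ'
      have := hq τ ⟨hτ.1.le, hτ.2.le⟩ τ' hτ'
      rwa [Real.norm_eq_abs, Real.norm_eq_abs, abs_of_nonneg (sq_nonneg (τ' - τ)), smul_eq_mul]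
    refine h1.trans_isLittleO ?_
    have h2 : Tendsto (fun τ' => τ' - τ) (𝓝 τ) (𝓝 0) := by
      have := (continuous_sub_right τ).tendsto τ
      simpa using this
    exact (Asymptotics.isLittleO_pow_id (𝕜 := ℝ) one_lt_two).comp_tendsto h2
  have key : ∀ τ τ' : ℝ, 0 ≤ τ → τ ≤ τ' → τ' ≤ T →
      D.P Φ τ' y - D.P Φ τ y = ∫ σ in τ..τ', D.L (D.P Φ σ) y := by
    intro τ τ' h0 h1 h2
    refine (intervalIntegral.integral_eq_sub_of_hasDerivAt_of_le (f := fun τ => D.P Φ τ y)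
      (f' := fun τ => D.L (D.P Φ τ) y) h1 ?_ ?_ ?_).symm
    · exact (tU.continuousOn [] y).mono (Icc_subset_Icc h0 h2)
    · exact fun x hx => hd x ⟨h0.trans_lt hx.1, hx.2.trans_le h2⟩
    · exact tV.intervalIntegrable [] y ⟨h0, h1.trans h2⟩ ⟨h0.trans h1, h2⟩
  intro τ hτ τ' hτ'
  rcases le_total τ τ' with hle | hle
  · exact key τ τ' hτ.1 hle hτ'.2
  · rw [intervalIntegral.integral_symm, ← key τ' τ hτ'.1 hle hτ.2]; ring

/-- The Duhamel term. -/
def J (D : Dat e ι) (g : E → ℝ) (r : ℝ) (y : E) : ℝ := ∫ σ in (0 : ℝ)..r, D.P g σ y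

lemma J_evo (D : Dat e ι) {g : E → ℝ} (h : SB e g) (T : ℝ) : Evo e T (D.J g) (D.P g) := by
  refine ⟨(D.P_tf h T).integral, D.P_tf h T, fun y τ hτ τ' hτ' => ?_⟩
  have h0 : (0 : ℝ) ∈ Icc 0 T := ⟨le_rfl, hτ.1.trans hτ.2⟩
  exact intervalIntegral.integral_interval_sub_left
    ((D.P_tf h T).intervalIntegrable [] y h0 hτ') ((D.P_tf h T).intervalIntegrable [] y h0 hτ)

lemma J_eq (D : Dat e ι) {g : E → ℝ} (h : SB e g) {r : ℝ} (hr : 0 ≤ r) (y : E) :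
    D.P g r y = D.L (D.J g r) y + g y := by
  have h1 := D.L_integral (D.P_tf h r) (r := r) ⟨hr, le_rfl⟩ y
  have h2 := (D.P_evo h r).eq y 0 ⟨le_rfl, hr⟩ r ⟨hr, le_rfl⟩
  rw [D.P_zero h, ← h1] at h2
  unfold J
  linarith

end Dat

end Semigroup

section Cholesky

variable {E : Type*} [NormedAddCommGroup E] [NormedSpace ℝ E]
  {κ : Type*} [Fintype κ] {e : κ → E}

lemma bd_mul {n : ℕ} {f g : E → ℝ} (hf : Sm f) (hg : Sm g)
    (bf : ∀ γ : List κ, γ.length ≤ n → ∃ C : ℝ, ∀ y, |wd e γ f y| ≤ C)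
    (bg : ∀ γ : List κ, γ.length ≤ n → ∃ C : ℝ, ∀ y, |wd e γ g y| ≤ C) :
    ∀ γ : List κ, γ.length ≤ n → ∃ C : ℝ, ∀ y, |wd e γ (fun y => f y * g y) y| ≤ C := by
  intro γ
  induction γ using List.reverseRecOn generalizing f g n with
  | nil =>
    intro _
    obtain ⟨C, hC⟩ := bf [] (by simp)
    obtain ⟨D, hD⟩ := bg [] (by simp)
    refine ⟨C * D, fun y => ?_⟩
    simp only [wd_nil, abs_mul]
    exact mul_le_mul (hC y) (hD y) (abs_nonneg _) ((abs_nonneg _).trans (hC y))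
  | append_singleton γ i ih =>
    intro hn
    simp only [List.length_append, List.length_singleton] at hn
    obtain ⟨n, rfl⟩ : ∃ m, n = m + 1 := ⟨n - 1, by omega⟩
    have h1 := ih (n := n) (hf.dd (e i)) hg (fun γ hγ => by
      obtain ⟨C, hC⟩ := bf (γ ++ [i]) (by simpa using hγ)
      exact ⟨C, fun y => by have := hC y; rwa [wd_append] at this⟩)
      (fun γ hγ => bg γ (by omega)) (by omega)
    have h2 := ih (n := n) hf (hg.dd (e i)) (fun γ hγ => bf γ (by omega)) (fun γ hγ => by
      obtain ⟨C, hC⟩ := bg (γ ++ [i]) (by simpa using hγ)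
      exact ⟨C, fun y => by have := hC y; rwa [wd_append] at this⟩) (by omega)
    obtain ⟨C, hC⟩ := h1
    obtain ⟨D, hD⟩ := h2
    refine ⟨C + D, fun y => ?_⟩
    rw [wd_append, wd_cons, wd_nil, dd_mul hf hg,
      wd_add ((hf.dd _).mul hg) (hf.mul (hg.dd _))]
    exact (abs_add_le _ _).trans (add_le_add (hC y) (hD y))

lemma sb_inv_sqrt {f : E → ℝ} (hf : SB e f) {ν : ℝ} (hν : 0 < ν) (h : ∀ y, ν ≤ f y) :
    SB e (fun y => (√(f y))⁻¹) := by
  have hp : ∀ y, 0 < f y := fun y => hν.trans_le (h y)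
  set g : E → ℝ := fun y => (√(f y))⁻¹ with hg
  have hs : Sm g := ContDiff.inv (ContDiff.sqrt hf.sm fun y => (hp y).ne')
    fun y => (Real.sqrt_pos.2 (hp y)).ne'
  have hd : ∀ i, dd (e i) g = fun y => (-1 / 2) * ((g y * (g y * g y)) * dd (e i) f y) := by
    intro i
    funext y
    have h1 := (hf.sm.differentiableAt (y := y)).hasFDerivAt.sqrt (hp y).ne'
    have h2 := (hasDerivAt_inv (Real.sqrt_pos.2 (hp y)).ne').comp_hasFDerivAt y h1
    have h3 : fderiv ℝ g y = _ := h2.fderiv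
    change fderiv ℝ g y (e i) = _
    rw [h3]
    simp only [hg, smul_apply, smul_eq_mul, dd]
    have : √(f y) ≠ 0 := (Real.sqrt_pos.2 (hp y)).ne'
    field_simp
  have hb : ∀ n : ℕ, ∀ γ : List κ, γ.length ≤ n → ∃ C : ℝ, ∀ y, |wd e γ g y| ≤ C := by
    intro n
    induction n with
    | zero =>
      intro γ hγ
      obtain rfl : γ = [] := List.length_eq_zero_iff.1 (by omega)
      refine ⟨(√ν)⁻¹, fun y => ?_⟩
      simp only [wd_nil, hg]
      rw [abs_of_nonneg (by positivity)]
      exact inv_anti₀ (Real.sqrt_pos.2 hν) (Real.sqrt_le_sqrt (h y))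
    | succ n ih =>
      intro γ
      induction γ using List.reverseRecOn with
      | nil => exact fun _ => ih [] (by simp)
      | append_singleton γ i _ =>
        intro hγ
        simp only [List.length_append, List.length_singleton] at hγ
        have hgg := hs.mul hs
        have hggg := hs.mul hgg
        obtain ⟨C, hC⟩ := bd_mul hggg (hf.sm.dd (e i)) (bd_mul hs hgg ih (bd_mul hs hs ih ih))
          (fun γ _ => (hf.dd i).bd γ) γ (by omega)
        refine ⟨|(-1 / 2 : ℝ)| * C, fun y => ?_⟩
        rw [wd_append, wd_cons, wd_nil, hd, wd_const_mul (hggg.mul (hf.sm.dd _)), abs_mul]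
        exact mul_le_mul_of_nonneg_left (hC y) (abs_nonneg _)
  exact SB.mk hs fun γ => hb _ γ le_rfl

lemma exists_sqrt (S : Finset κ) {ν : ℝ} (hν : 0 < ν) : ∀ (Q : κ → κ → E → ℝ),
    (∀ i j, SB e (Q i j)) → (∀ i j y, Q i j y = Q j i y) → (∀ i j y, i ∉ S → Q i j y = 0) →
    (∀ y (ξ : κ → ℝ), ν * ∑ i ∈ S, ξ i ^ 2 ≤ ∑ i, ∑ j, Q i j y * ξ i * ξ j) →
    ∃ σ : κ → κ → E → ℝ, (∀ m i, SB e (σ m i)) ∧ (∀ m ∉ S, ∀ i y, σ m i y = 0) ∧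
      ∀ i j y, Q i j y = ∑ m, σ m i y * σ m j y := by
  induction S using Finset.induction_on with
  | empty =>
    intro Q _ _ h0 _
    exact ⟨fun _ _ _ => 0, fun _ _ => sb_const 0, fun _ _ _ _ => rfl,
      fun i j y => by simp [h0 i j y (by simp)]⟩
  | insert a S ha ih =>
    intro Q hQ hsym h0 hell
    have haa : ∀ y, ν ≤ Q a a y := fun y => by
      have := hell y (fun i => if i = a then 1 else 0)
      simpa [Finset.sum_insert ha, ha] using this
    have hp : ∀ y, 0 < Q a a y := fun y => hν.trans_le (haa y)
    set s : κ → E → ℝ := fun i y => Q i a y * (√(Q a a y))⁻¹ with hs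
    have hsSB : ∀ i, SB e (s i) := fun i => (hQ i a).mul (sb_inv_sqrt (hQ a a) hν haa)
    have hsa : ∀ y, s a y = √(Q a a y) := fun y => by
      simp only [hs]
      rw [← div_eq_mul_inv, Real.div_sqrt]
    have hsa0 : ∀ y, 0 < s a y := fun y => by rw [hsa]; exact Real.sqrt_pos.2 (hp y)
    have hss : ∀ i y, s i y * s a y = Q i a y := fun i y => by
      rw [hsa]; simp only [hs]
      rw [mul_assoc, inv_mul_cancel₀ (Real.sqrt_pos.2 (hp y)).ne', mul_one]
    have hz : ∀ i j y, i ∉ S → Q i j y - s i y * s j y = 0 := by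
      intro i j y hi
      by_cases hia : i = a
      · subst hia
        rw [mul_comm, hss, hsym]; ring
      · have hi' : i ∉ insert a S := by simp [hia, hi]
        simp [h0 i j y hi', hs, h0 i a y hi']
    have hsym' : ∀ i j y, Q i j y - s i y * s j y = Q j i y - s j y * s i y := fun i j y => by
      rw [hsym i j y]; ring
    obtain ⟨σ, h1, h2, h3⟩ := ih (fun i j y => Q i j y - s i y * s j y)
      (fun i j => (hQ i j).sub ((hsSB i).mul (hsSB j))) hsym' hz (fun y ξ => by
        set ξ' : κ → ℝ := fun i => if i = a then
          -(∑ j ∈ Finset.univ.erase a, s j y * ξ j) / s a y else ξ i with hξ'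
        have hne : ∀ i, i ≠ a → ξ' i = ξ i := fun i hi => by simp [hξ', hi]
        have hsum : ∑ i, s i y * ξ' i = 0 := by
          rw [← Finset.add_sum_erase _ _ (Finset.mem_univ a)]
          have : ∑ j ∈ Finset.univ.erase a, s j y * ξ' j =
              ∑ j ∈ Finset.univ.erase a, s j y * ξ j :=
            Finset.sum_congr rfl fun j hj => by rw [hne j (Finset.ne_of_mem_erase hj)]
          rw [this]
          simp only [hξ', if_true]
          have := (hsa0 y).ne'
          field_simp; ring
        have e1 : ∑ i, ∑ j, (Q i j y - s i y * s j y) * ξ i * ξ j =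
            ∑ i, ∑ j, (Q i j y - s i y * s j y) * ξ' i * ξ' j := by
          refine Finset.sum_congr rfl fun i _ => Finset.sum_congr rfl fun j _ => ?_
          by_cases hi : i = a
          · rw [hz i j y (hi ▸ ha)]; ring
          by_cases hj : j = a
          · rw [hsym', hz j i y (hj ▸ ha)]; ring
          rw [hne i hi, hne j hj]
        have e2 : ∑ i, ∑ j, (Q i j y - s i y * s j y) * ξ' i * ξ' j =
            ∑ i, ∑ j, Q i j y * ξ' i * ξ' j := by
          have : ∑ i, ∑ j, s i y * s j y * ξ' i * ξ' j = 0 := by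
            have : ∑ i, ∑ j, s i y * s j y * ξ' i * ξ' j =
                (∑ i, s i y * ξ' i) * ∑ j, s j y * ξ' j := by
              rw [Finset.sum_mul_sum]
              exact Finset.sum_congr rfl fun i _ => Finset.sum_congr rfl fun j _ => by ring
            rw [this, hsum, zero_mul]
          simp only [sub_mul, Finset.sum_sub_distrib, this, sub_zero]
        rw [e1, e2]
        refine le_trans (mul_le_mul_of_nonneg_left ?_ hν.le) (hell y ξ')
        rw [Finset.sum_insert ha]
        have : ∑ i ∈ S, ξ' i ^ 2 = ∑ i ∈ S, ξ i ^ 2 :=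
          Finset.sum_congr rfl fun i hi => by rw [hne i fun h => ha (h ▸ hi)]
        rw [this]
        linarith [sq_nonneg (ξ' a)])
    refine ⟨fun m => if m = a then s else σ m, fun m i => ?_, fun m hm i y => ?_, fun i j y => ?_⟩
    · by_cases hm : m = a
      · simp only [hm, if_true]; exact hsSB i
      · simp only [hm, if_false]; exact h1 m i
    · simp only [Finset.mem_insert, not_or] at hm
      simp only [hm.1, if_false]
      exact h2 m hm.2 i y
    · rw [← Finset.add_sum_erase _ _ (Finset.mem_univ a)]
      have e3 : ∑ m ∈ Finset.univ.erase a, (if m = a then s else σ m) i y *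
          (if m = a then s else σ m) j y = ∑ m ∈ Finset.univ.erase a, σ m i y * σ m j y :=
        Finset.sum_congr rfl fun m hm => by rw [if_neg (Finset.ne_of_mem_erase hm)]
      have e4 := h3 i j y
      rw [← Finset.add_sum_erase _ _ (Finset.mem_univ a), h2 a ha i y] at e4
      simp only [if_true, e3]
      linarith

end Cholesky

section SpaceTime

variable {N : ℕ}

/-- The coordinate directions of `ℝ^N`. -/
def ex (N : ℕ) (i : Fin N) : ES N := EuclideanSpace.single i 1

/-- The coordinate basis of space-time. -/
def eS (N : ℕ) : Module.Basis (Unit ⊕ Fin N) ℝ (ℝ × ES N) :=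
  (Module.Basis.singleton Unit ℝ).prod (EuclideanSpace.basisFun (Fin N) ℝ).toBasis

@[simp] lemma eS_inl : eS N (Sum.inl ()) = (1, 0) := by
  simp [eS, Module.Basis.prod_apply]

@[simp] lemma eS_inr (i : Fin N) : eS N (Sum.inr i) = (0, ex N i) := by
  simp [eS, Module.Basis.prod_apply, ex]

/-- A spatial word as a space-time word. -/
def sw (γ : List (Fin N)) : List (Unit ⊕ Fin N) := γ.map Sum.inr

/-- The time slice of a function on space-time. -/
def sl (F : ℝ × ES N → ℝ) (t : ℝ) : ES N → ℝ := fun x => F (t, x)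

lemma Sm.sl {F : ℝ × ES N → ℝ} (h : Sm F) (t : ℝ) : Sm (sl F t) :=
  ContDiff.comp (g := F) h (contDiff_prodMk_right t)

lemma dd_sl {F : ℝ × ES N → ℝ} (h : Sm F) (t : ℝ) (v : ES N) : dd v (sl F t) = sl (dd (0, v) F) t := by
  funext x
  have h1 := (h.differentiableAt (y := (t, x))).hasFDerivAt.comp x
    (hasFDerivAt_prodMk_right (𝕜 := ℝ) t x)
  have h2 := congrArg (fun f => f v) h1.fderiv
  exact h2

lemma wd_sl {F : ℝ × ES N → ℝ} (h : Sm F) (t : ℝ) (γ : List (Fin N)) :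
    wd (ex N) γ (sl F t) = sl (wd (eS N) (sw γ) F) t := by
  induction γ with
  | nil => rfl
  | cons i γ ih =>
    rw [wd_cons, ih, dd_sl (h.wd _ _)]
    simp [sw]

/-- Smooth bounded coefficients on space-time. -/
structure Coef (N : ℕ) where
  Q : Fin N → Fin N → ℝ × ES N → ℝ
  b : Fin N → ℝ × ES N → ℝ
  c : ℝ × ES N → ℝ
  hQ : ∀ i j, SB (eS N) (Q i j)
  hb : ∀ j, SB (eS N) (b j)
  hc : SB (eS N) c
  symm : ∀ i j y, Q i j y = Q j i y
  ν₀ : ℝ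
  ν₀_pos : 0 < ν₀
  ell : ∀ y (ξ : Fin N → ℝ), ν₀ * ∑ i, ξ i ^ 2 ≤ ∑ i, ∑ j, Q i j y * ξ i * ξ j
  c₀ : ℝ
  c₀_nonneg : 0 ≤ c₀
  c_le : ∀ y, c y ≤ c₀

/-- The operator with coefficient functions frozen in time. -/
def Op (q : Fin N → Fin N → ES N → ℝ) (b : Fin N → ES N → ℝ) (c : ES N → ℝ) (φ : ES N → ℝ)
    (x : ES N) : ℝ :=
  (∑ i, ∑ j, q i j x * wd (ex N) [i, j] φ x) + (∑ j, b j x * wd (ex N) [j] φ x) + c x * φ x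

namespace Coef

/-- The elliptic operator at time `t`. -/
def A (K : Coef N) (t : ℝ) (φ : ES N → ℝ) : ES N → ℝ :=
  Op (fun i j => sl (K.Q i j) t) (fun j => sl (K.b j) t) (sl K.c t) φ

lemma exists_dat (K : Coef N) : ∃ D : Dat (eS N) (Unit ⊕ Fin N), (∀ y, D.c y = K.c y) ∧
    ∀ Φ, Sm Φ → ∀ t x, D.L Φ (t, x) = K.A t (sl Φ t) x - dd (eS N (Sum.inl ())) Φ (t, x) := by
  let Q' : (Unit ⊕ Fin N) → (Unit ⊕ Fin N) → ℝ × ES N → ℝ := fun i j y =>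
    Sum.elim (fun _ => 0) (fun i => Sum.elim (fun _ => 0) (fun j => K.Q i j y) j) i
  obtain ⟨σ, h1, -, h3⟩ := exists_sqrt (e := eS N) (Finset.univ.map ⟨Sum.inr, Sum.inr_injective⟩)
    K.ν₀_pos Q' (by
      rintro (i | i) (j | j)
      · exact sb_const 0
      · exact sb_const 0
      · exact sb_const 0
      · exact K.hQ i j) (by
      rintro (i | i) (j | j) y
      · rfl
      · rfl
      · rfl
      · exact K.symm i j y) (by
      rintro (i | i) (j | j) y h <;> simp [Q'] at h ⊢) (by
      intro y ξ
      simpa [Q'] using K.ell y fun i => ξ (Sum.inr i))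
  set n : ℝ := 2 * (Fintype.card (Unit ⊕ Fin N) : ℝ) with hn
  have hn0 : 0 < n := by
    have : 0 < Fintype.card (Unit ⊕ Fin N) := Fintype.card_pos
    positivity
  refine ⟨⟨fun m i y => √n * σ m i y, fun j => Sum.elim (fun _ _ => -1) (fun j => K.b j) j, K.c,
    fun m i => (h1 m i).const_mul _, ?_, K.hc⟩, fun y => rfl, fun Φ hΦ t x => ?_⟩
  · rintro (j | j)
    · exact sb_const (-1)
    · exact K.hb j
  have e1 : n⁻¹ * (∑ m, ∑ i, √n * σ m i (t, x) *
      ∑ j, √n * σ m j (t, x) * wd (eS N) [i, j] Φ (t, x)) =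
      ∑ i, ∑ j, Q' i j (t, x) * wd (eS N) [i, j] Φ (t, x) := by
    rw [Finset.sum_comm, Finset.mul_sum]
    refine Finset.sum_congr rfl fun i _ => ?_
    simp only [Finset.mul_sum, h3, Finset.sum_mul]
    rw [Finset.sum_comm]
    refine Finset.sum_congr rfl fun j _ => Finset.sum_congr rfl fun m _ => ?_
    have : n⁻¹ * (√n * √n) = 1 := by
      rw [Real.mul_self_sqrt hn0.le, inv_mul_cancel₀ hn0.ne']
    linear_combination (σ m i (t, x) * σ m j (t, x) * wd (eS N) [i, j] Φ (t, x)) * this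
  have h2 : ∀ i j, wd (ex N) [i, j] (sl Φ t) x = wd (eS N) [Sum.inr i, Sum.inr j] Φ (t, x) :=
    fun i j => congrFun (wd_sl hΦ t [i, j]) x
  have h4 : ∀ j, wd (ex N) [j] (sl Φ t) x = wd (eS N) [Sum.inr j] Φ (t, x) :=
    fun j => congrFun (wd_sl hΦ t [j]) x
  unfold Dat.L A Op
  simp only [h2, h4]
  rw [← hn, e1]
  simp only [Fintype.sum_sum_type, Q', sl]
  simp [wd_cons]
  ring

end Coef

/-- Smooth solutions of `D_t w = 𝒜 w + g` on `[s,T] × ℝ^N`. -/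
structure Sol (K : Coef N) (s T : ℝ) (g : ℝ × ES N → ℝ) (w : ℝ → ES N → ℝ) : Prop where
  sm : ∀ t ∈ Icc s T, Sm (w t)
  bd : ∀ γ, ∃ C : ℝ, ∀ t ∈ Icc s T, ∀ x, |wd (ex N) γ (w t) x| ≤ C
  cont : ∀ γ, ContinuousOn (fun p : ℝ × ES N => wd (ex N) γ (w p.1) p.2) (Icc s T ×ˢ univ)
  der : ∀ γ, ∀ t ∈ Icc s T, ∀ x, HasDerivWithinAt (fun t => wd (ex N) γ (w t) x)
    (wd (ex N) γ (fun x => K.A t (w t) x + g (t, x)) x) (Icc s T) t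

lemma TF.continuousOn_prod {T : ℝ} {U : ℝ → ℝ × ES N → ℝ} (h : TF (eS N) T U)
    (γ : List (Unit ⊕ Fin N)) :
    ContinuousOn (fun p : ℝ × (ℝ × ES N) => wd (eS N) γ (U p.1) p.2) (Icc 0 T ×ˢ univ) := by
  obtain ⟨C, hC0, hC⟩ := h.lip γ
  rintro ⟨τ, y⟩ ⟨hτ, -⟩
  have h1 : Tendsto (fun p : ℝ × (ℝ × ES N) => C * |p.1 - τ| +
      |wd (eS N) γ (U τ) p.2 - wd (eS N) γ (U τ) y|) (𝓝[Icc 0 T ×ˢ univ] (τ, y)) (𝓝 0) := by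
    have hc : Continuous fun p : ℝ × (ℝ × ES N) => C * |p.1 - τ| +
      |wd (eS N) γ (U τ) p.2 - wd (eS N) γ (U τ) y| := by
      have := ((h.sm hτ).wd (eS N) γ).continuous
      fun_prop
    have := hc.tendsto (τ, y)
    simp only [sub_self, abs_zero, mul_zero, add_zero] at this
    exact this.mono_left nhdsWithin_le_nhds
  refine tendsto_iff_norm_sub_tendsto_zero.2 (squeeze_zero' (Eventually.of_forall fun _ =>
    norm_nonneg _) ?_ h1)
  filter_upwards [self_mem_nhdsWithin] with p hp
  have h2 := hC p.1 hp.1 τ hτ p.2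
  calc ‖_‖ = |(wd (eS N) γ (U p.1) p.2 - wd (eS N) γ (U τ) p.2) +
        (wd (eS N) γ (U τ) p.2 - wd (eS N) γ (U τ) y)| := by rw [Real.norm_eq_abs]; congr 1; ring
    _ ≤ _ := (abs_add_le _ _).trans (add_le_add h2 le_rfl)

/-- Restricting an evolution to the characteristic diagonal. -/
lemma Evo.sol {T s : ℝ} {U V : ℝ → ℝ × ES N → ℝ} (h : Evo (eS N) (T - s) U V) (K : Coef N)
    {g : ℝ × ES N → ℝ}
    (hV : ∀ τ ∈ Icc 0 (T - s), ∀ t x, V τ (t, x) = K.A t (sl (U τ) t) x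
      - dd (eS N (Sum.inl ())) (U τ) (t, x) + g (t, x)) :
    Sol K s T g (fun t x => U (t - s) (t, x)) := by
  have hm : ∀ t ∈ Icc s T, t - s ∈ Icc 0 (T - s) := fun t ht => ⟨by linarith [ht.1], by linarith [ht.2]⟩
  have hw : ∀ γ, ∀ t ∈ Icc s T, ∀ x, wd (ex N) γ (fun x => U (t - s) (t, x)) x =
      wd (eS N) (sw γ) (U (t - s)) (t, x) := fun γ t ht x =>
    congrFun (wd_sl (h.tU.sm (hm t ht)) t γ) x
  refine ⟨fun t ht => (h.tU.sm (hm t ht)).sl t, fun γ => ?_, fun γ => ?_, fun γ t ht x => ?_⟩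
  · obtain ⟨C, hC⟩ := h.tU.bd (sw γ)
    exact ⟨C, fun t ht x => by rw [hw γ t ht]; exact hC _ (hm t ht) _⟩
  · have h1 := (h.tU.continuousOn_prod (sw γ)).comp
      (f := fun p : ℝ × ES N => (p.1 - s, p)) (s := Icc s T ×ˢ univ) (by fun_prop)
      (fun p hp => ⟨hm _ hp.1, trivial⟩)
    exact h1.congr fun p hp => hw γ p.1 hp.1 p.2
  · have hU := h.tU.sm (hm t ht)
    have hd := (hU.dd (eS N (Sum.inl ())))
    have e1 : wd (ex N) γ (fun x => K.A t (fun x => U (t - s) (t, x)) x + g (t, x)) x =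
        wd (eS N) (sw γ) (V (t - s)) (t, x) +
          dd (eS N (Sum.inl ())) (wd (eS N) (sw γ) (U (t - s))) (t, x) := by
      have : (fun x => K.A t (fun x => U (t - s) (t, x)) x + g (t, x)) =
          sl (fun y => V (t - s) y + dd (eS N (Sum.inl ())) (U (t - s)) y) t := by
        funext x
        simp only [sl, hV _ (hm t ht)]
        change _ = K.A t (fun x => U (t - s) (t, x)) x - _ + _ + _
        ring
      rw [this, wd_sl ((h.tV.sm (hm t ht)).add hd), wd_add (h.tV.sm (hm t ht)) hd, wd_dd_comm hU]
      rfl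
    rw [e1]
    obtain ⟨C, hC0, hC⟩ := h.quad (sw γ)
    have hline : HasDerivAt (fun t' : ℝ => wd (eS N) (sw γ) (U (t - s)) (t', x))
        (dd (eS N (Sum.inl ())) (wd (eS N) (sw γ) (U (t - s))) (t, x)) t := by
      have h1 := ((hU.wd (eS N) (sw γ)).differentiableAt (y := (t, x))).hasFDerivAt.comp_hasDerivAt t
        ((hasDerivAt_id t).prodMk (hasDerivAt_const t x))
      simp only [dd, eS_inl]
      exact h1
    have hmain : HasDerivWithinAt (fun t' : ℝ => wd (eS N) (sw γ) (U (t' - s)) (t', x) -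
        wd (eS N) (sw γ) (U (t - s)) (t', x)) (wd (eS N) (sw γ) (V (t - s)) (t, x)) (Icc s T) t := by
      obtain ⟨M, hM⟩ := h.tV.bd (Sum.inl () :: sw γ)
      rw [hasDerivWithinAt_iff_isLittleO]
      have h1 : (fun t' => wd (eS N) (sw γ) (U (t' - s)) (t', x) -
        wd (eS N) (sw γ) (U (t - s)) (t', x) - (wd (eS N) (sw γ) (U (t - s)) (t, x) -
        wd (eS N) (sw γ) (U (t - s)) (t, x)) - (t' - t) • wd (eS N) (sw γ) (V (t - s)) (t, x))
          =O[𝓝[Icc s T] t] fun t' => (t' - t) ^ 2 := by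
        refine Asymptotics.IsBigO.of_bound (C + M) ?_
        filter_upwards [self_mem_nhdsWithin] with t' ht'
        rw [Real.norm_eq_abs, Real.norm_eq_abs, abs_of_nonneg (sq_nonneg (t' - t)), smul_eq_mul]
        have h2 := hC _ (hm t ht) _ (hm t' ht') (t', x)
        have h3 := taylor_one ((h.tV.sm (hm t ht)).wd (eS N) (sw γ)).differentiable (y := (t, x))
          (v := (t' - t) • eS N (Sum.inl ())) (B := |t' - t| * M) (fun r _ => by
            rw [dd_vec_smul, abs_mul]
            exact mul_le_mul_of_nonneg_left (hM _ (hm t ht) _) (abs_nonneg _))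
        have e2 : (t, x) + (t' - t) • eS N (Sum.inl ()) = (t', x) := by
          rw [eS_inl, Prod.smul_mk, Prod.mk_add_mk]; simp
        rw [e2] at h3
        have e3 : wd (eS N) (sw γ) (U (t' - s)) (t', x) -
            wd (eS N) (sw γ) (U (t - s)) (t', x) - (wd (eS N) (sw γ) (U (t - s)) (t, x) -
            wd (eS N) (sw γ) (U (t - s)) (t, x)) - (t' - t) * wd (eS N) (sw γ) (V (t - s)) (t, x) =
            (wd (eS N) (sw γ) (U (t' - s)) (t', x) - wd (eS N) (sw γ) (U (t - s)) (t', x) -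
              (t' - s - (t - s)) * wd (eS N) (sw γ) (V (t - s)) (t', x)) +
            (t' - t) * (wd (eS N) (sw γ) (V (t - s)) (t', x) -
              wd (eS N) (sw γ) (V (t - s)) (t, x)) := by ring
        rw [e3]
        refine (abs_add_le _ _).trans ?_
        rw [abs_mul]
        have h4 := mul_le_mul_of_nonneg_left h3 (abs_nonneg (t' - t))
        have h5 : |t' - t| * (|t' - t| * M) = M * (t' - t) ^ 2 := by
          rw [← sq_abs (t' - t)]; ring
        have h6 : (t' - s - (t - s)) ^ 2 = (t' - t) ^ 2 := by ring
        rw [h6] at h2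
        linarith
      refine h1.trans_isLittleO ?_
      have h2 : Tendsto (fun τ' => τ' - t) (𝓝[Icc s T] t) (𝓝 0) := by
        have := (continuous_sub_right t).tendsto t
        simp only [sub_self] at this
        exact this.mono_left nhdsWithin_le_nhds
      exact (Asymptotics.isLittleO_pow_id (𝕜 := ℝ) one_lt_two).comp_tendsto h2
    refine (hmain.add hline.hasDerivWithinAt).congr (fun t' ht' => ?_) ?_
    · rw [hw γ t' ht']; simp
    · rw [hw γ t ht]; simp

end SpaceTime

section Propagator

variable {N : ℕ}

namespace Coef

/-- Square-root data for the space-time operator. -/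
def dat (K : Coef N) : Dat (eS N) (Unit ⊕ Fin N) := K.exists_dat.choose

lemma dat_c (K : Coef N) (y : ℝ × ES N) : K.dat.c y ≤ K.c₀ := by
  rw [dat, K.exists_dat.choose_spec.1]; exact K.c_le y

lemma dat_L (K : Coef N) {Φ : ℝ × ES N → ℝ} (h : Sm Φ) (t : ℝ) (x : ES N) :
    K.dat.L Φ (t, x) = K.A t (sl Φ t) x - dd (eS N (Sum.inl ())) Φ (t, x) :=
  K.exists_dat.choose_spec.2 Φ h t x

/-- The evolution operator applied to the slice of `Φ` at time `s`. -/
def G (K : Coef N) (Φ : ℝ × ES N → ℝ) (s t : ℝ) (x : ES N) : ℝ := K.dat.P Φ (t - s) (t, x)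

lemma G_sol (K : Coef N) {Φ : ℝ × ES N → ℝ} (h : SB (eS N) Φ) (s T : ℝ) :
    Sol K s T (fun _ => 0) (K.G Φ s) :=
  (K.dat.P_evo h (T - s)).sol K fun τ hτ t x => by
    rw [K.dat_L (K.dat.P_sm h hτ.1), add_zero]

lemma G_self (K : Coef N) {Φ : ℝ × ES N → ℝ} (h : SB (eS N) Φ) (s : ℝ) : K.G Φ s s = sl Φ s := by
  funext x
  rw [G, sub_self, K.dat.P_zero h]; rfl

lemma G_sub (K : Coef N) {Φ Ψ : ℝ × ES N → ℝ} (h : SB (eS N) Φ) (h' : SB (eS N) Ψ) {s t : ℝ}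
    (hst : s ≤ t) : K.G (fun y => Φ y - Ψ y) s t = fun x => K.G Φ s t x - K.G Ψ s t x :=
  funext fun _ => K.dat.P_sub h h' (sub_nonneg.2 hst) _

lemma G_sup (K : Coef N) {Φ : ℝ × ES N → ℝ} (h : SB (eS N) Φ) {B : ℝ} (hB : ∀ y, |Φ y| ≤ B)
    {s t : ℝ} (hst : s ≤ t) (x : ES N) : |K.G Φ s t x| ≤ Real.exp (K.c₀ * (t - s)) * B :=
  K.dat.P_sup K.c₀_nonneg K.dat_c h hB (sub_nonneg.2 hst) _

/-- The solution of the inhomogeneous problem given by Duhamel's formula. -/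
def U (K : Coef N) (f g : ℝ × ES N → ℝ) (t : ℝ) (x : ES N) : ℝ :=
  K.dat.P f t (t, x) + K.dat.J g t (t, x)

lemma U_sol (K : Coef N) {f g : ℝ × ES N → ℝ} (hf : SB (eS N) f) (hg : SB (eS N) g) (T : ℝ) :
    Sol K 0 T g (K.U f g) := by
  have h1 := (K.dat.P_evo hf (T - 0)).sol (s := 0) K (g := fun _ => 0) fun τ hτ t x => by
    rw [K.dat_L (K.dat.P_sm hf hτ.1), add_zero]
  have hJ := K.dat.J_evo hg (T - 0)
  have h2 := hJ.sol (s := 0) K (g := g) fun τ hτ t x => by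
    rw [K.dat.J_eq hg hτ.1, K.dat_L (hJ.tU.sm hτ)]
  have e1 : K.U f g = fun t x => K.dat.P f (t - 0) (t, x) + K.dat.J g (t - 0) (t, x) := by
    funext t x; simp [U]
  rw [e1]
  have hw : ∀ γ, ∀ t ∈ Icc 0 T, ∀ x, wd (ex N) γ (fun x => K.dat.P f (t - 0) (t, x) +
      K.dat.J g (t - 0) (t, x)) x = wd (ex N) γ (fun x => K.dat.P f (t - 0) (t, x)) x +
        wd (ex N) γ (fun x => K.dat.J g (t - 0) (t, x)) x := fun γ t ht x =>
    congrFun (wd_add (h1.sm t ht) (h2.sm t ht) _ _) x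
  refine ⟨fun t ht => (h1.sm t ht).add (h2.sm t ht), fun γ => ?_, fun γ => ?_, fun γ t ht x => ?_⟩
  · obtain ⟨C, hC⟩ := h1.bd γ
    obtain ⟨C', hC'⟩ := h2.bd γ
    refine ⟨C + C', fun t ht x => ?_⟩
    rw [hw γ t ht]
    exact (abs_add_le _ _).trans (add_le_add (hC t ht x) (hC' t ht x))
  · exact ((h1.cont γ).add (h2.cont γ)).congr fun p hp => hw γ p.1 hp.1 p.2
  · have h3 := ((h1.der γ t ht x).add (h2.der γ t ht x)).congr (fun t' ht' => hw γ t' ht' x)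
      (hw γ t ht x)
    refine h3.congr_deriv (Eq.symm ?_)
    have hA : ∀ {φ : ES N → ℝ}, Sm φ → Sm (K.A t φ) := fun {φ} hφ => by
      unfold A Op
      exact ((Sm.sum fun i _ => Sm.sum fun j _ => ((K.hQ i j).sm.sl t).mul (hφ.wd _ _)).add
        (Sm.sum fun j _ => ((K.hb j).sm.sl t).mul (hφ.wd _ _))).add ((K.hc.sm.sl t).mul hφ)
    have hA2 : ∀ x, K.A t (fun x => K.dat.P f (t - 0) (t, x) + K.dat.J g (t - 0) (t, x)) x =
        K.A t (fun x => K.dat.P f (t - 0) (t, x)) x +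
        K.A t (fun x => K.dat.J g (t - 0) (t, x)) x := fun x => by
      unfold A Op
      simp only [hw _ t ht, mul_add, Finset.sum_add_distrib]
      ring
    have := congrFun (wd_add (hA (h1.sm t ht)) ((hA (h2.sm t ht)).add (hg.sm.sl t)) (ex N) γ) x
    refine Eq.trans (congrArg (fun F => wd (ex N) γ F x) (funext fun x => ?_)) (this.trans ?_)
    · rw [hA2, add_assoc]; rfl
    · have e : ∀ F : ES N → ℝ, (fun x => F x + (fun _ : ℝ × ES N => (0 : ℝ)) (t, x)) = F :=
        fun F => funext fun x => add_zero _
      rw [e]; rfl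

lemma U_zero (K : Coef N) {f g : ℝ × ES N → ℝ} (hf : SB (eS N) f) : K.U f g 0 = sl f 0 := by
  funext x
  simp [U, K.dat.P_zero hf, Dat.J, sl]

lemma U_words (K : Coef N) {f g : ℝ × ES N → ℝ} (hf : SB (eS N) f) (hg : SB (eS N) g)
    (γ : List (Fin N)) {t : ℝ} (ht : 0 ≤ t) (x : ES N) :
    IntervalIntegrable (fun σ => wd (ex N) γ (K.G g (t - σ) t) x) volume 0 t ∧
    wd (ex N) γ (K.U f g t) x = wd (ex N) γ (K.G f 0 t) x +
      ∫ σ in (0 : ℝ)..t, wd (ex N) γ (K.G g (t - σ) t) x := by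
  have h0 : (0 : ℝ) ∈ Icc 0 t := ⟨le_rfl, ht⟩
  have h1 : t ∈ Icc 0 t := ⟨ht, le_rfl⟩
  have hT := K.dat.P_tf hg t
  have e1 : ∀ σ ∈ Icc 0 t, wd (ex N) γ (K.G g (t - σ) t) x = wd (eS N) (sw γ) (K.dat.P g σ) (t, x) :=
    fun σ hσ => by
      have : K.G g (t - σ) t = sl (K.dat.P g σ) t := by
        funext x; simp [G, sl]
      rw [this, wd_sl (K.dat.P_sm hg hσ.1)]; rfl
  have hu : uIcc 0 t = Icc 0 t := uIcc_of_le ht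
  refine ⟨(hT.intervalIntegrable (sw γ) (t, x) h0 h1).congr fun σ hσ => (e1 σ ?_).symm, ?_⟩
  · rw [← hu]; exact uIoc_subset_uIcc hσ
  rw [intervalIntegral.integral_congr (g := fun σ => wd (eS N) (sw γ) (K.dat.P g σ) (t, x))
    fun σ hσ => e1 σ (hu ▸ hσ)]
  have hi := integral_words hT h0 h1
  have e2 : K.U f g t = fun x => sl (K.dat.P f t) t x + sl (K.dat.J g t) t x := rfl
  have e3 : K.G f 0 t = sl (K.dat.P f t) t := by funext x; simp [G, sl]
  have hJ : Sm (K.dat.J g t) := hi.1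
  rw [e2, wd_add ((K.dat.P_sm hf ht).sl t) (hJ.sl t), e3, wd_sl hJ]
  exact congrArg (_ + ·) (congrFun (hi.2 (sw γ)) (t, x))

end Coef

end Propagator

section MaxPrinciple

variable {E : Type*} [NormedAddCommGroup E] [NormedSpace ℝ E]

lemma dd_contDiff {f : E → ℝ} {n : WithTop ℕ∞} (hf : ContDiff ℝ (n + 1) f) (v : E) :
    ContDiff ℝ n (dd v f) :=
  (hf.fderiv_right le_rfl).clm_apply contDiff_const

lemma dd_comb_comb_two {κ : Type*} [Fintype κ] (e : κ → E) {f : E → ℝ} (hf : ContDiff ℝ 2 f)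
    (a : κ → ℝ) : dd (∑ j, a j • e j) (dd (∑ j, a j • e j) f) =
      fun y => ∑ i, a i * ∑ j, a j * wd e [i, j] f y := by
  have h1 : ∀ j, Differentiable ℝ (dd (e j) f) := fun j =>
    (dd_contDiff (n := 1) hf (e j)).differentiable one_ne_zero
  rw [dd_comb, dd_comb]
  funext y
  refine Finset.sum_congr rfl fun i _ => ?_
  congr 1
  change fderiv ℝ (fun y => ∑ j, a j * dd (e j) f y) y (e i) = _
  rw [fderiv_fun_sum fun j _ => ((h1 j) y).const_mul (a j)]
  simp only [sum_apply]
  refine Finset.sum_congr rfl fun j _ => ?_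
  have := congrArg (fun l => l (e i)) (fderiv_const_mul ((h1 j) y) (a j))
  exact this

lemma dd_dd_nonpos {f : E → ℝ} (hf : ContDiff ℝ 2 f) {x : E} (hm : IsLocalMax f x) (v : E) :
    dd v f x = 0 ∧ dd v (dd v f) x ≤ 0 := by
  have h0 : fderiv ℝ f x = 0 := hm.fderiv_eq_zero
  refine ⟨by simp [dd, h0], ?_⟩
  by_contra! hpos
  have hd : Differentiable ℝ f := hf.differentiable two_ne_zero
  have hd1 : Differentiable ℝ (dd v f) :=
    (dd_contDiff (n := 1) hf v).differentiable one_ne_zero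
  set F : ℝ → ℝ := fun t => f (x + t • v) with hF
  have e1 : deriv F = fun t => dd v f (x + t • v) := by
    funext t; exact (hasDerivAt_line hd.differentiableAt).deriv
  have e2 : deriv (deriv F) 0 = dd v (dd v f) x := by
    rw [e1, (hasDerivAt_line hd1.differentiableAt).deriv]; simp
  have hc : Continuous F := hf.continuous.comp (by fun_prop)
  have hmin : IsLocalMin F 0 := isLocalMin_of_deriv_deriv_pos (by rw [e2]; exact hpos)
    (by rw [e1]; simp [dd, h0]) hc.continuousAt
  have hmax : IsLocalMax F 0 := by
    have ht : Tendsto (fun t : ℝ => x + t • v) (𝓝 0) (𝓝 x) := by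
      have : Continuous fun t : ℝ => x + t • v := by fun_prop
      simpa using this.tendsto 0
    have := ht.eventually hm
    simpa [IsLocalMax, IsMaxFilter, hF] using this
  have heq : F =ᶠ[𝓝 0] fun _ => F 0 := by
    filter_upwards [hmin, hmax] with t h1 h2 using le_antisymm h2 h1
  have h3 : deriv (deriv F) 0 = 0 := by
    have := heq.deriv.deriv_eq
    simpa using this
  rw [e2] at h3
  linarith

variable {N : ℕ}

lemma elliptic_nonpos {f : ES N → ℝ} (hf : ContDiff ℝ 2 f) {x : ES N} (hm : IsLocalMax f x)
    (q : Fin N → Fin N → ℝ) (hs : ∀ i j, q i j = q j i) {ν : ℝ} (hν : 0 < ν)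
    (hell : ∀ ξ : Fin N → ℝ, ν * ∑ i, ξ i ^ 2 ≤ ∑ i, ∑ j, q i j * ξ i * ξ j) :
    (∀ i, wd (ex N) [i] f x = 0) ∧ ∑ i, ∑ j, q i j * wd (ex N) [i, j] f x ≤ 0 := by
  refine ⟨fun i => (dd_dd_nonpos hf hm (ex N i)).1, ?_⟩
  obtain ⟨σ, -, -, h3⟩ := exists_sqrt (e := ex N) Finset.univ hν (fun i j (_ : ES N) => q i j)
    (fun i j => sb_const _) (fun i j _ => hs i j) (fun i j _ h => by simp at h)
    (fun _ ξ => hell ξ)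
  have key : ∑ i, ∑ j, q i j * wd (ex N) [i, j] f x =
      ∑ m, dd (∑ j, σ m j x • ex N j) (dd (∑ j, σ m j x • ex N j) f) x := by
    simp only [dd_comb_comb_two (ex N) hf]
    simp only [Finset.mul_sum]
    conv_rhs => rw [Finset.sum_comm]
    refine Finset.sum_congr rfl fun i _ => ?_
    conv_rhs => rw [Finset.sum_comm]
    refine Finset.sum_congr rfl fun j _ => ?_
    rw [h3 i j x, Finset.sum_mul]
    refine Finset.sum_congr rfl fun m _ => by ring
  rw [key]
  exact Finset.sum_nonpos fun m _ => (dd_dd_nonpos hf hm _).2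

lemma deriv_nonneg_of_max {f : ℝ → ℝ} {f' s T t : ℝ} (ht : t ∈ Ioc s T)
    (h : HasDerivWithinAt f f' (Icc s T) t) (hm : ∀ t' ∈ Icc s T, f t' ≤ f t) : 0 ≤ f' := by
  have h1 : HasDerivWithinAt f f' (Icc s t) t := h.mono (Icc_subset_Icc_right ht.2)
  have h2 : HasDerivWithinAt f f' (Iic t) t := by
    refine h1.mono_of_mem_nhdsWithin ?_
    rw [mem_nhdsWithin]
    exact ⟨Ioi s, isOpen_Ioi, ht.1, fun y hy => ⟨hy.1.le, hy.2⟩⟩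
  have h3 : HasDerivWithinAt f f' (Iio t) t := h2.mono Iio_subset_Iic_self
  rw [hasDerivWithinAt_iff_tendsto_slope' (by simp)] at h3
  have : NeBot (𝓝[<] t) := nhdsLT_neBot t
  refine ge_of_tendsto h3 ?_
  have : Ioo s t ∈ 𝓝[<] t := Ioo_mem_nhdsLT ht.1
  filter_upwards [this] with y hy
  rw [slope_def_field]
  have h4 := hm y ⟨hy.1.le, hy.2.le.trans ht.2⟩
  exact div_nonneg_of_nonpos (by linarith) (by linarith [hy.2])

lemma max_point {s T : ℝ} {K : Set (ES N)} (hK : IsCompact K) {z : ℝ → ES N → ℝ}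
    (hz : ContinuousOn (fun p : ℝ × ES N => z p.1 p.2) (Icc s T ×ˢ K)) {t : ℝ} {x : ES N}
    (ht : t ∈ Icc s T) (hx : x ∈ K) (hp : 0 < z t x) :
    ∃ t₁ ∈ Icc s T, ∃ x₁ ∈ K, 0 < z t₁ x₁ ∧ (∀ t ∈ Icc s T, ∀ x ∈ K, z t x ≤ z t₁ x₁) := by
  obtain ⟨p, hp1, hp2⟩ := (isCompact_Icc.prod hK).exists_isMaxOn ⟨(t, x), ht, hx⟩ hz
  refine ⟨p.1, hp1.1, p.2, hp1.2, hp.trans_le (hp2 (mk_mem_prod ht hx)), fun t' ht' x' hx' =>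
    hp2 (mk_mem_prod ht' hx')⟩

end MaxPrinciple

section Operator

variable {N : ℕ}

/-- The bilinear form `⟨Q ∇f, ∇g⟩`. -/
def Gam (q : Fin N → Fin N → ES N → ℝ) (f g : ES N → ℝ) (x : ES N) : ℝ :=
  ∑ i, ∑ j, q i j x * wd (ex N) [i] f x * wd (ex N) [j] g x

variable {q : Fin N → Fin N → ES N → ℝ} {b : Fin N → ES N → ℝ} {c : ES N → ℝ} {f g : ES N → ℝ}

lemma op_mul (hf : Sm f) (hg : Sm g) (x : ES N) :
    Op q b 0 (fun y => f y * g y) x = f x * Op q b 0 g x + g x * Op q b 0 f x +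
      (Gam q f g x + Gam q g f x) := by
  have h1 : ∀ j, wd (ex N) [j] (fun y => f y * g y) =
      fun y => wd (ex N) [j] f y * g y + f y * wd (ex N) [j] g y := fun j => dd_mul hf hg _
  have h2 : ∀ i j, wd (ex N) [i, j] (fun y => f y * g y) x =
      wd (ex N) [i, j] f x * g x + wd (ex N) [j] f x * wd (ex N) [i] g x +
      (wd (ex N) [i] f x * wd (ex N) [j] g x + f x * wd (ex N) [i, j] g x) := by
    intro i j
    rw [wd_cons, h1, dd_add ((hf.wd _ _).mul hg) (hf.mul (hg.wd _ _)),
      dd_mul (hf.wd _ _) hg, dd_mul hf (hg.wd _ _)]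
    rfl
  unfold Op Gam
  simp only [h2, h1, Pi.zero_apply, zero_mul, add_zero, mul_add, Finset.mul_sum,
    Finset.sum_add_distrib]
  have e1 : ∀ i j, q i j x * (wd (ex N) [j] f x * wd (ex N) [i] g x) =
      q i j x * wd (ex N) [i] g x * wd (ex N) [j] f x := fun i j => by ring
  have e2 : ∀ i j, q i j x * (wd (ex N) [i] f x * wd (ex N) [j] g x) =
      q i j x * wd (ex N) [i] f x * wd (ex N) [j] g x := fun i j => by ring
  have e3 : ∀ i j, q i j x * (wd (ex N) [i, j] f x * g x) =
      g x * (q i j x * wd (ex N) [i, j] f x) := fun i j => by ring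
  have e4 : ∀ i j, q i j x * (f x * wd (ex N) [i, j] g x) =
      f x * (q i j x * wd (ex N) [i, j] g x) := fun i j => by ring
  have e5 : ∀ j, b j x * (wd (ex N) [j] f x * g x) = g x * (b j x * wd (ex N) [j] f x) :=
    fun j => by ring
  have e6 : ∀ j, b j x * (f x * wd (ex N) [j] g x) = f x * (b j x * wd (ex N) [j] g x) :=
    fun j => by ring
  simp only [e1, e2, e3, e4, e5, e6]
  ring

lemma op_split (x : ES N) : Op q b c f x = Op q b 0 f x + c x * f x := by
  simp [Op]

lemma op_add (hf : Sm f) (hg : Sm g) (x : ES N) :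
    Op q b c (fun y => f y + g y) x = Op q b c f x + Op q b c g x := by
  unfold Op
  simp only [wd_add hf hg, mul_add, Finset.sum_add_distrib]
  ring

lemma op_const_mul (hf : Sm f) (a : ℝ) (x : ES N) :
    Op q b c (fun y => a * f y) x = a * Op q b c f x := by
  unfold Op
  simp only [wd_const_mul hf, mul_add, Finset.mul_sum]
  congr 1
  · congr 1
    · exact Finset.sum_congr rfl fun i _ => Finset.sum_congr rfl fun j _ => by ring
    · exact Finset.sum_congr rfl fun j _ => by ring
  · ring

lemma op_sum {ι : Type*} {s : Finset ι} {f : ι → ES N → ℝ} (hf : ∀ i ∈ s, Sm (f i)) (x : ES N) :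
    Op q b c (fun y => ∑ i ∈ s, f i y) x = ∑ i ∈ s, Op q b c (f i) x := by
  unfold Op
  simp only [wd_sum hf, Finset.mul_sum, Finset.sum_add_distrib]
  congr 1
  congr 1
  · conv_rhs => rw [Finset.sum_comm]
    refine Finset.sum_congr rfl fun i _ => ?_
    conv_rhs => rw [Finset.sum_comm]
  · rw [Finset.sum_comm]

lemma wd_pow_succ (hf : Sm f) (n : ℕ) (i : Fin N) :
    wd (ex N) [i] (fun y => f y ^ (n + 1)) = fun y => (n + 1) * f y ^ n * wd (ex N) [i] f y := by
  funext y
  simp only [wd_cons, wd_nil, dd]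
  rw [fderiv_fun_pow (n + 1) hf.differentiableAt]
  simp

lemma Sm.pow (hf : Sm f) (n : ℕ) : Sm (fun y => f y ^ n) := ContDiff.pow hf n

lemma gam_pow (hf : Sm f) (n : ℕ) (x : ES N) :
    Gam q (fun y => f y ^ (n + 1)) g x = (n + 1) * f x ^ n * Gam q f g x := by
  unfold Gam
  simp only [wd_pow_succ hf, Finset.mul_sum]
  exact Finset.sum_congr rfl fun i _ => Finset.sum_congr rfl fun j _ => by ring

lemma op_pow (hf : Sm f) (n : ℕ) (x : ES N) :
    Op q b 0 (fun y => f y ^ (n + 2)) x = (n + 2) * f x ^ (n + 1) * Op q b 0 f x +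
      (n + 2) * (n + 1) * f x ^ n * Gam q f f x := by
  induction n with
  | zero =>
    have : (fun y => f y ^ (0 + 2)) = fun y => f y * f y := by funext y; ring
    rw [this, op_mul hf hf]; norm_num; ring
  | succ n ih =>
    have h1 : (fun y => f y ^ (n + 1 + 2)) = fun y => f y ^ (n + 2) * f y := by funext y; ring
    have h2 : Gam q f (fun y => f y ^ (n + 2)) x = (n + 2) * f x ^ (n + 1) * Gam q f f x := by
      unfold Gam
      simp only [wd_pow_succ hf (n + 1), Finset.mul_sum]
      refine Finset.sum_congr rfl fun i _ => Finset.sum_congr rfl fun j _ => ?_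
      push_cast; ring
    rw [h1, op_mul (hf.pow _) hf, ih, h2, gam_pow hf (n + 1)]
    push_cast
    ring

lemma dd_sum_mul {ι : Type*} [Fintype ι] {a f : ι → ES N → ℝ} (ha : ∀ i, Sm (a i))
    (hf : ∀ i, Sm (f i)) (v : ES N) : dd v (fun y => ∑ i, a i y * f i y) = fun y =>
      (∑ i, a i y * dd v (f i) y) + ∑ i, dd v (a i) y * f i y := by
  rw [dd_sum fun i _ => (ha i).mul (hf i)]
  funext y
  simp only [dd_mul (ha _) (hf _), Finset.sum_add_distrib]
  ring

lemma Sm.op (hq : ∀ i j, Sm (q i j)) (hb : ∀ j, Sm (b j)) (hc : Sm c) (hf : Sm f) :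
    Sm (Op q b c f) :=
  ((Sm.sum fun _ _ => Sm.sum fun _ _ => (hq _ _).mul (hf.wd _ _)).add
    (Sm.sum fun _ _ => (hb _).mul (hf.wd _ _))).add (hc.mul hf)

lemma dd_op (hq : ∀ i j, Sm (q i j)) (hb : ∀ j, Sm (b j)) (hc : Sm c) (hf : Sm f) (v : ES N) :
    dd v (Op q b c f) = fun x => Op q b c (dd v f) x +
      Op (fun i j => dd v (q i j)) (fun j => dd v (b j)) (dd v c) f x := by
  have h1 : ∀ i, Sm fun x => ∑ j, q i j x * wd (ex N) [i, j] f x := fun i =>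
    Sm.sum fun _ _ => (hq _ _).mul (hf.wd _ _)
  have h2 : Sm fun x => ∑ i, ∑ j, q i j x * wd (ex N) [i, j] f x := Sm.sum fun i _ => h1 i
  have h3 : Sm fun x => ∑ j, b j x * wd (ex N) [j] f x := Sm.sum fun _ _ => (hb _).mul (hf.wd _ _)
  have e : Op q b c f = fun x => (∑ i, ∑ j, q i j x * wd (ex N) [i, j] f x) +
    (∑ j, b j x * wd (ex N) [j] f x) + c x * f x := rfl
  rw [e, dd_add (h2.add h3) (hc.mul hf), dd_add h2 h3, dd_mul hc hf, dd_sum fun i _ => h1 i,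
    dd_sum_mul hb fun j => hf.wd _ _]
  funext x
  simp only [dd_sum_mul (hq _) fun j => hf.wd _ _, Op, wd_dd_comm hf, Finset.sum_add_distrib]
  ring

end Operator

section Commutators

variable {N : ℕ}

namespace Coef

/-- The operator whose coefficients are the derivatives of those of `K` along a word. -/
def Ad (K : Coef N) (γ : List (Fin N)) (t : ℝ) (φ : ES N → ℝ) : ES N → ℝ :=
  Op (fun i j => wd (ex N) γ (sl (K.Q i j) t)) (fun j => wd (ex N) γ (sl (K.b j) t))
    (wd (ex N) γ (sl K.c t)) φ

variable (K : Coef N) {t : ℝ} {φ : ES N → ℝ}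

lemma sm_Ad (γ : List (Fin N)) (hφ : Sm φ) : Sm (K.Ad γ t φ) :=
  Sm.op (fun i j => ((K.hQ i j).sm.sl t).wd _ _) (fun j => ((K.hb j).sm.sl t).wd _ _)
    ((K.hc.sm.sl t).wd _ _) hφ

lemma dd_Ad (γ : List (Fin N)) (hφ : Sm φ) (k : Fin N) : dd (ex N k) (K.Ad γ t φ) =
    fun x => K.Ad γ t (wd (ex N) [k] φ) x + K.Ad (k :: γ) t φ x :=
  dd_op (fun i j => ((K.hQ i j).sm.sl t).wd _ _) (fun j => ((K.hb j).sm.sl t).wd _ _)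
    ((K.hc.sm.sl t).wd _ _) hφ _

lemma wd_A_one (hφ : Sm φ) (k : Fin N) (x : ES N) : wd (ex N) [k] (K.A t φ) x =
    K.A t (wd (ex N) [k] φ) x + K.Ad [k] t φ x :=
  congrFun (K.dd_Ad [] hφ k) x

lemma wd_A_two (hφ : Sm φ) (k l : Fin N) : wd (ex N) [k, l] (K.A t φ) =
    fun x => K.A t (wd (ex N) [k, l] φ) x + K.Ad [k] t (wd (ex N) [l] φ) x +
      (K.Ad [l] t (wd (ex N) [k] φ) x + K.Ad [k, l] t φ x) := by
  have h1 : wd (ex N) [l] (K.A t φ) = fun x => K.Ad [] t (wd (ex N) [l] φ) x + K.Ad [l] t φ x :=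
    K.dd_Ad [] hφ l
  rw [wd_cons, h1, dd_add (K.sm_Ad _ (hφ.wd _ _)) (K.sm_Ad _ hφ), K.dd_Ad _ (hφ.wd _ _),
    K.dd_Ad _ hφ]
  rfl

lemma wd_A_three (hφ : Sm φ) (k l m : Fin N) (x : ES N) : wd (ex N) [k, l, m] (K.A t φ) x =
    K.A t (wd (ex N) [k, l, m] φ) x +
      (K.Ad [k] t (wd (ex N) [l, m] φ) x + K.Ad [l] t (wd (ex N) [k, m] φ) x +
        K.Ad [m] t (wd (ex N) [k, l] φ) x) +
      (K.Ad [k, l] t (wd (ex N) [m] φ) x + K.Ad [k, m] t (wd (ex N) [l] φ) x +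
        K.Ad [l, m] t (wd (ex N) [k] φ) x) + K.Ad [k, l, m] t φ x := by
  have h1 : K.A t (wd (ex N) [l, m] φ) = K.Ad [] t (wd (ex N) [l, m] φ) := rfl
  rw [wd_cons, K.wd_A_two hφ l m, h1,
    dd_add ((K.sm_Ad _ (hφ.wd _ _)).add (K.sm_Ad _ (hφ.wd _ _)))
      ((K.sm_Ad _ (hφ.wd _ _)).add (K.sm_Ad _ hφ)),
    dd_add (K.sm_Ad _ (hφ.wd _ _)) (K.sm_Ad _ (hφ.wd _ _)),
    dd_add (K.sm_Ad _ (hφ.wd _ _)) (K.sm_Ad _ hφ), K.dd_Ad _ (hφ.wd _ _),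
    K.dd_Ad _ (hφ.wd _ _), K.dd_Ad _ (hφ.wd _ _), K.dd_Ad _ hφ]
  have h2 : ∀ i j, K.Ad [] t (wd (ex N) [i] (wd (ex N) [j, m] φ)) = K.A t (wd (ex N) [i, j, m] φ) :=
    fun i j => rfl
  have h3 : ∀ γ i j, K.Ad γ t (wd (ex N) [i] (wd (ex N) [j] φ)) = K.Ad γ t (wd (ex N) [i, j] φ) :=
    fun γ i j => rfl
  simp only [h2, h3]
  ring

end Coef

/-- Pointwise structural bounds for the coefficients. -/
structure PB (K : Coef N) (κ ν₁ l t : ℝ) (x : ES N) (ν d r ϱ : ℝ) : Prop where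
  ν_le : ν₁ ≤ ν
  r_nonneg : 0 ≤ r
  ϱ_nonneg : 0 ≤ ϱ
  ell : ∀ ξ : Fin N → ℝ, ν * ∑ i, ξ i ^ 2 ≤ ∑ i, ∑ j, K.Q i j (t, x) * ξ i * ξ j
  qx : ∀ i, |∑ j, K.Q i j (t, x) * x j| ≤ κ * (1 + ‖x‖ ^ 2) * ν
  drift : (∑ i, K.Q i i (t, x)) + ∑ j, K.b j (t, x) * x j ≤ κ * (1 + ‖x‖ ^ 2) * ν
  q1 : ∀ k i j, |wd (ex N) [k] (sl (K.Q i j) t) x| ≤ κ * ν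
  q2 : ∀ Ξ : Fin N → Fin N → ℝ, (∀ h k, Ξ h k = Ξ k h) →
    (∑ h, ∑ k, ∑ l, ∑ m, wd (ex N) [l, m] (sl (K.Q h k) t) x * Ξ h k * Ξ l m)
      ≤ κ * ν * ∑ h, ∑ k, Ξ h k ^ 2
  q3 : ∀ k l m i j, |wd (ex N) [k, l, m] (sl (K.Q i j) t) x| ≤ κ * ν
  dis : ∀ ξ : Fin N → ℝ, (∑ i, ∑ j, wd (ex N) [j] (sl (K.b i) t) x * ξ j * ξ i) ≤ d * ∑ i, ξ i ^ 2
  b2 : ∀ k l j, |wd (ex N) [k, l] (sl (K.b j) t) x| ≤ r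
  b3 : ∀ k l m j, |wd (ex N) [k, l, m] (sl (K.b j) t) x| ≤ r
  c1 : ∀ k, |wd (ex N) [k] (sl K.c t) x| ≤ ϱ
  c2 : ∀ k l, |wd (ex N) [k, l] (sl K.c t) x| ≤ ϱ
  c3 : ∀ k l m, |wd (ex N) [k, l, m] (sl K.c t) x| ≤ ϱ
  funz : d + l * r + l * ϱ ^ 2 ≤ κ * ν
  c_le : K.c (t, x) ≤ κ

lemma abs_sum_fin {f : Fin N → ℝ} {B : ℝ} (h : ∀ i, |f i| ≤ B) : |∑ i, f i| ≤ N * B := by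
  refine (Finset.abs_sum_le_sum_abs _ _).trans ?_
  simpa using Finset.sum_le_card_nsmul Finset.univ _ B fun i _ => h i

lemma abs_mul_le_mul {a b A B : ℝ} (ha : |a| ≤ A) (hb : |b| ≤ B) : |a * b| ≤ A * B := by
  rw [abs_mul]
  exact mul_le_mul ha hb (abs_nonneg _) ((abs_nonneg _).trans ha)

lemma sum_rot {ι : Type*} [Fintype ι] (F : ι → ι → ι → ℝ) :
    ∑ p, ∑ i, ∑ j, F i j p = ∑ i, ∑ j, ∑ p, F i j p := by
  rw [Finset.sum_comm]
  exact Finset.sum_congr rfl fun k _ => Finset.sum_comm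

lemma sum_rot_four {ι : Type*} [Fintype ι] (F : ι → ι → ι → ι → ℝ) :
    ∑ i, ∑ j, ∑ k, ∑ m, F i j k m = ∑ k, ∑ m, ∑ i, ∑ j, F i j k m := by
  rw [← sum_rot fun k m i => ∑ j, F i j k m]
  exact Finset.sum_congr rfl fun i _ => sum_rot fun k m j => F i j k m

/-- Pointwise sizes of the derivatives of a function. -/
structure Sizes (φ : ES N → ℝ) (x : ES N) (X0 X1 X2 X3 X4 : ℝ) : Prop where
  h0 : |φ x| ≤ X0
  h1 : ∀ i, |wd (ex N) [i] φ x| ≤ X1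
  h2 : ∀ i j, |wd (ex N) [i, j] φ x| ≤ X2
  h3 : ∀ i j k, |wd (ex N) [i, j, k] φ x| ≤ X3
  h4 : ∀ i j k l, |wd (ex N) [i, j, k, l] φ x| ≤ X4
  s1 : ∑ i, wd (ex N) [i] φ x ^ 2 = X1 ^ 2
  s2 : ∑ i, ∑ j, wd (ex N) [i, j] φ x ^ 2 = X2 ^ 2
  s3 : ∑ i, ∑ j, ∑ k, wd (ex N) [i, j, k] φ x ^ 2 = X3 ^ 2

variable {K : Coef N} {κ ν₁ l t ν d r ϱ X0 X1 X2 X3 X4 : ℝ} {x : ES N} {φ : ES N → ℝ}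

lemma wd_swap {f : ES N → ℝ} (hf : Sm f) (i j : Fin N) (γ : List (Fin N)) :
    wd (ex N) (i :: j :: γ) f = wd (ex N) (j :: i :: γ) f := dd_comm (hf.wd _ γ) _ _

lemma commutator_one (h : PB K κ ν₁ l t x ν d r ϱ) (s : Sizes φ x X0 X1 X2 X3 X4) :
    ∑ k, wd (ex N) [k] φ x * K.Ad [k] t φ x ≤
      N ^ 3 * (κ * ν * (X1 * X2)) + N * (ϱ * (X1 * X0)) + d * X1 ^ 2 := by
  have e : ∑ k, wd (ex N) [k] φ x * K.Ad [k] t φ x =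
      (∑ k, wd (ex N) [k] φ x * ∑ i, ∑ j, wd (ex N) [k] (sl (K.Q i j) t) x * wd (ex N) [i, j] φ x) +
      (∑ i, ∑ j, wd (ex N) [j] (sl (K.b i) t) x * wd (ex N) [j] φ x * wd (ex N) [i] φ x) +
      ∑ k, wd (ex N) [k] φ x * (wd (ex N) [k] (sl K.c t) x * φ x) := by
    rw [Finset.sum_comm (f := fun i j => wd (ex N) [j] (sl (K.b i) t) x * wd (ex N) [j] φ x *
      wd (ex N) [i] φ x)]
    simp only [Coef.Ad, Op, mul_add, Finset.sum_add_distrib]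
    congr 2
    refine Finset.sum_congr rfl fun i _ => ?_
    rw [Finset.mul_sum]
    exact Finset.sum_congr rfl fun j _ => by ring
  have b1 := le_of_abs_le (abs_sum_fin fun k => abs_mul_le_mul (s.h1 k)
    (abs_sum_fin fun i => abs_sum_fin fun j => abs_mul_le_mul (h.q1 k i j) (s.h2 i j)))
  have b2 := h.dis fun i => wd (ex N) [i] φ x
  have b3 := le_of_abs_le (abs_sum_fin fun k => abs_mul_le_mul (s.h1 k) (abs_mul_le_mul (h.c1 k) s.h0))
  rw [s.s1] at b2
  rw [e]
  linarith

lemma commutator_two (h : PB K κ ν₁ l t x ν d r ϱ) (s : Sizes φ x X0 X1 X2 X3 X4) (hφ : Sm φ) :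
    ∑ k, ∑ m, wd (ex N) [k, m] φ x * (K.Ad [k] t (wd (ex N) [m] φ) x +
      (K.Ad [m] t (wd (ex N) [k] φ) x + K.Ad [k, m] t φ x)) ≤
      2 * (N ^ 4 * (κ * ν * (X2 * X3)) + N ^ 2 * (ϱ * (X2 * X1)) + d * X2 ^ 2) +
      (κ * ν * X2 ^ 2 + N ^ 3 * (r * (X2 * X1)) + N ^ 2 * (ϱ * (X2 * X0))) := by
  have e1 : ∑ k, ∑ m, wd (ex N) [k, m] φ x * K.Ad [m] t (wd (ex N) [k] φ) x =
      ∑ k, ∑ m, wd (ex N) [k, m] φ x * K.Ad [k] t (wd (ex N) [m] φ) x := by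
    rw [Finset.sum_comm]
    exact Finset.sum_congr rfl fun k _ => Finset.sum_congr rfl fun m _ => by rw [wd_swap hφ]
  have e2 : ∑ k, ∑ m, wd (ex N) [k, m] φ x * K.Ad [k] t (wd (ex N) [m] φ) x =
      (∑ k, ∑ m, wd (ex N) [k, m] φ x * ∑ i, ∑ j, wd (ex N) [k] (sl (K.Q i j) t) x *
        wd (ex N) [i, j, m] φ x) +
      (∑ m, ∑ i, ∑ j, wd (ex N) [j] (sl (K.b i) t) x * wd (ex N) [j, m] φ x *
        wd (ex N) [i, m] φ x) +
      ∑ k, ∑ m, wd (ex N) [k, m] φ x * (wd (ex N) [k] (sl K.c t) x * wd (ex N) [m] φ x) := by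
    have : ∀ m, ∑ i, ∑ j, wd (ex N) [j] (sl (K.b i) t) x * wd (ex N) [j, m] φ x *
        wd (ex N) [i, m] φ x = ∑ k, wd (ex N) [k, m] φ x * ∑ j, wd (ex N) [k] (sl (K.b j) t) x *
          wd (ex N) [j, m] φ x := fun m => by
      rw [Finset.sum_comm]
      refine Finset.sum_congr rfl fun i _ => ?_
      rw [Finset.mul_sum]
      exact Finset.sum_congr rfl fun j _ => by ring
    simp only [this]
    rw [Finset.sum_comm (f := fun m k => wd (ex N) [k, m] φ x * ∑ j, wd (ex N) [k] (sl (K.b j) t) x *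
          wd (ex N) [j, m] φ x)]
    simp only [Coef.Ad, Op, mul_add, Finset.sum_add_distrib]
    rfl
  have e3 : ∑ k, ∑ m, wd (ex N) [k, m] φ x * K.Ad [k, m] t φ x =
      (∑ i, ∑ j, ∑ k, ∑ m, wd (ex N) [k, m] (sl (K.Q i j) t) x * wd (ex N) [i, j] φ x *
        wd (ex N) [k, m] φ x) +
      (∑ k, ∑ m, wd (ex N) [k, m] φ x * ∑ j, wd (ex N) [k, m] (sl (K.b j) t) x *
        wd (ex N) [j] φ x) +
      ∑ k, ∑ m, wd (ex N) [k, m] φ x * (wd (ex N) [k, m] (sl K.c t) x * φ x) := by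
    simp only [Coef.Ad, Op, mul_add, Finset.sum_add_distrib, Finset.mul_sum]
    congr 2
    rw [sum_rot_four fun i j k m => wd (ex N) [k, m] (sl (K.Q i j) t) x * wd (ex N) [i, j] φ x *
        wd (ex N) [k, m] φ x]
    exact Finset.sum_congr rfl fun k _ => Finset.sum_congr rfl fun m _ => Finset.sum_congr rfl
      fun i _ => Finset.sum_congr rfl fun j _ => by ring
  have b1 := le_of_abs_le (abs_sum_fin fun k => abs_sum_fin fun m => abs_mul_le_mul (s.h2 k m)
    (abs_sum_fin fun i => abs_sum_fin fun j => abs_mul_le_mul (h.q1 k i j) (s.h3 i j m)))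
  have b2 : _ ≤ ∑ m, d * ∑ i, wd (ex N) [i, m] φ x ^ 2 :=
    Finset.sum_le_sum fun m _ => h.dis fun i => wd (ex N) [i, m] φ x
  have b3 := le_of_abs_le (abs_sum_fin fun k => abs_sum_fin fun m => abs_mul_le_mul (s.h2 k m)
    (abs_mul_le_mul (h.c1 k) (s.h1 m)))
  have b4 := h.q2 (fun i j => wd (ex N) [i, j] φ x) fun i j => by rw [wd_swap hφ]
  have b5 := le_of_abs_le (abs_sum_fin fun k => abs_sum_fin fun m => abs_mul_le_mul (s.h2 k m)
    (abs_sum_fin fun j => abs_mul_le_mul (h.b2 k m j) (s.h1 j)))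
  have b6 := le_of_abs_le (abs_sum_fin fun k => abs_sum_fin fun m => abs_mul_le_mul (s.h2 k m)
    (abs_mul_le_mul (h.c2 k m) s.h0))
  rw [← Finset.mul_sum, Finset.sum_comm (f := fun m i => wd (ex N) [i, m] φ x ^ 2), s.s2] at b2
  rw [s.s2] at b4
  simp only [mul_add, Finset.sum_add_distrib]
  rw [e1, e3, e2]
  linarith

lemma commutator_three (h : PB K κ ν₁ l t x ν d r ϱ) (s : Sizes φ x X0 X1 X2 X3 X4) (hφ : Sm φ) :
    ∑ k, ∑ m, ∑ p, wd (ex N) [k, m, p] φ x *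
      ((K.Ad [k] t (wd (ex N) [m, p] φ) x + K.Ad [m] t (wd (ex N) [k, p] φ) x +
        K.Ad [p] t (wd (ex N) [k, m] φ) x) +
      (K.Ad [k, m] t (wd (ex N) [p] φ) x + K.Ad [k, p] t (wd (ex N) [m] φ) x +
        K.Ad [m, p] t (wd (ex N) [k] φ) x) + K.Ad [k, m, p] t φ x) ≤
      3 * (N ^ 5 * (κ * ν * (X3 * X4)) + N ^ 3 * (ϱ * (X3 * X2)) + d * X3 ^ 2) +
      3 * (κ * ν * X3 ^ 2 + N ^ 4 * (r * (X3 * X2)) + N ^ 3 * (ϱ * (X3 * X1))) +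
      (N ^ 5 * (κ * ν * (X3 * X2)) + N ^ 4 * (r * (X3 * X1)) + N ^ 3 * (ϱ * (X3 * X0))) := by
  have sw1 : ∀ k m p, wd (ex N) [k, m, p] φ x = wd (ex N) [m, k, p] φ x := fun k m p => by
    rw [wd_swap hφ]
  have sw2 : ∀ k m p, wd (ex N) [k, m, p] φ x = wd (ex N) [k, p, m] φ x := fun k m p => by
    rw [wd_cons, wd_swap hφ]; rfl
  have e1 : ∀ P : Fin N → Fin N → Fin N → ℝ, ∑ k, ∑ m, ∑ p, wd (ex N) [k, m, p] φ x * P m k p =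
      ∑ k, ∑ m, ∑ p, wd (ex N) [k, m, p] φ x * P k m p := fun P => by
    rw [Finset.sum_comm]
    exact Finset.sum_congr rfl fun k _ => Finset.sum_congr rfl fun m _ =>
      Finset.sum_congr rfl fun p _ => by rw [sw1]
  have e2 : ∀ P : Fin N → Fin N → Fin N → ℝ, ∑ k, ∑ m, ∑ p, wd (ex N) [k, m, p] φ x * P k p m =
      ∑ k, ∑ m, ∑ p, wd (ex N) [k, m, p] φ x * P k m p := fun P => by
    refine Finset.sum_congr rfl fun k _ => ?_
    rw [Finset.sum_comm]
    exact Finset.sum_congr rfl fun m _ => Finset.sum_congr rfl fun p _ => by rw [sw2]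
  have e3 : ∀ P : Fin N → Fin N → Fin N → ℝ, ∑ k, ∑ m, ∑ p, wd (ex N) [k, m, p] φ x * P p k m =
      ∑ k, ∑ m, ∑ p, wd (ex N) [k, m, p] φ x * P k m p := fun P =>
    (e2 fun k m p => P m k p).trans (e1 P)
  have e4 : ∀ P : Fin N → Fin N → Fin N → ℝ, ∑ k, ∑ m, ∑ p, wd (ex N) [k, m, p] φ x * P m p k =
      ∑ k, ∑ m, ∑ p, wd (ex N) [k, m, p] φ x * P k m p := fun P =>
    (e1 fun k m p => P k p m).trans (e2 P)
  have f1 : ∑ k, ∑ m, ∑ p, wd (ex N) [k, m, p] φ x * K.Ad [k] t (wd (ex N) [m, p] φ) x =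
      (∑ k, ∑ m, ∑ p, wd (ex N) [k, m, p] φ x * ∑ i, ∑ j, wd (ex N) [k] (sl (K.Q i j) t) x *
        wd (ex N) [i, j, m, p] φ x) +
      (∑ m, ∑ p, ∑ i, ∑ j, wd (ex N) [j] (sl (K.b i) t) x * wd (ex N) [j, m, p] φ x *
        wd (ex N) [i, m, p] φ x) +
      ∑ k, ∑ m, ∑ p, wd (ex N) [k, m, p] φ x * (wd (ex N) [k] (sl K.c t) x *
        wd (ex N) [m, p] φ x) := by
    have h1 : ∀ m p, ∑ i, ∑ j, wd (ex N) [j] (sl (K.b i) t) x * wd (ex N) [j, m, p] φ x *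
        wd (ex N) [i, m, p] φ x = ∑ k, wd (ex N) [k, m, p] φ x *
          ∑ j, wd (ex N) [k] (sl (K.b j) t) x * wd (ex N) [j, m, p] φ x := fun m p => by
      rw [Finset.sum_comm]
      refine Finset.sum_congr rfl fun i _ => ?_
      rw [Finset.mul_sum]
      exact Finset.sum_congr rfl fun j _ => by ring
    simp only [h1]
    rw [← sum_rot fun m p k => wd (ex N) [k, m, p] φ x *
          ∑ j, wd (ex N) [k] (sl (K.b j) t) x * wd (ex N) [j, m, p] φ x]
    simp only [Coef.Ad, Op, mul_add, Finset.sum_add_distrib]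
    rfl
  have f2 : ∑ k, ∑ m, ∑ p, wd (ex N) [k, m, p] φ x * K.Ad [k, m] t (wd (ex N) [p] φ) x =
      (∑ p, ∑ i, ∑ j, ∑ k, ∑ m, wd (ex N) [k, m] (sl (K.Q i j) t) x * wd (ex N) [i, j, p] φ x *
        wd (ex N) [k, m, p] φ x) +
      (∑ k, ∑ m, ∑ p, wd (ex N) [k, m, p] φ x * ∑ j, wd (ex N) [k, m] (sl (K.b j) t) x *
        wd (ex N) [j, p] φ x) +
      ∑ k, ∑ m, ∑ p, wd (ex N) [k, m, p] φ x * (wd (ex N) [k, m] (sl K.c t) x *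
        wd (ex N) [p] φ x) := by
    have g : ∑ p, ∑ i, ∑ j, ∑ k, ∑ m, wd (ex N) [k, m] (sl (K.Q i j) t) x *
        wd (ex N) [i, j, p] φ x * wd (ex N) [k, m, p] φ x =
        ∑ k, ∑ m, ∑ p, wd (ex N) [k, m, p] φ x * ∑ i, ∑ j, wd (ex N) [k, m] (sl (K.Q i j) t) x *
          wd (ex N) [i, j, p] φ x := by
      refine (Finset.sum_congr rfl fun p _ => sum_rot_four fun i j k m =>
        wd (ex N) [k, m] (sl (K.Q i j) t) x * wd (ex N) [i, j, p] φ x *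
          wd (ex N) [k, m, p] φ x).trans ((sum_rot fun k m p => ∑ i, ∑ j,
          wd (ex N) [k, m] (sl (K.Q i j) t) x * wd (ex N) [i, j, p] φ x *
          wd (ex N) [k, m, p] φ x).trans ?_)
      simp only [Finset.mul_sum]
      exact Finset.sum_congr rfl fun k _ => Finset.sum_congr rfl fun m _ => Finset.sum_congr rfl
        fun p _ => Finset.sum_congr rfl fun i _ => Finset.sum_congr rfl fun j _ => by ring
    rw [g]
    simp only [Coef.Ad, Op, mul_add, Finset.sum_add_distrib]
    rfl
  have f3 : ∑ k, ∑ m, ∑ p, wd (ex N) [k, m, p] φ x * K.Ad [k, m, p] t φ x =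
      (∑ k, ∑ m, ∑ p, wd (ex N) [k, m, p] φ x * ∑ i, ∑ j, wd (ex N) [k, m, p] (sl (K.Q i j) t) x *
        wd (ex N) [i, j] φ x) +
      (∑ k, ∑ m, ∑ p, wd (ex N) [k, m, p] φ x * ∑ j, wd (ex N) [k, m, p] (sl (K.b j) t) x *
        wd (ex N) [j] φ x) +
      ∑ k, ∑ m, ∑ p, wd (ex N) [k, m, p] φ x * (wd (ex N) [k, m, p] (sl K.c t) x * φ x) := by
    simp only [Coef.Ad, Op, mul_add, Finset.sum_add_distrib]
  have b1 := le_of_abs_le (abs_sum_fin fun k => abs_sum_fin fun m => abs_sum_fin fun p =>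
    abs_mul_le_mul (s.h3 k m p) (abs_sum_fin fun i => abs_sum_fin fun j =>
      abs_mul_le_mul (h.q1 k i j) (s.h4 i j m p)))
  have b2 : _ ≤ ∑ m, ∑ p, d * ∑ i, wd (ex N) [i, m, p] φ x ^ 2 :=
    Finset.sum_le_sum fun m _ => Finset.sum_le_sum fun p _ =>
      h.dis fun i => wd (ex N) [i, m, p] φ x
  have b3 := le_of_abs_le (abs_sum_fin fun k => abs_sum_fin fun m => abs_sum_fin fun p =>
    abs_mul_le_mul (s.h3 k m p) (abs_mul_le_mul (h.c1 k) (s.h2 m p)))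
  have b4 : _ ≤ ∑ p, κ * ν * ∑ i, ∑ j, wd (ex N) [i, j, p] φ x ^ 2 :=
    Finset.sum_le_sum fun p _ =>
      h.q2 (fun i j => wd (ex N) [i, j, p] φ x) fun i j => by rw [wd_swap hφ]
  have b5 := le_of_abs_le (abs_sum_fin fun k => abs_sum_fin fun m => abs_sum_fin fun p =>
    abs_mul_le_mul (s.h3 k m p) (abs_sum_fin fun j => abs_mul_le_mul (h.b2 k m j) (s.h2 j p)))
  have b6 := le_of_abs_le (abs_sum_fin fun k => abs_sum_fin fun m => abs_sum_fin fun p =>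
    abs_mul_le_mul (s.h3 k m p) (abs_mul_le_mul (h.c2 k m) (s.h1 p)))
  have b7 := le_of_abs_le (abs_sum_fin fun k => abs_sum_fin fun m => abs_sum_fin fun p =>
    abs_mul_le_mul (s.h3 k m p) (abs_sum_fin fun i => abs_sum_fin fun j =>
      abs_mul_le_mul (h.q3 k m p i j) (s.h2 i j)))
  have b8 := le_of_abs_le (abs_sum_fin fun k => abs_sum_fin fun m => abs_sum_fin fun p =>
    abs_mul_le_mul (s.h3 k m p) (abs_sum_fin fun j => abs_mul_le_mul (h.b3 k m p j) (s.h1 j)))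
  have b9 := le_of_abs_le (abs_sum_fin fun k => abs_sum_fin fun m => abs_sum_fin fun p =>
    abs_mul_le_mul (s.h3 k m p) (abs_mul_le_mul (h.c3 k m p) s.h0))
  rw [← Finset.mul_sum, sum_rot (fun i j p => wd (ex N) [i, j, p] φ x ^ 2), s.s3] at b4
  have r2 : ∑ m, ∑ p, ∑ i, wd (ex N) [i, m, p] φ x ^ 2 = X3 ^ 2 := by
    rw [← s.s3, ← sum_rot fun m p i => wd (ex N) [i, m, p] φ x ^ 2]
  simp only [← Finset.mul_sum] at b2
  rw [r2] at b2
  simp only [mul_add, Finset.sum_add_distrib]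
  rw [e1 fun k m p => K.Ad [k] t (wd (ex N) [m, p] φ) x,
    e3 fun k m p => K.Ad [k] t (wd (ex N) [m, p] φ) x,
    e2 fun k m p => K.Ad [k, m] t (wd (ex N) [p] φ) x,
    e4 fun k m p => K.Ad [k, m] t (wd (ex N) [p] φ) x, f1, f2, f3]
  linarith

end Commutators

section BernsteinAlgebra

lemma young_weighted {κ l L : ℝ} (hl : 0 < l) (hL : L * l = κ ^ 2) {p : ℝ} (hp : 0 ≤ p) (x y : ℝ) :
    2 * κ * (p * (x * y)) ≤ l * (p * x ^ 2) + L * (p * y ^ 2) := by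
  have h : 0 ≤ l * x ^ 2 + L * y ^ 2 - 2 * κ * (x * y) := by
    have : 0 ≤ l * (l * x ^ 2 + L * y ^ 2 - 2 * κ * (x * y)) := by
      have : l * (l * x ^ 2 + L * y ^ 2 - 2 * κ * (x * y)) = (l * x - κ * y) ^ 2 := by
        linear_combination y ^ 2 * hL
      rw [this]; positivity
    exact nonneg_of_mul_nonneg_right this hl
  nlinarith [mul_nonneg hp h]

lemma young_geometric {κ ε m p q : ℝ} (hκ : 1 ≤ κ) (hm : m ^ 2 ≤ ε * p * q)
    (hp : 0 ≤ p) (hq : 0 ≤ q) (hε : κ ^ 2 * ε ≤ 1 / 1000) (x y : ℝ) :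
    κ * (m * (x * y)) ≤ (q * x ^ 2 + p * y ^ 2) / 10 := by
  refine le_of_abs_le (abs_le_of_sq_le_sq ?_ (by positivity))
  have h1 : (κ * (m * (x * y))) ^ 2 ≤ 1 / 1000 * ((p * q) * (x * y) ^ 2) := by
    calc (κ * (m * (x * y))) ^ 2 = κ ^ 2 * m ^ 2 * (x * y) ^ 2 := by ring
      _ ≤ κ ^ 2 * (ε * p * q) * (x * y) ^ 2 := by gcongr
      _ = κ ^ 2 * ε * ((p * q) * (x * y) ^ 2) := by ring
      _ ≤ _ := by gcongr
  nlinarith [sq_nonneg (q * x ^ 2 - p * y ^ 2), mul_nonneg (mul_nonneg hp hq) (sq_nonneg (x * y))]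

/-- Weights of the Bernstein function. -/
structure Wts (ε w w' m v : ℝ) : Prop where
  w_nonneg : 0 ≤ w
  le : w ≤ ε * w'
  m_nonneg : 0 ≤ m
  m_le : m ≤ ε * w'
  m_sq : m ^ 2 ≤ ε * w * w'
  v_le : v ≤ ε * w'

set_option maxHeartbeats 2000000 in
lemma bernstein_algebra {κ l L ν₁ ε ν d r ϱ X0 X1 X2 X3 X4 S1 S2 S3 w1 w2 w3 m1 m2 m3 v1 v2 v3 : ℝ}
    (hκ : 1 ≤ κ) (hl : 0 < l) (hL : L * l = κ ^ 2) (hν₁ : 0 < ν₁) (hν : ν₁ ≤ ν) (hr : 0 ≤ r)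
    (hε0 : 0 ≤ ε) (hε : κ ^ 2 * ε ≤ 1 / 1000) (hεL : L * ε ≤ l / 4) (hεν : ε ≤ ν₁ / 10)
    (hd : d + l * r + l * ϱ ^ 2 ≤ κ * ν)
    (W1 : Wts ε w1 1 m1 v1) (W2 : Wts ε w2 w1 m2 v2) (W3 : Wts ε w3 w2 m3 v3)
    (hS1 : S1 ≤ κ * (ν * (X1 * X2) + ϱ * (X1 * X0)) + d * X1 ^ 2)
    (hS2 : S2 ≤ κ * (ν * (X2 * X3) + ν * X2 ^ 2 + r * (X2 * X1) + ϱ * (X2 * X1) +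
      ϱ * (X2 * X0)) + 2 * d * X2 ^ 2)
    (hS3 : S3 ≤ κ * (ν * (X3 * X4) + ν * X3 ^ 2 + ν * (X3 * X2) + r * (X3 * X2) + r * (X3 * X1) +
      ϱ * (X3 * X2) + ϱ * (X3 * X1) + ϱ * (X3 * X0)) + 3 * d * X3 ^ 2) :
    2 * (w1 * S1 + w2 * S2 + w3 * S3) -
      2 * ν * (X1 ^ 2 + w1 * X2 ^ 2 + w2 * X3 ^ 2 + w3 * X4 ^ 2) +
      (κ * ν * (m1 * (X1 ^ 2 + X1 * X2)) + v1 * X1 ^ 2) +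
      (κ * ν * (m2 * (X2 ^ 2 + X2 * X3)) + v2 * X2 ^ 2) +
      (κ * ν * (m3 * (X3 ^ 2 + X3 * X4)) + v3 * X3 ^ 2) ≤
    10 * L * (X0 ^ 2 + w1 * X1 ^ 2 + w2 * X2 ^ 2 + w3 * X3 ^ 2) := by
  have hν0 : 0 < ν := hν₁.trans_le hν
  have hκ0 : 0 < κ := by linarith
  have hL0 : 0 < L := by
    rw [eq_div_of_mul_eq hl.ne' hL]; positivity
  have hε1 : ε ≤ 1 := by
    linarith [le_mul_of_one_le_left hε0 (one_le_pow₀ hκ (n := 2))]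
  have w1n := W1.w_nonneg
  have w2n := W2.w_nonneg
  have w3n := W3.w_nonneg
  have w1le : w1 ≤ 1 := by linarith [W1.le]
  have w2le : w2 ≤ w1 := W2.le.trans (mul_le_of_le_one_left w1n hε1)
  have w3le : w3 ≤ w2 := W3.le.trans (mul_le_of_le_one_left w2n hε1)
  -- absorption of a lower weight into the previous gradient term
  have ab : ∀ {w w' X : ℝ}, w ≤ ε * w' → 0 ≤ w' →
      κ ^ 2 * (w * (ν * X ^ 2)) ≤ w' * ν * X ^ 2 / 1000 ∧
        κ * (w * (ν * X ^ 2)) ≤ w' * ν * X ^ 2 / 1000 := by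
    intro w w' X h h'
    have hX : 0 ≤ ν * X ^ 2 := by positivity
    have e0 : 0 ≤ w' * (ν * X ^ 2) := mul_nonneg h' hX
    have hκε : κ * ε ≤ 1 / 1000 := by
      refine le_trans ?_ hε
      gcongr
      exact le_self_pow₀ hκ two_ne_zero
    constructor
    · have : κ ^ 2 * (w * (ν * X ^ 2)) ≤ κ ^ 2 * (ε * w' * (ν * X ^ 2)) := by gcongr
      linarith only [this, mul_le_mul_of_nonneg_right hε e0]
    · have : κ * (w * (ν * X ^ 2)) ≤ κ * (ε * w' * (ν * X ^ 2)) := by gcongr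
      linarith only [this, mul_le_mul_of_nonneg_right hκε e0]
  have vv : ∀ {v w' X : ℝ}, v ≤ ε * w' → 0 ≤ w' → v * X ^ 2 ≤ w' * ν * X ^ 2 / 10 := by
    intro v w' X h h'
    have h1 : v * X ^ 2 ≤ ε * w' * X ^ 2 := by gcongr
    have h2 : ε * (w' * X ^ 2) ≤ ν / 10 * (w' * X ^ 2) := by gcongr; linarith only [hεν, hν]
    linarith only [h1, h2]
  have yν : ∀ {w X Y : ℝ}, 0 ≤ w →
      2 * κ * (w * ν * (Y * X)) ≤ 1 / 10 * (w * ν * Y ^ 2) + 10 * κ ^ 2 * (w * ν * X ^ 2) := by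
    intro w X Y h
    have key := young_weighted (κ := κ) (l := 1 / 10) (L := 10 * κ ^ 2) (by norm_num) (by ring)
      (p := w * ν) (mul_nonneg h hν0.le) Y X
    exact key
  -- terms at level one
  obtain ⟨a1, a2⟩ := ab (X := X1) W1.le zero_le_one
  have a3 := (ab (X := X1) W1.m_le zero_le_one).2
  have a4 := vv (X := X1) W1.v_le zero_le_one
  have a5 := mul_le_mul_of_nonneg_left (young_geometric hκ W1.m_sq w1n zero_le_one hε X1 X2) hν0.le
  have a6 := yν (X := X1) (Y := X2) w1n
  have a7 := young_weighted hl hL w1n (ϱ * X1) X0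
  have a8 : L * (w1 * X0 ^ 2) ≤ L * X0 ^ 2 := by
    have := mul_le_mul_of_nonneg_right w1le (mul_nonneg hL0.le (sq_nonneg X0)); linarith
  have a9 := mul_le_mul_of_nonneg_left hd (mul_nonneg w1n (sq_nonneg X1))
  have a10 := mul_le_mul_of_nonneg_left hS1 w1n
  -- terms at level two
  obtain ⟨b1, b2⟩ := ab (X := X2) W2.le w1n
  have b3 := (ab (X := X2) W2.m_le w1n).2
  have b4 := vv (X := X2) W2.v_le w1n
  have b5 := mul_le_mul_of_nonneg_left (young_geometric hκ W2.m_sq w2n w1n hε X2 X3) hν0.le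
  have b6 := yν (X := X2) (Y := X3) w2n
  have b7 := young_weighted hl hL w2n (ϱ * X2) X0
  have b7' := young_weighted hl hL w2n (ϱ * X2) X1
  have b8 : L * (w2 * X0 ^ 2) ≤ L * X0 ^ 2 := by
    have := mul_le_mul_of_nonneg_right (w2le.trans w1le) (mul_nonneg hL0.le (sq_nonneg X0)); linarith
  have b8' : L * (w2 * X1 ^ 2) ≤ L * (w1 * X1 ^ 2) := by gcongr
  have b9 := mul_le_mul_of_nonneg_left hd (mul_nonneg w2n (sq_nonneg X2))
  have b10 := mul_le_mul_of_nonneg_left hS2 w2n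
  have b11 := young_weighted hl hL (mul_nonneg w2n hr) X2 X1
  have rr : ∀ {w w' X : ℝ}, w ≤ ε * w' → 0 ≤ w' → L * (w * r * X ^ 2) ≤ l / 4 * (w' * r * X ^ 2) := by
    intro w w' X h h'
    have h1 : L * (w * r * X ^ 2) ≤ L * (ε * w' * r * X ^ 2) := by gcongr
    have h2 : L * ε * (w' * r * X ^ 2) ≤ l / 4 * (w' * r * X ^ 2) := by gcongr
    linarith
  have b12 := rr (X := X1) W2.le w1n
  -- terms at level three
  obtain ⟨c1, c2⟩ := ab (X := X3) W3.le w2n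
  have c3 := (ab (X := X3) W3.m_le w2n).2
  have c4 := vv (X := X3) W3.v_le w2n
  have c5 := mul_le_mul_of_nonneg_left (young_geometric hκ W3.m_sq w3n w2n hε X3 X4) hν0.le
  have c6 := yν (X := X3) (Y := X4) w3n
  have c7 := young_weighted hl hL w3n (ϱ * X3) X0
  have c7' := young_weighted hl hL w3n (ϱ * X3) X1
  have c7'' := young_weighted hl hL w3n (ϱ * X3) X2
  have c8 : L * (w3 * X0 ^ 2) ≤ L * X0 ^ 2 := by
    have := mul_le_mul_of_nonneg_right (w3le.trans (w2le.trans w1le))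
      (mul_nonneg hL0.le (sq_nonneg X0)); linarith
  have c8' : L * (w3 * X1 ^ 2) ≤ L * (w1 * X1 ^ 2) := by gcongr; exact w3le.trans w2le
  have c8'' : L * (w3 * X2 ^ 2) ≤ L * (w2 * X2 ^ 2) := by gcongr
  have c9 := mul_le_mul_of_nonneg_left hd (mul_nonneg w3n (sq_nonneg X3))
  have c10 := mul_le_mul_of_nonneg_left hS3 w3n
  have c11 := young_weighted hl hL (mul_nonneg w3n hr) X3 X2
  have c12 := rr (X := X2) W3.le w2n
  have c13 := young_weighted hl hL (mul_nonneg w3n hr) X3 X1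
  have c14 := rr (X := X1) (W3.le.trans (mul_le_mul_of_nonneg_left w2le hε0)) w1n
  have c15 : 2 * κ * (w3 * ν * (X3 * X2)) ≤ κ * (w3 * (ν * X3 ^ 2)) + κ * (w3 * (ν * X2 ^ 2)) := by
    have : 0 ≤ κ * (w3 * ν) * (X3 - X2) ^ 2 := by positivity
    linarith only [this]
  have c16 := (ab (X := X2) (W3.le.trans (mul_le_mul_of_nonneg_left w2le hε0)) w1n).2
  -- nonnegative leftovers
  have p0 : 0 ≤ ν * X1 ^ 2 := by positivity
  have p1 : 0 ≤ w1 * ν * X2 ^ 2 := by positivity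
  have p2 : 0 ≤ w2 * ν * X3 ^ 2 := by positivity
  have p3 : 0 ≤ w3 * ν * X4 ^ 2 := by positivity
  have n1 : 0 ≤ l * (w1 * r * X1 ^ 2) := by positivity
  have n2 : 0 ≤ l * (w2 * r * X2 ^ 2) := by positivity
  have n3 : 0 ≤ l * (w3 * r * X3 ^ 2) := by positivity
  have q1 : 0 ≤ l * (w1 * (ϱ ^ 2 * X1 ^ 2)) := by positivity
  have q2 : 0 ≤ l * (w2 * (ϱ ^ 2 * X2 ^ 2)) := by positivity
  have q3 : 0 ≤ l * (w3 * (ϱ ^ 2 * X3 ^ 2)) := by positivity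
  have o0 : 0 ≤ L * X0 ^ 2 := by positivity
  have o1 : 0 ≤ L * (w1 * X1 ^ 2) := by positivity
  have o2 : 0 ≤ L * (w2 * X2 ^ 2) := by positivity
  have o3 : 0 ≤ L * (w3 * X3 ^ 2) := by positivity
  have A : 2 * (w1 * S1) + (κ * ν * (m1 * (X1 ^ 2 + X1 * X2)) + v1 * X1 ^ 2) ≤
      1 / 2 * (ν * X1 ^ 2) + 1 / 2 * (w1 * ν * X2 ^ 2) - 2 * (l * (w1 * r * X1 ^ 2)) + L * X0 ^ 2 := by
    linarith only [a1, a2, a3, a4, a5, a6, a7, a8, a9, a10, p0, p1, n1, q1, o0]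
  have B : 2 * (w2 * S2) + (κ * ν * (m2 * (X2 ^ 2 + X2 * X3)) + v2 * X2 ^ 2) ≤
      1 / 2 * (w1 * ν * X2 ^ 2) + 1 / 2 * (w2 * ν * X3 ^ 2) - 3 * (l * (w2 * r * X2 ^ 2)) +
        l / 4 * (w1 * r * X1 ^ 2) + L * X0 ^ 2 + L * (w1 * X1 ^ 2) := by
    linarith only [b1, b2, b3, b4, b5, b6, b7, b7', b8, b8', b9, b10, b11, b12, p1, p2, n2, q2, o0, o1]
  have C : 2 * (w3 * S3) + (κ * ν * (m3 * (X3 ^ 2 + X3 * X4)) + v3 * X3 ^ 2) ≤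
      1 / 10 * (w1 * ν * X2 ^ 2) + 1 / 2 * (w2 * ν * X3 ^ 2) + 1 / 2 * (w3 * ν * X4 ^ 2) +
        l / 4 * (w2 * r * X2 ^ 2) + l / 4 * (w1 * r * X1 ^ 2) + L * X0 ^ 2 + L * (w1 * X1 ^ 2) +
        L * (w2 * X2 ^ 2) := by
    linarith only [c1, c2, c3, c4, c5, c6, c7, c7', c7'', c8, c8', c8'', c9, c10, c11, c12, c13, c14, c15, c16, p1, p2, p3, n3, q3, o0, o1, o2]
  linarith only [A, B, C, p0, p1, p2, p3, n1, n2, o0, o1, o2, o3]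

end BernsteinAlgebra

section BernsteinCutoff

variable {N : ℕ}

/-- The quadratic cutoff function `1 - |x|² / R²`. -/
def cut (N : ℕ) (R : ℝ) (x : ES N) : ℝ := 1 - (R ^ 2)⁻¹ * ∑ i, x i * x i

lemma sm_coord (i : Fin N) : Sm fun x : ES N => x i :=
  (EuclideanSpace.proj i : ES N →L[ℝ] ℝ).contDiff

lemma dd_coord (i k : Fin N) : dd (ex N k) (fun x : ES N => x i) = fun _ => if i = k then 1 else 0 := by
  funext y
  have : (fun x : ES N => x i) = (EuclideanSpace.proj i : ES N →L[ℝ] ℝ) := rfl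
  rw [dd, this, ContinuousLinearMap.fderiv]
  simp [ex]

lemma cut_eq (R : ℝ) (x : ES N) : cut N R x = 1 - (R ^ 2)⁻¹ * ‖x‖ ^ 2 := by
  rw [cut, EuclideanSpace.real_norm_sq_eq]
  simp only [pow_two]

lemma sm_cut (R : ℝ) : Sm (cut N R) :=
  (sm_const 1).sub ((sm_const _).mul (Sm.sum fun i _ => (sm_coord i).mul (sm_coord i)))

lemma wd_cut_one (R : ℝ) (k : Fin N) : wd (ex N) [k] (cut N R) = fun x => -(2 * (R ^ 2)⁻¹) * x k := by
  have hs : Sm fun x : ES N => ∑ i, x i * x i := Sm.sum fun i _ => (sm_coord i).mul (sm_coord i)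
  rw [wd_cons, wd_nil]
  unfold cut
  rw [dd_sub (sm_const _) ((sm_const _).mul hs), dd_const, dd_const_mul hs,
    dd_sum fun i _ => (sm_coord i).mul (sm_coord i)]
  funext x
  simp only [dd_mul (sm_coord _) (sm_coord _), dd_coord]
  simp [Finset.sum_add_distrib]
  ring

lemma wd_cut_two (R : ℝ) (i k : Fin N) :
    wd (ex N) [i, k] (cut N R) = fun _ => -(2 * (R ^ 2)⁻¹) * if k = i then 1 else 0 := by
  have : wd (ex N) [i, k] (cut N R) = dd (ex N i) (wd (ex N) [k] (cut N R)) := rfl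
  rw [this, wd_cut_one, dd_const_mul (sm_coord _), dd_coord]

lemma cut_nonneg {R : ℝ} (hR : 1 ≤ R) {x : ES N} (hx : ‖x‖ ≤ R) : 0 ≤ cut N R x := by
  rw [cut_eq, sub_nonneg, inv_mul_le_iff₀ (by positivity), mul_one]
  gcongr

lemma cut_le_one (R : ℝ) (x : ES N) : cut N R x ≤ 1 := by
  rw [cut_eq]
  have : 0 ≤ (R ^ 2)⁻¹ * ‖x‖ ^ 2 := by positivity
  linarith

lemma cut_eq_zero {R : ℝ} (hR : 1 ≤ R) {x : ES N} (hx : ‖x‖ = R) : cut N R x = 0 := by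
  have : R ≠ 0 := by positivity
  rw [cut_eq, hx, inv_mul_cancel₀ (by positivity), sub_self]

lemma cut_half {R : ℝ} (hR : 1 ≤ R) {x : ES N} (hx : ‖x‖ ≤ R / 2) : 1 / 2 ≤ cut N R x := by
  have h0 : 0 < R := by linarith
  have h1 : ‖x‖ ^ 2 ≤ (R / 2) ^ 2 := by gcongr
  have h2 : (R ^ 2)⁻¹ * ‖x‖ ^ 2 ≤ (R ^ 2)⁻¹ * (R / 2) ^ 2 := by gcongr
  have h3 : (R ^ 2)⁻¹ * (R / 2) ^ 2 = 1 / 4 := by field_simp; norm_num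
  rw [cut_eq]
  linarith

lemma ball_weight {R : ℝ} (hR : 1 ≤ R) {x : ES N} (hx : ‖x‖ ≤ R) :
    2 * (R ^ 2)⁻¹ * (1 + ‖x‖ ^ 2) ≤ 4 := by
  have h0 : 0 < R := by linarith
  have h1 : 1 + ‖x‖ ^ 2 ≤ 2 * R ^ 2 := by nlinarith [norm_nonneg x]
  calc 2 * (R ^ 2)⁻¹ * (1 + ‖x‖ ^ 2) ≤ 2 * (R ^ 2)⁻¹ * (2 * R ^ 2) := by gcongr
    _ = 4 := by field_simp; norm_num

variable {K : Coef N} {κ ν₁ l t ν d r ϱ R : ℝ} {x : ES N}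

local notation "QQ" => fun i j => sl (K.Q i j) t
local notation "BB" => fun j => sl (K.b j) t

lemma op_cut (h : PB K κ ν₁ l t x ν d r ϱ) (hκν : 0 ≤ κ * ν) (hR : 1 ≤ R) (hx : ‖x‖ ≤ R) :
    -(4 * (κ * ν)) ≤ Op QQ BB 0 (cut N R) x := by
  have e : Op QQ BB 0 (cut N R) x =
      -(2 * (R ^ 2)⁻¹) * ((∑ i, K.Q i i (t, x)) + ∑ j, K.b j (t, x) * x j) := by
    simp only [Op, wd_cut_one, wd_cut_two, sl]
    simp only [mul_add, Finset.mul_sum]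
    simp
    congr 1
    · exact congrArg Neg.neg (Finset.sum_congr rfl fun _ _ => by ring)
    · exact congrArg Neg.neg (Finset.sum_congr rfl fun _ _ => by ring)
  have h1 : 2 * (R ^ 2)⁻¹ * ((∑ i, K.Q i i (t, x)) + ∑ j, K.b j (t, x) * x j) ≤
      2 * (R ^ 2)⁻¹ * (κ * (1 + ‖x‖ ^ 2) * ν) := by
    gcongr
    exact h.drift
  have h2 : 2 * (R ^ 2)⁻¹ * (1 + ‖x‖ ^ 2) * (κ * ν) ≤ 4 * (κ * ν) := by
    gcongr
    exact ball_weight hR hx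
  rw [e]
  linarith

lemma gam_cut (h : PB K κ ν₁ l t x ν d r ϱ) (hκν : 0 ≤ κ * ν) (hR : 1 ≤ R) (hx : ‖x‖ ≤ R)
    {g : ES N → ℝ} {Y : ℝ} (hY : ∀ j, |wd (ex N) [j] g x| ≤ Y) :
    |Gam QQ (cut N R) g x| ≤ 4 * (κ * ν) * (N * Y) := by
  have e : Gam QQ (cut N R) g x =
      ∑ j, -(2 * (R ^ 2)⁻¹) * (∑ i, K.Q j i (t, x) * x i) * wd (ex N) [j] g x := by
    simp only [Gam, wd_cut_one, sl]
    rw [Finset.sum_comm]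
    refine Finset.sum_congr rfl fun j _ => ?_
    rw [Finset.mul_sum, Finset.sum_mul]
    refine Finset.sum_congr rfl fun i _ => ?_
    rw [K.symm i j]; ring
  rw [e]
  refine (abs_sum_fin (B := 4 * (κ * ν) * Y) fun j => ?_).trans (le_of_eq (by ring))
  refine abs_mul_le_mul ?_ (hY j)
  rw [abs_mul, abs_neg, abs_of_nonneg (by positivity)]
  calc 2 * (R ^ 2)⁻¹ * |∑ i, K.Q j i (t, x) * x i|
      ≤ 2 * (R ^ 2)⁻¹ * (κ * (1 + ‖x‖ ^ 2) * ν) := by gcongr; exact h.qx j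
    _ = 2 * (R ^ 2)⁻¹ * (1 + ‖x‖ ^ 2) * (κ * ν) := by ring
    _ ≤ 4 * (κ * ν) := by gcongr; exact ball_weight hR hx

lemma gam_comm (f g : ES N → ℝ) : Gam QQ f g x = Gam QQ g f x := by
  simp only [Gam]
  rw [Finset.sum_comm]
  refine Finset.sum_congr rfl fun j _ => Finset.sum_congr rfl fun i _ => ?_
  rw [show sl (K.Q i j) t x = sl (K.Q j i) t x from K.symm _ _ _]; ring

lemma gam_self (h : PB K κ ν₁ l t x ν d r ϱ) (f : ES N → ℝ) :
    ν * ∑ m, wd (ex N) [m] f x ^ 2 ≤ Gam QQ f f x := h.ell fun m => wd (ex N) [m] f x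

variable {ι : Type*} [Fintype ι]

lemma op_sum_sq (h : PB K κ ν₁ l t x ν d r ϱ) {F : ι → ES N → ℝ} (hF : ∀ i, Sm (F i)) :
    2 * (∑ i, F i x * Op QQ BB 0 (F i) x) + 2 * ν * ∑ i, ∑ m, wd (ex N) [m] (F i) x ^ 2 ≤
      Op QQ BB 0 (fun y => ∑ i, F i y * F i y) x := by
  rw [op_sum fun i _ => (hF i).mul (hF i), Finset.mul_sum, Finset.mul_sum, ← Finset.sum_add_distrib]
  refine Finset.sum_le_sum fun i _ => ?_
  rw [op_mul (hF i) (hF i)]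
  linarith [gam_self h (F i)]

lemma op_cut_pow_sum_sq (h : PB K κ ν₁ l t x ν d r ϱ) (hκ : 0 ≤ κ) (hν : 0 ≤ ν) (hR : 1 ≤ R)
    (hx : ‖x‖ ≤ R) {F : ι → ES N → ℝ} (hF : ∀ i, Sm (F i)) (n : ℕ) {X Y : ℝ}
    (hX : ∀ i, |F i x| ≤ X) (hY : ∀ i m, |wd (ex N) [m] (F i) x| ≤ Y) :
    cut N R x ^ (n + 2) * (2 * (∑ i, F i x * Op QQ BB 0 (F i) x) +
      2 * ν * ∑ i, ∑ m, wd (ex N) [m] (F i) x ^ 2) -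
      (n + 2) * cut N R x ^ (n + 1) * (κ * ν) *
        (4 * (∑ i, F i x * F i x) + 16 * (Fintype.card ι * N) * (X * Y)) ≤
    Op QQ BB 0 (fun y => cut N R y ^ (n + 2) * ∑ i, F i y * F i y) x := by
  have hκν : 0 ≤ κ * ν := mul_nonneg hκ hν
  have hS : Sm fun y => ∑ i, F i y * F i y := Sm.sum fun i _ => (hF i).mul (hF i)
  have hc := cut_nonneg hR hx
  have hS0 : 0 ≤ ∑ i, F i x * F i x := Finset.sum_nonneg fun i _ => mul_self_nonneg _
  rw [op_mul ((sm_cut R).pow _) hS, op_pow (sm_cut R), gam_comm _ (fun y => cut N R y ^ (n + 2)),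
    gam_pow (sm_cut R) (n + 1)]
  have hD : ∀ j, |wd (ex N) [j] (fun y => ∑ i, F i y * F i y) x| ≤ Fintype.card ι * (2 * (X * Y)) := by
    intro j
    have : wd (ex N) [j] (fun y => ∑ i, F i y * F i y) x =
        ∑ i, (wd (ex N) [j] (F i) x * F i x + F i x * wd (ex N) [j] (F i) x) := by
      rw [wd_cons, wd_nil, dd_sum fun i _ => (hF i).mul (hF i)]
      exact Finset.sum_congr rfl fun i _ => congrFun (dd_mul (hF i) (hF i) _) x
    rw [this]
    refine (Finset.abs_sum_le_sum_abs _ _).trans ?_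
    refine (Finset.sum_le_card_nsmul _ _ (2 * (X * Y)) fun i _ => ?_).trans (by simp)
    have := abs_mul_le_mul (hX i) (hY i j)
    rw [show wd (ex N) [j] (F i) x * F i x + F i x * wd (ex N) [j] (F i) x =
      2 * (F i x * wd (ex N) [j] (F i) x) by ring, abs_mul, abs_two]
    linarith
  have g1 := (abs_le.1 (gam_cut h hκν hR hx hD)).1
  have g2 : 0 ≤ Gam QQ (cut N R) (cut N R) x :=
    le_trans (mul_nonneg hν (Finset.sum_nonneg fun _ _ => sq_nonneg _)) (gam_self h _)
  have g3 := op_cut h hκν hR hx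
  have g4 := op_sum_sq h hF
  have p1 := mul_le_mul_of_nonneg_left g4 (pow_nonneg hc (n + 2))
  have p2 : 0 ≤ (n + 2 : ℝ) * cut N R x ^ (n + 1) := by positivity
  have p3 := mul_le_mul_of_nonneg_left g3 (mul_nonneg p2 hS0)
  have p4 := mul_le_mul_of_nonneg_left g1 p2
  have p5 : 0 ≤ (∑ i, F i x * F i x) * ((n + 2) * (n + 1) * cut N R x ^ n *
    Gam QQ (cut N R) (cut N R) x) := by positivity
  push_cast
  rw [show ((n : ℝ) + 1 + 1) = n + 2 by ring]
  generalize Gam QQ (cut N R) (cut N R) x = G1 at *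
  generalize Op QQ BB 0 (cut N R) x = G2 at *
  generalize Gam QQ (cut N R) (fun y => ∑ i, F i y * F i y) x = G3 at *
  generalize Op QQ BB 0 (fun y => ∑ i, F i y * F i y) x = G4 at *
  generalize (∑ i, F i x * F i x) = S at *
  generalize cut N R x ^ (n + 1) = c1 at *
  generalize cut N R x ^ (n + 2) = c2 at *
  linarith only [p1, p3, p4, p5]

end BernsteinCutoff

section BernsteinPoint

variable {N : ℕ}

/-- Sum of the squares of a family of derivatives. -/
def lv {ι : Type*} [Fintype ι] (γ : ι → List (Fin N)) (w : ES N → ℝ) (x : ES N) : ℝ :=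
  ∑ i, wd (ex N) (γ i) w x * wd (ex N) (γ i) w x

/-- Time derivative of `lv` along the evolution with generator `A`. -/
def lvt {ι : Type*} [Fintype ι] (γ : ι → List (Fin N)) (w Aw : ES N → ℝ) (x : ES N) : ℝ :=
  2 * ∑ i, wd (ex N) (γ i) w x * wd (ex N) (γ i) Aw x

/-- Words of length one, two and three. -/
def w1 (i : Fin N) : List (Fin N) := [i]
def w2 (p : Fin N × Fin N) : List (Fin N) := [p.1, p.2]
def w3 (p : Fin N × Fin N × Fin N) : List (Fin N) := [p.1, p.2.1, p.2.2]

/-- The Bernstein function. -/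
def bern (R A₁ A₂ A₃ : ℝ) (w : ES N → ℝ) (x : ES N) : ℝ :=
  w x * w x + A₁ * (cut N R x ^ (0 + 2) * lv w1 w x) + A₂ * (cut N R x ^ (2 + 2) * lv w2 w x) +
    A₃ * (cut N R x ^ (4 + 2) * lv w3 w x)

lemma lv_nonneg {ι : Type*} [Fintype ι] (γ : ι → List (Fin N)) (w : ES N → ℝ) (x : ES N) :
    0 ≤ lv γ w x := Finset.sum_nonneg fun _ _ => mul_self_nonneg _

lemma le_lv {ι : Type*} [Fintype ι] (γ : ι → List (Fin N)) (w : ES N → ℝ) (x : ES N) (i : ι) :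
    wd (ex N) (γ i) w x ^ 2 ≤ lv γ w x := by
  rw [pow_two]
  exact Finset.single_le_sum (f := fun i => wd (ex N) (γ i) w x * wd (ex N) (γ i) w x)
    (fun _ _ => mul_self_nonneg _) (Finset.mem_univ i)

lemma sm_lv {ι : Type*} [Fintype ι] (γ : ι → List (Fin N)) {w : ES N → ℝ} (hw : Sm w) :
    Sm (lv γ w) := Sm.sum fun i _ => (hw.wd _ (γ i)).mul (hw.wd _ (γ i))

lemma sm_bern (R A₁ A₂ A₃ : ℝ) {w : ES N → ℝ} (hw : Sm w) : Sm (bern R A₁ A₂ A₃ w) :=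
  (((hw.mul hw).add ((sm_const _).mul (((sm_cut R).pow _).mul (sm_lv _ hw)))).add
    ((sm_const _).mul (((sm_cut R).pow _).mul (sm_lv _ hw)))).add
    ((sm_const _).mul (((sm_cut R).pow _).mul (sm_lv _ hw)))

variable {K : Coef N} {κ ν₁ l t ν d r ϱ R : ℝ} {x : ES N}

local notation "QQ" => fun i j => sl (K.Q i j) t
local notation "BB" => fun j => sl (K.b j) t

lemma level_zero (h : PB K κ ν₁ l t x ν d r ϱ) {w : ES N → ℝ} (hw : Sm w) :
    2 * (w x * K.A t w x) - Op QQ BB 0 (fun y => w y * w y) x ≤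
      2 * κ * (w x * w x) - 2 * ν * ∑ m, wd (ex N) [m] w x ^ 2 := by
  rw [op_mul hw hw, Coef.A, op_split]
  have h1 := gam_self h w
  have h2 : sl K.c t x * (w x * w x) ≤ κ * (w x * w x) :=
    mul_le_mul_of_nonneg_right h.c_le (mul_self_nonneg _)
  linarith

lemma level_pos (h : PB K κ ν₁ l t x ν d r ϱ) (hκ : 0 ≤ κ) (hν : 0 ≤ ν) (hR : 1 ≤ R)
    (hx : ‖x‖ ≤ R) {w : ES N → ℝ} (hw : Sm w) {ι : Type*} [Fintype ι] (γ : ι → List (Fin N)) (n : ℕ)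
    {X Y S κ' : ℝ} (hX0 : 0 ≤ X) (hY0 : 0 ≤ Y) (hX : lv γ w x = X ^ 2)
    (hY : ∑ i, ∑ m, wd (ex N) (m :: γ i) w x ^ 2 = Y ^ 2)
    (hS : ∑ i, wd (ex N) (γ i) w x * (wd (ex N) (γ i) (K.A t w) x -
      K.A t (wd (ex N) (γ i) w) x) ≤ S) (hκ' : 16 * (n + 2) * κ * (Fintype.card ι * N) ≤ κ')
    (hκ'' : 4 * (n + 2) * κ ≤ κ') :
    cut N R x ^ (n + 2) * lvt γ w (K.A t w) x -
      Op QQ BB 0 (fun y => cut N R y ^ (n + 2) * lv γ w y) x ≤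
    cut N R x ^ (n + 2) * (2 * κ * X ^ 2 + 2 * S - 2 * ν * Y ^ 2) +
      κ' * ν * (cut N R x ^ (n + 1) * (X ^ 2 + X * Y)) := by
  have hc := cut_nonneg hR hx
  have k1 := op_cut_pow_sum_sq h hκ hν hR hx (F := fun i => wd (ex N) (γ i) w)
    (fun i => hw.wd _ _) n (X := X) (Y := Y)
    (fun i => abs_le_of_sq_le_sq (hX ▸ le_lv γ w x i) hX0)
    (fun i m => abs_le_of_sq_le_sq (by
      rw [← hY]
      refine le_trans ?_ (Finset.single_le_sum (f := fun i => ∑ m, wd (ex N) (m :: γ i) w x ^ 2)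
        (fun _ _ => Finset.sum_nonneg fun _ _ => sq_nonneg _) (Finset.mem_univ i))
      exact Finset.single_le_sum (f := fun m => wd (ex N) (m :: γ i) w x ^ 2)
        (fun _ _ => sq_nonneg _) (Finset.mem_univ m)) hY0)
  have hY' : ∑ i, ∑ m, wd (ex N) [m] (wd (ex N) (γ i) w) x ^ 2 = Y ^ 2 := hY
  have hX' : ∑ i, wd (ex N) (γ i) w x * wd (ex N) (γ i) w x = X ^ 2 := hX
  rw [hY', hX'] at k1
  have k2 : lvt γ w (K.A t w) x ≤
      2 * (∑ i, wd (ex N) (γ i) w x * Op QQ BB 0 (wd (ex N) (γ i) w) x) + 2 * κ * X ^ 2 + 2 * S := by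
    have e : lvt γ w (K.A t w) x =
        2 * (∑ i, wd (ex N) (γ i) w x * Op QQ BB 0 (wd (ex N) (γ i) w) x) +
        2 * (sl K.c t x * ∑ i, wd (ex N) (γ i) w x * wd (ex N) (γ i) w x) +
        2 * ∑ i, wd (ex N) (γ i) w x * (wd (ex N) (γ i) (K.A t w) x -
          K.A t (wd (ex N) (γ i) w) x) := by
      simp only [lvt, Finset.mul_sum, ← Finset.sum_add_distrib]
      refine Finset.sum_congr rfl fun i _ => ?_
      rw [show K.A t (wd (ex N) (γ i) w) x = Op QQ BB 0 (wd (ex N) (γ i) w) x +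
        sl K.c t x * wd (ex N) (γ i) w x from op_split x]
      ring
    have hcc : sl K.c t x * X ^ 2 ≤ κ * X ^ 2 := mul_le_mul_of_nonneg_right h.c_le (sq_nonneg _)
    rw [e, hX']
    linarith
  have k3 := mul_le_mul_of_nonneg_left k2 (pow_nonneg hc (n + 2))
  have k4 : (n + 2) * cut N R x ^ (n + 1) * (κ * ν) *
        (4 * X ^ 2 + 16 * (Fintype.card ι * N) * (X * Y)) ≤
      κ' * ν * (cut N R x ^ (n + 1) * (X ^ 2 + X * Y)) := by
    have p1 : 0 ≤ ν * cut N R x ^ (n + 1) * X ^ 2 := by positivity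
    have p2 : 0 ≤ ν * cut N R x ^ (n + 1) * (X * Y) := by positivity
    have q1 := mul_le_mul_of_nonneg_right hκ'' p1
    have q2 := mul_le_mul_of_nonneg_right hκ' p2
    linarith
  simp only [lv] at k1 ⊢
  linarith

set_option maxHeartbeats 1000000 in
/-- Differential inequality for the Bernstein function. -/
lemma bern_point (hN : 1 ≤ N) (h : PB K κ ν₁ l t x ν d r ϱ) (hκ : 1 ≤ κ) (hl : 0 < l)
    (hν₁ : 0 < ν₁) (hR : 1 ≤ R) (hx : ‖x‖ ≤ R) {w : ES N → ℝ} (hw : Sm w)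
    {A₁ A₂ A₃ A₁' A₂' A₃' ε κ' L : ℝ} (hA₁ : 0 ≤ A₁) (hA₂ : 0 ≤ A₂) (hA₃ : 0 ≤ A₃)
    (hκ' : κ' = 96 * N ^ 5 * κ) (hL : L * l = κ' ^ 2) (hε0 : 0 ≤ ε) (hε : κ' ^ 2 * ε ≤ 1 / 1000)
    (hεL : L * ε ≤ l / 4) (hεν : ε ≤ ν₁ / 10)
    (W1 : Wts ε (A₁ * cut N R x ^ 2) 1 (A₁ * cut N R x) (A₁' * cut N R x ^ 2))
    (W2 : Wts ε (A₂ * cut N R x ^ 4) (A₁ * cut N R x ^ 2) (A₂ * cut N R x ^ 3)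
      (A₂' * cut N R x ^ 4))
    (W3 : Wts ε (A₃ * cut N R x ^ 6) (A₂ * cut N R x ^ 4) (A₃ * cut N R x ^ 5)
      (A₃' * cut N R x ^ 6)) :
    2 * (w x * K.A t w x) +
      (A₁ * (cut N R x ^ (0 + 2) * lvt w1 w (K.A t w) x) + A₁' * (cut N R x ^ (0 + 2) * lv w1 w x)) +
      (A₂ * (cut N R x ^ (2 + 2) * lvt w2 w (K.A t w) x) + A₂' * (cut N R x ^ (2 + 2) * lv w2 w x)) +
      (A₃ * (cut N R x ^ (4 + 2) * lvt w3 w (K.A t w) x) + A₃' * (cut N R x ^ (4 + 2) * lv w3 w x)) -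
      Op QQ BB 0 (bern R A₁ A₂ A₃ w) x ≤ (2 * κ + 10 * L) * bern R A₁ A₂ A₃ w x := by
  have hν : 0 < ν := hν₁.trans_le h.ν_le
  have hκ0 : 0 ≤ κ := by linarith
  have hN' : (1 : ℝ) ≤ N := by exact_mod_cast hN
  have pw : ∀ k, k ≤ 5 → (N : ℝ) ^ k ≤ N ^ 5 := fun k hk => pow_le_pow_right₀ hN' hk
  have o5 : (1 : ℝ) ≤ N ^ 5 := one_le_pow₀ hN'
  have hκκ' : κ ≤ κ' := by rw [hκ']; nlinarith
  have hNκ : ∀ k, k ≤ 5 → 16 * (6 * (N : ℝ) ^ k * κ) ≤ κ' := fun k hk => by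
    rw [hκ']; have := mul_le_mul_of_nonneg_right (pw k hk) hκ0; linarith
  have hN1 : ∀ k, k ≤ 5 → 96 * (N : ℝ) ^ k ≤ κ' := fun k hk => by
    have := hNκ k hk
    nlinarith [mul_le_mul_of_nonneg_left hκ (pow_nonneg (zero_le_one.trans hN') k)]
  -- sizes
  set X1 := √(lv w1 w x) with hX1
  set X2 := √(lv w2 w x) with hX2
  set X3 := √(lv w3 w x) with hX3
  set X4 := √(∑ i, ∑ m, wd (ex N) (m :: w3 i) w x ^ 2) with hX4
  have s1 : lv w1 w x = X1 ^ 2 := (Real.sq_sqrt (lv_nonneg _ _ _)).symm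
  have s2 : lv w2 w x = X2 ^ 2 := (Real.sq_sqrt (lv_nonneg _ _ _)).symm
  have s3 : lv w3 w x = X3 ^ 2 := (Real.sq_sqrt (lv_nonneg _ _ _)).symm
  have s4 : ∑ i, ∑ m, wd (ex N) (m :: w3 i) w x ^ 2 = X4 ^ 2 := (Real.sq_sqrt
    (Finset.sum_nonneg fun _ _ => Finset.sum_nonneg fun _ _ => sq_nonneg _)).symm
  have t1 : ∑ m, wd (ex N) [m] w x ^ 2 = X1 ^ 2 := by
    rw [← s1]; exact Finset.sum_congr rfl fun _ _ => pow_two _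
  have t2 : ∑ i, ∑ m, wd (ex N) [i, m] w x ^ 2 = X2 ^ 2 := by
    rw [← s2, lv, Fintype.sum_prod_type]
    exact Finset.sum_congr rfl fun _ _ => Finset.sum_congr rfl fun _ _ => pow_two _
  have t3 : ∑ i, ∑ m, ∑ p, wd (ex N) [i, m, p] w x ^ 2 = X3 ^ 2 := by
    rw [← s3, lv, Fintype.sum_prod_type]
    refine Finset.sum_congr rfl fun _ _ => ?_
    rw [Fintype.sum_prod_type]
    exact Finset.sum_congr rfl fun _ _ => Finset.sum_congr rfl fun _ _ => pow_two _
  have sz : Sizes w x |w x| X1 X2 X3 X4 :=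
    { h0 := le_rfl
      h1 := fun i => Real.abs_le_sqrt (le_lv w1 w x i)
      h2 := fun i j => Real.abs_le_sqrt (le_lv w2 w x (i, j))
      h3 := fun i j k => Real.abs_le_sqrt (le_lv w3 w x (i, j, k))
      h4 := fun i j k m => Real.abs_le_sqrt (by
        refine le_trans ?_ (Finset.single_le_sum (f := fun p => ∑ m, wd (ex N) (m :: w3 p) w x ^ 2)
          (fun _ _ => Finset.sum_nonneg fun _ _ => sq_nonneg _) (Finset.mem_univ (j, k, m)))
        exact Finset.single_le_sum (f := fun i => wd (ex N) (i :: w3 (j, k, m)) w x ^ 2)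
          (fun _ _ => sq_nonneg _) (Finset.mem_univ i))
      s1 := t1
      s2 := t2
      s3 := t3 }
  have x1 : 0 ≤ X1 := Real.sqrt_nonneg _
  have x2 : 0 ≤ X2 := Real.sqrt_nonneg _
  have x3 : 0 ≤ X3 := Real.sqrt_nonneg _
  have x4 : 0 ≤ X4 := Real.sqrt_nonneg _
  have x0 : 0 ≤ |w x| := abs_nonneg _
  have hr := h.r_nonneg
  have hϱ := h.ϱ_nonneg
  -- commutators
  obtain ⟨S1, c1, c1'⟩ : ∃ S, S ≤ κ' * (ν * (X1 * X2) + ϱ * (X1 * |w x|)) + d * X1 ^ 2 ∧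
      ∑ i, wd (ex N) (w1 i) w x * (wd (ex N) (w1 i) (K.A t w) x -
        K.A t (wd (ex N) (w1 i) w) x) ≤ S := by
    refine ⟨_, ?_, le_rfl⟩
    have e : ∑ i, wd (ex N) (w1 i) w x * (wd (ex N) (w1 i) (K.A t w) x -
        K.A t (wd (ex N) (w1 i) w) x) = ∑ k, wd (ex N) [k] w x * K.Ad [k] t w x := by
      refine Finset.sum_congr rfl fun i _ => ?_
      rw [w1, K.wd_A_one hw]; ring
    rw [e]
    refine (commutator_one h sz).trans ?_
    have a1 := mul_le_mul_of_nonneg_right (hNκ 3 (by norm_num)) (by positivity : 0 ≤ ν * (X1 * X2))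
    have a2 := mul_le_mul_of_nonneg_right (hN1 1 (by norm_num)) (by positivity : 0 ≤ ϱ * (X1 * |w x|))
    have p1 : 0 ≤ N ^ 3 * (κ * ν * (X1 * X2)) := by positivity
    have p2 : 0 ≤ N * (ϱ * (X1 * |w x|)) := by positivity
    linarith only [a1, a2, p1, p2]
  obtain ⟨S2, c2, c2'⟩ : ∃ S, S ≤ κ' * (ν * (X2 * X3) + ν * X2 ^ 2 + r * (X2 * X1) +
      ϱ * (X2 * X1) + ϱ * (X2 * |w x|)) + 2 * d * X2 ^ 2 ∧
      ∑ i, wd (ex N) (w2 i) w x * (wd (ex N) (w2 i) (K.A t w) x -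
        K.A t (wd (ex N) (w2 i) w) x) ≤ S := by
    refine ⟨_, ?_, le_rfl⟩
    have e : ∑ i, wd (ex N) (w2 i) w x * (wd (ex N) (w2 i) (K.A t w) x -
        K.A t (wd (ex N) (w2 i) w) x) = ∑ k, ∑ m, wd (ex N) [k, m] w x *
          (K.Ad [k] t (wd (ex N) [m] w) x +
      (K.Ad [m] t (wd (ex N) [k] w) x + K.Ad [k, m] t w x)) := by
      rw [Fintype.sum_prod_type]
      refine Finset.sum_congr rfl fun i _ => Finset.sum_congr rfl fun j _ => ?_
      rw [w2, K.wd_A_two hw]; ring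
    rw [e]
    refine (commutator_two h sz hw).trans ?_
    have a1 := mul_le_mul_of_nonneg_right (hNκ 4 (by norm_num)) (by positivity : 0 ≤ ν * (X2 * X3))
    have a2 := mul_le_mul_of_nonneg_right (hN1 2 (by norm_num)) (by positivity : 0 ≤ ϱ * (X2 * X1))
    have a3 := mul_le_mul_of_nonneg_right hκκ' (by positivity : 0 ≤ ν * X2 ^ 2)
    have a4 := mul_le_mul_of_nonneg_right (hN1 3 (by norm_num)) (by positivity : 0 ≤ r * (X2 * X1))
    have a5 := mul_le_mul_of_nonneg_right (hN1 2 (by norm_num)) (by positivity : 0 ≤ ϱ * (X2 * |w x|))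
    have p1 : 0 ≤ N ^ 4 * (κ * ν * (X2 * X3)) := by positivity
    have p2 : 0 ≤ N ^ 2 * (ϱ * (X2 * X1)) := by positivity
    have p4 : 0 ≤ N ^ 3 * (r * (X2 * X1)) := by positivity
    have p5 : 0 ≤ N ^ 2 * (ϱ * (X2 * |w x|)) := by positivity
    linarith only [a1, a2, a3, a4, a5, p1, p2, p4, p5]
  obtain ⟨S3, c3, c3'⟩ : ∃ S, S ≤ κ' * (ν * (X3 * X4) + ν * X3 ^ 2 + ν * (X3 * X2) +
      r * (X3 * X2) + r * (X3 * X1) + ϱ * (X3 * X2) + ϱ * (X3 * X1) + ϱ * (X3 * |w x|)) +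
      3 * d * X3 ^ 2 ∧
      ∑ i, wd (ex N) (w3 i) w x * (wd (ex N) (w3 i) (K.A t w) x -
        K.A t (wd (ex N) (w3 i) w) x) ≤ S := by
    refine ⟨_, ?_, le_rfl⟩
    have e : ∑ i, wd (ex N) (w3 i) w x * (wd (ex N) (w3 i) (K.A t w) x -
        K.A t (wd (ex N) (w3 i) w) x) = ∑ k, ∑ m, ∑ p, wd (ex N) [k, m, p] w x *
      ((K.Ad [k] t (wd (ex N) [m, p] w) x + K.Ad [m] t (wd (ex N) [k, p] w) x +
        K.Ad [p] t (wd (ex N) [k, m] w) x) +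
      (K.Ad [k, m] t (wd (ex N) [p] w) x + K.Ad [k, p] t (wd (ex N) [m] w) x +
        K.Ad [m, p] t (wd (ex N) [k] w) x) + K.Ad [k, m, p] t w x) := by
      rw [Fintype.sum_prod_type]
      refine Finset.sum_congr rfl fun i _ => ?_
      rw [Fintype.sum_prod_type]
      refine Finset.sum_congr rfl fun j _ => Finset.sum_congr rfl fun k _ => ?_
      rw [w3, K.wd_A_three hw]; ring
    rw [e]
    refine (commutator_three h sz hw).trans ?_
    have a1 := mul_le_mul_of_nonneg_right (hNκ 5 le_rfl) (by positivity : 0 ≤ ν * (X3 * X4))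
    have a2 := mul_le_mul_of_nonneg_right (hN1 3 (by norm_num)) (by positivity : 0 ≤ ϱ * (X3 * X2))
    have a3 := mul_le_mul_of_nonneg_right (hNκ 0 (by norm_num)) (by positivity : 0 ≤ ν * X3 ^ 2)
    have a4 := mul_le_mul_of_nonneg_right (hN1 4 (by norm_num)) (by positivity : 0 ≤ r * (X3 * X2))
    have a5 := mul_le_mul_of_nonneg_right (hN1 3 (by norm_num)) (by positivity : 0 ≤ ϱ * (X3 * X1))
    have a6 := mul_le_mul_of_nonneg_right (hNκ 5 le_rfl) (by positivity : 0 ≤ ν * (X3 * X2))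
    have a7 := mul_le_mul_of_nonneg_right (hN1 4 (by norm_num)) (by positivity : 0 ≤ r * (X3 * X1))
    have a8 := mul_le_mul_of_nonneg_right (hN1 3 (by norm_num)) (by positivity : 0 ≤ ϱ * (X3 * |w x|))
    have p1 : 0 ≤ N ^ 5 * (κ * ν * (X3 * X4)) := by positivity
    have p2 : 0 ≤ N ^ 3 * (ϱ * (X3 * X2)) := by positivity
    have p3 : 0 ≤ κ * ν * X3 ^ 2 := by positivity
    have p4 : 0 ≤ N ^ 4 * (r * (X3 * X2)) := by positivity
    have p5 : 0 ≤ N ^ 3 * (ϱ * (X3 * X1)) := by positivity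
    have p6 : 0 ≤ N ^ 5 * (κ * ν * (X3 * X2)) := by positivity
    have p7 : 0 ≤ N ^ 4 * (r * (X3 * X1)) := by positivity
    have p8 : 0 ≤ N ^ 3 * (ϱ * (X3 * |w x|)) := by positivity
    rw [pow_zero, mul_one] at a3
    linarith only [a1, a2, a3, a4, a5, a6, a7, a8, p1, p2, p3, p4, p5, p6, p7, p8]
  -- the four levels
  have ℓ0 := level_zero h hw
  rw [t1] at ℓ0
  have ℓ1 := level_pos h hκ0 hν.le hR hx hw w1 0 (κ' := κ') x1 x2 s1 (by
    rw [← t2, Finset.sum_comm]; rfl) c1' (by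
      have := hNκ 2 (by norm_num)
      simp only [Fintype.card_fin]; push_cast
      have : 0 ≤ (N : ℝ) ^ 2 * κ := by positivity
      linarith) (by
      have := hNκ 0 (by norm_num)
      push_cast; linarith)
  have ℓ2 := level_pos h hκ0 hν.le hR hx hw w2 2 (κ' := κ') x2 x3 s2 (by
    rw [← t3, Finset.sum_comm]
    refine Finset.sum_congr rfl fun _ _ => ?_
    rw [Fintype.sum_prod_type]; rfl) c2' (by
      have := hNκ 3 (by norm_num)
      simp only [Fintype.card_fin, Fintype.card_prod]; push_cast
      have : 0 ≤ (N : ℝ) ^ 3 * κ := by positivity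
      linarith) (by
      have := hNκ 0 (by norm_num)
      push_cast; linarith)
  have ℓ3 := level_pos h hκ0 hν.le hR hx hw w3 4 (κ' := κ') x3 x4 s3 s4 c3' (by
      have := hNκ 4 (by norm_num)
      simp only [Fintype.card_fin, Fintype.card_prod]; push_cast
      linarith) (by
      have := hNκ 0 (by norm_num)
      push_cast; linarith)
  have alg := bernstein_algebra (X0 := |w x|) (hκ.trans hκκ') hl hL hν₁ h.ν_le hr hε0 hε hεL hεν
    (h.funz.trans (mul_le_mul_of_nonneg_right hκκ' hν.le)) W1 W2 W3 c1 c2 c3 (X4 := X4)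
  have sm1 := ((sm_cut (N := N) R).pow (0 + 2)).mul (sm_lv w1 hw)
  have sm2 := ((sm_cut (N := N) R).pow (2 + 2)).mul (sm_lv w2 hw)
  have sm3 := ((sm_cut (N := N) R).pow (4 + 2)).mul (sm_lv w3 hw)
  have eO : Op QQ BB 0 (bern R A₁ A₂ A₃ w) x = Op QQ BB 0 (fun y => w y * w y) x +
      A₁ * Op QQ BB 0 (fun y => cut N R y ^ (0 + 2) * lv w1 w y) x +
      A₂ * Op QQ BB 0 (fun y => cut N R y ^ (2 + 2) * lv w2 w y) x +
      A₃ * Op QQ BB 0 (fun y => cut N R y ^ (4 + 2) * lv w3 w y) x := by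
    unfold bern
    rw [op_add (((hw.mul hw).add ((sm_const _).mul sm1)).add ((sm_const _).mul sm2))
        ((sm_const _).mul sm3), op_add ((hw.mul hw).add ((sm_const _).mul sm1)) ((sm_const _).mul sm2),
      op_add (hw.mul hw) ((sm_const _).mul sm1), op_const_mul sm1, op_const_mul sm2,
      op_const_mul sm3]
  have m1 := mul_le_mul_of_nonneg_left ℓ1 hA₁
  have m2 := mul_le_mul_of_nonneg_left ℓ2 hA₂
  have m3 := mul_le_mul_of_nonneg_left ℓ3 hA₃
  rw [eO]
  simp only [bern, s1, s2, s3] at *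
  rw [sq_abs] at alg
  norm_num only at m1 m2 m3 alg ⊢
  rw [pow_one] at m1
  linarith only [alg, m1, m2, m3, ℓ0]

end BernsteinPoint

section Bernstein

variable {N : ℕ}

/-- Local uniform form of the structural hypotheses. -/
def LH (K : Coef N) (T R κ ν₁ l : ℝ) : Prop :=
  ∀ t ∈ Icc 0 T, ∀ x : ES N, ‖x‖ ≤ R → ∃ ν d r ϱ, PB K κ ν₁ l t x ν d r ϱ

/-- Time weights. -/
def tw (a : ℝ) (j k : ℕ) (σ : ℝ) : ℝ := a ^ k * σ ^ (k - j)
def twd (a : ℝ) (j k : ℕ) (σ : ℝ) : ℝ := a ^ k * ((k - j : ℕ) * σ ^ (k - j - 1))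

lemma tw_nonneg {a : ℝ} (ha : 0 ≤ a) (j k : ℕ) {σ : ℝ} (hσ : 0 ≤ σ) : 0 ≤ tw a j k σ := by
  unfold tw; positivity

lemma hasDeriv_tw (a : ℝ) (j k : ℕ) (s t : ℝ) (S : Set ℝ) :
    HasDerivWithinAt (fun t => tw a j k (t - s)) (twd a j k (t - s)) S t := by
  unfold tw twd
  have := (((hasDerivAt_id' t).sub_const s).pow (k - j)).const_mul (a ^ k)
  exact (this.congr_deriv (by simp)).hasDerivWithinAt

lemma wts_tw {a T σ c : ℝ} (ha : 0 ≤ a) (hT : 0 ≤ T) (hσ : σ ∈ Icc 0 T) (hc : c ∈ Icc (0 : ℝ) 1)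
    (j k : ℕ) (hk : k ≤ 2) :
    Wts (a * (3 * (1 + T))) (tw a j (k + 1) σ * c ^ (2 * k + 2)) (tw a j k σ * c ^ (2 * k))
      (tw a j (k + 1) σ * c ^ (2 * k + 1)) (twd a j (k + 1) σ * c ^ (2 * k + 2)) := by
  obtain ⟨h0, h1⟩ := hσ
  obtain ⟨c0, c1⟩ := hc
  have hp : 0 ≤ σ ^ (k - j) := by positivity
  have e1 : σ ^ (k + 1 - j) ≤ 3 * (1 + T) * σ ^ (k - j) := by
    rcases Nat.lt_or_ge k j with h | h
    · rw [Nat.sub_eq_zero_of_le h, Nat.sub_eq_zero_of_le h.le]; simp; linarith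
    · rw [Nat.sub_add_comm h, pow_succ']
      gcongr; linarith
  have e2 : ((k + 1 - j : ℕ) : ℝ) * σ ^ (k + 1 - j - 1) ≤ 3 * (1 + T) * σ ^ (k - j) := by
    rcases Nat.lt_or_ge k j with h | h
    · rw [Nat.sub_eq_zero_of_le h]; simp; positivity
    · rw [Nat.sub_add_comm h, Nat.add_sub_cancel]
      gcongr
      have : ((k - j + 1 : ℕ) : ℝ) ≤ 3 := by exact_mod_cast (by omega : k - j + 1 ≤ 3)
      linarith
  have base : ∀ p m, p ≤ 3 * (1 + T) * σ ^ (k - j) → 2 * k ≤ m →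
      a ^ (k + 1) * p * c ^ m ≤ a * (3 * (1 + T)) * (a ^ k * σ ^ (k - j) * c ^ (2 * k)) := by
    intro p m hp hm
    calc a ^ (k + 1) * p * c ^ m ≤ a ^ (k + 1) * (3 * (1 + T) * σ ^ (k - j)) * c ^ (2 * k) := by
          have : c ^ m ≤ c ^ (2 * k) := pow_le_pow_of_le_one c0 c1 hm
          gcongr
      _ = _ := by ring
  unfold tw twd
  refine ⟨by positivity, base _ _ e1 (by omega), by positivity, base _ _ e1 (by omega), ?_,
    base _ _ e2 (by omega)⟩
  have := mul_le_mul_of_nonneg_left (base _ (2 * k + 2 ) e1 (by omega))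
    (by positivity : 0 ≤ a ^ (k + 1) * σ ^ (k + 1 - j) * c ^ (2 * k))
  calc _ = a ^ (k + 1) * σ ^ (k + 1 - j) * c ^ (2 * k) *
        (a ^ (k + 1) * σ ^ (k + 1 - j) * c ^ (2 * k + 2)) := by ring
    _ ≤ a ^ (k + 1) * σ ^ (k + 1 - j) * c ^ (2 * k + 2) *
        (a * (3 * (1 + T)) * (a ^ k * σ ^ (k - j) * c ^ (2 * k))) := by
      have e3 := mul_le_mul_of_nonneg_right e1
        (by positivity : 0 ≤ a ^ (k + 1) * σ ^ (k + 1 - j) * c ^ (4 * k + 2) * a ^ (k + 1))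
      calc _ = σ ^ (k + 1 - j) * (a ^ (k + 1) * σ ^ (k + 1 - j) * c ^ (4 * k + 2) * a ^ (k + 1)) := by
            ring
        _ ≤ _ := e3
        _ = _ := by ring
    _ = _ := by ring

variable {K : Coef N} {s T : ℝ} {w : ℝ → ES N → ℝ}

lemma hasDeriv_lv (h : Sol K s T (fun _ => 0) w) {ι : Type*} [Fintype ι] (γ : ι → List (Fin N))
    {t : ℝ} (ht : t ∈ Icc s T) (x : ES N) :
    HasDerivWithinAt (fun t => lv γ (w t) x) (lvt γ (w t) (K.A t (w t)) x) (Icc s T) t := by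
  have h1 : ∀ i, HasDerivWithinAt (fun t => wd (ex N) (γ i) (w t) x * wd (ex N) (γ i) (w t) x)
      (2 * (wd (ex N) (γ i) (w t) x * wd (ex N) (γ i) (K.A t (w t)) x)) (Icc s T) t := fun i => by
    have := h.der (γ i) t ht x
    simp only [add_zero] at this
    exact (this.mul this).congr_deriv (by ring)
  have h2 := HasDerivWithinAt.fun_sum (u := Finset.univ) fun i _ => h1 i
  exact h2.congr_deriv (by rw [lvt, Finset.mul_sum])

lemma cont_lv (h : Sol K s T (fun _ => 0) w) {ι : Type*} [Fintype ι] (γ : ι → List (Fin N)) :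
    ContinuousOn (fun p : ℝ × ES N => lv γ (w p.1) p.2) (Icc s T ×ˢ univ) :=
  continuousOn_finsetSum _ fun i _ => (h.cont (γ i)).mul (h.cont (γ i))

lemma lv_le {ι : Type*} [Fintype ι] (γ : ι → List (Fin N)) {u : ES N → ℝ} {x : ES N} {B : ℝ}
    (h : ∀ i, |wd (ex N) (γ i) u x| ≤ B) : lv γ u x ≤ Fintype.card ι * B ^ 2 := by
  refine (Finset.sum_le_card_nsmul _ _ (B ^ 2) fun i _ => ?_).trans (by simp)
  rw [← pow_two, ← sq_abs]
  have := h i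
  gcongr

lemma bern_max (hN : 1 ≤ N) {κ ν₁ l R : ℝ} (hT : 0 ≤ T) (hκ : 1 ≤ κ) (hl : 0 < l) (hν₁ : 0 < ν₁)
    (hR : 1 ≤ R) (hs : s ∈ Icc 0 T) (hK : LH K T R κ ν₁ l) (h : Sol K s T (fun _ => 0) w)
    {j : ℕ} {a ε κ' L W B M : ℝ} (ha : 0 ≤ a) (ha1 : a ≤ 1) (hκ' : κ' = 96 * N ^ 5 * κ)
    (hL0 : 0 ≤ L) (hL : L * l = κ' ^ 2) (hεa : ε = a * (3 * (1 + T)))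
    (hε : κ' ^ 2 * ε ≤ 1 / 1000) (hεL : L * ε ≤ l / 4) (hεν : ε ≤ ν₁ / 10)
    (hM : M = W ^ 2 + 3 * (N ^ 3 * B ^ 2))
    (hW : ∀ t ∈ Icc s T, ∀ x, |w t x| ≤ W)
    (hB : ∀ γ : List (Fin N), γ.length ≤ j → 1 ≤ γ.length → ∀ x, |wd (ex N) γ (w s) x| ≤ B)
    {t : ℝ} (ht : t ∈ Icc s T) {x : ES N} (hx : ‖x‖ ≤ R) :
    Real.exp (-(2 * κ + 10 * L + 1) * (t - s)) *
      bern R (tw a j 1 (t - s)) (tw a j 2 (t - s)) (tw a j 3 (t - s)) (w t) x ≤ M := by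
  have hN' : (1 : ℝ) ≤ N := by exact_mod_cast hN
  set lam := 2 * κ + 10 * L + 1 with hlam
  have hsq : ∀ t ∈ Icc s T, ∀ x, w t x * w t x ≤ W ^ 2 := fun t ht x => by
    rw [← pow_two, ← sq_abs]
    have := hW t ht x
    gcongr
  by_contra! hlt
  have hcont : ContinuousOn (fun p : ℝ × ES N => Real.exp (-lam * (p.1 - s)) *
      bern R (tw a j 1 (p.1 - s)) (tw a j 2 (p.1 - s)) (tw a j 3 (p.1 - s)) (w p.1) p.2 - M)
      (Icc s T ×ˢ closedBall 0 R) := by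
    have hc : Continuous fun p : ℝ × ES N => cut N R p.2 := (sm_cut R).continuous.comp continuous_snd
    have hl : ∀ {ι : Type} [Fintype ι] (γ : ι → List (Fin N)) (k n : ℕ),
        ContinuousOn (fun p : ℝ × ES N => tw a j k (p.1 - s) * (cut N R p.2 ^ n * lv γ (w p.1) p.2))
        (Icc s T ×ˢ univ) := fun γ k n => by
      have : Continuous fun p : ℝ × ES N => tw a j k (p.1 - s) := by unfold tw; fun_prop
      exact this.continuousOn.mul ((hc.pow n).continuousOn.mul (cont_lv h γ))
    have h0 := (h.cont []).mul (h.cont [])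
    have := ((h0.add (hl w1 1 (0 + 2))).add (hl w2 2 (2 + 2))).add (hl w3 3 (4 + 2))
    have he : Continuous fun p : ℝ × ES N => Real.exp (-lam * (p.1 - s)) := by fun_prop
    exact ((he.continuousOn.mul this).sub continuousOn_const).mono
      (prod_mono le_rfl (subset_univ _))
  obtain ⟨t₁, ht₁, x₁, hx₁, hpos, hmax⟩ := max_point (isCompact_closedBall (0 : ES N) R) (z := fun t x =>
    Real.exp (-lam * (t - s)) *
      bern R (tw a j 1 (t - s)) (tw a j 2 (t - s)) (tw a j 3 (t - s)) (w t) x - M) hcont ht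
    (by simpa using hx) (sub_pos.2 hlt)
  rw [mem_closedBall_zero_iff] at hx₁
  have hM0 : 0 ≤ M := by rw [hM]; positivity
  have hc0 := cut_nonneg hR hx₁
  have hc1 := cut_le_one R x₁
  have pc : ∀ n, cut N R x₁ ^ n ≤ 1 := fun n => pow_le_one₀ hc0 hc1
  -- initial time
  rcases eq_or_lt_of_le ht₁.1 with hts | hts
  · subst hts
    have lev : ∀ {ι : Type} [Fintype ι] (γ : ι → List (Fin N)) (k n : ℕ), 1 ≤ k →
        (∀ i, (γ i).length = k) → (Fintype.card ι : ℝ) ≤ N ^ 3 →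
        tw a j k (s - s) * (cut N R x₁ ^ n * lv γ (w s) x₁) ≤ N ^ 3 * B ^ 2 := by
      intro ι _ γ k n hk hγ hcard
      rcases Nat.lt_or_ge j k with hjk | hjk
      · rw [tw, sub_self, zero_pow (by omega)]; simp; positivity
      · have e : tw a j k (s - s) ≤ 1 := by
          rw [tw, Nat.sub_eq_zero_of_le hjk, pow_zero, mul_one]
          exact pow_le_one₀ ha ha1
        have e2 := lv_le γ (fun i => hB (γ i) (by rw [hγ]; exact hjk) (by rw [hγ]; exact hk) x₁)
        have l0 := lv_nonneg γ (w s) x₁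
        calc _ ≤ 1 * (1 * lv γ (w s) x₁) := by
              gcongr
              exact pc n
          _ = lv γ (w s) x₁ := by ring
          _ ≤ Fintype.card ι * B ^ 2 := e2
          _ ≤ _ := by gcongr
    have l1 := lev w1 1 (0 + 2) le_rfl (fun _ => rfl) (by
      rw [Fintype.card_fin]; exact le_self_pow₀ hN' (by norm_num))
    have l2 := lev w2 2 (2 + 2) (by norm_num) (fun _ => rfl) (by
      rw [Fintype.card_prod, Fintype.card_fin]; push_cast; rw [← pow_two]
      exact pow_le_pow_right₀ hN' (by norm_num))
    have l3 := lev w3 3 (4 + 2) (by norm_num) (fun _ => rfl) (by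
      rw [Fintype.card_prod, Fintype.card_prod, Fintype.card_fin]; push_cast
      exact le_of_eq (by ring))
    have l0 := hsq s ht₁ x₁
    rw [sub_self, mul_zero, Real.exp_zero, one_mul, sub_pos, hM] at hpos
    rw [sub_self] at l1 l2 l3
    unfold bern at hpos
    linarith
  -- boundary of the ball
  rcases eq_or_lt_of_le hx₁ with hxR | hxR
  · have hb : bern R (tw a j 1 (t₁ - s)) (tw a j 2 (t₁ - s)) (tw a j 3 (t₁ - s)) (w t₁) x₁ ≤ W ^ 2 := by
      unfold bern
      rw [cut_eq_zero hR hxR]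
      simpa using hsq t₁ ht₁ x₁
    have he : Real.exp (-lam * (t₁ - s)) ≤ 1 := by
      rw [Real.exp_le_one_iff]
      have : 0 ≤ lam * (t₁ - s) := mul_nonneg (by rw [hlam]; linarith) (by linarith)
      linarith
    have : Real.exp (-lam * (t₁ - s)) *
      bern R (tw a j 1 (t₁ - s)) (tw a j 2 (t₁ - s)) (tw a j 3 (t₁ - s)) (w t₁) x₁ ≤ 1 * W ^ 2 := by
      calc _ ≤ Real.exp (-lam * (t₁ - s)) * W ^ 2 := by gcongr
        _ ≤ _ := by gcongr
    have : W ^ 2 ≤ M := by rw [hM]; linarith [show 0 ≤ 3 * ((N : ℝ) ^ 3 * B ^ 2) by positivity]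
    linarith
  -- interior
  have hσ : t₁ - s ∈ Icc 0 T := ⟨by linarith, by linarith [ht₁.2, hs.1]⟩
  have ht0 : t₁ ∈ Icc 0 T := ⟨hs.1.trans ht₁.1, ht₁.2⟩
  obtain ⟨ν, d, r, ϱ, hP⟩ := hK t₁ ht0 x₁ hx₁
  have hw := h.sm t₁ ht₁
  have hA : ∀ k, 0 ≤ tw a j k (t₁ - s) := fun k => tw_nonneg ha j k hσ.1
  have key := bern_point hN hP hκ hl hν₁ hR hx₁ hw (hA 1) (hA 2) (hA 3) hκ' hL
    (ε := ε) (by rw [hεa]; positivity) hε hεL hεν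
    (A₁' := twd a j 1 (t₁ - s)) (A₂' := twd a j 2 (t₁ - s)) (A₃' := twd a j 3 (t₁ - s))
    (by have := wts_tw ha hT hσ ⟨hc0, hc1⟩ j 0 (by norm_num)
        rw [hεa]; simpa [tw] using this)
    (by have := wts_tw ha hT hσ ⟨hc0, hc1⟩ j 1 (by norm_num)
        rw [hεa]; simpa using this)
    (by have := wts_tw ha hT hσ ⟨hc0, hc1⟩ j 2 (by norm_num)
        rw [hεa]; simpa using this)
  set V := bern R (tw a j 1 (t₁ - s)) (tw a j 2 (t₁ - s)) (tw a j 3 (t₁ - s)) (w t₁) with hV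
  have hVpos : 0 < V x₁ := by
    have := Real.exp_pos (-lam * (t₁ - s))
    have : 0 < Real.exp (-lam * (t₁ - s)) * V x₁ := by linarith
    exact (pos_iff_pos_of_mul_pos this).1 (Real.exp_pos _)
  have hloc : IsLocalMax V x₁ := by
    filter_upwards [isOpen_ball.mem_nhds (show x₁ ∈ ball (0 : ES N) R by simpa using hxR)] with y hy
    have := hmax t₁ ht₁ y (ball_subset_closedBall hy)
    simp only [tsub_le_iff_right, sub_add_cancel] at this
    exact le_of_mul_le_mul_left this (Real.exp_pos _)
  have hV2 : ContDiff ℝ 2 V := (sm_bern R _ _ _ hw).of_le two_le_smooth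
  obtain ⟨g1, g2⟩ := elliptic_nonpos hV2 hloc (fun i j => K.Q i j (t₁, x₁)) (fun i j => K.symm i j _)
    K.ν₀_pos (K.ell _)
  have hO : Op (fun i j => sl (K.Q i j) t₁) (fun j => sl (K.b j) t₁) 0 V x₁ ≤ 0 := by
    unfold Op
    simp only [g1]
    simpa [sl] using g2
  have hd0 := h.der [] t₁ ht₁ x₁
  simp only [add_zero] at hd0
  have lev : ∀ {ι : Type} [Fintype ι] (γ : ι → List (Fin N)) (k n : ℕ), HasDerivWithinAt
      (fun t => tw a j k (t - s) * (cut N R x₁ ^ n * lv γ (w t) x₁))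
      (tw a j k (t₁ - s) * (cut N R x₁ ^ n * lvt γ (w t₁) (K.A t₁ (w t₁)) x₁) +
        twd a j k (t₁ - s) * (cut N R x₁ ^ n * lv γ (w t₁) x₁)) (Icc s T) t₁ := fun γ k n =>
    ((hasDeriv_tw a j k s t₁ _).mul ((hasDeriv_lv h γ ht₁ x₁).const_mul _)).congr_deriv (by ring)
  have hdV := (((hd0.mul hd0).add (lev w1 1 (0 + 2))).add (lev w2 2 (2 + 2))).add (lev w3 3 (4 + 2))
  have hexp : HasDerivWithinAt (fun t => Real.exp (-lam * (t - s)))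
      (Real.exp (-lam * (t₁ - s)) * -lam) (Icc s T) t₁ := by
    have := (((hasDerivAt_id' t₁).sub_const s).const_mul (-lam)).exp
    exact (this.congr_deriv (by simp)).hasDerivWithinAt
  have hder := (hexp.mul hdV).sub_const M
  have hnn := deriv_nonneg_of_max ⟨hts, ht₁.2⟩ hder fun t' ht' => by
    exact hmax t' ht' x₁ (by simpa using hx₁)
  have e0 : wd (ex N) [] (w t₁) x₁ = w t₁ x₁ := rfl
  have e1 : wd (ex N) [] (K.A t₁ (w t₁)) x₁ = K.A t₁ (w t₁) x₁ := rfl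
  simp only [e0, e1, Pi.add_apply, Pi.mul_apply] at hnn
  have hVe : V x₁ = w t₁ x₁ * w t₁ x₁ + tw a j 1 (t₁ - s) * (cut N R x₁ ^ (0 + 2) * lv w1 (w t₁) x₁) +
      tw a j 2 (t₁ - s) * (cut N R x₁ ^ (2 + 2) * lv w2 (w t₁) x₁) +
      tw a j 3 (t₁ - s) * (cut N R x₁ ^ (4 + 2) * lv w3 (w t₁) x₁) := rfl
  rw [← hVe, mul_assoc, ← mul_add] at hnn
  have hfin := nonneg_of_mul_nonneg_right hnn (Real.exp_pos _)
  rw [hlam] at hfin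
  linarith

/-- Bernstein estimates, uniform with respect to the radius of the ball and the coefficients. -/
lemma bernstein_estimate (hN : 1 ≤ N) {κ ν₁ l T : ℝ} (hT : 0 ≤ T) (hκ : 1 ≤ κ) (hl : 0 < l) (hν₁ : 0 < ν₁)
    (j : ℕ) : ∃ C, 0 < C ∧ ∀ (K : Coef N) (R : ℝ), 1 ≤ R → LH K T R κ ν₁ l → ∀ s ∈ Icc 0 T,
      ∀ w : ℝ → ES N → ℝ, Sol K s T (fun _ => 0) w → ∀ W B : ℝ,
      (∀ t ∈ Icc s T, ∀ x, |w t x| ≤ W) →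
      (∀ γ : List (Fin N), γ.length ≤ j → 1 ≤ γ.length → ∀ x, |wd (ex N) γ (w s) x| ≤ B) →
      ∀ t ∈ Icc s T, ∀ x, ‖x‖ ≤ R / 2 → ∀ γ : List (Fin N), 1 ≤ γ.length → γ.length ≤ 3 →
        (t - s) ^ (γ.length - j) * wd (ex N) γ (w t) x ^ 2 ≤ C * (W ^ 2 + B ^ 2) := by
  have hN' : (1 : ℝ) ≤ N := by exact_mod_cast hN
  obtain ⟨κ', hκ'⟩ : ∃ κ' : ℝ, κ' = 96 * N ^ 5 * κ := ⟨_, rfl⟩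
  have hκ0 : 0 < κ' := by rw [hκ']; positivity
  obtain ⟨L, hL⟩ : ∃ L : ℝ, L = κ' ^ 2 / l := ⟨_, rfl⟩
  have hL0 : 0 < L := by rw [hL]; positivity
  have hLl : L * l = κ' ^ 2 := by rw [hL]; field_simp
  obtain ⟨ε, hε⟩ : ∃ ε : ℝ, ε = (1 + 1000 * κ' ^ 2 + 4 * L / l + 10 / ν₁)⁻¹ := ⟨_, rfl⟩
  have hε0 : 0 < ε := by rw [hε]; positivity
  have hε1 : (1 + 1000 * κ' ^ 2 + 4 * L / l + 10 / ν₁) * ε = 1 := by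
    rw [hε]; exact mul_inv_cancel₀ (by positivity)
  have p1 : 0 ≤ κ' ^ 2 * ε := by positivity
  have p2 : 0 ≤ L / l * ε := by positivity
  have p3 : 0 ≤ 1 / ν₁ * ε := by positivity
  have e1 : ε + 1000 * (κ' ^ 2 * ε) + 4 * (L / l * ε) + 10 * (1 / ν₁ * ε) = 1 := by
    linear_combination hε1
  have i1 : κ' ^ 2 * ε ≤ 1 / 1000 := by linarith
  have i2 : L * ε ≤ l / 4 := by
    have : L / l * ε ≤ 1 / 4 := by linarith
    have := mul_le_mul_of_nonneg_left this hl.le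
    calc L * ε = l * (L / l * ε) := by field_simp
      _ ≤ l * (1 / 4) := this
      _ = l / 4 := by ring
  have i3 : ε ≤ ν₁ / 10 := by
    have : 1 / ν₁ * ε ≤ 1 / 10 := by linarith
    have := mul_le_mul_of_nonneg_left this hν₁.le
    calc ε = ν₁ * (1 / ν₁ * ε) := by field_simp
      _ ≤ ν₁ * (1 / 10) := this
      _ = ν₁ / 10 := by ring
  obtain ⟨a, ha⟩ : ∃ a : ℝ, a = ε / (3 * (1 + T)) := ⟨_, rfl⟩
  have ha0 : 0 < a := by rw [ha]; positivity
  have hεa : ε = a * (3 * (1 + T)) := by rw [ha]; field_simp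
  have ha1 : a ≤ 1 := by nlinarith
  refine ⟨64 * (a ^ 3)⁻¹ * Real.exp ((2 * κ + 10 * L + 1) * T) * (3 * N ^ 3), by positivity, ?_⟩
  intro K R hR hK s hs w h W B hW hB t ht x hx γ hγ1 hγ3
  have hxR : ‖x‖ ≤ R := by linarith [norm_nonneg x]
  have key := bern_max hN hT hκ hl hν₁ hR hs hK h ha0.le ha1 hκ' hL0.le hLl hεa i1 i2 i3 rfl hW hB ht hxR
  set M := W ^ 2 + 3 * (N ^ 3 * B ^ 2) with hM
  have hc := cut_half hR hx
  have hc1 := cut_le_one R x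
  have hσ : 0 ≤ t - s := by linarith [ht.1]
  have hVle : bern R (tw a j 1 (t - s)) (tw a j 2 (t - s)) (tw a j 3 (t - s)) (w t) x ≤
      Real.exp ((2 * κ + 10 * L + 1) * T) * M := by
    have e : bern R (tw a j 1 (t - s)) (tw a j 2 (t - s)) (tw a j 3 (t - s)) (w t) x =
        Real.exp ((2 * κ + 10 * L + 1) * (t - s)) * (Real.exp (-(2 * κ + 10 * L + 1) * (t - s)) *
        bern R (tw a j 1 (t - s)) (tw a j 2 (t - s)) (tw a j 3 (t - s)) (w t) x) := by
      rw [← mul_assoc, ← Real.exp_add]; ring_nf; simp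
    rw [e]
    have hM0 : 0 ≤ M := by rw [hM]; positivity
    calc _ ≤ Real.exp ((2 * κ + 10 * L + 1) * (t - s)) * M := by gcongr
      _ ≤ _ := by gcongr; linarith [ht.2, hs.1]
  have lev : ∀ (k n : ℕ) (X S : ℝ), k ≤ 3 → n ≤ 6 → X ≤ S → 0 ≤ X →
      tw a j k (t - s) * (cut N R x ^ n * S) ≤ Real.exp ((2 * κ + 10 * L + 1) * T) * M →
      (t - s) ^ (k - j) * X ≤
        64 * (a ^ 3)⁻¹ * Real.exp ((2 * κ + 10 * L + 1) * T) * (3 * N ^ 3) * (W ^ 2 + B ^ 2) := by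
    intro k n X S hk hn hXS hX hle
    have q1 : (1 / 2 : ℝ) ^ 6 ≤ cut N R x ^ n := by
      calc (1 / 2 : ℝ) ^ 6 ≤ (1 / 2) ^ n := pow_le_pow_of_le_one (by norm_num) (by norm_num) hn
        _ ≤ _ := by gcongr
    have q2 : a ^ 3 ≤ a ^ k := pow_le_pow_of_le_one ha0.le ha1 hk
    have q3 : a ^ 3 * (1 / 2) ^ 6 * ((t - s) ^ (k - j) * X) ≤
        Real.exp ((2 * κ + 10 * L + 1) * T) * M := by
      refine le_trans ?_ hle
      unfold tw
      calc _ = a ^ 3 * (t - s) ^ (k - j) * ((1 / 2) ^ 6 * X) := by ring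
        _ ≤ _ := by gcongr
    have q4 : M ≤ 3 * N ^ 3 * (W ^ 2 + B ^ 2) := by
      rw [hM]
      have : (1 : ℝ) ≤ N ^ 3 := one_le_pow₀ hN'
      nlinarith [sq_nonneg W, sq_nonneg B]
    calc (t - s) ^ (k - j) * X = 64 * (a ^ 3)⁻¹ * (a ^ 3 * (1 / 2) ^ 6 * ((t - s) ^ (k - j) * X)) := by
          field_simp; norm_num
      _ ≤ 64 * (a ^ 3)⁻¹ * (Real.exp ((2 * κ + 10 * L + 1) * T) * (3 * N ^ 3 * (W ^ 2 + B ^ 2))) := by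
          exact mul_le_mul_of_nonneg_left (q3.trans (mul_le_mul_of_nonneg_left q4 (Real.exp_pos _).le))
            (by positivity)
      _ = _ := by ring
  have t0 : 0 ≤ w t x * w t x := mul_self_nonneg _
  have tt : ∀ {ι : Type} [Fintype ι] (γ : ι → List (Fin N)) (k n : ℕ),
      0 ≤ tw a j k (t - s) * (cut N R x ^ n * lv γ (w t) x) := fun γ k n =>
    mul_nonneg (tw_nonneg ha0.le _ _ hσ) (mul_nonneg (pow_nonneg (by linarith) _) (lv_nonneg _ _ _))
  have u1 := tt w1 1 (0 + 2)
  have u2 := tt w2 2 (2 + 2)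
  have u3 := tt w3 3 (4 + 2)
  unfold bern at hVle
  match γ, hγ1, hγ3 with
  | [i], _, _ =>
    exact lev 1 (0 + 2) _ _ (by norm_num) (by norm_num) (le_lv w1 (w t) x i) (sq_nonneg _) (by linarith)
  | [i, k], _, _ =>
    exact lev 2 (2 + 2) _ _ (by norm_num) (by norm_num) (le_lv w2 (w t) x (i, k)) (sq_nonneg _)
      (by linarith)
  | [i, k, m], _, _ =>
    exact lev 3 (4 + 2) _ _ (by norm_num) (by norm_num) (le_lv w3 (w t) x (i, k, m)) (sq_nonneg _)
      (by linarith)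
  | _ :: _ :: _ :: _ :: γ, _, h =>
    simp only [List.length_cons] at h
    omega

end Bernstein

section Steklov

variable {E : Type*} [NormedAddCommGroup E] [NormedSpace ℝ E]

/-- The mean of `Φ` over the segment from `y` to `y + v`. -/
def stek (v : E) (Φ : E → ℝ) : E → ℝ := fun y => ∫ r in (0 : ℝ)..1, Φ (y + r • v)

lemma dd_translate (a v : E) (Φ : E → ℝ) :
    dd v (fun y => Φ (y + a)) = fun y => dd v Φ (y + a) := by
  funext y
  simp only [dd]
  rw [fderiv_comp_add_right]

lemma stek_integrable {Φ : E → ℝ} (h : Continuous Φ) (v y : E) :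
    IntervalIntegrable (fun r : ℝ => Φ (y + r • v)) volume 0 1 :=
  (h.comp (by fun_prop)).intervalIntegrable _ _

lemma stek_bound {Φ : E → ℝ} {v y : E} {B : ℝ} (hB : ∀ y, |Φ y| ≤ B) : |stek v Φ y| ≤ B := by
  rw [stek, ← Real.norm_eq_abs]
  refine (intervalIntegral.norm_integral_le_of_norm_le_const fun r _ => hB _).trans_eq ?_
  simp

lemma stek_osc {Φ : E → ℝ} (h : Continuous Φ) {v a : E} {ω : ℝ} (hω : ∀ y, |Φ (y + a) - Φ y| ≤ ω)
    (y : E) : |stek v Φ (y + a) - stek v Φ y| ≤ ω := by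
  rw [stek, stek, ← intervalIntegral.integral_sub (stek_integrable h _ _) (stek_integrable h _ _),
    ← Real.norm_eq_abs]
  refine (intervalIntegral.norm_integral_le_of_norm_le_const (C := ω) fun r _ => ?_).trans_eq
    (by simp)
  rw [Real.norm_eq_abs, add_right_comm]
  exact hω _

lemma stek_close {Φ : E → ℝ} (h : Continuous Φ) {v y : E} {ω : ℝ}
    (hω : ∀ r ∈ Icc (0 : ℝ) 1, |Φ (y + r • v) - Φ y| ≤ ω) : |stek v Φ y - Φ y| ≤ ω := by
  have e : Φ y = ∫ _ in (0 : ℝ)..1, Φ y := by simp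
  rw [e, stek, ← intervalIntegral.integral_sub (stek_integrable h _ _)
    (intervalIntegrable_const), ← Real.norm_eq_abs]
  refine (intervalIntegral.norm_integral_le_of_norm_le_const (C := ω) fun r hr => ?_).trans_eq
    (by simp)
  rw [uIoc_of_le zero_le_one] at hr
  simpa using hω r (Ioc_subset_Icc_self hr)

variable {κ : Type*} [Fintype κ] [FiniteDimensional ℝ E] (e : Module.Basis κ ℝ E)

lemma wd_translate (a : E) (γ : List κ) (Φ : E → ℝ) :
    wd e γ (fun y => Φ (y + a)) = fun y => wd e γ Φ (y + a) := by
  induction γ with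
  | nil => rfl
  | cons i γ ih => rw [wd_cons, ih, dd_translate]; rfl

variable {e}

lemma tf_translate {Φ : E → ℝ} (h : SB e Φ) (η : ℝ) (i : κ) :
    TF e 1 (fun r y => Φ (y + r • η • e i)) := by
  refine ⟨⟨fun p => ContDiff.comp (g := Φ) h.sm (contDiff_id.add contDiff_const), fun γ => ?_⟩,
    fun γ => ?_⟩
  · obtain ⟨C, hC⟩ := h.bd γ
    exact ⟨C, fun p y => by rw [wd_translate]; exact hC _⟩
  · obtain ⟨C, hC⟩ := h.bd (i :: γ)
    refine ⟨|η| * C, mul_nonneg (abs_nonneg _) ((abs_nonneg _).trans (hC 0)), ?_⟩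
    intro τ _ τ' _ y
    rw [wd_translate, wd_translate]
    have := taylor_one (f := wd e γ Φ) (h.sm.wd e γ).differentiable (y := y + τ' • η • e i)
      (v := ((τ - τ') * η) • e i) (B := |η| * C * |τ - τ'|) fun t _ => by
        rw [dd_vec_smul]
        simp only [abs_mul]
        have := mul_le_mul_of_nonneg_left (hC (y + τ' • η • e i + t • ((τ - τ') * η) • e i))
          (mul_nonneg (abs_nonneg (τ - τ')) (abs_nonneg η))
        rw [wd_cons] at this
        linarith
    rwa [show y + τ' • η • e i + ((τ - τ') * η) • e i = y + τ • η • e i by module] at this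

lemma stek_words {Φ : E → ℝ} (h : SB e Φ) (η : ℝ) (i : κ) :
    SB e (stek (η • e i) Φ) ∧
      ∀ γ, wd e γ (stek (η • e i) Φ) = stek (η • e i) (wd e γ Φ) := by
  obtain ⟨h1, h2⟩ := integral_words (tf_translate h η i) (a := 0) (b := 1) (by simp) (by simp)
  have h3 : ∀ γ, wd e γ (stek (η • e i) Φ) = stek (η • e i) (wd e γ Φ) := fun γ => by
    unfold stek
    rw [h2 γ]
    simp only [wd_translate]
  refine ⟨SB.mk h1 fun γ => ?_, h3⟩
  obtain ⟨C, hC⟩ := h.bd γ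
  exact ⟨C, fun y => by rw [h3]; exact stek_bound hC⟩

lemma stek_dd {Φ : E → ℝ} (h : SB e Φ) {η : ℝ} (hη : 0 < η) (i : κ) (y : E) :
    dd (e i) (stek (η • e i) Φ) y = (Φ (y + η • e i) - Φ y) / η := by
  have h1 := congrFun ((stek_words h η i).2 [i]) y
  rw [wd_cons, wd_nil] at h1
  rw [h1, stek]
  have h2 : ∀ r : ℝ, HasDerivAt (fun r : ℝ => Φ (y + r • η • e i)) (η * wd e [i] Φ (y + r • η • e i)) r := by
    intro r
    refine (hasDerivAt_line (f := Φ) (y := y) (v := η • e i) h.sm.differentiableAt).congr_deriv ?_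
    rw [dd_vec_smul]; rfl
  have h3 := intervalIntegral.integral_eq_sub_of_hasDerivAt (fun r _ => h2 r)
    (((stek_integrable (h.sm.wd e [i]).continuous (η • e i) y)).const_mul η)
  rw [intervalIntegral.integral_const_mul] at h3
  rw [eq_div_iff hη.ne', mul_comm, h3]
  simp

/-- Iterated averaging smooths in the directions of `S`, with explicit bounds in terms of the
oscillation of the averaged function. -/
lemma exists_smoothing {Φ : E → ℝ} (h : SB e Φ) {η : ℝ} (hη : 0 < η) (I : Set κ) (S : List κ)
    (hS : ∀ i ∈ S, i ∈ I) : ∃ Ψ, SB e Ψ ∧ ∀ γ,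
      (∀ B, (∀ y, |wd e γ Φ y| ≤ B) → ∀ y, |wd e γ Ψ y| ≤ B) ∧
      ∀ ω, (∀ i ∈ I, ∀ r ∈ Icc (0 : ℝ) η, ∀ y, |wd e γ Φ (y + r • e i) - wd e γ Φ y| ≤ ω) →
        (∀ y, |wd e γ Ψ y - wd e γ Φ y| ≤ S.length * ω) ∧
        (∀ i ∈ S, ∀ y, |wd e (i :: γ) Ψ y| ≤ ω / η) ∧
        (∀ i ∈ I, ∀ r ∈ Icc (0 : ℝ) η, ∀ y, |wd e γ Ψ (y + r • e i) - wd e γ Ψ y| ≤ ω) := by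
  induction S with
  | nil =>
    exact ⟨Φ, h, fun γ => ⟨fun B hB => hB, fun ω hω => ⟨by simp, by simp, hω⟩⟩⟩
  | cons j S ih =>
    obtain ⟨Ψ, hΨ, hp⟩ := ih fun i hi => hS i (List.mem_cons_of_mem _ hi)
    obtain ⟨h1, h2⟩ := stek_words hΨ η j
    refine ⟨stek (η • e j) Ψ, h1, fun γ => ⟨fun B hB y => ?_, fun ω hω => ?_⟩⟩
    · rw [h2]; exact stek_bound ((hp γ).1 B hB)
    obtain ⟨p1, p2, p3⟩ := (hp γ).2 ω hω
    have hc := (hΨ.sm.wd e γ).continuous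
    refine ⟨fun y => ?_, fun i hi y => ?_, fun i hi r hr y => ?_⟩
    · have q : |wd e γ (stek (η • e j) Ψ) y - wd e γ Ψ y| ≤ ω := by
        rw [h2]
        refine stek_close hc fun r hr => ?_
        have := p3 j (hS j (by simp)) (r * η) ⟨by have := hr.1; positivity, by
          have := mul_le_mul_of_nonneg_right hr.2 hη.le; linarith⟩ y
        rwa [← smul_smul] at this
      have := abs_sub_le (wd e γ (stek (η • e j) Ψ) y) (wd e γ Ψ y) (wd e γ Φ y)
      have := p1 y
      push_cast [List.length_cons]
      linarith
    · rcases List.mem_cons.1 hi with rfl | hi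
      · rw [wd_cons, h2, stek_dd (SB.wd hΨ γ) hη, abs_div, abs_of_pos hη]
        gcongr
        exact p3 i (hS i (by simp)) η ⟨hη.le, le_rfl⟩ y
      · rw [h2]
        exact stek_bound (p2 i hi)
    · rw [h2]
      exact stek_osc hc (fun y => p3 i hi r hr y) y

end Steklov

section SmoothSchauder

variable {N : ℕ}

/-- Boundedness and `θ`-Hölder continuity in the spatial coordinate directions. -/
def HB (θ M : ℝ) (Φ : ℝ × ES N → ℝ) : Prop :=
  (∀ y, |Φ y| ≤ M) ∧
    ∀ i : Fin N, ∀ r : ℝ, 0 ≤ r → ∀ y, |Φ (y + r • eS N (Sum.inr i)) - Φ y| ≤ M * r ^ θ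

lemma HB.nonneg {θ M : ℝ} {Φ : ℝ × ES N → ℝ} (h : HB θ M Φ) : 0 ≤ M := (abs_nonneg _).trans (h.1 0)

lemma ex_sum (v : ES N) : ∑ i, v i • ex N i = v := by
  have := (EuclideanSpace.basisFun (Fin N) ℝ).sum_repr v
  simpa [ex] using this

lemma diff_le {f : ES N → ℝ} (hf : Differentiable ℝ f) {ρ D : ℝ}
    (hb : ∀ i, ∀ x, ‖x‖ ≤ ρ → |wd (ex N) [i] f x| ≤ D) {x y : ES N} (hx : ‖x‖ ≤ ρ) (hy : ‖y‖ ≤ ρ) :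
    |f x - f y| ≤ N * ‖x - y‖ * D := by
  have h := taylor_one hf (y := y) (v := x - y) (B := N * ‖x - y‖ * D) fun t ht => by
    rw [← ex_sum (x - y), dd_comb]
    have hm : ‖y + t • ∑ i, (x - y) i • ex N i‖ ≤ ρ := by
      rw [ex_sum]
      have := (convex_closedBall (0 : ES N) ρ).add_smul_sub_mem (x := y) (y := x)
        (by simpa using hy) (by simpa using hx) ht
      simpa using this
    have hD := fun i => hb i _ hm
    calc _ ≤ ∑ i : Fin N, ‖x - y‖ * D := by
          refine (Finset.abs_sum_le_sum_abs _ _).trans (Finset.sum_le_sum fun i _ => ?_)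
          rw [abs_mul]
          exact mul_le_mul (by simpa using PiLp.norm_apply_le (x - y) i) (hD i) (abs_nonneg _)
            (norm_nonneg _)
      _ = _ := by
        rw [ex_sum, Finset.sum_const, Finset.card_univ, Fintype.card_fin, nsmul_eq_mul, mul_assoc]
  simpa using h

lemma exists_spatial_smoothing {Φ : ℝ × ES N → ℝ} (h : SB (eS N) Φ) {η θ : ℝ} (hη : 0 < η)
    (hθ : 0 < θ) :
    ∃ Ψ, SB (eS N) Ψ ∧ ∀ γ M, HB θ M (wd (eS N) (sw γ) Φ) →
      (∀ y, |wd (eS N) (sw γ) Ψ y| ≤ M) ∧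
      (∀ y, |wd (eS N) (sw γ) Ψ y - wd (eS N) (sw γ) Φ y| ≤ N * (M * η ^ θ)) ∧
      (∀ i y, |wd (eS N) (sw (i :: γ)) Ψ y| ≤ M * η ^ θ / η) := by
  obtain ⟨Ψ, hΨ, hp⟩ := exists_smoothing h hη (range Sum.inr)
    ((Finset.univ : Finset (Fin N)).toList.map Sum.inr) (by simp)
  refine ⟨Ψ, hΨ, fun γ M hM => ⟨(hp _).1 M hM.1, ?_⟩⟩
  obtain ⟨h1, h2, -⟩ := (hp (sw γ)).2 (M * η ^ θ) (by
    rintro _ ⟨i, rfl⟩ r hr y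
    refine (hM.2 i r hr.1 y).trans ?_
    have := hM.nonneg
    gcongr
    exacts [hr.1, hr.2])
  refine ⟨fun y => by simpa using h1 y, fun i y => ?_⟩
  exact h2 (Sum.inr i) (by simp) y

variable (N) in
/-- The uniform smoothing constant. -/
def GC (T κ ν₁ l C : ℝ) : Prop := ∀ (K : Coef N) (R : ℝ), 1 ≤ R → LH K T R κ ν₁ l → K.c₀ ≤ κ →
    ∀ j ≤ 3, ∀ Φ, SB (eS N) Φ → ∀ B, (∀ γ, γ.length ≤ j → ∀ y, |wd (eS N) (sw γ) Φ y| ≤ B) →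
    ∀ s ∈ Icc 0 T, ∀ t ∈ Icc s T, ∀ x, ‖x‖ ≤ R / 2 → ∀ γ : List (Fin N), γ.length ≤ 3 →
      √(t - s) ^ (γ.length - j) * |wd (ex N) γ (K.G Φ s t) x| ≤ C * B

lemma exists_gc (hN : 1 ≤ N) {κ ν₁ l T : ℝ} (hT : 0 ≤ T) (hκ : 1 ≤ κ) (hl : 0 < l)
    (hν₁ : 0 < ν₁) : ∃ C, 1 ≤ C ∧ GC N T κ ν₁ l C := by
  choose C hC0 hC using bernstein_estimate hN hT hκ hl hν₁
  obtain ⟨D, hD⟩ : ∃ D, D = ∑ j ∈ Finset.range 4, C j := ⟨_, rfl⟩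
  have hD0 : 0 ≤ D := by rw [hD]; exact Finset.sum_nonneg fun j _ => (hC0 j).le
  obtain ⟨E, hE⟩ : ∃ E, E = Real.exp (κ * T) := ⟨_, rfl⟩
  have hE1 : 1 ≤ E := by rw [hE]; exact Real.one_le_exp (by positivity)
  refine ⟨(1 + 2 * D) * E, by nlinarith, ?_⟩
  intro K R hR hK hc j hj Φ hΦ B hB s hs t ht x hx γ hγ
  have hB0 : 0 ≤ B := (abs_nonneg _).trans (hB [] (by simp) 0)
  have hW : ∀ t ∈ Icc s T, ∀ x, |K.G Φ s t x| ≤ E * B := fun t ht x => by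
    refine (K.G_sup hΦ (hB [] (by simp)) ht.1 x).trans ?_
    rw [hE]
    gcongr
    · linarith [ht.1]
    · linarith [hs.1, ht.2]
  by_cases h0 : 1 ≤ γ.length
  · have h1 := hC j K R hR hK s hs _ (K.G_sol hΦ s T) (E * B) B hW (fun γ hγ _ x => by
      rw [K.G_self hΦ, wd_sl hΦ.sm]; exact hB γ hγ _) t ht x hx γ h0 hγ
    have h2 : C j ≤ D := by
      rw [hD]
      exact Finset.single_le_sum (fun i _ => (hC0 i).le) (Finset.mem_range.2 (by omega))
    refine abs_le_of_sq_le_sq' ?_ (by positivity) |>.2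
    have h3 : (√(t - s) ^ (γ.length - j) * |wd (ex N) γ (K.G Φ s t) x|) ^ 2 =
        (t - s) ^ (γ.length - j) * wd (ex N) γ (K.G Φ s t) x ^ 2 := by
      rw [mul_pow, sq_abs, ← pow_mul, mul_comm _ 2, pow_mul, Real.sq_sqrt (by linarith [ht.1])]
    rw [h3]
    calc _ ≤ _ := h1
      _ ≤ D * ((E * B) ^ 2 + (E * B) ^ 2) := by
        gcongr
        nlinarith
      _ ≤ _ := by
        have e : ((1 + 2 * D) * E * B) ^ 2 - D * ((E * B) ^ 2 + (E * B) ^ 2) =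
          (E * B) ^ 2 * (1 + 2 * D + 4 * D ^ 2) := by ring
        have : 0 ≤ (E * B) ^ 2 * (1 + 2 * D + 4 * D ^ 2) := by positivity
        linarith
  · have h1 : γ = [] := List.length_eq_zero_iff.1 (by omega)
    subst h1
    simp only [List.length_nil, zero_le, Nat.sub_eq_zero_of_le, pow_zero, one_mul, wd_nil]
    have : E * B ≤ (1 + 2 * D) * E * B := by gcongr; nlinarith
    exact (hW t ht x).trans this

lemma sqrt_rpow {σ : ℝ} (hσ : 0 ≤ σ) (p : ℝ) : √σ ^ p = σ ^ (p / 2) := by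
  rw [Real.sqrt_eq_rpow, ← Real.rpow_mul hσ]; congr 1; ring

lemma G_split (K : Coef N) {Φ Ψ : ℝ × ES N → ℝ} (h : SB (eS N) Φ) (h' : SB (eS N) Ψ) {s t : ℝ}
    (hst : s ≤ t) (γ : List (Fin N)) (x : ES N) :
    wd (ex N) γ (K.G Φ s t) x =
      wd (ex N) γ (K.G (fun y => Ψ y - Φ y) s t) x * (-1) + wd (ex N) γ (K.G Ψ s t) x := by
  rw [K.G_sub h' h hst, wd_sub ((K.G_sol h' s t).sm t ⟨hst, le_rfl⟩) ((K.G_sol h s t).sm t ⟨hst, le_rfl⟩)]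
  ring

lemma G_holder {κ ν₁ l T C θ : ℝ} (hC : 1 ≤ C) (hθ : θ ∈ Ioo (0 : ℝ) 1)
    (hG : GC N T κ ν₁ l C) : ∃ D, 1 ≤ D ∧
    ∀ (K : Coef N) (R : ℝ), 1 ≤ R → LH K T R κ ν₁ l → K.c₀ ≤ κ →
    ∀ Φ, SB (eS N) Φ → ∀ M, HB θ M Φ → ∀ s ∈ Icc 0 T, ∀ t ∈ Ioc s T, ∀ x, ‖x‖ ≤ R / 2 →
    ∀ γ : List (Fin N),
      (γ.length ≤ 2 → |wd (ex N) γ (K.G Φ s t) x| ≤ D * M * (t - s) ^ ((θ - 2) / 2)) ∧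
      (γ.length = 3 → |wd (ex N) γ (K.G Φ s t) x| ≤ D * M * (t - s) ^ ((θ - 3) / 2)) := by
  obtain ⟨a, ha⟩ : ∃ a, a = 1 + √T := ⟨_, rfl⟩
  have ha1 : 1 ≤ a := by rw [ha]; linarith [Real.sqrt_nonneg T]
  refine ⟨C * (N + a) * a ^ 2, ?_, ?_⟩
  · have : (0 : ℝ) ≤ N := by positivity
    have : 1 ≤ a ^ 2 := one_le_pow₀ ha1
    have : 1 ≤ C * (N + a) := by nlinarith
    nlinarith
  intro K R hR hK hc Φ hΦ M hM s hs t ht x hx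
  have hM0 := hM.nonneg
  obtain ⟨h, hh⟩ : ∃ h, h = √(t - s) := ⟨_, rfl⟩
  have hσ : 0 < t - s := by linarith [ht.1]
  have hh0 : 0 < h := by rw [hh]; exact Real.sqrt_pos.2 hσ
  have hha : h ≤ a := by
    rw [hh, ha]
    have : √(t - s) ≤ √T := Real.sqrt_le_sqrt (by linarith [ht.2, hs.1])
    linarith
  have hst : s ≤ t := ht.1.le
  obtain ⟨Ψ, hΨ, hp⟩ := exists_spatial_smoothing hΦ hh0 hθ.1
  obtain ⟨p1, p2, p3⟩ := hp [] M hM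
  have hpos : 0 < h ^ θ := Real.rpow_pos_of_pos hh0 θ
  have hle1 : h ≤ a * h ^ θ := by
    have e : h = h ^ (1 - θ) * h ^ θ := by
      rw [← Real.rpow_add hh0]; simp
    calc h = h ^ (1 - θ) * h ^ θ := e
      _ ≤ a ^ (1 - θ) * h ^ θ := by
        gcongr
        linarith [hθ.2]
      _ ≤ a ^ (1 : ℝ) * h ^ θ := by
        gcongr
        linarith [hθ.1]
      _ = _ := by rw [Real.rpow_one]
  have main : ∀ γ : List (Fin N), 1 ≤ γ.length → γ.length ≤ 3 →
      h ^ γ.length * |wd (ex N) γ (K.G Φ s t) x| ≤ C * (N + a) * M * h ^ θ := by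
    intro γ h1 h3
    have q1 := hG K R hR hK hc 0 (by norm_num) _ (hΨ.sub hΦ) (N * (M * h ^ θ)) (fun γ hγ y => by
      rw [List.length_eq_zero_iff.1 (Nat.le_zero.1 hγ)]; exact p2 y) s hs t ⟨hst, ht.2⟩ x hx γ h3
    have q2 := hG K R hR hK hc 1 (by norm_num) _ hΨ (a * (M * h ^ θ / h)) (fun γ hγ y => by
      match γ, hγ with
      | [], _ =>
        refine (p1 y).trans ?_
        rw [mul_div_assoc', le_div_iff₀ hh0]
        calc M * h ≤ M * (a * h ^ θ) := by gcongr
          _ = _ := by ring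
      | [i], _ =>
        refine (p3 i y).trans ?_
        exact le_mul_of_one_le_left (by positivity) ha1
      | _ :: _ :: _, h => simp at h) s hs t ⟨hst, ht.2⟩ x hx γ h3
    rw [← hh, Nat.sub_zero] at q1
    rw [← hh] at q2
    have q3 := mul_le_mul_of_nonneg_left q2 hh0.le
    rw [← mul_assoc, ← pow_succ', Nat.sub_add_cancel h1] at q3
    rw [G_split K hΦ hΨ hst]
    have q4 := abs_add_le (wd (ex N) γ (K.G (fun y => Ψ y - Φ y) s t) x * (-1))
      (wd (ex N) γ (K.G Ψ s t) x)
    rw [abs_mul, abs_neg, abs_one, mul_one] at q4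
    have q5 := mul_le_mul_of_nonneg_left q4 (pow_nonneg hh0.le γ.length)
    have e : h * (C * (a * (M * h ^ θ / h))) = C * a * M * h ^ θ := by field_simp
    rw [e] at q3
    linarith
  have conv : ∀ p : ℝ, ∀ k : ℕ, p = θ - k → ∀ X Y : ℝ, h ^ k * X ≤ Y * h ^ θ →
      X ≤ Y * (t - s) ^ (p / 2) := by
    intro p k hpk X Y hXY
    rw [← sqrt_rpow hσ.le, ← hh, hpk, Real.rpow_sub hh0, Real.rpow_natCast, mul_div_assoc',
      le_div_iff₀ (by positivity)]
    linarith
  have hY : C * (N + a) * M ≤ C * (N + a) * a ^ 2 * M := by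
    have : 1 ≤ a ^ 2 := one_le_pow₀ ha1
    have : 0 ≤ C * (N + a) * M := by positivity
    nlinarith
  intro γ
  refine ⟨fun h2 => ?_, fun h3 => ?_⟩
  · refine conv (θ - 2) 2 (by norm_num) _ _ ?_
    match γ, h2 with
    | [], _ =>
      have q := hG K R hR hK hc 0 (by norm_num) _ hΦ M (fun γ hγ y => by
        rw [List.length_eq_zero_iff.1 (Nat.le_zero.1 hγ)]; exact hM.1 y) s hs t ⟨hst, ht.2⟩ x hx []
        (by norm_num)
      simp only [List.length_nil, Nat.sub_zero, pow_zero, one_mul] at q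
      calc _ ≤ h ^ 2 * (C * M) := by gcongr
        _ = (h * C * M) * h := by ring
        _ ≤ (a * C * M) * (a * h ^ θ) := by gcongr
        _ = C * 1 * a ^ 2 * M * h ^ θ := by ring
        _ ≤ _ := by
          gcongr
          have : (0 : ℝ) ≤ N := by positivity
          linarith
    | [i], _ =>
      have q := main [i] (by simp) (by simp)
      rw [List.length_singleton, pow_one] at q
      calc _ = h * (h * |wd (ex N) [i] (K.G Φ s t) x|) := by ring
        _ ≤ h * (C * (N + a) * M * h ^ θ) := by gcongr
        _ ≤ a ^ 2 * (C * (N + a) * M * h ^ θ) := by gcongr; nlinarith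
        _ = _ := by ring
    | [i, k], _ =>
      refine (main [i, k] (by simp) (by simp)).trans ?_
      gcongr
    | _ :: _ :: _ :: γ, h =>
      simp only [List.length_cons] at h
      omega
  · refine conv (θ - 3) 3 (by norm_num) _ _ ?_
    have q := main γ (by omega) (by omega)
    rw [h3] at q
    refine q.trans ?_
    gcongr

end SmoothSchauder

section SmoothSchauderMain

variable {N : ℕ}

/-- Slice words of a solution are differentiable. -/
lemma G_word_diff_le (K : Coef N) {Φ : ℝ × ES N → ℝ} (h : SB (eS N) Φ) {s t : ℝ} (hst : s ≤ t)
    (γ : List (Fin N)) {ρ D : ℝ}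
    (hb : ∀ i, ∀ x, ‖x‖ ≤ ρ → |wd (ex N) (i :: γ) (K.G Φ s t) x| ≤ D) {x y : ES N}
    (hx : ‖x‖ ≤ ρ) (hy : ‖y‖ ≤ ρ) :
    |wd (ex N) γ (K.G Φ s t) x - wd (ex N) γ (K.G Φ s t) y| ≤ N * ‖x - y‖ * D :=
  diff_le (((K.G_sol h s t).sm t ⟨hst, le_rfl⟩).wd _ γ).differentiable hb hx hy

lemma initial_holder {κ ν₁ l T C θ : ℝ} (hC : 1 ≤ C) (hT : 0 ≤ T) (hθ : θ ∈ Ioo (0 : ℝ) 1)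
    (hG : GC N T κ ν₁ l C) {K : Coef N} {R : ℝ} (hR : 1 ≤ R) (hK : LH K T R κ ν₁ l)
    (hc : K.c₀ ≤ κ) {f : ℝ × ES N → ℝ} (hf : SB (eS N) f) {M : ℝ}
    (hM : ∀ γ : List (Fin N), γ.length ≤ 2 → HB θ M (wd (eS N) (sw γ) f)) {t : ℝ} (ht : t ∈ Icc 0 T)
    {x y : ES N} (hx : ‖x‖ ≤ R / 2) (hy : ‖y‖ ≤ R / 2) (hxy : ‖x - y‖ ≤ 1) (γ : List (Fin N))
    (hγ : γ.length = 2) :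
    |wd (ex N) γ (K.G f 0 t) x - wd (ex N) γ (K.G f 0 t) y| ≤ 3 * C * N * M * ‖x - y‖ ^ θ := by
  have hM0 := (hM [] (by simp)).nonneg
  rcases eq_or_ne x y with rfl | hne
  · simp [Real.zero_rpow hθ.1.ne']
  obtain ⟨h, hh⟩ : ∃ h, h = ‖x - y‖ := ⟨_, rfl⟩
  have hh0 : 0 < h := by rw [hh]; exact norm_pos_iff.2 (sub_ne_zero.2 hne)
  rw [← hh] at hxy ⊢
  have hpos : 0 < h ^ θ := Real.rpow_pos_of_pos hh0 θ
  have h0 : (0 : ℝ) ∈ Icc 0 T := ⟨le_rfl, hT⟩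
  obtain ⟨Ψ, hΨ, hp⟩ := exists_spatial_smoothing hf hh0 hθ.1
  have q1 : ∀ x : ES N, ‖x‖ ≤ R / 2 →
      |wd (ex N) γ (K.G (fun y => Ψ y - f y) 0 t) x| ≤ C * (N * (M * h ^ θ)) := fun x hx => by
    have := hG K R hR hK hc 2 (by norm_num) _ (hΨ.sub hf) (N * (M * h ^ θ)) (fun γ hγ y => by
      rw [wd_sub hΨ.sm hf.sm]
      exact (hp γ M (hM γ hγ)).2.1 y) 0 h0 t ht x hx γ (by omega)
    rwa [hγ, Nat.sub_self, pow_zero, one_mul] at this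
  have hle : M ≤ M * h ^ θ / h := by
    rw [le_div_iff₀ hh0]
    have := Real.rpow_le_rpow_of_exponent_ge hh0 hxy hθ.2.le
    rw [Real.rpow_one] at this
    exact mul_le_mul_of_nonneg_left this hM0
  have q2 := G_word_diff_le K hΨ ht.1 γ (ρ := R / 2) (D := C * (M * h ^ θ / h)) (fun i x hx => by
    have := hG K R hR hK hc 3 (by norm_num) _ hΨ (M * h ^ θ / h) (fun γ hγ y => by
      by_cases h3 : γ.length ≤ 2
      · exact ((hp γ M (hM γ h3)).1 y).trans hle
      · match γ with
        | [] => simp at h3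
        | i :: γ => exact (hp γ M (hM γ (by simp only [List.length_cons] at hγ; omega))).2.2 i y) 0 h0 t ht x hx (i :: γ)
        (by simp [hγ])
    simpa [hγ] using this) hx hy
  rw [← hh] at q2
  rw [G_split K hf hΨ ht.1 γ x, G_split K hf hΨ ht.1 γ y]
  have e : N * h * (C * (M * h ^ θ / h)) = C * N * M * h ^ θ := by field_simp
  rw [e] at q2
  have a1 := abs_le.1 (q1 x hx)
  have a2 := abs_le.1 (q1 y hy)
  have a3 := abs_le.1 q2
  rw [abs_le]
  constructor
  · linarith only [a1.1, a1.2, a2.1, a2.2, a3.1, a3.2]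
  · linarith only [a1.1, a1.2, a2.1, a2.2, a3.1, a3.2]

lemma integral_rpow_zero {θ t : ℝ} (hθ : 0 < θ) :
    IntervalIntegrable (fun σ : ℝ => σ ^ ((θ - 2) / 2)) volume 0 t ∧
      ∫ σ in (0 : ℝ)..t, σ ^ ((θ - 2) / 2) = 2 / θ * t ^ (θ / 2) := by
  have h : -1 < (θ - 2) / 2 := by linarith
  refine ⟨intervalIntegral.intervalIntegrable_rpow' h, ?_⟩
  rw [integral_rpow (Or.inl h), show (θ - 2) / 2 + 1 = θ / 2 by ring,
    Real.zero_rpow (by positivity)]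
  field_simp
  ring

lemma integral_rpow_far {θ δ t : ℝ} (hθ : θ < 1) (hδ : 0 < δ) (hδt : δ ≤ t) :
    IntervalIntegrable (fun σ : ℝ => σ ^ ((θ - 3) / 2)) volume δ t ∧
      ∫ σ in δ..t, σ ^ ((θ - 3) / 2) ≤ 2 / (1 - θ) * δ ^ ((θ - 1) / 2) := by
  have h0 : (0 : ℝ) ∉ uIcc δ t := by
    rw [uIcc_of_le hδt]; exact fun h => absurd h.1 (not_le.2 hδ)
  refine ⟨intervalIntegral.intervalIntegrable_rpow (Or.inr h0), ?_⟩
  rw [integral_rpow (Or.inr ⟨by linarith, h0⟩), show (θ - 3) / 2 + 1 = (θ - 1) / 2 by ring]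
  have h1 : 0 < t ^ ((θ - 1) / 2) := Real.rpow_pos_of_pos (by linarith) _
  have h2 : 0 < 1 - θ := by linarith
  have h3 : θ - 1 ≠ 0 := by linarith
  have e : (t ^ ((θ - 1) / 2) - δ ^ ((θ - 1) / 2)) / ((θ - 1) / 2) =
      2 / (1 - θ) * (δ ^ ((θ - 1) / 2) - t ^ ((θ - 1) / 2)) := by
    rw [div_eq_iff (by positivity), div_mul_eq_mul_div, div_mul_eq_mul_div, eq_div_iff h2.ne']
    ring
  rw [e]
  gcongr
  linarith

lemma duhamel_bound {T D θ : ℝ} (hθ : θ ∈ Ioo (0 : ℝ) 1)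
    {K : Coef N} {R : ℝ} {g : ℝ × ES N → ℝ} {M : ℝ} (hDM : 0 ≤ D * M)
    (hD : ∀ s ∈ Icc 0 T, ∀ t ∈ Ioc s T, ∀ x, ‖x‖ ≤ R / 2 → ∀ γ : List (Fin N),
      (γ.length ≤ 2 → |wd (ex N) γ (K.G g s t) x| ≤ D * M * (t - s) ^ ((θ - 2) / 2)) ∧
      (γ.length = 3 → |wd (ex N) γ (K.G g s t) x| ≤ D * M * (t - s) ^ ((θ - 3) / 2)))
    {t : ℝ} (ht : t ∈ Icc 0 T) {x : ES N} (hx : ‖x‖ ≤ R / 2) (γ : List (Fin N)) (hγ : γ.length ≤ 2) :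
    |∫ σ in (0 : ℝ)..t, wd (ex N) γ (K.G g (t - σ) t) x| ≤ D * M * (2 / θ * (1 + T)) := by
  obtain ⟨i1, i2⟩ := integral_rpow_zero (t := t) hθ.1
  have h := intervalIntegral.norm_integral_le_of_norm_le
    (f := fun σ => wd (ex N) γ (K.G g (t - σ) t) x) ht.1
    (g := fun σ => D * M * σ ^ ((θ - 2) / 2)) (Eventually.of_forall fun σ hσ => by
      have := (hD (t - σ) ⟨by linarith [hσ.2], by linarith [hσ.1, ht.2]⟩ t
        ⟨by linarith [hσ.1], ht.2⟩ x hx γ).1 hγ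
      rwa [sub_sub_cancel] at this) (i1.const_mul _)
  rw [intervalIntegral.integral_const_mul, i2, Real.norm_eq_abs] at h
  refine h.trans ?_
  have h0 := ht.1
  have hp := hθ.1
  gcongr
  calc t ^ (θ / 2) ≤ (1 + T) ^ (θ / 2) := by gcongr; linarith [ht.2]
    _ ≤ (1 + T) ^ (1 : ℝ) := by
      apply Real.rpow_le_rpow_of_exponent_le
      · linarith [ht.2]
      · linarith [hθ.2]
    _ = 1 + T := Real.rpow_one _

lemma duhamel_holder {T D θ : ℝ} (hθ : θ ∈ Ioo (0 : ℝ) 1)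
    {K : Coef N} {R : ℝ} {g : ℝ × ES N → ℝ} (hg : SB (eS N) g) {M : ℝ} (hDM : 0 ≤ D * M)
    (hD : ∀ s ∈ Icc 0 T, ∀ t ∈ Ioc s T, ∀ x, ‖x‖ ≤ R / 2 → ∀ γ : List (Fin N),
      (γ.length ≤ 2 → |wd (ex N) γ (K.G g s t) x| ≤ D * M * (t - s) ^ ((θ - 2) / 2)) ∧
      (γ.length = 3 → |wd (ex N) γ (K.G g s t) x| ≤ D * M * (t - s) ^ ((θ - 3) / 2)))
    {t : ℝ} (ht : t ∈ Icc 0 T) {x y : ES N} (hx : ‖x‖ ≤ R / 2) (hy : ‖y‖ ≤ R / 2)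
    (γ : List (Fin N)) (hγ : γ.length = 2) :
    |(∫ σ in (0 : ℝ)..t, wd (ex N) γ (K.G g (t - σ) t) x) -
      ∫ σ in (0 : ℝ)..t, wd (ex N) γ (K.G g (t - σ) t) y| ≤
      D * M * (4 / θ + N * (2 / (1 - θ))) * ‖x - y‖ ^ θ := by
  rcases eq_or_ne x y with rfl | hne
  · simp [Real.zero_rpow hθ.1.ne']
  obtain ⟨h, hh⟩ : ∃ h, h = ‖x - y‖ := ⟨_, rfl⟩
  have hh0 : 0 < h := by rw [hh]; exact norm_pos_iff.2 (sub_ne_zero.2 hne)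
  have hpos : 0 < h ^ θ := Real.rpow_pos_of_pos hh0 θ
  have ht0 := ht.1
  have hθ1 : 0 < 1 - θ := by linarith [hθ.2]
  have hθ0 := hθ.1
  have hI := fun x : ES N => (K.U_words hg hg γ ht.1 x).1
  obtain ⟨F, hF⟩ : ∃ F : ℝ → ℝ, F = fun σ => wd (ex N) γ (K.G g (t - σ) t) x -
      wd (ex N) γ (K.G g (t - σ) t) y := ⟨_, rfl⟩
  have hFi : IntervalIntegrable F volume 0 t := by rw [hF]; exact (hI x).sub (hI y)
  have b1 : ∀ σ ∈ Ioc 0 t, ‖F σ‖ ≤ 2 * (D * M) * σ ^ ((θ - 2) / 2) := fun σ hσ => by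
    have hs : t - σ ∈ Icc 0 T := ⟨by linarith [hσ.2], by linarith [hσ.1, ht.2]⟩
    have hs' : t ∈ Ioc (t - σ) T := ⟨by linarith [hσ.1], ht.2⟩
    have h1 := (hD _ hs t hs' x hx γ).1 hγ.le
    have h2 := (hD _ hs t hs' y hy γ).1 hγ.le
    rw [sub_sub_cancel] at h1 h2
    rw [hF, Real.norm_eq_abs]
    have := abs_sub (wd (ex N) γ (K.G g (t - σ) t) x) (wd (ex N) γ (K.G g (t - σ) t) y)
    linarith
  have b2 : ∀ σ ∈ Ioc 0 t, ‖F σ‖ ≤ N * h * (D * M) * σ ^ ((θ - 3) / 2) := fun σ hσ => by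
    have hs : t - σ ∈ Icc 0 T := ⟨by linarith [hσ.2], by linarith [hσ.1, ht.2]⟩
    have hs' : t ∈ Ioc (t - σ) T := ⟨by linarith [hσ.1], ht.2⟩
    have := G_word_diff_le K hg hs'.1.le γ (ρ := R / 2) (D := D * M * σ ^ ((θ - 3) / 2))
      (fun i x hx => by
        have := (hD _ hs t hs' x hx (i :: γ)).2 (by simp [hγ])
        rwa [sub_sub_cancel] at this) hx hy
    rw [hF, Real.norm_eq_abs, hh]
    linarith
  obtain ⟨δ, hδ⟩ : ∃ δ, δ = min t (h ^ 2) := ⟨_, rfl⟩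
  have hδt : δ ≤ t := hδ ▸ min_le_left _ _
  have hδ0 : 0 ≤ δ := by rw [hδ]; positivity
  have hm : δ ∈ uIcc 0 t := by rw [uIcc_of_le ht0]; exact ⟨hδ0, hδt⟩
  have f1 : IntervalIntegrable F volume 0 δ := hFi.mono_set (uIcc_subset_uIcc_left hm)
  have f2 : IntervalIntegrable F volume δ t := hFi.mono_set (uIcc_subset_uIcc_right hm)
  have c1 : |∫ σ in (0 : ℝ)..δ, F σ| ≤ D * M * (4 / θ) * h ^ θ := by
    obtain ⟨i1, i2⟩ := integral_rpow_zero (t := δ) hθ.1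
    have q := intervalIntegral.norm_integral_le_of_norm_le hδ0
      (Eventually.of_forall fun σ hσ => b1 σ ⟨hσ.1, hσ.2.trans hδt⟩) (i1.const_mul (2 * (D * M)))
    rw [intervalIntegral.integral_const_mul, i2, Real.norm_eq_abs] at q
    refine q.trans ?_
    have : δ ^ (θ / 2) ≤ h ^ θ := by
      calc δ ^ (θ / 2) ≤ (h ^ 2) ^ (θ / 2) := by gcongr; exact hδ ▸ min_le_right _ _
        _ = h ^ θ := by
          rw [← Real.rpow_natCast, ← Real.rpow_mul hh0.le]; congr 1; push_cast; ring
    calc _ ≤ 2 * (D * M) * (2 / θ * h ^ θ) := by gcongr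
      _ = _ := by ring
  have c2 : |∫ σ in δ..t, F σ| ≤ D * M * (N * (2 / (1 - θ))) * h ^ θ := by
    by_cases hth : t ≤ h ^ 2
    · rw [hδ, min_eq_left hth, intervalIntegral.integral_same, abs_zero]
      positivity
    · have hδ' : δ = h ^ 2 := by rw [hδ, min_eq_right (not_le.1 hth).le]
      have hδ1 : 0 < δ := by rw [hδ']; positivity
      obtain ⟨i1, i2⟩ := integral_rpow_far hθ.2 hδ1 hδt
      have q := intervalIntegral.norm_integral_le_of_norm_le hδt
        (Eventually.of_forall fun σ hσ => b2 σ ⟨hδ1.trans hσ.1, hσ.2⟩)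
        (i1.const_mul (N * h * (D * M)))
      rw [intervalIntegral.integral_const_mul, Real.norm_eq_abs] at q
      have e : δ ^ ((θ - 1) / 2) = h ^ θ / h := by
        rw [hδ', ← Real.rpow_natCast, ← Real.rpow_mul hh0.le, ← Real.rpow_sub_one hh0.ne']
        congr 1; push_cast; ring
      rw [e] at i2
      calc _ ≤ _ := q
        _ ≤ N * h * (D * M) * (2 / (1 - θ) * (h ^ θ / h)) := by gcongr
        _ = _ := by field_simp
  rw [← intervalIntegral.integral_sub (hI x) (hI y)]
  have e : (∫ σ in (0 : ℝ)..t, (wd (ex N) γ (K.G g (t - σ) t) x - wd (ex N) γ (K.G g (t - σ) t) y)) =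
      (∫ σ in (0 : ℝ)..δ, F σ) + ∫ σ in δ..t, F σ := by
    rw [intervalIntegral.integral_add_adjacent_intervals f1 f2, hF]
  rw [e, ← hh]
  refine (abs_add_le _ _).trans ?_
  linarith

/-- Uniform Schauder estimates for smooth data and smooth bounded coefficients. -/
theorem smooth_schauder (hN : 1 ≤ N) {κ ν₁ l T θ : ℝ} (hT : 0 ≤ T) (hκ : 1 ≤ κ) (hl : 0 < l)
    (hν₁ : 0 < ν₁) (hθ : θ ∈ Ioo (0 : ℝ) 1) : ∃ D, 1 ≤ D ∧
    ∀ (K : Coef N) (R : ℝ), 1 ≤ R → LH K T R κ ν₁ l → K.c₀ ≤ κ → ∀ f g, SB (eS N) f → SB (eS N) g →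
    ∀ M, (∀ γ : List (Fin N), γ.length ≤ 2 → HB θ M (wd (eS N) (sw γ) f)) → HB θ M g →
    ∀ t ∈ Icc 0 T, ∀ x, ‖x‖ ≤ R / 2 → ∀ γ : List (Fin N), γ.length ≤ 2 →
      |wd (ex N) γ (K.U f g t) x| ≤ D * M ∧
      ∀ y, ‖y‖ ≤ R / 2 → γ.length = 2 →
        |wd (ex N) γ (K.U f g t) x - wd (ex N) γ (K.U f g t) y| ≤ D * M * ‖x - y‖ ^ θ := by
  obtain ⟨C, hC1, hC⟩ := exists_gc hN hT hκ hl hν₁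
  obtain ⟨D, hD1, hD⟩ := G_holder hC1 hθ hC
  have hθ0 := hθ.1
  have hθ1 : 0 < 1 - θ := by linarith [hθ.2]
  obtain ⟨D₁, hD₁⟩ : ∃ D₁, D₁ = C + D * (2 / θ * (1 + T)) := ⟨_, rfl⟩
  obtain ⟨D₂, hD₂⟩ : ∃ D₂, D₂ = 3 * C * N + D * (4 / θ + N * (2 / (1 - θ))) := ⟨_, rfl⟩
  have hp1 : 1 ≤ D₁ := by
    rw [hD₁]
    have : 0 ≤ D * (2 / θ * (1 + T)) := by positivity
    linarith
  have hp2 : 0 ≤ D₂ := by rw [hD₂]; positivity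
  refine ⟨2 * D₁ + D₂, by linarith, ?_⟩
  intro K R hR hK hc f g hf hg M hfM hgM t ht
  have hM0 := hgM.nonneg
  have hG := hD K R hR hK hc g hg M hgM
  have bd : ∀ x, ‖x‖ ≤ R / 2 → ∀ γ : List (Fin N), γ.length ≤ 2 →
      |wd (ex N) γ (K.U f g t) x| ≤ D₁ * M := fun x hx γ hγ => by
    rw [(K.U_words hf hg γ ht.1 x).2]
    have h1 := hC K R hR hK hc 2 (by norm_num) f hf M (fun γ hγ => (hfM γ hγ).1) 0 ⟨le_rfl, hT⟩ t ht
      x hx γ (by omega)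
    rw [Nat.sub_eq_zero_of_le hγ, pow_zero, one_mul] at h1
    have h2 := duhamel_bound hθ (by positivity) hG ht hx γ hγ
    refine (abs_add_le _ _).trans ?_
    rw [hD₁]
    linarith
  intro x hx γ hγ
  refine ⟨(bd x hx γ hγ).trans (by gcongr; linarith), fun y hy h2 => ?_⟩
  by_cases hxy : ‖x - y‖ ≤ 1
  · rw [(K.U_words hf hg γ ht.1 x).2, (K.U_words hf hg γ ht.1 y).2]
    have h3 := initial_holder hC1 hT hθ hC hR hK hc hf hfM ht hx hy hxy γ h2
    have h4 := duhamel_holder hθ hg (by positivity) hG ht hx hy γ h2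
    have h5 : D₂ * M * ‖x - y‖ ^ θ ≤ (2 * D₁ + D₂) * M * ‖x - y‖ ^ θ := by gcongr; linarith
    refine le_trans ?_ h5
    rw [hD₂, add_sub_add_comm]
    refine (abs_add_le _ _).trans ?_
    linarith
  · have h3 := bd x hx γ hγ
    have h4 := bd y hy γ hγ
    have h5 : (1 : ℝ) ≤ ‖x - y‖ ^ θ := Real.one_le_rpow (not_le.1 hxy).le hθ.1.le
    have h6 := abs_sub (wd (ex N) γ (K.U f g t) x) (wd (ex N) γ (K.U f g t) y)
    calc _ ≤ 2 * D₁ * M := by linarith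
      _ ≤ (2 * D₁ + D₂) * M * 1 := by rw [mul_one]; gcongr; linarith
      _ ≤ _ := by gcongr

end SmoothSchauderMain

section Mollification

variable {N : ℕ}

instance : (volume : Measure (ℝ × ES N)).IsAddHaarMeasure :=
  inferInstanceAs ((volume : Measure ℝ).prod (volume : Measure (ES N))).IsAddHaarMeasure

/-- Convolution of a kernel with a function. -/
def cv (k A : ℝ × ES N → ℝ) (p : ℝ × ES N) : ℝ := ∫ z, k z * A (p - z)

lemma cv_integrable {k A : ℝ × ES N → ℝ} (hk : Continuous k) (hs : HasCompactSupport k)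
    (hA : Continuous A) (p : ℝ × ES N) : Integrable fun z => k z * A (p - z) :=
  (hk.mul (hA.comp (continuous_const.sub continuous_id))).integrable_of_hasCompactSupport hs.mul_right

lemma cv_eq (k A : ℝ × ES N → ℝ) :
    cv k A = MeasureTheory.convolution k A (ContinuousLinearMap.lsmul ℝ ℝ) volume := rfl

lemma cv_smooth {k A : ℝ × ES N → ℝ} (hk : Sm k) (hs : HasCompactSupport k) (hA : Continuous A) :
    Sm (cv k A) := by
  rw [cv_eq]
  exact hs.contDiff_convolution_left _ hk hA.locallyIntegrable

lemma dd_cv {k A : ℝ × ES N → ℝ} (hk : Sm k) (hs : HasCompactSupport k) (hA : Continuous A)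
    (v : ℝ × ES N) : dd v (cv k A) = cv (dd v k) A := by
  funext p
  have h := hs.hasFDerivAt_convolution_left (ContinuousLinearMap.lsmul ℝ ℝ)
    (hk.of_le (by exact_mod_cast le_top)) (hA.locallyIntegrable (μ := volume)) p
  have hc : Continuous (fderiv ℝ k) := hk.continuous_fderiv (by simp)
  rw [dd, cv_eq, h.fderiv]
  unfold MeasureTheory.convolution
  rw [ContinuousLinearMap.integral_apply]
  · rfl
  · refine Continuous.integrable_of_hasCompactSupport ?_ ?_
    · exact ((ContinuousLinearMap.precompL (ℝ × ES N) (ContinuousLinearMap.lsmul ℝ ℝ)).isBoundedBilinearMap.continuous).comp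
        (hc.prodMk (hA.comp (continuous_const.sub continuous_id)))
    · refine (hs.fderiv ℝ).mono' fun z hz => ?_
      refine subset_tsupport _ fun h0 => hz ?_
      simp only [h0, map_zero]
      rfl

lemma HasCompactSupport.dd {k : ℝ × ES N → ℝ} (hs : HasCompactSupport k) (v : ℝ × ES N) :
    HasCompactSupport (dd v k) :=
  (hs.fderiv ℝ).mono' fun z hz => subset_tsupport _ fun h0 => hz (by simp [_root_.dd, h0])

lemma HasCompactSupport.wd {ι : Type*} {k : ℝ × ES N → ℝ} (hs : HasCompactSupport k)
    (e : ι → ℝ × ES N) (γ : List ι) : HasCompactSupport (wd e γ k) := by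
  induction γ with
  | nil => exact hs
  | cons i γ ih => exact ih.dd _

lemma cv_sb {k A : ℝ × ES N → ℝ} (hk : Sm k) (hs : HasCompactSupport k) (hA : Continuous A) {B : ℝ}
    (hB : ∀ p, |A p| ≤ B) : SB (eS N) (cv k A) := by
  have hw : ∀ γ, wd (eS N) γ (cv k A) = cv (wd (eS N) γ k) A := fun γ => by
    induction γ with
    | nil => rfl
    | cons i γ ih => rw [wd_cons, ih, dd_cv (hk.wd _ γ) (hs.wd _ γ) hA]; rfl
  refine SB.mk (cv_smooth hk hs hA) fun γ => ⟨∫ z, |wd (eS N) γ k z| * B, fun p => ?_⟩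
  rw [hw, ← Real.norm_eq_abs]
  refine norm_integral_le_of_norm_le ?_ (Eventually.of_forall fun z => ?_)
  · exact (((hk.wd _ γ).continuous.integrable_of_hasCompactSupport (hs.wd _ γ)).abs).mul_const B
  · rw [norm_mul, Real.norm_eq_abs, Real.norm_eq_abs]
    gcongr
    exact hB _

/-- Mollification by a normalized bump function. -/
def mo (φ : ContDiffBump (0 : ℝ × ES N)) (A : ℝ × ES N → ℝ) : ℝ × ES N → ℝ :=
  cv (φ.normed volume) A

variable (φ : ContDiffBump (0 : ℝ × ES N)) {A : ℝ × ES N → ℝ}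

lemma mo_sb (hA : Continuous A) {B : ℝ} (hB : ∀ p, |A p| ≤ B) : SB (eS N) (mo φ A) :=
  cv_sb φ.contDiff_normed φ.hasCompactSupport_normed hA hB

lemma mo_integrable (hA : Continuous A) (p : ℝ × ES N) :
    Integrable fun z => φ.normed volume z * A (p - z) :=
  cv_integrable φ.continuous_normed φ.hasCompactSupport_normed hA p

lemma normed_eq_zero_or (p z : ℝ × ES N) :
    φ.normed volume z = 0 ∨ dist (p - z) p < φ.rOut := by
  by_cases h : φ.normed volume z = 0
  · exact Or.inl h
  · have : z ∈ Function.support (φ.normed volume) := h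
    rw [φ.support_normed_eq, mem_ball_zero_iff] at this
    exact Or.inr (by rwa [dist_eq_norm, sub_sub_cancel_left, norm_neg])

lemma integral_normed_mul (c : ℝ) : ∫ z, φ.normed volume z * c = c := by
  rw [integral_mul_const, φ.integral_normed, one_mul]

lemma mo_le (hA : Continuous A) {p : ℝ × ES N} {B : ℝ} (h : ∀ q, A q ≤ B) : mo φ A p ≤ B := by
  rw [← integral_normed_mul φ B]
  refine integral_mono (mo_integrable φ hA p) (φ.integrable_normed.mul_const B) fun z => ?_
  exact mul_le_mul_of_nonneg_left (h _) (φ.nonneg_normed _)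

lemma le_mo (hA : Continuous A) {p : ℝ × ES N} {B : ℝ} (h : ∀ q, B ≤ A q) : B ≤ mo φ A p := by
  rw [← integral_normed_mul φ B]
  refine integral_mono (φ.integrable_normed.mul_const B) (mo_integrable φ hA p) fun z => ?_
  exact mul_le_mul_of_nonneg_left (h _) (φ.nonneg_normed _)

lemma integral_normed_mul_le {F : ℝ × ES N → ℝ} (p : ℝ × ES N) {η : ℝ}
    (h : ∀ z, dist (p - z) p < φ.rOut → |F z| ≤ η) : |∫ z, φ.normed volume z * F z| ≤ η := by
  rw [← integral_normed_mul φ η, ← Real.norm_eq_abs]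
  refine norm_integral_le_of_norm_le (φ.integrable_normed.mul_const η)
    (Eventually.of_forall fun z => ?_)
  rw [norm_mul, Real.norm_eq_abs, Real.norm_eq_abs, abs_of_nonneg (φ.nonneg_normed _)]
  rcases normed_eq_zero_or φ p z with h0 | h0
  · simp [h0]
  · exact mul_le_mul_of_nonneg_left (h z h0) (φ.nonneg_normed _)

lemma mo_close (hA : Continuous A) {p : ℝ × ES N} {a η : ℝ}
    (h : ∀ q, dist q p < φ.rOut → |A q - a| ≤ η) : |mo φ A p - a| ≤ η := by
  have e : mo φ A p - a = ∫ z, φ.normed volume z * (A (p - z) - a) := by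
    simp only [mul_sub]
    rw [integral_sub (mo_integrable φ hA p) (φ.integrable_normed.mul_const a),
      integral_normed_mul]
    rfl
  rw [e]
  exact integral_normed_mul_le φ p fun z hz => h _ hz

lemma mo_hb (hA : Continuous A) {θ M : ℝ} (h : HB θ M A) : HB θ M (mo φ A) := by
  refine ⟨fun y => integral_normed_mul_le φ y fun z _ => h.1 _, fun i r hr y => ?_⟩
  unfold mo cv
  rw [← integral_sub (mo_integrable φ hA _) (mo_integrable φ hA y)]
  simp only [← mul_sub]
  refine integral_normed_mul_le φ y fun z _ => ?_
  rw [add_sub_right_comm]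
  exact h.2 i r hr _

lemma hasDerivAt_mo {A' : ℝ × ES N → ℝ} (hA : Continuous A) (hA' : Continuous A') {B ρ : ℝ}
    (hB : ∀ p, |A' p| ≤ B) {v : ℝ × ES N}
    (hd : ∀ p : ℝ × ES N, ‖p.2‖ < ρ → HasDerivAt (fun s : ℝ => A (p + s • v)) (A' p) 0)
    {p : ℝ × ES N} (hp : ‖p.2‖ + φ.rOut < ρ) :
    HasDerivAt (fun s : ℝ => mo φ A (p + s • v)) (mo φ A' p) 0 := by
  have hS : ∀ᶠ s : ℝ in 𝓝 0, ‖(p + s • v).2‖ + φ.rOut < ρ := by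
    refine ContinuousAt.eventually_lt (f := fun s : ℝ => ‖(p + s • v).2‖ + φ.rOut)
      (by fun_prop) continuousAt_const ?_
    simpa using hp
  have h := (hasDerivAt_integral_of_dominated_loc_of_deriv_le (μ := volume) (x₀ := (0 : ℝ)) hS
    (F := fun s z => φ.normed volume z * A (p + s • v - z))
    (F' := fun s z => φ.normed volume z * A' (p + s • v - z))
    (bound := fun z => φ.normed volume z * B)
    (Eventually.of_forall fun s => (mo_integrable φ hA _).aestronglyMeasurable)
    (mo_integrable φ hA _) (mo_integrable φ hA' _).aestronglyMeasurable
    (Eventually.of_forall fun z s _ => ?_) (φ.integrable_normed.mul_const B)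
    (Eventually.of_forall fun z s hs => ?_)).2
  · simpa [mo, cv] using h
  · rw [norm_mul, Real.norm_eq_abs, Real.norm_eq_abs, abs_of_nonneg (φ.nonneg_normed _)]
    exact mul_le_mul_of_nonneg_left (hB _) (φ.nonneg_normed _)
  · rcases normed_eq_zero_or φ (p + s • v) z with h0 | h0
    · simpa [h0] using hasDerivAt_const s (0 : ℝ)
    · have h1 : ‖(p + s • v - z).2‖ < ρ := by
        have : ‖(p + s • v - z).2 - (p + s • v).2‖ < φ.rOut := by
          refine lt_of_le_of_lt ?_ h0
          rw [dist_eq_norm, ← Prod.snd_sub]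
          exact norm_snd_le _
        have h2 := norm_add_le ((p + s • v - z).2 - (p + s • v).2) (p + s • v).2
        rw [sub_add_cancel] at h2
        have h3 : ‖(p + s • v).2‖ + φ.rOut < ρ := hs
        linarith
      refine HasDerivAt.const_mul _ ?_
      have h3 : HasDerivAt (fun s' : ℝ => s' - s) 1 s := (hasDerivAt_id' s).sub_const s
      have h4 := HasDerivAt.comp s (h₂ := fun r : ℝ => A (p + s • v - z + r • v))
        (by simpa using hd _ h1) h3
      rw [mul_one] at h4
      refine h4.congr_of_eventuallyEq (Eventually.of_forall fun r => ?_)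
      simp only [Function.comp]
      congr 1
      rw [sub_smul]; abel

lemma wd_mo (W : List (Fin N) → ℝ × ES N → ℝ) {k : ℕ} {ρ : ℝ}
    (hc : ∀ γ, γ.length ≤ k → Continuous (W γ))
    (hb : ∀ γ, γ.length ≤ k → ∃ B : ℝ, ∀ p, |W γ p| ≤ B)
    (hd : ∀ γ, γ.length < k → ∀ i, ∀ p : ℝ × ES N, ‖p.2‖ < ρ →
      HasDerivAt (fun s : ℝ => W γ (p + s • eS N (Sum.inr i))) (W (i :: γ) p) 0) :
    ∀ γ : List (Fin N), γ.length ≤ k → ∀ p : ℝ × ES N, ‖p.2‖ + φ.rOut < ρ →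
      wd (eS N) (sw γ) (mo φ (W [])) p = mo φ (W γ) p := by
  obtain ⟨B₀, hB₀⟩ := hb [] (by simp)
  have hS := (mo_sb φ (hc [] (by simp)) hB₀).sm
  intro γ
  induction γ with
  | nil => intro _ p _; rfl
  | cons i γ ih =>
    intro hγ p hp
    simp only [List.length_cons] at hγ
    obtain ⟨B, hB⟩ := hb (i :: γ) (by simpa using hγ)
    have h1 := hasDerivAt_mo φ (hc γ (by omega)) (hc (i :: γ) (by simpa using hγ)) hB
      (v := eS N (Sum.inr i)) (hd γ (by omega) i) hp
    have h2 := hasDerivAt_line (f := wd (eS N) (sw γ) (mo φ (W []))) (y := p) (t := 0)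
      (v := eS N (Sum.inr i)) (hS.wd _ _).differentiableAt
    have h3 : (fun s : ℝ => wd (eS N) (sw γ) (mo φ (W [])) (p + s • eS N (Sum.inr i)))
        =ᶠ[𝓝 0] fun s => mo φ (W γ) (p + s • eS N (Sum.inr i)) := by
      have : ∀ᶠ s : ℝ in 𝓝 0, ‖(p + s • eS N (Sum.inr i)).2‖ + φ.rOut < ρ :=
        ContinuousAt.eventually_lt (f := fun s : ℝ => ‖(p + s • eS N (Sum.inr i)).2‖ + φ.rOut)
          (by fun_prop) continuousAt_const (by simpa using hp)
      filter_upwards [this] with s hs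
      exact ih (by omega) _ hs
    have := (h1.congr_of_eventuallyEq h3).unique h2
    rw [zero_smul, add_zero] at this
    exact this.symm

end Mollification

section Approximation

variable {N : ℕ} {T : ℝ}

/-- Functions on `[0,T] × ℝ^N` with `k` jointly continuous spatial derivatives. -/
structure AC (T : ℝ) (k : ℕ) (a : ℝ → ES N → ℝ) : Prop where
  sm : ∀ t ∈ Icc 0 T, ContDiff ℝ k (a t)
  cont : ∀ γ : List (Fin N), γ.length ≤ k →
    ContinuousOn (fun p : ℝ × ES N => wd (ex N) γ (a p.1) p.2) (Icc 0 T ×ˢ univ)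

lemma wd_contDiff {f : ES N → ℝ} (γ : List (Fin N)) : ∀ {j : ℕ}, ContDiff ℝ (j + γ.length : ℕ) f →
    ContDiff ℝ j (wd (ex N) γ f) := by
  induction γ with
  | nil => intro j h; simpa using h
  | cons i γ ih =>
    intro j h
    refine dd_contDiff (n := (j : ℕ∞)) ?_ _
    have := ih (j := j + 1) (by convert h using 2; simp; ring)
    exact_mod_cast this

/-- Clamping of the time variable. -/
def cl (T t : ℝ) : ℝ := max 0 (min t T)

lemma cl_mem (hT : 0 ≤ T) (t : ℝ) : cl T t ∈ Icc 0 T :=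
  ⟨le_max_left _ _, max_le hT (min_le_right _ _)⟩

lemma cl_eq {t : ℝ} (ht : t ∈ Icc 0 T) : cl T t = t := by
  rw [cl, min_eq_left ht.2, max_eq_right ht.1]

/-- Radial projection onto a ball. -/
def pj (ρ : ℝ) (x : ES N) : ES N := (ρ / max ρ ‖x‖) • x

lemma pj_continuous {ρ : ℝ} (hρ : 0 < ρ) : Continuous (pj (N := N) ρ) := by
  unfold pj
  refine Continuous.smul (continuous_const.div (continuous_const.max continuous_norm) fun x => ?_)
    continuous_id
  exact (lt_of_lt_of_le hρ (le_max_left _ _)).ne'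

lemma pj_norm {ρ : ℝ} (hρ : 0 < ρ) (x : ES N) : ‖pj ρ x‖ ≤ ρ := by
  have h : 0 < max ρ ‖x‖ := lt_of_lt_of_le hρ (le_max_left _ _)
  rw [pj, norm_smul, Real.norm_eq_abs, abs_of_pos (div_pos hρ h), div_mul_eq_mul_div, div_le_iff₀ h]
  exact mul_le_mul_of_nonneg_left (le_max_right _ _) hρ.le

lemma pj_eq {ρ : ℝ} (hρ : 0 < ρ) {x : ES N} (hx : ‖x‖ < ρ) : pj ρ x = x := by
  rw [pj, max_eq_left hx.le, div_self hρ.ne', one_smul]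

/-- Extension of the spatial derivatives of a function to the whole space-time. -/
def xt (T : ℝ) (π : ES N → ES N) (a : ℝ → ES N → ℝ) (γ : List (Fin N)) (p : ℝ × ES N) : ℝ :=
  wd (ex N) γ (a (cl T p.1)) (π p.2)

variable {a : ℝ → ES N → ℝ} {π : ES N → ES N} {k : ℕ}

lemma AC.xt_continuous (h : AC T k a) (hT : 0 ≤ T) (hπ : Continuous π) (γ : List (Fin N))
    (hγ : γ.length ≤ k) : Continuous (xt T π a γ) := by
  refine (h.cont γ hγ).comp_continuous (f := fun p : ℝ × ES N => (cl T p.1, π p.2)) ?_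
    fun p => ⟨cl_mem hT _, mem_univ _⟩
  unfold cl
  fun_prop

lemma AC.xt_bounded (h : AC T k a) (hT : 0 ≤ T) {ρ : ℝ} (hρ : 0 < ρ) (γ : List (Fin N))
    (hγ : γ.length ≤ k) : ∃ B : ℝ, ∀ p, |xt T (pj ρ) a γ p| ≤ B := by
  obtain ⟨B, hB⟩ := (isCompact_Icc.prod (isCompact_closedBall (0 : ES N) ρ)).exists_bound_of_continuousOn
    ((h.cont γ hγ).mono (prod_mono le_rfl (subset_univ _)))
  exact ⟨B, fun p => hB (cl T p.1, pj ρ p.2)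
    ⟨cl_mem hT _, mem_closedBall_zero_iff.2 (pj_norm hρ _)⟩⟩

lemma AC.xt_deriv (h : AC T k a) (hT : 0 ≤ T) {ρ : ℝ} (hρ : ∀ x, ‖x‖ < ρ → π x = x)
    (γ : List (Fin N)) (hγ : γ.length < k) (i : Fin N) (p : ℝ × ES N) (hp : ‖p.2‖ < ρ) :
    HasDerivAt (fun s : ℝ => xt T π a γ (p + s • eS N (Sum.inr i))) (xt T π a (i :: γ) p) 0 := by
  have hd : Differentiable ℝ (wd (ex N) γ (a (cl T p.1))) :=
    (wd_contDiff (j := 1) γ ((h.sm _ (cl_mem hT _)).of_le (by exact_mod_cast (by omega)))).differentiable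
      (by simp)
  have h1 := hasDerivAt_line (v := ex N i) (y := p.2) (t := 0) (hd _)
  have hS : ∀ᶠ s : ℝ in 𝓝 0, ‖p.2 + s • ex N i‖ < ρ :=
    ContinuousAt.eventually_lt (f := fun s : ℝ => ‖p.2 + s • ex N i‖) (by fun_prop)
      continuousAt_const (by simpa using hp)
  rw [zero_smul, add_zero] at h1
  have e : xt T π a (i :: γ) p = dd (ex N i) (wd (ex N) γ (a (cl T p.1))) p.2 := by
    rw [xt, hρ _ hp]; rfl
  rw [e]
  refine h1.congr_of_eventuallyEq ?_
  filter_upwards [hS] with s hs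
  simp only [xt, eS_inr, Prod.fst_add, Prod.snd_add, Prod.smul_fst, Prod.smul_snd, smul_zero, add_zero]
  rw [hρ _ hs]

lemma wd_mo_xt (h : AC T k a) (hT : 0 ≤ T) (hπ : Continuous π)
    {ρ : ℝ} (hρ : ∀ x, ‖x‖ < ρ → π x = x)
    (hb : ∀ γ : List (Fin N), γ.length ≤ k → ∃ B : ℝ, ∀ p, |xt T π a γ p| ≤ B)
    (φ : ContDiffBump (0 : ℝ × ES N)) (γ : List (Fin N)) (hγ : γ.length ≤ k) (p : ℝ × ES N)
    (hp : ‖p.2‖ + φ.rOut < ρ) :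
    wd (eS N) (sw γ) (mo φ (xt T π a [])) p = mo φ (xt T π a γ) p :=
  wd_mo φ _ (h.xt_continuous hT hπ) hb (h.xt_deriv hT hρ) γ hγ p hp

lemma continuous_close {A : ℝ × ES N → ℝ} (hA : Continuous A) {S : Set (ℝ × ES N)} (hS : IsCompact S)
    {η : ℝ} (hη : 0 < η) : ∃ ε > 0, ∀ p ∈ S, ∀ q, dist q p < ε → |A q - A p| ≤ η := by
  have := hS.uniformContinuousAt_of_continuousAt A (fun p _ => hA.continuousAt) (dist_mem_uniformity hη)
  obtain ⟨ε, hε, h⟩ := Metric.mem_uniformity_dist.1 this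
  refine ⟨ε, hε, fun p hp q hq => ?_⟩
  have h1 : dist (A p) (A q) < η := h (by rwa [dist_comm] at hq) hp
  rw [dist_comm, Real.dist_eq] at h1
  exact h1.le

/-- Mollifications approximate a function and its spatial derivatives locally uniformly. -/
lemma AC.approx (h : AC T k a) (hT : 0 ≤ T) (hπ : Continuous π)
    {ρ : ℝ} (hρ : ∀ x, ‖x‖ < ρ → π x = x)
    (hb : ∀ γ : List (Fin N), γ.length ≤ k → ∃ B : ℝ, ∀ p, |xt T π a γ p| ≤ B)
    {R η : ℝ} (hR : R < ρ) (hη : 0 < η) :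
    ∀ᶠ ε in 𝓝[>] (0 : ℝ), ∀ φ : ContDiffBump (0 : ℝ × ES N), φ.rOut = ε →
      ∀ γ : List (Fin N), γ.length ≤ k → ∀ t ∈ Icc 0 T, ∀ x : ES N, ‖x‖ ≤ R →
        |wd (ex N) γ (sl (mo φ (xt T π a [])) t) x - wd (ex N) γ (a t) x| ≤ η := by
  have h1 : ∀ γ ∈ {γ : List (Fin N) | γ.length ≤ k}, ∀ᶠ ε in 𝓝[>] (0 : ℝ),
      ∀ φ : ContDiffBump (0 : ℝ × ES N), φ.rOut = ε → ∀ t ∈ Icc 0 T, ∀ x : ES N, ‖x‖ ≤ R →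
        |wd (ex N) γ (sl (mo φ (xt T π a [])) t) x - wd (ex N) γ (a t) x| ≤ η := by
    intro γ hγ
    have hc := h.xt_continuous hT hπ γ hγ
    obtain ⟨ε, hε, hh⟩ := continuous_close hc
      (isCompact_Icc.prod (isCompact_closedBall (0 : ES N) R)) (S := Icc 0 T ×ˢ closedBall 0 R) hη
    filter_upwards [Ioo_mem_nhdsGT (lt_min hε (sub_pos.2 hR))] with ε' hε' φ hφ t ht x hx
    obtain ⟨B₀, hB₀⟩ := hb [] (by simp)
    have hS := (mo_sb φ (h.xt_continuous hT hπ [] (by simp)) hB₀).sm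
    have hlt := lt_min_iff.1 hε'.2
    rw [wd_sl hS]
    simp only [sl]
    rw [wd_mo_xt h hT hπ hρ hb φ γ hγ (t, x) (by simp only; linarith)]
    refine mo_close φ hc fun q hq => ?_
    have := hh (t, x) ⟨ht, mem_closedBall_zero_iff.2 hx⟩ q (by linarith)
    rwa [show xt T π a γ (t, x) = wd (ex N) γ (a t) x by
      simp only [xt]; rw [cl_eq ht, hρ _ (lt_of_le_of_lt hx hR)]] at this
  filter_upwards [(eventually_all_finite (List.finite_length_le (Fin N) k)).2 h1]
    with ε hε φ hφ γ hγ using hε γ hγ φ hφ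

lemma exists_bump {P : ℝ → Prop} (h : ∀ᶠ ε in 𝓝[>] (0 : ℝ), P ε) :
    ∃ φ : ContDiffBump (0 : ℝ × ES N), P φ.rOut := by
  obtain ⟨ε, h1, h2⟩ := (h.and self_mem_nhdsWithin).exists
  have h2 : 0 < ε := h2
  exact ⟨⟨ε / 2, ε, by positivity, by linarith⟩, h1⟩

lemma holder_continuousOn {δ : ℝ} (hδ : 0 < δ) {h : ℝ → ES N → ℝ}
    (hh : ∀ R > 0, ParabolicHolderOn T δ R h) :
    ContinuousOn (fun p : ℝ × ES N => h p.1 p.2) (Icc 0 T ×ˢ univ) := by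
  rintro ⟨t, x⟩ ⟨ht, -⟩
  obtain ⟨C, hC⟩ := hh (‖x‖ + 1) (by positivity)
  have h1 : Tendsto (fun p : ℝ × ES N => C * (|p.1 - t| + ‖p.2 - x‖ ^ 2) ^ (δ / 2))
      (𝓝[Icc 0 T ×ˢ univ] (t, x)) (𝓝 0) := by
    have : Continuous fun p : ℝ × ES N => C * (|p.1 - t| + ‖p.2 - x‖ ^ 2) ^ (δ / 2) := by
      refine continuous_const.mul (Continuous.rpow_const (by fun_prop) fun _ => Or.inr (by positivity))
    have := this.tendsto (t, x)
    simp only [sub_self, abs_zero, norm_zero, ne_eq, OfNat.ofNat_ne_zero, not_false_eq_true, zero_pow,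
      add_zero, Real.zero_rpow (by positivity : δ / 2 ≠ 0), mul_zero] at this
    exact this.mono_left nhdsWithin_le_nhds
  have h2 : ∀ᶠ p : ℝ × ES N in 𝓝[Icc 0 T ×ˢ univ] (t, x), ‖p.2‖ < ‖x‖ + 1 :=
    nhdsWithin_le_nhds (ContinuousAt.eventually_lt (f := fun p : ℝ × ES N => ‖p.2‖) (by fun_prop)
      continuousAt_const (by simp))
  refine tendsto_iff_dist_tendsto_zero.2 (squeeze_zero' (Eventually.of_forall fun _ => dist_nonneg) ?_ h1)
  filter_upwards [h2, self_mem_nhdsWithin] with p hp hp2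
  rw [Real.dist_eq]
  exact hC p.1 hp2.1 t ht p.2 (mem_closedBall_zero_iff.2 hp.le) x
    (mem_closedBall_zero_iff.2 (by simp))

lemma AC.of_holder {δ : ℝ} (hδ : 0 < δ) (sm : ∀ t ∈ Icc (0 : ℝ) T, ContDiff ℝ 3 (a t))
    (h0 : ∀ R > 0, ParabolicHolderOn T δ R a)
    (h1 : ∀ R > 0, ∀ k, ParabolicHolderOn T δ R fun t x => pd1 (a t) k x)
    (h2 : ∀ R > 0, ∀ k l, ParabolicHolderOn T δ R fun t x => pd2 (a t) k l x)
    (h3 : ∀ R > 0, ∀ k l m, ParabolicHolderOn T δ R fun t x => pd3 (a t) k l m x) : AC T 3 a := by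
  refine ⟨sm, fun γ hγ => ?_⟩
  match γ, hγ with
  | [], _ => exact holder_continuousOn hδ h0
  | [k], _ => exact holder_continuousOn hδ fun R hR => h1 R hR k
  | [k, l], _ => exact holder_continuousOn hδ fun R hR => h2 R hR k l
  | [k, l, m], _ => exact holder_continuousOn hδ fun R hR => h3 R hR k l m
  | _ :: _ :: _ :: _ :: _, h => simp only [List.length_cons] at h; omega

variable {q : ℝ → ES N → Fin N → Fin N → ℝ} {b : ℝ → ES N → Fin N → ℝ} {c : ℝ → ES N → ℝ}

lemma Hyp.ac_q (H : Hyp N T q b c) (i j : Fin N) : AC T 3 fun t x => q t x i j :=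
  AC.of_holder H.δ_mem.1 (fun t ht => H.smooth_q t ht i j) (fun R hR => H.holder_q R hR i j)
    (fun R hR => H.holder_q1 R hR i j) (fun R hR => H.holder_q2 R hR i j)
    (fun R hR => H.holder_q3 R hR i j)

lemma Hyp.ac_b (H : Hyp N T q b c) (j : Fin N) : AC T 3 fun t x => b t x j :=
  AC.of_holder H.δ_mem.1 (fun t ht => H.smooth_b t ht j) (fun R hR => H.holder_b R hR j)
    (fun R hR => H.holder_b1 R hR j) (fun R hR => H.holder_b2 R hR j)
    (fun R hR => H.holder_b3 R hR j)

lemma Hyp.ac_c (H : Hyp N T q b c) : AC T 3 c :=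
  AC.of_holder H.δ_mem.1 H.smooth_c H.holder_c H.holder_c1 H.holder_c2 H.holder_c3

lemma quad_error {ι : Type*} [Fintype ι] {e : ι → ι → ℝ} {η : ℝ} (he : ∀ i j, |e i j| ≤ η) (ξ : ι → ℝ) :
    |∑ i, ∑ j, e i j * ξ i * ξ j| ≤ Fintype.card ι * η * ∑ i, ξ i ^ 2 := by
  have h1 : ∀ i j, |e i j * ξ i * ξ j| ≤ η * (ξ i ^ 2 + ξ j ^ 2) / 2 := fun i j => by
    rw [mul_assoc, abs_mul]
    have h2 : |ξ i * ξ j| ≤ (ξ i ^ 2 + ξ j ^ 2) / 2 := by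
      rw [abs_le]; constructor <;> nlinarith [sq_nonneg (ξ i + ξ j), sq_nonneg (ξ i - ξ j)]
    have := mul_le_mul (he i j) h2 (abs_nonneg _) ((abs_nonneg _).trans (he i j))
    linarith
  calc _ ≤ ∑ i, ∑ j, |e i j * ξ i * ξ j| :=
        (Finset.abs_sum_le_sum_abs _ _).trans (Finset.sum_le_sum fun i _ => Finset.abs_sum_le_sum_abs _ _)
    _ ≤ ∑ i, ∑ j, η * (ξ i ^ 2 + ξ j ^ 2) / 2 :=
        Finset.sum_le_sum fun i _ => Finset.sum_le_sum fun j _ => h1 i j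
    _ = _ := by
        simp only [mul_add, add_div, Finset.sum_add_distrib, Finset.sum_const, Finset.card_univ,
          nsmul_eq_mul, ← Finset.mul_sum, ← Finset.sum_div]
        ring

lemma linear_error {e : Fin N → ℝ} {η : ℝ} (he : ∀ i, |e i| ≤ η) (x : ES N) :
    |∑ j, e j * x j| ≤ N * η * ‖x‖ := by
  calc _ ≤ ∑ j, |e j * x j| := Finset.abs_sum_le_sum_abs _ _
    _ ≤ ∑ _j : Fin N, η * ‖x‖ := Finset.sum_le_sum fun j _ => by
        rw [abs_mul]
        have := PiLp.norm_apply_le x j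
        rw [Real.norm_eq_abs] at this
        exact mul_le_mul (he j) this (abs_nonneg _) ((abs_nonneg _).trans (he j))
    _ = _ := by simp; ring

lemma quartic_error {e : Fin N → Fin N → Fin N → Fin N → ℝ} {η : ℝ}
    (he : ∀ h k l m, |e h k l m| ≤ η) (Ξ : Fin N → Fin N → ℝ) :
    |∑ h, ∑ k, ∑ l, ∑ m, e h k l m * Ξ h k * Ξ l m| ≤ N ^ 2 * η * ∑ h, ∑ k, Ξ h k ^ 2 := by
  have := quad_error (e := fun p q : Fin N × Fin N => e p.1 p.2 q.1 q.2) (fun p q => he _ _ _ _)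
    fun p => Ξ p.1 p.2
  simp only [Fintype.sum_prod_type, Fintype.card_prod, Fintype.card_fin, Nat.cast_mul] at this
  rwa [← sq] at this

end Approximation

section ApproximatingCoefficients

variable {N : ℕ} {T : ℝ} {q : ℝ → ES N → Fin N → Fin N → ℝ} {b : ℝ → ES N → Fin N → ℝ}
  {c : ℝ → ES N → ℝ}

/-- Two coefficient systems are close, with three spatial derivatives, on a ball. -/
structure Close (K : Coef N) (q : ℝ → ES N → Fin N → Fin N → ℝ) (b : ℝ → ES N → Fin N → ℝ)
    (c : ℝ → ES N → ℝ) (T R η : ℝ) : Prop where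
  q : ∀ i j, ∀ γ : List (Fin N), γ.length ≤ 3 → ∀ t ∈ Icc 0 T, ∀ x : ES N, ‖x‖ ≤ R →
    |wd (ex N) γ (sl (K.Q i j) t) x - wd (ex N) γ (fun y => q t y i j) x| ≤ η
  b : ∀ j, ∀ γ : List (Fin N), γ.length ≤ 3 → ∀ t ∈ Icc 0 T, ∀ x : ES N, ‖x‖ ≤ R →
    |wd (ex N) γ (sl (K.b j) t) x - wd (ex N) γ (fun y => b t y j) x| ≤ η
  c : ∀ γ : List (Fin N), γ.length ≤ 3 → ∀ t ∈ Icc 0 T, ∀ x : ES N, ‖x‖ ≤ R →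
    |wd (ex N) γ (sl K.c t) x - wd (ex N) γ (c t) x| ≤ η

lemma mo_quadratic (φ : ContDiffBump (0 : ℝ × ES N)) {A : Fin N → Fin N → ℝ × ES N → ℝ}
    (hA : ∀ i j, Continuous (A i j)) (ξ : Fin N → ℝ) (p : ℝ × ES N) :
    ∑ i, ∑ j, mo φ (A i j) p * ξ i * ξ j = mo φ (fun y => ∑ i, ∑ j, A i j y * ξ i * ξ j) p := by
  have hi := fun i j => ((mo_integrable φ (hA i j) p).mul_const (ξ i)).mul_const (ξ j)
  unfold mo cv
  simp only [Finset.mul_sum, ← mul_assoc]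
  rw [integral_finsetSum _ fun i _ => integrable_finsetSum _ fun j _ => hi i j]
  refine Finset.sum_congr rfl fun i _ => ?_
  rw [integral_finsetSum _ fun j _ => hi i j]
  refine Finset.sum_congr rfl fun j _ => ?_
  rw [integral_mul_const, integral_mul_const]

lemma norm_sq_eq_sum (ξ : ES N) : ‖ξ‖ ^ 2 = ∑ i, ξ i ^ 2 := by
  rw [EuclideanSpace.norm_sq_eq]; simp

lemma Hyp.exists_close (H : Hyp N T q b c) {R η : ℝ} (hR : 1 ≤ R) (hη : 0 < η) :
    ∃ K : Coef N, K.c₀ = max H.c₀ 0 ∧ Close K q b c T R η := by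
  have hT := H.T_pos.le
  have hρ : 0 < R + 1 := by linarith
  have hπ := pj_continuous (N := N) hρ
  have hb : ∀ {a : ℝ → ES N → ℝ}, AC T 3 a → ∀ γ : List (Fin N), γ.length ≤ 3 →
      ∃ B : ℝ, ∀ p, |xt T (pj (R + 1)) a γ p| ≤ B := fun h γ hγ => h.xt_bounded hT hρ γ hγ
  have ap : ∀ {a : ℝ → ES N → ℝ}, AC T 3 a → _ := fun {a} h =>
    h.approx hT hπ (fun x hx => pj_eq hρ hx) (hb h) (lt_add_one R) hη
  obtain ⟨φ, ⟨hq, hb'⟩, hc⟩ := exists_bump (N := N)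
    (((eventually_all.2 fun i => eventually_all.2 fun j => ap (H.ac_q i j)).and
      (eventually_all.2 fun j => ap (H.ac_b j))).and (ap H.ac_c))
  have hcont : ∀ {a : ℝ → ES N → ℝ}, AC T 3 a → Continuous (xt T (pj (R + 1)) a []) :=
    fun h => h.xt_continuous hT hπ [] (by simp)
  have hsb : ∀ {a : ℝ → ES N → ℝ}, AC T 3 a → SB (eS N) (mo φ (xt T (pj (R + 1)) a [])) :=
    fun h => (hb h [] (by simp)).elim fun B hB => mo_sb φ (hcont h) hB
  refine ⟨{
    Q := fun i j => mo φ (xt T (pj (R + 1)) (fun t x => q t x i j) [])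
    b := fun j => mo φ (xt T (pj (R + 1)) (fun t x => b t x j) [])
    c := mo φ (xt T (pj (R + 1)) c [])
    hQ := fun i j => hsb (H.ac_q i j)
    hb := fun j => hsb (H.ac_b j)
    hc := hsb H.ac_c
    symm := fun i j y => ?_
    ν₀ := H.ν₀
    ν₀_pos := H.ν₀_pos
    ell := fun y ξ => ?_
    c₀ := max H.c₀ 0
    c₀_nonneg := le_max_right _ _
    c_le := fun y => mo_le φ (hcont H.ac_c) fun p =>
      (H.c_ub _ (cl_mem hT _) _).trans (le_max_left _ _) }, rfl,
    ⟨fun i j => hq i j φ rfl, fun j => hb' j φ rfl, hc φ rfl⟩⟩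
  · exact congrArg (fun A => mo φ A y) (funext fun p => H.q_symm _ (cl_mem hT p.1) _ i j)
  · rw [mo_quadratic φ (fun i j => hcont (H.ac_q i j))]
    refine le_mo φ (continuous_finsetSum _ fun i _ => continuous_finsetSum _ fun j _ =>
      ((hcont (H.ac_q i j)).mul_const _).mul_const _) fun p => ?_
    have h1 := H.ellip _ (cl_mem hT p.1) (pj (R + 1) p.2) (WithLp.toLp 2 ξ)
    have h2 := H.ν_lb _ (cl_mem hT p.1) (pj (R + 1) p.2)
    rw [norm_sq_eq_sum] at h1
    exact (mul_le_mul_of_nonneg_right h2 (Finset.sum_nonneg fun i _ => sq_nonneg _)).trans h1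

/-- The uniform constants valid for all sufficiently close coefficients. -/
lemma Hyp.exists_lh (H : Hyp N T q b c) : ∃ κ ν₁ l η₀ : ℝ, 1 ≤ κ ∧ 0 < ν₁ ∧ 0 < l ∧ 0 < η₀ ∧
    max H.c₀ 0 ≤ κ ∧ ∀ (K : Coef N) (R : ℝ), K.c₀ = max H.c₀ 0 → Close K q b c T R η₀ →
      LH K T R κ ν₁ l := by
  have hN : (1 : ℝ) ≤ N := by exact_mod_cast H.N_pos
  have hν₀ := H.ν₀_pos
  obtain ⟨l, hl⟩ : ∃ l, l = min H.L₁ (H.L₂ / 2) := ⟨_, rfl⟩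
  have hl0 : 0 < l := hl ▸ lt_min H.L₁_pos (half_pos H.L₂_pos)
  have hl1 : l ≤ H.L₁ := hl ▸ min_le_left _ _
  have hl2 : 2 * l ≤ H.L₂ := by have : l ≤ H.L₂ / 2 := hl ▸ min_le_right _ _; linarith
  obtain ⟨η, hη⟩ : ∃ η, η = min 1 (H.ν₀ / (2 * N ^ 2)) := ⟨_, rfl⟩
  have hη0 : 0 < η := by rw [hη]; positivity
  have hη1 : η ≤ 1 := hη ▸ min_le_left _ _
  have e2 : N ^ 2 * η ≤ H.ν₀ / 2 := by
    calc N ^ 2 * η ≤ N ^ 2 * (H.ν₀ / (2 * N ^ 2)) := by gcongr; exact hη ▸ min_le_right _ _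
      _ = H.ν₀ / 2 := by field_simp
  have e1 : N * η ≤ H.ν₀ / 2 := by
    refine le_trans ?_ e2; gcongr; nlinarith
  have e0 : η ≤ H.ν₀ / 2 := by
    refine le_trans ?_ e1; nlinarith
  have p1 := H.C₁_pos
  have p2 := H.C₂_pos
  have p3 := H.C₃_pos
  have p4 := H.K₁_pos
  have p5 := H.K₂_pos
  have p6 := H.K₃_pos
  have p7 := H.L₃_pos
  have p8 : 0 ≤ max H.c₀ 0 := le_max_right _ _
  obtain ⟨m, hm⟩ : ∃ m, m = l / H.ν₀ := ⟨_, rfl⟩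
  have hm0 : 0 < m := by rw [hm]; positivity
  have hml : l = m * H.ν₀ := by rw [hm]; field_simp
  obtain ⟨κ, hκ⟩ : ∃ κ, κ = 2 * (H.C₁ + H.C₂ + H.C₃ + H.K₁ + H.K₂ + H.K₃ + H.L₃) +
    6 * m + max H.c₀ 0 + 2 := ⟨_, rfl⟩
  refine ⟨κ, H.ν₀ / 2, l, η, by linarith, by positivity, hl0, hη0, by linarith, ?_⟩
  intro K R hKc hC t ht x hx
  have hν : H.ν₀ ≤ H.ν t x := H.ν_lb t ht x
  have hν0 : 0 < H.ν t x := lt_of_lt_of_le hν₀ hν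
  have hq := fun i j γ hγ => hC.q i j γ hγ t ht x hx
  have hb := fun j γ hγ => hC.b j γ hγ t ht x hx
  have hc := fun γ hγ => hC.c γ hγ t ht x hx
  have hx1 : ‖x‖ ≤ 1 + ‖x‖ ^ 2 := by nlinarith [sq_nonneg (‖x‖ - 1)]
  have hx0 : 1 ≤ 1 + ‖x‖ ^ 2 := by nlinarith [sq_nonneg (‖x‖)]
  have hr : 0 ≤ H.r t x := (abs_nonneg _).trans
    (H.db2_bound t ht x ⟨0, H.N_pos⟩ ⟨0, H.N_pos⟩ ⟨0, H.N_pos⟩)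
  have hϱ : 0 ≤ H.ϱ t x := H.ϱ₀_pos.le.trans (H.ϱ_lb t ht x)
  have ap : ∀ {u v w : ℝ}, |u - v| ≤ η → |v| ≤ w → |u| ≤ w + η := fun {u v w} h1 h2 => by
    have := abs_add_le (u - v) v
    rw [sub_add_cancel] at this
    linarith
  have hXν : H.ν t x ≤ (1 + ‖x‖ ^ 2) * H.ν t x := by nlinarith
  have hκν : ∀ {u : ℝ}, 2 * u + 1 ≤ κ → u * H.ν t x + H.ν₀ / 2 ≤ κ * (H.ν t x / 2) := fun {u} hu => by
    have := mul_le_mul_of_nonneg_right hu hν0.le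
    linarith
  have hκX : ∀ {u : ℝ}, 2 * u + 2 ≤ κ →
      u * (1 + ‖x‖ ^ 2) * H.ν t x + H.ν₀ / 2 * ‖x‖ + H.ν₀ / 2 ≤
        κ * (1 + ‖x‖ ^ 2) * (H.ν t x / 2) := fun {u} hu => by
    have h1 := mul_le_mul_of_nonneg_right hu (by positivity : 0 ≤ (1 + ‖x‖ ^ 2) * H.ν t x)
    have h2 : H.ν₀ * ‖x‖ ≤ (1 + ‖x‖ ^ 2) * H.ν t x := by
      rw [mul_comm]; exact mul_le_mul hx1 hν hν₀.le (by positivity)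
    linarith
  refine ⟨H.ν t x / 2, H.d t x + H.ν t x / 2, H.r t x + 1, H.ϱ t x + 1, ?_⟩
  refine {
    ν_le := by linarith
    r_nonneg := by linarith
    ϱ_nonneg := by linarith
    ell := fun ξ => ?_
    qx := fun i => ?_
    drift := ?_
    q1 := fun k i j => ?_
    q2 := fun Ξ hΞ => ?_
    q3 := fun k l m i j => ?_
    dis := fun ξ => ?_
    b2 := fun k l j => ?_
    b3 := fun k l m j => ?_
    c1 := fun k => ?_
    c2 := fun k l => ?_
    c3 := fun k l m => ?_
    funz := ?_
    c_le := ?_ }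
  · have h1 := H.ellip t ht x (WithLp.toLp 2 ξ)
    rw [norm_sq_eq_sum] at h1
    have h2 := quad_error (fun i j => hq i j [] (by simp)) ξ
    simp only [sub_mul, Finset.sum_sub_distrib, Fintype.card_fin] at h2
    have h3 : N * η * ∑ i, ξ i ^ 2 ≤ H.ν t x / 2 * ∑ i, ξ i ^ 2 := by
      gcongr; linarith
    have h4 := (abs_le.1 h2).1
    simp only [wd_nil, sl] at h1 h4
    linarith
  · have h1 := PiLp.norm_apply_le ((EuclideanSpace.equiv (Fin N) ℝ).symm fun i => ∑ j, q t x i j * x j) i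
    have h2 := h1.trans (H.growth_Q t ht x)
    have h3 := linear_error (fun j => hq i j [] (by simp)) x
    simp only [sub_mul, Finset.sum_sub_distrib] at h3
    have h4 : N * η * ‖x‖ ≤ H.ν₀ / 2 * ‖x‖ := by gcongr
    have h5 := abs_add_le ((∑ j, K.Q i j (t, x) * x j) - ∑ j, q t x i j * x j) (∑ j, q t x i j * x j)
    rw [sub_add_cancel] at h5
    have h6 := hκX (u := H.C₁) (by linarith)
    simp only [wd_nil, sl] at h3
    have h7 : |∑ j, q t x i j * x j| ≤ H.C₁ * (1 + ‖x‖ ^ 2) * H.ν t x := h2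
    linarith
  · have h1 := H.growth_tr t ht x
    have h2 := H.growth_b t ht x
    have h3 := (abs_le.1 (linear_error (fun j => hb j [] (by simp)) x)).2
    simp only [sub_mul, Finset.sum_sub_distrib, wd_nil, sl] at h3
    have h4 : N * η * ‖x‖ ≤ H.ν₀ / 2 * ‖x‖ := by gcongr
    have h5 : ∑ i, K.Q i i (t, x) ≤ ∑ i, (q t x i i + η) := Finset.sum_le_sum fun i _ => by
      have := (abs_le.1 (hq i i [] (by simp))).2
      simp only [wd_nil, sl] at this
      linarith
    simp only [Finset.sum_add_distrib, Finset.sum_const, Finset.card_univ, Fintype.card_fin,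
      nsmul_eq_mul] at h5
    have h6 := hκX (u := H.C₂ + H.C₃) (by linarith)
    linarith
  · exact (ap (hq i j [k] (by simp)) (H.dq1_bound t ht x i j k)).trans
      ((add_le_add_right e0 _).trans (hκν (by linarith)))
  · have h1 := H.dq2_quad t ht x Ξ hΞ
    have h2 := (abs_le.1 (quartic_error (fun h k l m => hq h k [l, m] (by simp)) Ξ)).2
    simp only [sub_mul, Finset.sum_sub_distrib] at h2
    have h3 : N ^ 2 * η * ∑ h, ∑ k, Ξ h k ^ 2 ≤ H.ν₀ / 2 * ∑ h, ∑ k, Ξ h k ^ 2 := by gcongr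
    have h4 := mul_le_mul_of_nonneg_right (hκν (u := H.K₂) (by linarith))
      (by positivity : 0 ≤ ∑ h, ∑ k, Ξ h k ^ 2)
    have h5 : (∑ h, ∑ k, ∑ l, ∑ m, wd (ex N) [l, m] (fun y => q t y h k) x * Ξ h k * Ξ l m)
      ≤ H.K₂ * H.ν t x * ∑ h, ∑ k, Ξ h k ^ 2 := h1
    linarith
  · exact (ap (hq i j [k, l, m] (by simp)) (H.dq3_bound t ht x i j k l m)).trans
      ((add_le_add_right e0 _).trans (hκν (by linarith)))
  · have h1 := H.dissip t ht x (WithLp.toLp 2 ξ)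
    rw [norm_sq_eq_sum] at h1
    have h2 := (abs_le.1 (quad_error (fun j i => hb i [j] (by simp)) ξ)).2
    rw [Finset.sum_comm] at h2
    simp only [sub_mul, Finset.sum_sub_distrib, Fintype.card_fin] at h2
    have h3 : N * η * ∑ i, ξ i ^ 2 ≤ H.ν t x / 2 * ∑ i, ξ i ^ 2 := by
      gcongr; linarith
    have h4 : (∑ i, ∑ j, wd (ex N) [j] (fun y => b t y i) x * ξ j * ξ i) ≤ H.d t x * ∑ i, ξ i ^ 2 := h1
    linarith
  · exact (ap (hb j [k, l] (by simp)) (H.db2_bound t ht x j k l)).trans (by linarith)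
  · exact (ap (hb j [k, l, m] (by simp)) (H.db3_bound t ht x j k l m)).trans (by linarith)
  · exact (ap (hc [k] (by simp)) (H.dc1_bound t ht x k)).trans (by linarith)
  · exact (ap (hc [k, l] (by simp)) (H.dc2_bound t ht x k l)).trans (by linarith)
  · exact (ap (hc [k, l, m] (by simp)) (H.dc3_bound t ht x k l m)).trans (by linarith)
  · have h1 := H.funz t ht x
    have h2 : l * H.r t x ≤ H.L₁ * H.r t x := by gcongr
    have h3 : l * (H.ϱ t x + 1) ^ 2 ≤ 2 * l * H.ϱ t x ^ 2 + 2 * l := by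
      nlinarith [mul_nonneg hl0.le (sq_nonneg (H.ϱ t x - 1))]
    have h4 : 2 * l * H.ϱ t x ^ 2 ≤ H.L₂ * H.ϱ t x ^ 2 := by gcongr
    have h5 : l ≤ m * H.ν t x := by rw [hml]; gcongr
    have h6 := mul_le_mul_of_nonneg_right
      (by linarith : 2 * H.L₃ + 6 * m + 1 ≤ κ) hν0.le
    linarith
  · exact (K.c_le _).trans (by rw [hKc]; linarith)

end ApproximatingCoefficients

section ContinuousConvergence

variable {N : ℕ} {T : ℝ} {a w F : ℕ → ℝ × ES N → ℝ} {α ω Φ : ℝ × ES N → ℝ}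

/-- The filter of large indices and space-time points near `p`. -/
def nf (T : ℝ) (p : ℝ × ES N) : Filter (ℕ × ℝ × ES N) :=
  (hyperfilter ℕ : Filter ℕ) ×ˢ 𝓝[Icc 0 T ×ˢ univ] p

/-- Continuous convergence of a sequence of functions on `[0,T] × ℝ^N`. -/
def CC (T : ℝ) (a : ℕ → ℝ × ES N → ℝ) (α : ℝ × ES N → ℝ) : Prop :=
  ∀ t ∈ Icc 0 T, ∀ x, Tendsto (fun z => a z.1 z.2) (nf T (t, x)) (𝓝 (α (t, x)))

/-- Equicontinuity of a sequence of functions on `[0,T] × ℝ^N`. -/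
def EC (T : ℝ) (a : ℕ → ℝ × ES N → ℝ) : Prop :=
  ∀ t ∈ Icc 0 T, ∀ x, Tendsto (fun z => a z.1 z.2 - a z.1 (t, x)) (nf T (t, x)) (𝓝 0)

/-- Equicontinuity in space, uniformly in time. -/
def SE (T : ℝ) (a : ℕ → ℝ × ES N → ℝ) : Prop :=
  ∀ x₀, ∀ ε > 0, ∃ δ > 0, ∀ᶠ n in atTop, ∀ t ∈ Icc 0 T, ∀ x, ‖x - x₀‖ < δ →
    |a n (t, x) - a n (t, x₀)| ≤ ε

lemma hyperfilter_le : (hyperfilter ℕ : Filter ℕ) ≤ atTop := Nat.hyperfilter_le_atTop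

lemma tendsto_zero_of_le {ι : Type*} {l : Filter ι} {f : ι → ℝ} (h : ∀ ε > 0, ∀ᶠ z in l, |f z| ≤ ε) :
    Tendsto f l (𝓝 0) := by
  refine Metric.tendsto_nhds.2 fun ε hε => (h (ε / 2) (half_pos hε)).mono fun z hz => ?_
  rw [Real.dist_eq, sub_zero]
  linarith

lemma eventually_le_of_tendsto_zero {ι : Type*} {l : Filter ι} {f : ι → ℝ} (h : Tendsto f l (𝓝 0)) {ε : ℝ} (hε : 0 < ε) :
    ∀ᶠ z in l, |f z| ≤ ε :=
  (Metric.tendsto_nhds.1 h ε hε).mono fun z hz => by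
    rw [Real.dist_eq, sub_zero] at hz
    exact hz.le

lemma eventually_nf {t : ℝ} {x : ES N} {P : ℕ × ℝ × ES N → Prop} : (∀ᶠ z in nf T (t, x), P z) ↔
    ∃ δ > 0, ∀ᶠ n in (hyperfilter ℕ : Filter ℕ), ∀ t' ∈ Icc 0 T, |t' - t| < δ →
      ∀ x', ‖x' - x‖ < δ → P (n, t', x') := by
  constructor
  · intro h
    obtain ⟨A, hA, B, hB, hAB⟩ := eventually_prod_iff.1 h
    obtain ⟨δ, hδ, h1⟩ := Metric.mem_nhdsWithin_iff.1 hB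
    refine ⟨δ, hδ, hA.mono fun n hn t' ht' h2 x' hx' => hAB hn (h1 ⟨?_, ht', mem_univ _⟩)⟩
    rw [mem_ball, Prod.dist_eq, max_lt_iff, Real.dist_eq, dist_eq_norm]
    exact ⟨h2, hx'⟩
  · rintro ⟨δ, hδ, h⟩
    refine eventually_prod_iff.2 ⟨_, h, fun p => p ∈ Icc 0 T ×ˢ univ ∧ p ∈ ball (t, x) δ,
      inter_mem self_mem_nhdsWithin (nhdsWithin_le_nhds (ball_mem_nhds _ hδ)), ?_⟩
    rintro n hn ⟨t', x'⟩ ⟨⟨h1, -⟩, h2⟩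
    rw [mem_ball, Prod.dist_eq, max_lt_iff, Real.dist_eq, dist_eq_norm] at h2
    exact hn t' h1 h2.1 x' h2.2

lemma nf_const {t : ℝ} (ht : t ∈ Icc 0 T) (x : ES N) :
    Tendsto (fun n => (n, t, x)) (hyperfilter ℕ : Filter ℕ) (nf T (t, x)) :=
  tendsto_id.prodMk (tendsto_const_pure.mono_right (pure_le_nhdsWithin ⟨ht, mem_univ _⟩))

lemma CC.tendsto (h : CC T a α) {t : ℝ} (ht : t ∈ Icc 0 T) (x : ES N) :
    Tendsto (fun n => a n (t, x)) (hyperfilter ℕ : Filter ℕ) (𝓝 (α (t, x))) :=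
  (h t ht x).comp (nf_const ht x)

lemma CC.continuousOn (h : CC T a α) : ContinuousOn α (Icc 0 T ×ˢ univ) := by
  rintro ⟨t, x⟩ ⟨ht, -⟩
  refine (closed_nhds_basis (α (t, x))).tendsto_right_iff.2 fun V ⟨hV, hc⟩ => ?_
  obtain ⟨A, hA, B, hB, hAB⟩ := eventually_prod_iff.1 ((h t ht x).eventually_mem hV)
  filter_upwards [hB, self_mem_nhdsWithin] with p h1 h2
  exact hc.mem_of_tendsto (h.tendsto h2.1 p.2) (hA.mono fun n hn => hAB hn h1)

lemma CC.of_local (hα : ContinuousOn α (Icc 0 T ×ˢ univ))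
    (h : ∀ R ε : ℝ, 0 < ε → ∀ᶠ n in atTop, ∀ t ∈ Icc 0 T, ∀ x, ‖x‖ ≤ R →
      |a n (t, x) - α (t, x)| ≤ ε) : CC T a α := by
  intro t ht x
  have h1 : Tendsto (fun z : ℕ × ℝ × ES N => α z.2) (nf T (t, x)) (𝓝 (α (t, x))) :=
    Tendsto.comp (hα (t, x) ⟨ht, mem_univ _⟩) tendsto_snd
  have h2 : Tendsto (fun z : ℕ × ℝ × ES N => a z.1 z.2 - α z.2) (nf T (t, x)) (𝓝 0) := by
    refine tendsto_zero_of_le fun ε hε => eventually_nf.2 ⟨1, one_pos, ?_⟩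
    filter_upwards [hyperfilter_le (h (‖x‖ + 1) ε hε)] with n hn t' ht' _ x' hx'
    refine hn t' ht' x' ?_
    have := norm_add_le (x' - x) x
    rw [sub_add_cancel] at this
    linarith
  simpa using h2.add h1

lemma EC.cc (h : EC T a) (hb : ∀ t ∈ Icc 0 T, ∀ x, ∃ C, ∀ᶠ n in atTop, |a n (t, x)| ≤ C) :
    CC T a fun p => ulim fun n => a n p := by
  intro t ht x
  obtain ⟨C, hC⟩ := hb t ht x
  have h1 : Tendsto (fun z : ℕ × ℝ × ES N => a z.1 (t, x)) (nf T (t, x)) _ :=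
    (tendsto_ulim_of_eventually hC).comp tendsto_fst
  simpa using (h t ht x).add h1

/-- `F` is the time derivative of `w`. -/
def TD (T : ℝ) (w F : ℕ → ℝ × ES N → ℝ) : Prop :=
  ∀ n, ∀ t ∈ Icc 0 T, ∀ x, HasDerivWithinAt (fun t => w n (t, x)) (F n (t, x)) (Icc 0 T) t

lemma TD.increment (h : TD T w F) {n : ℕ} {t : ℝ} (ht : t ∈ Icc 0 T) {x : ES N} {δ A ε : ℝ}
    (hb : ∀ t' ∈ Icc 0 T, |t' - t| < δ → |F n (t', x) - A| ≤ ε) {t' : ℝ} (ht' : t' ∈ Icc 0 T)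
    (hd : |t' - t| < δ) : |w n (t', x) - w n (t, x) - (t' - t) * A| ≤ ε * |t' - t| := by
  have h1 := Convex.norm_image_sub_le_of_norm_hasDerivWithin_le (f := fun t => w n (t, x) - t * A)
    (f' := fun t => F n (t, x) - A) (C := ε) (s := Icc 0 T ∩ ball t δ) (x := t) (y := t')
    (fun τ hτ => (((h n τ hτ.1 x).sub ((hasDerivWithinAt_id τ _).mul_const A)).mono
      inter_subset_left).congr_deriv (by ring))
    (fun τ hτ => hb τ hτ.1 (by simpa [Real.dist_eq] using hτ.2))
    ((convex_Icc 0 T).inter (convex_ball _ _))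
    ⟨ht, mem_ball_self ((abs_nonneg _).trans_lt hd)⟩ ⟨ht', by simpa [Real.dist_eq] using hd⟩
  rw [Real.norm_eq_abs, Real.norm_eq_abs] at h1
  convert h1 using 2
  ring

lemma TD.limit (h : TD T w F) (hw : CC T w ω) (hF : CC T F Φ) {t : ℝ} (ht : t ∈ Icc 0 T) (x : ES N) :
    HasDerivWithinAt (fun t => ω (t, x)) (Φ (t, x)) (Icc 0 T) t := by
  rw [hasDerivWithinAt_iff_isLittleO, Asymptotics.isLittleO_iff]
  intro ε hε
  have h1 := (hF t ht x).sub_const (Φ (t, x))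
  rw [sub_self] at h1
  obtain ⟨δ, hδ, h2⟩ := eventually_nf.1 (eventually_le_of_tendsto_zero h1 hε)
  filter_upwards [self_mem_nhdsWithin, nhdsWithin_le_nhds (ball_mem_nhds t hδ)] with t' ht' hd
  rw [mem_ball, Real.dist_eq] at hd
  rw [Real.norm_eq_abs, Real.norm_eq_abs, smul_eq_mul]
  refine le_of_tendsto (((hw.tendsto ht' x).sub (hw.tendsto ht x)).sub_const _).abs
    (h2.mono fun n hn => h.increment ht (fun s hs hsd => hn s hs hsd x (by simpa using hδ)) ht' hd)

lemma TD.ec (h : TD T w F)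
    (hF : ∀ t ∈ Icc 0 T, ∀ x, ∃ L, ∀ᶠ z in nf T (t, x), |F z.1 z.2| ≤ L) (hs : SE T w) : EC T w := by
  intro t ht x
  refine tendsto_zero_of_le fun ε hε => eventually_nf.2 ?_
  obtain ⟨L, hL⟩ := hF t ht x
  obtain ⟨δ, hδ, hL⟩ := eventually_nf.1 hL
  obtain ⟨δ', hδ', hx⟩ := hs x (ε / 2) (half_pos hε)
  have hL1 : 0 < |L| + 1 := by positivity
  refine ⟨min (min δ δ') (ε / 2 / (|L| + 1)), by positivity, ?_⟩
  filter_upwards [hL, hyperfilter_le hx] with n h1 h2 t' ht' hd x' hx'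
  simp only [lt_min_iff] at hd hx'
  have h3 := h2 t' ht' x' hx'.1.2
  have h4 := h.increment (A := 0) ht (fun s hs hsd => by
    rw [sub_zero]; exact h1 s hs hsd x (by simpa using hδ)) ht' hd.1.1
  rw [mul_zero, sub_zero] at h4
  have h5 := (lt_div_iff₀ hL1).1 hd.2
  have h6 : L * |t' - t| ≤ (|L| + 1) * |t' - t| := by
    gcongr; linarith [le_abs_self L]
  have h7 := abs_add_le (w n (t', x') - w n (t', x)) (w n (t', x) - w n (t, x))
  rw [sub_add_sub_cancel] at h7
  show |w n (t', x') - w n (t, x)| ≤ ε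
  linarith

lemma EC.dd (h : EC T w) {v : ES N} (hd : ∀ n, ∀ t ∈ Icc 0 T, Differentiable ℝ fun x => w n (t, x))
    (hs : SE T fun n p => _root_.dd v (fun x => w n (p.1, x)) p.2) :
    EC T fun n p => _root_.dd v (fun x => w n (p.1, x)) p.2 := by
  intro t ht x
  refine tendsto_zero_of_le fun ε hε => eventually_nf.2 ?_
  obtain ⟨δ, hδ, h1⟩ := hs x (ε / 8) (by positivity)
  obtain ⟨η, hη⟩ : ∃ η, η = δ / (2 * (‖v‖ + 1)) := ⟨_, rfl⟩
  have hη0 : 0 < η := by rw [hη]; positivity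
  have hηv : η * ‖v‖ < δ := by
    have : η * (2 * (‖v‖ + 1)) = δ := by rw [hη]; field_simp
    nlinarith [norm_nonneg v]
  obtain ⟨δ₁, hδ₁, h2⟩ := eventually_nf.1
    (eventually_le_of_tendsto_zero (h t ht x) (by positivity : 0 < η * (ε / 8)))
  obtain ⟨δ₂, hδ₂, h3⟩ := eventually_nf.1
    (eventually_le_of_tendsto_zero (h t ht (x + η • v)) (by positivity : 0 < η * (ε / 8)))
  refine ⟨min δ (min δ₁ δ₂), by positivity, ?_⟩
  filter_upwards [hyperfilter_le h1, h2, h3] with n h1 h2 h3 t' ht' hd' x' hx'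
  simp only [lt_min_iff] at hd' hx'
  have key : ∀ s ∈ Icc 0 T, |w n (s, x + η • v) - w n (s, x) -
      η * _root_.dd v (fun x => w n (s, x)) x| ≤ η * (ε / 8) := fun s hs => by
    have hd1 := hd n s hs
    have := taylor_one (f := fun y => w n (s, y) - fderiv ℝ (fun x => w n (s, x)) x y) (y := x)
      (v := η • v) (B := η * (ε / 8)) (hd1.sub (ContinuousLinearMap.differentiable _))
      fun τ hτ => by
        have e : _root_.dd (η • v) (fun y => w n (s, y) - fderiv ℝ (fun x => w n (s, x)) x y)
            (x + τ • η • v) = η * (_root_.dd v (fun x => w n (s, x)) (x + τ • η • v) -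
              _root_.dd v (fun x => w n (s, x)) x) := by
          unfold _root_.dd
          rw [fderiv_fun_sub (hd1 _) (ContinuousLinearMap.differentiableAt _),
            ContinuousLinearMap.fderiv]
          simp [mul_sub]
        rw [e, abs_mul, abs_of_pos hη0]
        gcongr
        refine h1 s hs _ ?_
        rw [add_sub_cancel_left, norm_smul, norm_smul, Real.norm_eq_abs, Real.norm_eq_abs,
          abs_of_nonneg hτ.1, abs_of_pos hη0]
        have := mul_nonneg hη0.le (norm_nonneg v)
        nlinarith [hτ.2]
    rw [map_add, map_smul, smul_eq_mul] at this
    convert this using 2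
    unfold _root_.dd
    ring
  have k1 := key t' ht'
  have k2 := key t ht
  have k3 := h2 t' ht' hd'.2.1 x (by simpa using hδ₁)
  have k4 := h3 t' ht' hd'.2.2 (x + η • v) (by simpa using hδ₂)
  have k5 := h1 t' ht' x' hx'.1
  have k6 : η * |_root_.dd v (fun x => w n (t', x)) x - _root_.dd v (fun x => w n (t, x)) x| ≤
      η * (ε / 2) := by
    rw [← abs_of_pos hη0, ← abs_mul, abs_of_pos hη0, abs_le]
    rw [abs_le] at k1 k2 k3 k4
    constructor <;> linarith only [k1.1, k1.2, k2.1, k2.2, k3.1, k3.2, k4.1, k4.2]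
  have k7 := le_of_mul_le_mul_left k6 hη0
  have k8 := abs_add_le (_root_.dd v (fun x => w n (t', x)) x' - _root_.dd v (fun x => w n (t', x)) x)
    (_root_.dd v (fun x => w n (t', x)) x - _root_.dd v (fun x => w n (t, x)) x)
  rw [sub_add_sub_cancel] at k8
  show |_root_.dd v (fun x => w n (t', x)) x' - _root_.dd v (fun x => w n (t, x)) x| ≤ ε
  linarith

/-- The linear form with given coordinates. -/
def fm (a : Fin N → ℝ) : ES N →L[ℝ] ℝ := ∑ i, a i • (EuclideanSpace.proj i : ES N →L[ℝ] ℝ)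

lemma fm_ex (a : Fin N → ℝ) (i : Fin N) : fm a (ex N i) = a i := by
  simp [fm, ex]

lemma fderiv_eq_fm (f : ES N → ℝ) (x : ES N) : fderiv ℝ f x = fm fun i => dd (ex N i) f x := by
  ext v
  conv_lhs => rw [← ex_sum v]
  simp [fm, dd, mul_comm]

lemma CC.hasFDerivAt (hw : CC T w ω) (hd : ∀ n, ∀ t ∈ Icc 0 T, Differentiable ℝ fun x => w n (t, x))
    {α : Fin N → ℝ × ES N → ℝ}
    (h : ∀ i, CC T (fun n p => _root_.dd (ex N i) (fun x => w n (p.1, x)) p.2) (α i))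
    {t : ℝ} (ht : t ∈ Icc 0 T) (x : ES N) :
    HasFDerivAt (fun x => ω (t, x)) (fm fun i => α i (t, x)) x := by
  refine hasFDerivAt_of_tendstoUniformlyOnFilter (l := (hyperfilter ℕ : Filter ℕ))
    (f := fun n x => w n (t, x)) (f' := fun n x => fderiv ℝ (fun x => w n (t, x)) x)
    (g' := fun x => fm fun i => α i (t, x)) ?_
    (Eventually.of_forall fun z => (hd z.1 t ht _).hasFDerivAt)
    (Eventually.of_forall fun y => hw.tendsto ht y)
  have h0 : Tendsto (fun y : ES N => (t, y)) (𝓝 x) (𝓝[Icc 0 T ×ˢ univ] (t, x)) :=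
    tendsto_nhdsWithin_iff.2 ⟨(Continuous.prodMk_right t).tendsto x,
      Eventually.of_forall fun y => ⟨ht, mem_univ _⟩⟩
  have h1 : Tendsto (fun z : ℕ × ES N => (z.1, t, z.2)) ((hyperfilter ℕ : Filter ℕ) ×ˢ 𝓝 x)
      (nf T (t, x)) := tendsto_id.prodMap h0
  have h2 : Tendsto (fun z : ℕ × ES N => fderiv ℝ (fun x => w z.1 (t, x)) z.2)
      ((hyperfilter ℕ : Filter ℕ) ×ˢ 𝓝 x) (𝓝 (fm fun i => α i (t, x))) := by
    simp only [fderiv_eq_fm]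
    exact tendsto_finsetSum _ fun i _ => ((h i t ht x).comp h1).smul_const _
  have h3 : Tendsto (fun z : ℕ × ES N => fm fun i => α i (t, z.2))
      ((hyperfilter ℕ : Filter ℕ) ×ˢ 𝓝 x) (𝓝 (fm fun i => α i (t, x))) :=
    tendsto_finsetSum _ fun i _ => (Tendsto.comp ((h i).continuousOn (t, x)
      ⟨ht, mem_univ _⟩) (h0.comp tendsto_snd)).smul_const _
  exact (h3.prodMk_nhds h2).mono_right (nhds_le_uniformity _)

lemma contDiff_of_fm {n : ℕ} {f : ES N → ℝ} {a : Fin N → ES N → ℝ}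
    (hf : ∀ x, HasFDerivAt f (fm fun i => a i x) x) (ha : ∀ i, ContDiff ℝ n (a i)) :
    ContDiff ℝ (n + 1 : ℕ) f := by
  have e : fderiv ℝ f = fun x => fm fun i => a i x := funext fun x => (hf x).fderiv
  refine (contDiff_succ_iff_fderiv (n := n)).2 ⟨fun x => (hf x).differentiableAt, by simp, ?_⟩
  rw [e]
  exact ContDiff.sum fun i _ => (ha i).smul contDiff_const

end ContinuousConvergence

section Existence

variable {N : ℕ} {T θ : ℝ} {q : ℝ → ES N → Fin N → Fin N → ℝ} {b : ℝ → ES N → Fin N → ℝ}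
  {c g : ℝ → ES N → ℝ}

lemma SE.of_bound {a : ℕ → ℝ × ES N → ℝ} {C β : ℝ} (hβ : 0 < β)
    (h : ∀ R : ℝ, ∀ᶠ n in atTop, ∀ t ∈ Icc 0 T, ∀ x, ‖x‖ ≤ R → ∀ y, ‖y‖ ≤ R →
      |a n (t, x) - a n (t, y)| ≤ C * ‖x - y‖ ^ β) : SE T a := by
  intro x₀ ε hε
  have h1 : Tendsto (fun r : ℝ => C * r ^ β) (𝓝 0) (𝓝 0) := by
    have := ((Real.continuousAt_rpow_const 0 β (Or.inr hβ.le)).tendsto).const_mul C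
    rwa [Real.zero_rpow hβ.ne', mul_zero] at this
  obtain ⟨δ, hδ, h2⟩ := Metric.eventually_nhds_iff.1 (eventually_le_of_tendsto_zero h1 hε)
  refine ⟨min δ 1, by positivity, (h (‖x₀‖ + 1)).mono fun n hn t ht x hx => ?_⟩
  have h3 := norm_add_le (x - x₀) x₀
  rw [sub_add_cancel] at h3
  refine (hn t ht x (by linarith [hx.trans_le (min_le_right _ _)]) x₀ (by linarith)).trans
    ((le_abs_self _).trans (h2 ?_))
  simpa using hx.trans_le (min_le_left _ _)

/-- Passage to the limit in the approximating problems. -/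
lemma exists_limit {K : ℕ → Coef N} {gs : ℕ → ℝ × ES N → ℝ} {u : ℕ → ℝ → ES N → ℝ} {D : ℝ}
    (hθ : 0 < θ) (hS : ∀ n, Sol (K n) 0 T (gs n) (u n))
    (hb : ∀ R : ℝ, ∀ᶠ n in atTop, ∀ t ∈ Icc 0 T, ∀ x, ‖x‖ ≤ R → ∀ γ : List (Fin N), γ.length ≤ 2 →
      |wd (ex N) γ (u n t) x| ≤ D ∧ ∀ y, ‖y‖ ≤ R → γ.length = 2 →
        |wd (ex N) γ (u n t) x - wd (ex N) γ (u n t) y| ≤ D * ‖x - y‖ ^ θ)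
    (hq : ∀ i j, CC T (fun n => (K n).Q i j) fun p => q p.1 p.2 i j)
    (hbb : ∀ j, CC T (fun n => (K n).b j) fun p => b p.1 p.2 j)
    (hc : CC T (fun n => (K n).c) fun p => c p.1 p.2) (hg : CC T gs fun p => g p.1 p.2) :
    ∃ v : ℝ → ES N → ℝ, (∀ t ∈ Icc 0 T, ContDiff ℝ 2 (v t)) ∧
      (∀ γ : List (Fin N), γ.length ≤ 2 → CC T (fun n p => wd (ex N) γ (u n p.1) p.2)
        fun p => wd (ex N) γ (v p.1) p.2) ∧
      ∀ t ∈ Icc 0 T, ∀ x, HasDerivWithinAt (fun t => v t x) (Aop q b c (v t) t x + g t x)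
        (Icc 0 T) t := by
  obtain ⟨W, hW⟩ : ∃ W : List (Fin N) → ℕ → ℝ × ES N → ℝ,
      W = fun γ n p => wd (ex N) γ (u n p.1) p.2 := ⟨_, rfl⟩
  have hdiff : ∀ γ n, ∀ t ∈ Icc 0 T, Differentiable ℝ fun x => W γ n (t, x) := fun γ n t ht => by
    rw [hW]; exact (((hS n).sm t ht).wd _ γ).differentiable
  have hcons : ∀ i γ, (fun n (p : ℝ × ES N) => dd (ex N i) (fun x => W γ n (p.1, x)) p.2) =
      W (i :: γ) := fun i γ => by rw [hW]; rfl
  have hbd : ∀ R : ℝ, ∀ᶠ n in atTop, ∀ t ∈ Icc 0 T, ∀ x, ‖x‖ ≤ R → ∀ γ : List (Fin N),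
      γ.length ≤ 2 → |W γ n (t, x)| ≤ D := fun R => by
    filter_upwards [hb R] with n hn t ht x hx γ hγ
    rw [hW]; exact (hn t ht x hx γ hγ).1
  have hlip : ∀ γ : List (Fin N), γ.length ≤ 1 → SE T (W γ) := fun γ hγ => by
    refine SE.of_bound one_pos (C := N * D) fun R => ?_
    filter_upwards [hbd R] with n hn t ht x hx y hy
    have := diff_le (hdiff γ n t ht) (ρ := R) (D := D) (fun i z hz => by
      have := hn t ht z hz (i :: γ) (by simpa using hγ)
      rwa [← hcons i γ] at this) hx hy
    rw [Real.rpow_one]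
    linarith
  have hse2 : ∀ γ : List (Fin N), γ.length = 2 → SE T (W γ) := fun γ hγ => by
    refine SE.of_bound hθ (C := D) fun R => ?_
    filter_upwards [hb R] with n hn t ht x hx y hy
    rw [hW]
    exact (hn t ht x hx γ hγ.le).2 y hy hγ
  have hO : ∀ γ : List (Fin N), γ.length ≤ 2 → ∀ t ∈ Icc 0 T, ∀ x,
      (fun z : ℕ × ℝ × ES N => W γ z.1 z.2) =O[nf T (t, x)] fun _ => (1 : ℝ) := by
    intro γ hγ t ht x
    refine Asymptotics.IsBigO.of_bound D (eventually_nf.2 ⟨1, one_pos, ?_⟩)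
    filter_upwards [hyperfilter_le (hbd (‖x‖ + 1))] with n hn t' ht' _ x' hx'
    have h3 := norm_add_le (x' - x) x
    rw [sub_add_cancel] at h3
    simpa using hn t' ht' x' (by linarith) γ hγ
  obtain ⟨F, hF⟩ : ∃ F : ℕ → ℝ × ES N → ℝ, F = fun n p =>
      (∑ i, ∑ j, (K n).Q i j p * W [i, j] n p) + (∑ j, (K n).b j p * W [j] n p) +
        (K n).c p * W [] n p + gs n p := ⟨_, rfl⟩
  have hTD : TD T (W []) F := fun n t ht x => by
    rw [hF, hW]; exact (hS n).der [] t ht x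
  have mO : ∀ {X Y : ℕ × ℝ × ES N → ℝ} {l : Filter (ℕ × ℝ × ES N)},
      X =O[l] (fun _ => (1 : ℝ)) → Y =O[l] (fun _ => (1 : ℝ)) →
      (fun z => X z * Y z) =O[l] fun _ => (1 : ℝ) := fun h1 h2 => by simpa using h1.mul h2
  have hFO : ∀ t ∈ Icc 0 T, ∀ x, ∃ L, ∀ᶠ z in nf T (t, x), |F z.1 z.2| ≤ L := fun t ht x => by
    have : (fun z : ℕ × ℝ × ES N => F z.1 z.2) =O[nf T (t, x)] fun _ => (1 : ℝ) := by
      rw [hF]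
      refine Asymptotics.IsBigO.add (Asymptotics.IsBigO.add (Asymptotics.IsBigO.add ?_ ?_) ?_)
        ((hg t ht x).isBigO_one ℝ)
      · exact Asymptotics.IsBigO.fun_sum fun i _ => Asymptotics.IsBigO.fun_sum fun j _ =>
          mO ((hq i j t ht x).isBigO_one ℝ) (hO [i, j] (by simp) t ht x)
      · exact Asymptotics.IsBigO.fun_sum fun j _ =>
          mO ((hbb j t ht x).isBigO_one ℝ) (hO [j] (by simp) t ht x)
      · exact mO ((hc t ht x).isBigO_one ℝ) (hO _ (by simp) t ht x)
    obtain ⟨L, hL⟩ := this.bound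
    exact ⟨L, hL.mono fun z hz => by simpa using hz⟩
  have e0 : EC T (W []) := hTD.ec hFO (hlip _ (by simp))
  have e1 : ∀ j, EC T (W [j]) := fun j => by
    rw [← hcons]
    exact e0.dd (hdiff []) (by rw [hcons]; exact hlip _ (by simp))
  have e2 : ∀ i j, EC T (W [i, j]) := fun i j => by
    rw [← hcons]
    exact (e1 j).dd (hdiff [j]) (by rw [hcons]; exact hse2 _ (by simp))
  have hpt : ∀ γ : List (Fin N), γ.length ≤ 2 → ∀ t ∈ Icc 0 T, ∀ x, ∃ C, ∀ᶠ n in atTop,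
      |W γ n (t, x)| ≤ C := fun γ hγ t ht x =>
    ⟨D, (hbd ‖x‖).mono fun n hn => hn t ht x le_rfl γ hγ⟩
  have c0 := e0.cc (hpt _ (by simp))
  have c1 := fun j => (e1 j).cc (hpt _ (by simp))
  have c2 := fun i j => (e2 i j).cc (hpt _ (by simp))
  obtain ⟨V, hV⟩ : ∃ V : List (Fin N) → ℝ × ES N → ℝ, V = fun γ p => ulim fun n => W γ n p :=
    ⟨_, rfl⟩
  have c0 : CC T (W []) (V []) := by rw [hV]; exact c0
  have c1 : ∀ j, CC T (W [j]) (V [j]) := fun j => by rw [hV]; exact c1 j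
  have c2 : ∀ i j, CC T (W [i, j]) (V [i, j]) := fun i j => by rw [hV]; exact c2 i j
  have d0 : ∀ t ∈ Icc 0 T, ∀ x, HasFDerivAt (fun x => V [] (t, x)) (fm fun i => V [i] (t, x)) x :=
    fun t ht x => c0.hasFDerivAt (hdiff []) (fun i => by rw [hcons]; exact c1 i) ht x
  have d1 : ∀ j, ∀ t ∈ Icc 0 T, ∀ x,
      HasFDerivAt (fun x => V [j] (t, x)) (fm fun i => V [i, j] (t, x)) x :=
    fun j t ht x => (c1 j).hasFDerivAt (hdiff [j]) (fun i => by rw [hcons]; exact c2 i j) ht x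
  have w1 : ∀ j, ∀ t ∈ Icc 0 T, wd (ex N) [j] (fun x => V [] (t, x)) = fun x => V [j] (t, x) :=
    fun j t ht => funext fun x => by
      show fderiv ℝ (fun x => V [] (t, x)) x (ex N j) = _
      rw [(d0 t ht x).fderiv, fm_ex]
  have w2 : ∀ i j, ∀ t ∈ Icc 0 T,
      wd (ex N) [i, j] (fun x => V [] (t, x)) = fun x => V [i, j] (t, x) :=
    fun i j t ht => funext fun x => by
      show fderiv ℝ (wd (ex N) [j] (fun x => V [] (t, x))) x (ex N i) = _
      rw [w1 j t ht, (d1 j t ht x).fderiv, fm_ex]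
  have cg : ∀ {a : ℕ → ℝ × ES N → ℝ} {α β : ℝ × ES N → ℝ}, CC T a α →
      (∀ t ∈ Icc 0 T, ∀ x, α (t, x) = β (t, x)) → CC T a β := fun h e t ht x => by
    rw [← e t ht x]; exact h t ht x
  refine ⟨fun t x => V [] (t, x), fun t ht => ?_, fun γ hγ => ?_, fun t ht x => ?_⟩
  · refine contDiff_of_fm (n := 1) (d0 t ht) fun j => contDiff_of_fm (n := 0) (d1 j t ht) fun i => ?_
    exact contDiff_zero.2 ((c2 i j).continuousOn.comp_continuous (Continuous.prodMk_right t)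
      fun y => ⟨ht, mem_univ _⟩)
  · match γ, hγ with
    | [], _ => rw [hW] at c0; exact c0
    | [j], _ =>
      have := c1 j
      rw [hW] at this
      exact cg this fun t ht x => (congrFun (w1 j t ht) x).symm
    | [i, j], _ =>
      have := c2 i j
      rw [hW] at this
      exact cg this fun t ht x => (congrFun (w2 i j t ht) x).symm
  · have hFc : CC T F fun p => (∑ i, ∑ j, q p.1 p.2 i j * V [i, j] p) +
        (∑ j, b p.1 p.2 j * V [j] p) + c p.1 p.2 * V [] p + g p.1 p.2 := fun t ht x => by
      rw [hF]
      exact (((tendsto_finsetSum _ fun i _ => tendsto_finsetSum _ fun j _ =>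
        (hq i j t ht x).mul (c2 i j t ht x)).add (tendsto_finsetSum _ fun j _ =>
        (hbb j t ht x).mul (c1 j t ht x))).add ((hc t ht x).mul (c0 t ht x))).add (hg t ht x)
    refine (hTD.limit c0 hFc ht x).congr_deriv ?_
    have p2 : ∀ i j, pd2 (fun x => V [] (t, x)) i j x = V [i, j] (t, x) := fun i j =>
      congrFun (w2 i j t ht) x
    have p1 : ∀ j, pd1 (fun x => V [] (t, x)) j x = V [j] (t, x) := fun j => congrFun (w1 j t ht) x
    simp only [Aop, p1, p2]

/-- Sup bound and Hölder bound along the coordinate directions. -/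
def HS (θ M : ℝ) (φ : ES N → ℝ) : Prop :=
  (∀ x, |φ x| ≤ M) ∧ ∀ i : Fin N, ∀ r : ℝ, 0 ≤ r → ∀ x, |φ (x + r • ex N i) - φ x| ≤ M * r ^ θ

lemma exists_smooth_data (hT : 0 ≤ T) {k : ℕ} {a : ℝ → ES N → ℝ} (h : AC T k a) {M : ℝ}
    (hH : ∀ γ : List (Fin N), γ.length ≤ k → ∀ t ∈ Icc 0 T, HS θ M (wd (ex N) γ (a t))) (R : ℝ)
    {η : ℝ} (hη : 0 < η) : ∃ F, SB (eS N) F ∧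
      (∀ γ : List (Fin N), γ.length ≤ k → HB θ M (wd (eS N) (sw γ) F)) ∧
      ∀ γ : List (Fin N), γ.length ≤ k → ∀ t ∈ Icc 0 T, ∀ x, ‖x‖ ≤ R →
        |wd (ex N) γ (sl F t) x - wd (ex N) γ (a t) x| ≤ η := by
  have hB : ∀ γ : List (Fin N), γ.length ≤ k → HB θ M (xt T id a γ) := fun γ hγ =>
    ⟨fun y => (hH γ hγ _ (cl_mem hT y.1)).1 _, fun i r hr y => by
      have := (hH γ hγ _ (cl_mem hT y.1)).2 i r hr y.2
      simpa [xt] using this⟩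
  have hb : ∀ γ : List (Fin N), γ.length ≤ k → ∃ B : ℝ, ∀ p, |xt T id a γ p| ≤ B := fun γ hγ =>
    ⟨M, (hB γ hγ).1⟩
  have hc := fun γ hγ => h.xt_continuous hT continuous_id γ hγ
  obtain ⟨φ, hφ⟩ := exists_bump (N := N) (h.approx hT continuous_id (ρ := R + 1)
    (fun x _ => rfl) hb (lt_add_one R) hη)
  refine ⟨mo φ (xt T id a []), mo_sb φ (hc [] (by simp)) (hB [] (by simp)).1, fun γ hγ => ?_,
    hφ φ rfl⟩
  have e : wd (eS N) (sw γ) (mo φ (xt T id a [])) = mo φ (xt T id a γ) := funext fun p =>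
    wd_mo_xt h hT continuous_id (ρ := ‖p.2‖ + φ.rOut + 1) (fun x _ => rfl) hb φ γ hγ p
      (lt_add_one _)
  rw [e]
  exact mo_hb φ (hc γ hγ) (hB γ hγ)

lemma Close.mono {K : Coef N} {R η η' : ℝ} (h : Close K q b c T R η) (hη : η ≤ η') :
    Close K q b c T R η' :=
  ⟨fun i j γ hγ t ht x hx => (h.q i j γ hγ t ht x hx).trans hη,
    fun j γ hγ t ht x hx => (h.b j γ hγ t ht x hx).trans hη,
    fun γ hγ t ht x hx => (h.c γ hγ t ht x hx).trans hη⟩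

/-- Existence of a solution satisfying the Schauder bounds. -/
theorem Hyp.exists_solution (H : Hyp N T q b c) (hθ : θ ∈ Ioo (0 : ℝ) 1) : ∃ D, 1 ≤ D ∧
    ∀ (f : ES N → ℝ) (g : ℝ → ES N → ℝ) (M : ℝ), ContDiff ℝ 2 f →
    ContinuousOn (fun p : ℝ × ES N => g p.1 p.2) (Icc 0 T ×ˢ univ) →
    (∀ γ : List (Fin N), γ.length ≤ 2 → HS θ M (wd (ex N) γ f)) → (∀ t ∈ Icc 0 T, HS θ M (g t)) →
    ∃ u : ℝ → ES N → ℝ, (∀ t ∈ Icc 0 T, ContDiff ℝ 2 (u t)) ∧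
      (∀ γ : List (Fin N), γ.length ≤ 2 →
        ContinuousOn (fun p : ℝ × ES N => wd (ex N) γ (u p.1) p.2) (Icc 0 T ×ˢ univ)) ∧
      (∀ t ∈ Icc 0 T, ∀ x, HasDerivWithinAt (fun t => u t x) (Aop q b c (u t) t x + g t x)
        (Icc 0 T) t) ∧
      (∀ x, u 0 x = f x) ∧
      ∀ t ∈ Icc 0 T, ∀ x, ∀ γ : List (Fin N), γ.length ≤ 2 → |wd (ex N) γ (u t) x| ≤ D * M ∧
        ∀ y, γ.length = 2 →
          |wd (ex N) γ (u t) x - wd (ex N) γ (u t) y| ≤ D * M * ‖x - y‖ ^ θ := by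
  have hT := H.T_pos.le
  obtain ⟨κ, ν₁, l, η₀, hκ, hν₁, hl, hη₀, hcκ, hLH⟩ := H.exists_lh
  obtain ⟨D, hD1, hD⟩ := smooth_schauder H.N_pos hT hκ hl hν₁ hθ
  refine ⟨D, hD1, fun f g M hf hg hfM hgM => ?_⟩
  have acf : AC T 2 fun _ => f := ⟨fun _ _ => hf, fun γ hγ =>
    ((wd_contDiff γ (j := 0) (hf.of_le (by exact_mod_cast (by omega)))).continuous.comp
      continuous_snd).continuousOn⟩
  have acg : AC T 0 g := ⟨fun t ht => contDiff_zero.2 (hg.comp_continuous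
      (Continuous.prodMk_right t) fun y => ⟨ht, mem_univ _⟩), fun γ hγ => by
    rw [List.length_eq_zero_iff.1 (Nat.le_zero.1 hγ)]; exact hg⟩
  obtain ⟨ε, hε⟩ : ∃ ε : ℕ → ℝ, ε = fun n : ℕ => 1 / ((n : ℝ) + 1) := ⟨_, rfl⟩
  have hε0 : ∀ n, 0 < ε n := fun n => by rw [hε]; positivity
  have hεt : Tendsto ε atTop (𝓝 0) := by rw [hε]; exact tendsto_one_div_add_atTop_nhds_zero_nat
  have hR1 : ∀ n : ℕ, (1 : ℝ) ≤ n + 1 := fun n => by simp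
  choose K hK hC using fun n : ℕ => H.exists_close (hR1 n) (lt_min hη₀ (hε0 n))
  choose fs hfs hfB hfC using fun n : ℕ => exists_smooth_data hT acf (fun γ hγ _ _ => hfM γ hγ)
    (n + 1) (hε0 n)
  choose gs hgs hgB hgC using fun n : ℕ => exists_smooth_data hT acg (fun γ hγ t ht => by
    rw [List.length_eq_zero_iff.1 (Nat.le_zero.1 hγ)]; exact hgM t ht) (n + 1) (hε0 n)
  have hbig : ∀ R : ℝ, ∀ᶠ n : ℕ in atTop, R ≤ (n + 1) / 2 ∧ R ≤ n + 1 := fun R => by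
    filter_upwards [eventually_ge_atTop ⌈2 * |R|⌉₊] with n hn
    have := Nat.ceil_le.1 hn
    have h1 := le_abs_self R
    have h2 := abs_nonneg R
    constructor <;> linarith
  have cc : ∀ {a : ℕ → ℝ × ES N → ℝ} {α : ℝ × ES N → ℝ}, ContinuousOn α (Icc 0 T ×ˢ univ) →
      (∀ n : ℕ, ∀ t ∈ Icc 0 T, ∀ x, ‖x‖ ≤ n + 1 → |a n (t, x) - α (t, x)| ≤ ε n) → CC T a α :=
    fun {a α} h1 h2 => CC.of_local h1 fun R e he => by
      filter_upwards [hbig R, eventually_le_of_tendsto_zero hεt he] with n hn hn' t ht x hx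
      exact (h2 n t ht x (hx.trans hn.2)).trans ((le_abs_self _).trans hn')
  have hη : ∀ n, min η₀ (ε n) ≤ ε n := fun n => min_le_right _ _
  have hest := fun n => hD (K n) (n + 1) (hR1 n) (hLH (K n) _ (hK n) ((hC n).mono (min_le_left _ _)))
    (by rw [hK]; exact hcκ) (fs n) (gs n) (hfs n) (hgs n) M (hfB n) (hgB n [] le_rfl)
  have hqc : ∀ i j, CC T (fun n => (K n).Q i j) fun p => q p.1 p.2 i j := fun i j =>
    cc ((H.ac_q i j).cont [] (by simp)) fun n t ht x hx =>
      ((hC n).q i j [] (by simp) t ht x hx).trans (hη n)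
  have hbc : ∀ j, CC T (fun n => (K n).b j) fun p => b p.1 p.2 j := fun j =>
    cc ((H.ac_b j).cont [] (by simp)) fun n t ht x hx =>
      ((hC n).b j [] (by simp) t ht x hx).trans (hη n)
  have hcc : CC T (fun n => (K n).c) fun p => c p.1 p.2 :=
    cc (H.ac_c.cont [] (by simp)) fun n t ht x hx =>
      ((hC n).c [] (by simp) t ht x hx).trans (hη n)
  have hgc : CC T gs fun p => g p.1 p.2 := cc hg fun n t ht x hx => hgC n [] le_rfl t ht x hx
  obtain ⟨v, hv1, hv2, hv3⟩ := exists_limit (D := D * M) (u := fun n => (K n).U (fs n) (gs n))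
    hθ.1 (fun n => (K n).U_sol (hfs n) (hgs n) T) (fun R => by
      filter_upwards [hbig R] with n hn t ht x hx γ hγ
      have := hest n t ht x (hx.trans hn.1) γ hγ
      exact ⟨this.1, fun y hy => this.2 y (hy.trans hn.1)⟩) hqc hbc hcc hgc
  refine ⟨v, hv1, fun γ hγ => (hv2 γ hγ).continuousOn, hv3, fun x => ?_, fun t ht x γ hγ => ?_⟩
  · have h0 : (0 : ℝ) ∈ Icc 0 T := ⟨le_rfl, hT⟩
    have hfc : CC T fs fun p => f p.2 := cc (hf.continuous.comp continuous_snd).continuousOn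
      fun n t ht x hx => hfC n [] (by simp) t ht x hx
    refine tendsto_nhds_unique ((hv2 [] (by simp)).tendsto h0 x) ((hfc.tendsto h0 x).congr fun n => ?_)
    exact (congrFun ((K n).U_zero (hfs n)) x).symm
  · refine ⟨le_of_tendsto ((hv2 γ hγ).tendsto ht x).abs (hyperfilter_le ((hbig ‖x‖).mono fun n hn =>
      (hest n t ht x hn.1 γ hγ).1)), fun y hy => ?_⟩
    refine le_of_tendsto (((hv2 γ hγ).tendsto ht x).sub ((hv2 γ hγ).tendsto ht y)).abs
      (hyperfilter_le (((hbig ‖x‖).and (hbig ‖y‖)).mono fun n hn =>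
        (hest n t ht x hn.1.1 γ hγ).2 y hn.2.1 hy))

end Existence

section Uniqueness

variable {N : ℕ} {T : ℝ} {q : ℝ → ES N → Fin N → Fin N → ℝ} {b : ℝ → ES N → Fin N → ℝ}
  {c : ℝ → ES N → ℝ}

lemma dd_lin {f g : ES N → ℝ} (hf : Differentiable ℝ f) (hg : Differentiable ℝ g) (α β : ℝ) (v : ES N) :
    dd v (fun y => α * f y - β * g y) = fun y => α * dd v f y - β * dd v g y := by
  funext y
  unfold dd
  rw [fderiv_fun_sub ((hf y).const_mul α) ((hg y).const_mul β), fderiv_const_mul (hf y),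
    fderiv_const_mul (hg y)]
  simp

lemma Aop_lin {f g : ES N → ℝ} (hf : ContDiff ℝ 2 f) (hg : ContDiff ℝ 2 g) (α β t : ℝ) (x : ES N) :
    Aop q b c (fun y => α * f y - β * g y) t x = α * Aop q b c f t x - β * Aop q b c g t x := by
  have h1 : ∀ j, pd1 (fun y => α * f y - β * g y) j = fun y => α * pd1 f j y - β * pd1 g j y :=
    fun j => dd_lin (hf.differentiable two_ne_zero) (hg.differentiable two_ne_zero) α β (ex N j)
  have h2 : ∀ i j, pd2 (fun y => α * f y - β * g y) i j =
      fun y => α * pd2 f i j y - β * pd2 g i j y := fun i j => by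
    unfold pd2
    rw [h1 j]
    exact dd_lin ((dd_contDiff (n := 1) hf (ex N j)).differentiable one_ne_zero)
      ((dd_contDiff (n := 1) hg (ex N j)).differentiable one_ne_zero) α β (ex N i)
  simp only [Aop, h1, h2, mul_sub, Finset.sum_sub_distrib]
  simp only [mul_left_comm _ α, mul_left_comm _ β]
  rw [mul_add, mul_add, mul_add, mul_add]
  simp only [Finset.mul_sum]
  ring

lemma Aop_one (t : ℝ) (x : ES N) : Aop q b c (fun _ => 1) t x = c t x := by
  have h1 : ∀ j, pd1 (fun _ : ES N => (1 : ℝ)) j = fun _ => 0 := fun j => dd_const _ _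
  have h2 : ∀ i j, pd2 (fun _ : ES N => (1 : ℝ)) i j = fun _ => 0 := fun i j => by
    unfold pd2; rw [h1]; exact dd_const _ _
  simp [Aop, h1, h2]

/-- Bounded solutions of the homogeneous equation with zero initial datum. -/
structure HSol (q : ℝ → ES N → Fin N → Fin N → ℝ) (b : ℝ → ES N → Fin N → ℝ)
    (c : ℝ → ES N → ℝ) (T : ℝ) (w : ℝ → ES N → ℝ) : Prop where
  bd : ∃ M, ∀ t ∈ Icc 0 T, ∀ x, |w t x| ≤ M
  sm : ∀ t ∈ Icc 0 T, ContDiff ℝ 2 (w t)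
  cont : ∀ i, ContinuousOn (fun p : ℝ × ES N => wd (ex N) [i] (w p.1) p.2) (Icc 0 T ×ˢ univ)
  der : ∀ t ∈ Icc 0 T, ∀ x, HasDerivWithinAt (fun t => w t x) (Aop q b c (w t) t x) (Icc 0 T) t
  zero : ∀ x, w 0 x = 0

lemma HSol.continuousOn {w : ℝ → ES N → ℝ} (h : HSol q b c T w) :
    ContinuousOn (fun p : ℝ × ES N => w p.1 p.2) (Icc 0 T ×ˢ univ) := by
  rintro ⟨t, x⟩ ⟨ht, -⟩
  have hD : ∀ i, ∃ D, ∀ p ∈ Icc 0 T ×ˢ closedBall (0 : ES N) (‖x‖ + 1),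
      |wd (ex N) [i] (w p.1) p.2| ≤ D := fun i => by
    obtain ⟨D, hD⟩ := (isCompact_Icc.prod (isCompact_closedBall (0 : ES N)
      (‖x‖ + 1))).exists_bound_of_continuousOn ((h.cont i).mono (prod_mono le_rfl (subset_univ _)))
    exact ⟨D, hD⟩
  choose D hD using hD
  have h1 : Tendsto (fun p : ℝ × ES N => w p.1 x) (𝓝[Icc 0 T ×ˢ univ] (t, x)) (𝓝 (w t x)) :=
    Tendsto.comp (h.der t ht x).continuousWithinAt (tendsto_nhdsWithin_iff.2
      ⟨continuous_fst.continuousAt.mono_left nhdsWithin_le_nhds,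
        eventually_mem_nhdsWithin.mono fun p hp => hp.1⟩)
  have h2 : Tendsto (fun p : ℝ × ES N => N * ‖p.2 - x‖ * ∑ i, |D i|)
      (𝓝[Icc 0 T ×ˢ univ] (t, x)) (𝓝 0) := by
    have : Continuous fun p : ℝ × ES N => N * ‖p.2 - x‖ * ∑ i, |D i| := by fun_prop
    simpa using (this.tendsto (t, x)).mono_left nhdsWithin_le_nhds
  have h3 : Tendsto (fun p : ℝ × ES N => w p.1 p.2 - w p.1 x)
      (𝓝[Icc 0 T ×ˢ univ] (t, x)) (𝓝 0) := by
    refine squeeze_zero_norm' ?_ h2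
    filter_upwards [self_mem_nhdsWithin, nhdsWithin_le_nhds (ball_mem_nhds (t, x) one_pos)]
      with p hp hpb
    rw [mem_ball, Prod.dist_eq, max_lt_iff, dist_eq_norm, dist_eq_norm] at hpb
    have h4 := norm_add_le (p.2 - x) x
    rw [sub_add_cancel] at h4
    exact diff_le ((h.sm p.1 hp.1).differentiable two_ne_zero) (ρ := ‖x‖ + 1)
      (fun i y hy => (hD i (p.1, y) ⟨hp.1, mem_closedBall_zero_iff.2 hy⟩).trans
        ((le_abs_self _).trans (Finset.single_le_sum (f := fun i => |D i|)
          (fun i _ => abs_nonneg _) (Finset.mem_univ i)))) (by linarith [hpb.2]) (by linarith)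
  have := h3.add h1
  simp only [sub_add_cancel, zero_add] at this
  exact this

lemma HSol.nonpos (H : Hyp N T q b c) {w : ℝ → ES N → ℝ} (h : HSol q b c T w) {t : ℝ}
    (ht : t ∈ Icc 0 T) (x : ES N) : w t x ≤ 0 := by
  obtain ⟨φ, lam, hlam, hφ, hφs, hφt, M, hM⟩ := H.liap
  obtain ⟨B, hB⟩ := h.bd
  by_contra! hp
  obtain ⟨ψ, hψ⟩ : ∃ ψ : ES N → ℝ, ψ = fun y => 1 * φ y - (-1) * (fun _ => 1 : ES N → ℝ) y := ⟨_, rfl⟩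
  have hψe : ∀ y, ψ y = φ y + 1 := fun y => by rw [hψ]; ring
  have hψs : ContDiff ℝ 2 ψ := by rw [hψ]; fun_prop
  have hψp : ∀ y, 1 < ψ y := fun y => by rw [hψe]; linarith [hφ y]
  obtain ⟨μ, hμ⟩ : ∃ μ, μ = lam + |M| + |H.c₀| + 1 := ⟨_, rfl⟩
  have hψA : ∀ s ∈ Icc 0 T, ∀ y, Aop q b c ψ s y < μ * ψ y := fun s hs y => by
    have e : Aop q b c ψ s y = 1 * Aop q b c φ s y - (-1) * Aop q b c (fun _ => 1) s y := by
      rw [hψ]; exact Aop_lin hφs contDiff_const _ _ s y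
    rw [e, Aop_one, hμ]
    have h1 := hM s hs y
    have h2 := H.c_ub s hs y
    have h3 := le_abs_self M
    have h4 := le_abs_self H.c₀
    have h5 := hψp y
    have h6 : 0 ≤ (|M| + |H.c₀|) * φ y := mul_nonneg (by positivity) (hφ y).le
    rw [hψe] at h5 ⊢
    nlinarith [hφ y]
  obtain ⟨ε, hε⟩ : ∃ ε, ε = Real.exp (-μ * t) * w t x / (2 * ψ x) := ⟨_, rfl⟩
  have hψx : 0 < ψ x := by linarith [hψp x]
  have hw0 : 0 < Real.exp (-μ * t) * w t x := mul_pos (Real.exp_pos _) hp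
  have hε0 : 0 < ε := by rw [hε]; positivity
  obtain ⟨z, hz⟩ : ∃ z : ℝ → ES N → ℝ, z = fun s y => Real.exp (-μ * s) * w s y - ε * ψ y := ⟨_, rfl⟩
  have hz0 : 0 < z t x := by
    have : z t x = Real.exp (-μ * t) * w t x / 2 := by rw [hz, hε]; field_simp; ring
    rw [this]; linarith
  have hμ0 : 0 < μ := by rw [hμ]; positivity
  have hB0 : 0 ≤ B := (abs_nonneg _).trans (hB t ht x)
  have hout : ∀ᶠ y in cocompact (ES N), B / ε ≤ φ y := hφt.eventually_ge_atTop _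
  obtain ⟨R, hR⟩ : ∃ R, ∀ y, 0 ≤ φ y - B / ε ∨ ‖y‖ < R := by
    rw [← Metric.cobounded_eq_cocompact, ← comap_norm_atTop, eventually_comap] at hout
    obtain ⟨R, hR⟩ := eventually_atTop.1 hout
    exact ⟨R, fun y => (le_or_gt R ‖y‖).imp (fun h => sub_nonneg.2 (hR _ h y rfl)) id⟩
  have hzR : ∀ s ∈ Icc 0 T, ∀ y, 0 < z s y → ‖y‖ < R := fun s hs y hpos => by
    refine (hR y).resolve_left fun h1 => ?_
    have h2 := (div_le_iff₀ hε0).1 (sub_nonneg.1 h1)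
    have h3 : Real.exp (-μ * s) ≤ 1 := Real.exp_le_one_iff.2 (by nlinarith [hs.1])
    have h4 : Real.exp (-μ * s) * w s y ≤ B := by
      have := hB s hs y
      calc Real.exp (-μ * s) * w s y ≤ Real.exp (-μ * s) * B := by
            gcongr; exact (le_abs_self _).trans this
        _ ≤ 1 * B := by gcongr
        _ = B := one_mul B
    rw [hz] at hpos
    simp only [hψe] at hpos
    nlinarith
  have hzc : ContinuousOn (fun p : ℝ × ES N => z p.1 p.2) (Icc 0 T ×ˢ closedBall 0 R) := by
    rw [hz]
    have h1 : Continuous ψ := hψs.continuous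
    exact ((by fun_prop : Continuous fun p : ℝ × ES N => Real.exp (-μ * p.1)).continuousOn.mul
      (h.continuousOn.mono (prod_mono le_rfl (subset_univ _)))).sub
      (by fun_prop : Continuous fun p : ℝ × ES N => ε * ψ p.2).continuousOn
  obtain ⟨t₁, ht₁, x₁, hx₁, hpos, hmax⟩ := max_point (isCompact_closedBall 0 R) hzc ht
    (mem_closedBall_zero_iff.2 (hzR t ht x hz0).le) hz0
  have hx₁R := hzR t₁ ht₁ x₁ hpos
  have ht₁0 : 0 < t₁ := by
    refine lt_of_le_of_ne ht₁.1 fun e => ?_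
    rw [← e, hz] at hpos
    simp only [h.zero] at hpos
    nlinarith [hψp x₁]
  have hzs : ContDiff ℝ 2 (z t₁) := by
    rw [hz]
    exact (contDiff_const.mul (h.sm t₁ ht₁)).sub (contDiff_const.mul hψs)
  have hloc : IsLocalMax (z t₁) x₁ := by
    filter_upwards [isOpen_ball.mem_nhds (mem_ball_zero_iff.2 hx₁R)] with y hy
    exact hmax t₁ ht₁ y (ball_subset_closedBall hy)
  obtain ⟨g1, g2⟩ := elliptic_nonpos hzs hloc (q t₁ x₁) (H.q_symm t₁ ht₁ x₁)
    (H.ν₀_pos.trans_le (H.ν_lb t₁ ht₁ x₁)) fun ξ => by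
      have := H.ellip t₁ ht₁ x₁ (WithLp.toLp 2 ξ)
      rwa [norm_sq_eq_sum] at this
  have hAz : Aop q b c (z t₁) t₁ x₁ ≤ c t₁ x₁ * z t₁ x₁ := by
    have h1 : ∀ j, pd1 (z t₁) j x₁ = 0 := g1
    have h2 : ∑ i, ∑ j, q t₁ x₁ i j * pd2 (z t₁) i j x₁ ≤ 0 := g2
    simp only [Aop, h1, mul_zero, Finset.sum_const_zero]
    linarith
  have hAe : Aop q b c (z t₁) t₁ x₁ =
      Real.exp (-μ * t₁) * Aop q b c (w t₁) t₁ x₁ - ε * Aop q b c ψ t₁ x₁ := by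
    rw [hz]; exact Aop_lin (h.sm t₁ ht₁) hψs _ _ _ _
  have hder : HasDerivWithinAt (fun s => z s x₁)
      (-μ * Real.exp (-μ * t₁) * w t₁ x₁ + Real.exp (-μ * t₁) * Aop q b c (w t₁) t₁ x₁)
      (Icc 0 T) t₁ := by
    rw [hz]
    have h1 : HasDerivAt (fun s : ℝ => Real.exp (-μ * s)) (-μ * Real.exp (-μ * t₁)) t₁ :=
      (((hasDerivAt_id' t₁).const_mul (-μ)).exp).congr_deriv (by ring)
    exact (h1.hasDerivWithinAt.mul (h.der t₁ ht₁ x₁)).sub_const _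
  have h0 := deriv_nonneg_of_max ⟨ht₁0, ht₁.2⟩ hder fun s hs => hmax s hs x₁ hx₁
  have h1 := mul_lt_mul_of_pos_left (hψA t₁ ht₁ x₁) hε0
  have hze : z t₁ x₁ = Real.exp (-μ * t₁) * w t₁ x₁ - ε * ψ x₁ := by rw [hz]
  have h2 : c t₁ x₁ ≤ μ := by
    have := H.c_ub t₁ ht₁ x₁
    rw [hμ]; linarith [le_abs_self H.c₀, abs_nonneg M]
  have h3 := mul_le_mul_of_nonneg_right h2 hpos.le
  rw [hze] at h3 hAz
  rw [hAe] at hAz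
  linarith

lemma HSol.eq_zero (H : Hyp N T q b c) {w : ℝ → ES N → ℝ} (h : HSol q b c T w) {t : ℝ}
    (ht : t ∈ Icc 0 T) (x : ES N) : w t x = 0 := by
  have e : ∀ f : ES N → ℝ, (fun y => -f y) = fun y => 0 * f y - 1 * f y := fun f => by
    funext y; ring
  have hn : HSol q b c T fun t x => -w t x := by
    obtain ⟨M, hM⟩ := h.bd
    refine ⟨⟨M, fun t ht x => by rw [abs_neg]; exact hM t ht x⟩, fun t ht => (h.sm t ht).neg,
      fun i => ((h.cont i).neg).congr fun p hp => ?_, fun t ht x => (h.der t ht x).neg.congr_deriv ?_,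
      fun x => by rw [h.zero, neg_zero]⟩
    · show fderiv ℝ (fun x => -w p.1 x) p.2 _ = _
      rw [fderiv_fun_neg]; rfl
    · rw [e, Aop_lin (h.sm t ht) (h.sm t ht)]; ring
  exact le_antisymm (h.nonpos H ht x) (neg_nonpos.1 (hn.nonpos H ht x))

/-- Uniqueness of bounded classical solutions. -/
theorem IsBCSolInhom.unique (H : Hyp N T q b c) {f : ES N → ℝ} {g u v : ℝ → ES N → ℝ}
    (hu : IsBCSolInhom q b c T f g u) (hv : IsBCSolInhom q b c T f g v) {t : ℝ}
    (ht : t ∈ Icc 0 T) (x : ES N) : v t x = u t x := by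
  obtain ⟨⟨M, hM⟩, u2, u3, -, u5, -, u7, u8⟩ := hu
  obtain ⟨⟨M', hM'⟩, v2, v3, -, v5, -, v7, v8⟩ := hv
  have e : ∀ f g : ES N → ℝ, (fun y => f y - g y) = fun y => 1 * f y - 1 * g y := fun f g => by
    funext y; ring
  have h : HSol q b c T fun t x => v t x - u t x := by
    refine ⟨⟨M' + M, fun t ht x => (abs_sub _ _).trans (add_le_add (hM' t ht x) (hM t ht x))⟩,
      fun t ht => (v2 t ht).sub (u2 t ht), fun i => ((v5 i).sub (u5 i)).congr fun p hp => ?_,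
      fun t ht x => ((v3 x t ht).hasDerivWithinAt.sub (u3 x t ht).hasDerivWithinAt).congr_deriv ?_,
      fun x => by rw [u8, v8, sub_self]⟩
    · show fderiv ℝ (fun x => v p.1 x - u p.1 x) p.2 _ = _
      rw [fderiv_fun_sub ((v2 p.1 hp.1).differentiable two_ne_zero _)
        ((u2 p.1 hp.1).differentiable two_ne_zero _)]
      rfl
    · rw [e, Aop_lin (v2 t ht) (u2 t ht), v7 t ht x, u7 t ht x]; ring
  exact sub_eq_zero.1 (h.eq_zero H ht x)

end Uniqueness

section HolderNorms

variable {N : ℕ} {T : ℝ} {q : ℝ → ES N → Fin N → Fin N → ℝ} {b : ℝ → ES N → Fin N → ℝ}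
  {c : ℝ → ES N → ℝ} {θ : ℝ}

lemma iteratedFDeriv_ex {f : ES N → ℝ} : ∀ {k : ℕ}, ContDiff ℝ k f → ∀ (s : Fin k → Fin N) (x : ES N),
    iteratedFDeriv ℝ k f x (fun j => ex N (s j)) = wd (ex N) (List.ofFn s) f x
  | 0, _, s, x => by simp
  | k + 1, hf, s, x => by
    have hk : DifferentiableAt ℝ (iteratedFDeriv ℝ k f) x :=
      (hf.differentiable_iteratedFDeriv (by exact_mod_cast Nat.lt_succ_self k)) x
    have e : wd (ex N) (List.ofFn fun j => s (Fin.succ j)) f = fun y =>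
        ContinuousMultilinearMap.apply ℝ (fun _ : Fin k => ES N) ℝ (fun j => ex N (s (Fin.succ j)))
          (iteratedFDeriv ℝ k f y) :=
      funext fun y => (iteratedFDeriv_ex (hf.of_le (by exact_mod_cast Nat.le_succ k)) _ y).symm
    have h := (ContinuousMultilinearMap.apply ℝ (fun _ : Fin k => ES N) ℝ
      fun j => ex N (s (Fin.succ j))).hasFDerivAt.comp x hk.hasFDerivAt
    rw [List.ofFn_succ, wd_cons, iteratedFDeriv_succ_apply_left, e, dd]
    exact (DFunLike.congr_fun h.fderiv (ex N (s 0))).symm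

lemma norm_ex (i : Fin N) : ‖ex N i‖ = 1 := by simp [ex]

lemma abs_apply_ex_le {k : ℕ} (L : ContinuousMultilinearMap ℝ (fun _ : Fin k => ES N) ℝ)
    (s : Fin k → Fin N) : |L fun j => ex N (s j)| ≤ ‖L‖ := by
  have := L.le_opNorm fun j => ex N (s j)
  simpa [norm_ex] using this

lemma opNorm_le_of_ex {k : ℕ} (L : ContinuousMultilinearMap ℝ (fun _ : Fin k => ES N) ℝ) {B : ℝ}
    (hB : 0 ≤ B) (h : ∀ s : Fin k → Fin N, |L fun j => ex N (s j)| ≤ B) : ‖L‖ ≤ N ^ k * B := by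
  refine L.opNorm_le_bound (by positivity) fun m => ?_
  have e : L m = ∑ s : Fin k → Fin N, (∏ j, m j (s j)) * L fun j => ex N (s j) := by
    conv_lhs => rw [show m = fun j => ∑ i, m j i • ex N i from funext fun j => (ex_sum (m j)).symm]
    rw [L.map_sum]
    exact Finset.sum_congr rfl fun s _ => L.map_smul_univ _ _
  rw [e]
  refine (norm_sum_le_of_le _ (n := fun _ => (∏ j, ‖m j‖) * B) fun s _ => ?_).trans (le_of_eq ?_)
  · rw [norm_mul, norm_prod]
    exact mul_le_mul (Finset.prod_le_prod (fun _ _ => norm_nonneg _) fun j _ =>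
      PiLp.norm_apply_le _ _) (h s) (abs_nonneg _) (Finset.prod_nonneg fun _ _ => norm_nonneg _)
  · simp only [Finset.sum_const, Finset.card_univ, Fintype.card_fun, Fintype.card_fin, nsmul_eq_mul]
    push_cast
    ring

lemma supNormE_le {k : ℕ} {f : ES N → ℝ} (hf : ContDiff ℝ k f) {B : ℝ} (hB : 0 ≤ B)
    (h : ∀ γ : List (Fin N), γ.length = k → ∀ x, |wd (ex N) γ f x| ≤ B) :
    supNormE k f ≤ ENNReal.ofReal (N ^ k * B) :=
  iSup_le fun x => ENNReal.ofReal_le_ofReal <| opNorm_le_of_ex _ hB fun s => by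
    rw [iteratedFDeriv_ex hf]
    exact h _ (by simp) x

lemma holderSemiE_le {k : ℕ} {f : ES N → ℝ} (hf : ContDiff ℝ k f) {B : ℝ} (hB : 0 ≤ B)
    (h : ∀ γ : List (Fin N), γ.length = k → ∀ x y,
      |wd (ex N) γ f x - wd (ex N) γ f y| ≤ B * ‖x - y‖ ^ θ) :
    holderSemiE k θ f ≤ ENNReal.ofReal (N ^ k * B) :=
  iSup_le fun x => iSup_le fun y => iSup_le fun hxy => ENNReal.ofReal_le_ofReal <| by
    have hp : 0 < ‖x - y‖ ^ θ := Real.rpow_pos_of_pos (norm_pos_iff.2 (sub_ne_zero.2 hxy)) _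
    rw [div_le_iff₀ hp, mul_assoc]
    refine opNorm_le_of_ex _ (by positivity) fun s => ?_
    rw [_root_.sub_apply, iteratedFDeriv_ex hf, iteratedFDeriv_ex hf]
    exact h _ (by simp) x y

lemma le_of_supNormE {k : ℕ} {f : ES N → ℝ} (hf : ContDiff ℝ k f) {m : ℝ} (hm : 0 ≤ m)
    (h : supNormE k f ≤ ENNReal.ofReal m) {γ : List (Fin N)} (hγ : γ.length = k) (x : ES N) :
    |wd (ex N) γ f x| ≤ m := by
  subst hγ
  have h1 := (ENNReal.ofReal_le_ofReal_iff hm).1 ((le_iSup _ x).trans h)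
  have h2 := iteratedFDeriv_ex hf γ.get x
  rw [List.ofFn_get] at h2
  rw [← h2]
  exact (abs_apply_ex_le _ _).trans h1

lemma le_of_holderSemiE {k : ℕ} {f : ES N → ℝ} (hf : ContDiff ℝ k f) {m : ℝ} (hm : 0 ≤ m)
    (h : holderSemiE k θ f ≤ ENNReal.ofReal m) {γ : List (Fin N)} (hγ : γ.length = k) {x y : ES N}
    (hxy : x ≠ y) : |wd (ex N) γ f x - wd (ex N) γ f y| ≤ m * ‖x - y‖ ^ θ := by
  subst hγ
  have h1 := (ENNReal.ofReal_le_ofReal_iff hm).1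
    (((le_iSup_of_le x <| le_iSup_of_le y <| le_iSup_of_le hxy le_rfl) :
      _ ≤ holderSemiE γ.length θ f).trans h)
  rw [div_le_iff₀ (Real.rpow_pos_of_pos (norm_pos_iff.2 (sub_ne_zero.2 hxy)) _)] at h1
  have h2 := iteratedFDeriv_ex hf γ.get
  simp only [List.ofFn_get] at h2
  rw [← h2, ← h2, ← _root_.sub_apply]
  exact (abs_apply_ex_le _ _).trans h1

lemma floor_theta (hθ : θ ∈ Ioo (0 : ℝ) 1) : ⌊θ⌋₊ = 0 := Nat.floor_eq_zero.2 hθ.2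

lemma floor_two_add (hθ : θ ∈ Ioo (0 : ℝ) 1) : ⌊2 + θ⌋₊ = 2 :=
  (Nat.floor_eq_iff (by linarith [hθ.1])).2 ⟨by push_cast; linarith [hθ.1], by
    push_cast; linarith [hθ.2]⟩

lemma CbNorm_theta (hθ : θ ∈ Ioo (0 : ℝ) 1) (f : ES N → ℝ) :
    CbNorm θ f = supNormE 0 f + holderSemiE 0 θ f := by
  rw [CbNorm, floor_theta hθ, if_neg (by simpa using hθ.1.ne)]
  simp

lemma CbNorm_two_add (hθ : θ ∈ Ioo (0 : ℝ) 1) (f : ES N → ℝ) :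
    CbNorm (2 + θ) f = supNormE 0 f + supNormE 1 f + supNormE 2 f + holderSemiE 2 θ f := by
  rw [CbNorm, floor_two_add hθ, if_neg (by push_cast; linarith [hθ.1])]
  simp [Finset.sum_range_succ]

lemma HS.of_le {M M' : ℝ} {φ : ES N → ℝ} (h : HS θ M φ) (hM : M ≤ M') : HS θ M' φ :=
  ⟨fun x => (h.1 x).trans hM, fun i r hr x => (h.2 i r hr x).trans
    (mul_le_mul_of_nonneg_right hM (Real.rpow_nonneg hr _))⟩

lemma HS_of_holder {m : ℝ} (hm : 0 ≤ m) {φ : ES N → ℝ} (h : ∀ x, |φ x| ≤ m)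
    (h' : ∀ x y, x ≠ y → |φ x - φ y| ≤ m * ‖x - y‖ ^ θ) : HS θ m φ := by
  refine ⟨h, fun i r hr x => ?_⟩
  rcases hr.eq_or_lt with rfl | hr
  · simpa using mul_nonneg hm (Real.rpow_nonneg le_rfl _)
  · have e : ‖x + r • ex N i - x‖ = r := by
      rw [add_sub_cancel_left, norm_smul, norm_ex, Real.norm_of_nonneg hr.le, mul_one]
    have := h' (x + r • ex N i) x fun h0 => hr.ne' (by rw [h0, sub_self, norm_zero] at e; exact e.symm)
    rwa [e] at this

lemma HS_of_deriv (hθ : θ ∈ Ioo (0 : ℝ) 1) {m : ℝ} {φ : ES N → ℝ} (hφ : Differentiable ℝ φ)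
    (h : ∀ x, |φ x| ≤ m) (h' : ∀ i x, |dd (ex N i) φ x| ≤ m) : HS θ (2 * m) φ := by
  have hm : 0 ≤ m := (abs_nonneg _).trans (h 0)
  refine ⟨fun x => (h x).trans (by linarith), fun i r hr x => ?_⟩
  rcases le_total r 1 with h1 | h1
  · have h2 := taylor_one hφ (y := x) (v := r • ex N i) (B := r * m) fun t _ => by
      rw [dd, map_smul, smul_eq_mul, abs_mul, abs_of_nonneg hr]
      exact mul_le_mul_of_nonneg_left (h' i _) hr
    have h3 : r ≤ r ^ θ := by
      simpa using Real.rpow_le_rpow_of_exponent_ge' hr h1 hθ.1.le hθ.2.le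
    nlinarith [Real.rpow_nonneg hr θ]
  · have h3 : 1 ≤ r ^ θ := Real.one_le_rpow h1 hθ.1.le
    have h4 := abs_sub (φ (x + r • ex N i)) (φ x)
    nlinarith [h x, h (x + r • ex N i)]

lemma HS_of_CbNorm_theta (hθ : θ ∈ Ioo (0 : ℝ) 1) {m : ℝ} (hm : 0 ≤ m) {g : ES N → ℝ}
    (hg : ContDiff ℝ 0 g) (h : CbNorm θ g ≤ ENNReal.ofReal m) : HS θ m g := by
  rw [CbNorm_theta hθ] at h
  exact HS_of_holder hm (fun x => le_of_supNormE (k := 0) hg hm (le_self_add.trans h) (γ := []) rfl x)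
    fun x y hxy => le_of_holderSemiE (k := 0) hg hm (le_add_self.trans h) (γ := []) rfl hxy

lemma HS_of_CbNorm_two_add (hθ : θ ∈ Ioo (0 : ℝ) 1) {m : ℝ} (hm : 0 ≤ m) {f : ES N → ℝ}
    (hf : ContDiff ℝ 2 f) (h : CbNorm (2 + θ) f ≤ ENNReal.ofReal m) (γ : List (Fin N))
    (hγ : γ.length ≤ 2) : HS θ (2 * m) (wd (ex N) γ f) := by
  rw [CbNorm_two_add hθ] at h
  have hs : ∀ k ≤ 2, supNormE k f ≤ ENNReal.ofReal m := fun k hk => by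
    refine le_trans ?_ (le_self_add.trans h)
    interval_cases k
    · exact le_self_add.trans le_self_add
    · exact le_add_self.trans le_self_add
    · exact le_add_self
  have hb : ∀ γ : List (Fin N), γ.length ≤ 2 → ∀ x, |wd (ex N) γ f x| ≤ m := fun γ hγ x =>
    le_of_supNormE (hf.of_le (by exact_mod_cast hγ)) hm (hs _ hγ) rfl x
  rcases hγ.eq_or_lt with h2 | h2
  · exact (HS_of_holder hm (hb γ hγ) fun x y hxy => le_of_holderSemiE hf hm
      (le_add_self.trans h) h2 hxy).of_le (by linarith)
  · have hd : ContDiff ℝ (1 : ℕ) (wd (ex N) γ f) :=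
      wd_contDiff γ (hf.of_le (by exact_mod_cast (by omega : 1 + γ.length ≤ 2)))
    exact HS_of_deriv hθ (hd.differentiable (by simp)) (hb γ hγ) fun i => hb (i :: γ) (by simp; omega)

lemma CbNorm_two_add_le (hN : 1 ≤ N) (hθ : θ ∈ Ioo (0 : ℝ) 1) {f : ES N → ℝ} (hf : ContDiff ℝ 2 f)
    {B : ℝ} (h : ∀ x, ∀ γ : List (Fin N), γ.length ≤ 2 → |wd (ex N) γ f x| ≤ B ∧
      ∀ y, γ.length = 2 → |wd (ex N) γ f x - wd (ex N) γ f y| ≤ B * ‖x - y‖ ^ θ) :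
    CbNorm (2 + θ) f ≤ ENNReal.ofReal (4 * (N ^ 2 * B)) := by
  have hB : 0 ≤ B := (abs_nonneg _).trans (h 0 [] (by simp)).1
  have hp : (0 : ℝ) ≤ N ^ 2 * B := by positivity
  have hs : ∀ k ≤ 2, supNormE k f ≤ ENNReal.ofReal (N ^ 2 * B) := fun k hk =>
    (supNormE_le (hf.of_le (by exact_mod_cast hk)) hB fun γ hγ x => (h x γ (hγ.trans_le hk)).1).trans
      (ENNReal.ofReal_le_ofReal (mul_le_mul_of_nonneg_right
        (pow_le_pow_right₀ (by exact_mod_cast hN) hk) hB))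
  rw [CbNorm_two_add hθ, show 4 * (N ^ 2 * B) = N ^ 2 * B + N ^ 2 * B + N ^ 2 * B + N ^ 2 * B by ring,
    ENNReal.ofReal_add (by positivity) hp, ENNReal.ofReal_add (by positivity) hp,
    ENNReal.ofReal_add hp hp]
  exact add_le_add (add_le_add (add_le_add (hs 0 (by simp)) (hs 1 (by simp))) (hs 2 le_rfl))
    (holderSemiE_le hf hB fun γ hγ x y => (h x γ hγ.le).2 y hγ)

end HolderNorms

/-- Theorem `thm-schauder`, optimal Schauder estimates. Under Hypotheses (H),
for `θ ∈ (0,1)`, `f ∈ C^{2+θ}_b(ℝ^N)` and `g ∈ C^{0,θ}([0,T] × ℝ^N)` the Cauchy problem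
`D_t u = 𝒜 u + g`, `u(0,·) = f`, admits a unique bounded classical solution `u`; moreover
`u(t,·) ∈ C^{2+θ}_b(ℝ^N)` for every `t ∈ [0,T]` and there is `C > 0`, independent of `f` and
`g`, such that `sup_t ‖u(t,·)‖_{C^{2+θ}_b} ≤ C (‖f‖_{C^{2+θ}_b} + sup_t ‖g(t,·)‖_{C^θ_b})`. -/
theorem optimal_schauder_estimates {N : ℕ} {T : ℝ} {q : ℝ → ES N → Fin N → Fin N → ℝ}
    {b : ℝ → ES N → Fin N → ℝ} {c : ℝ → ES N → ℝ} (H : Hyp N T q b c)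
    (θ : ℝ) (hθ : θ ∈ Ioo (0:ℝ) 1) :
    ∃ C > (0:ℝ), ∀ (f : ES N → ℝ) (g : ℝ → ES N → ℝ),
      MemCb (2 + θ) f →
      ContinuousOn (fun p : ℝ × ES N => g p.1 p.2) (Icc (0:ℝ) T ×ˢ univ) →
      (∀ t ∈ Icc (0:ℝ) T, MemCb θ (g t)) →
      (⨆ t ∈ Icc (0:ℝ) T, CbNorm θ (g t)) ≠ ⊤ →
      ∃ u : ℝ → ES N → ℝ, IsBCSolInhom q b c T f g u ∧
        (∀ v : ℝ → ES N → ℝ, IsBCSolInhom q b c T f g v →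
          ∀ t ∈ Icc (0:ℝ) T, ∀ x, v t x = u t x) ∧
        (∀ t ∈ Icc (0:ℝ) T, MemCb (2 + θ) (u t)) ∧
        (⨆ t ∈ Icc (0:ℝ) T, CbNorm (2 + θ) (u t)) ≤
          ENNReal.ofReal C * (CbNorm (2 + θ) f + ⨆ t ∈ Icc (0:ℝ) T, CbNorm θ (g t)) := by
  obtain ⟨D, hD, hex⟩ := H.exists_solution hθ
  have hN : (1 : ℝ) ≤ N := by exact_mod_cast H.N_pos
  refine ⟨4 * (N ^ 2 * (D * 2)), by positivity, fun f g hf hgc hg hgt => ?_⟩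
  have hfF := hf.2
  set F := CbNorm (2 + θ) f
  set G := ⨆ t ∈ Icc (0:ℝ) T, CbNorm θ (g t)
  have hf2 : ContDiff ℝ 2 f := by
    have := hf.1
    rw [floor_two_add hθ] at this
    exact_mod_cast this
  have hF0 : 0 ≤ F.toReal := ENNReal.toReal_nonneg
  have hG0 : 0 ≤ G.toReal := ENNReal.toReal_nonneg
  obtain ⟨u, u2, uc, ut, u0, ub⟩ := hex f g (2 * (F.toReal + G.toReal)) hf2 hgc
    (fun γ hγ => (HS_of_CbNorm_two_add hθ hF0 hf2 (ENNReal.ofReal_toReal hfF).ge γ hγ).of_le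
      (by linarith))
    (fun t ht => by
      refine (HS_of_CbNorm_theta hθ hG0 ?_ ?_).of_le (by linarith : G.toReal ≤ _)
      · have := (hg t ht).1
        rw [floor_theta hθ] at this
        exact_mod_cast this
      · rw [ENNReal.ofReal_toReal hgt]
        exact le_iSup₂ (f := fun t (_ : t ∈ Icc (0:ℝ) T) => CbNorm θ (g t)) t ht)
  have hd : ∀ t ∈ Icc (0:ℝ) T, ∀ x,
      derivWithin (fun t' => u t' x) (Icc (0:ℝ) T) t = Aop q b c (u t) t x + g t x := fun t ht x =>
    (ut t ht x).derivWithin (uniqueDiffOn_Icc H.T_pos t ht)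
  have hu : IsBCSolInhom q b c T f g u := by
    refine ⟨⟨_, fun t ht x => (ub t ht x [] (by simp)).1⟩, u2,
      fun x t ht => (ut t ht x).differentiableWithinAt, ?_, fun i => uc [i] (by simp),
      fun i j => uc [i, j] (by simp), hd, u0⟩
    have hq := fun i j => (H.ac_q i j).cont [] (by simp)
    have hb := fun j => (H.ac_b j).cont [] (by simp)
    have hc := H.ac_c.cont [] (by simp)
    refine ContinuousOn.congr (f := fun p : ℝ × ES N => Aop q b c (u p.1) p.1 p.2 + g p.1 p.2) ?_
      fun p hp => hd p.1 hp.1 p.2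
    exact (((continuousOn_finsetSum _ fun i _ => continuousOn_finsetSum _ fun j _ =>
      (hq i j).mul (uc [i, j] (by simp))).add (continuousOn_finsetSum _ fun j _ =>
      (hb j).mul (uc [j] (by simp)))).add (hc.mul (uc [] (by simp)))).add hgc
  have hn : ∀ t ∈ Icc (0:ℝ) T,
      CbNorm (2 + θ) (u t) ≤ ENNReal.ofReal (4 * (N ^ 2 * (D * 2))) * (F + G) := fun t ht => by
    rw [← ENNReal.ofReal_toReal hfF, ← ENNReal.ofReal_toReal hgt, ← ENNReal.ofReal_add hF0 hG0,
      ← ENNReal.ofReal_mul (by positivity)]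
    convert CbNorm_two_add_le H.N_pos hθ (u2 t ht) (ub t ht) using 2
    ring
  refine ⟨u, hu, fun v hv t ht x => hu.unique H hv ht x, fun t ht => ⟨?_, ?_⟩, iSup₂_le hn⟩
  · rw [floor_two_add hθ]
    exact_mod_cast u2 t ht
  · exact ((hn t ht).trans_lt (ENNReal.mul_lt_top ENNReal.ofReal_lt_top
      (ENNReal.add_lt_top.2 ⟨lt_top_iff_ne_top.2 hfF, lt_top_iff_ne_top.2 hgt⟩))).ne
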